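/- Let K be an abelian number field. Assume the Riemann hypothesis for ζ_K, and that J_{-1}^K(T) ≪ T^{1+α} for some fixed 0 ≤ α < 2 − √3. Then ∫_0^Y (M_K(e^y)/e^{y/2})^2 dy ∼ β·Y as Y → ∞, where β = 2 Σ_{γ>0} |ρ ζ_K'(ρ)|^{−2}, the sum running over the nontrivial zeros ρ = 1/2 + iγ of ζ_K with γ > 0; moreover this series converges. -/

import Mathlib

noncomputable section

open NumberField Filter Topology MeasureTheory Complex

open scoped Classical

/-- The Möbius function on integral ideals of a number field `K`. -/
def moebiusK (K : Type) [Field K] [NumberField K] (I : Ideal (𝓞 K)) : ℤ :=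
  if Squarefree I then (-1) ^ (UniqueFactorizationMonoid.factors I).card else 0

/-- The Mertens function of a number field `K`: the sum of `μ_K(𝔞)` over nonzero integral
ideals `𝔞` of norm at most `x`, where ideals of norm exactly `x` count with weight `1/2`. -/
def mertensK (K : Type) [Field K] [NumberField K] (x : ℝ) : ℝ :=
  ∑' I : Ideal (𝓞 K),
    if I ≠ ⊥ ∧ (Ideal.absNorm I : ℝ) < x then (moebiusK K I : ℝ)
    else if I ≠ ⊥ ∧ (Ideal.absNorm I : ℝ) = x then (moebiusK K I : ℝ) / 2
    else 0

/-- `M_K^- = liminf_{x → ∞} M_K(x) / x^{1/2}`, as an extended real number. -/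
def MKminus (K : Type) [Field K] [NumberField K] : EReal :=
  Filter.liminf (fun x : ℝ => ((mertensK K x / Real.sqrt x : ℝ) : EReal)) Filter.atTop

/-- `M_K^+ = limsup_{x → ∞} M_K(x) / x^{1/2}`, as an extended real number. -/
def MKplus (K : Type) [Field K] [NumberField K] : EReal :=
  Filter.limsup (fun x : ℝ => ((mertensK K x / Real.sqrt x : ℝ) : EReal)) Filter.atTop

/-- The naïve Mertens-type conjecture over `K`: `-1 ≤ M_K^- ≤ M_K^+ ≤ 1`. -/
def NaiveMertensConj (K : Type) [Field K] [NumberField K] : Prop :=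
  -1 ≤ MKminus K ∧ MKminus K ≤ MKplus K ∧ MKplus K ≤ 1

/-- A predicate identifying the Dedekind zeta function of `K`: a function analytic away
from `s = 1` agreeing with the Dirichlet series `∑ N(𝔞)^{-s}` on `Re s > 1`. -/
def IsDedekindZeta (K : Type) [Field K] [NumberField K] (Z : ℂ → ℂ) : Prop :=
  (∀ s : ℂ, s ≠ 1 → DifferentiableAt ℂ Z s) ∧
  ∀ s : ℂ, 1 < s.re →
    Z s = ∑' I : {I : Ideal (𝓞 K) // I ≠ ⊥}, (Ideal.absNorm I.1 : ℂ) ^ (-s)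

/-- The Riemann hypothesis for a zeta function `Z`: all nontrivial zeros lie on `Re s = 1/2`. -/
def ZetaRH (Z : ℂ → ℂ) : Prop :=
  ∀ ρ : ℂ, Z ρ = 0 → 0 < ρ.re → ρ.re < 1 → ρ.re = 1 / 2

set_option linter.unusedSectionVars false
set_option linter.unusedSimpArgs false

section Poisson
variable {ι : Type*} [Fintype ι]

lemma summable_one_add_norm_int_pow_inv :
    Summable fun m : ι → ℤ => ((1 + ‖(fun i => (m i : ℝ))‖) ^ (Fintype.card ι + 1))⁻¹ := by
  let b := Pi.basisFun ℝ ι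
  let L := Submodule.span ℤ (Set.range b)
  have hrank : Module.finrank ℤ L = Fintype.card ι := by
    rw [ZLattice.rank ℝ L]; simp
  have h := ZLattice.summable_norm_pow_inv L (Fintype.card ι + 1) (by omega)
  let f : (ι → ℤ) → L := fun m => ⟨∑ i, m i • b i, Submodule.sum_mem _ fun i _ =>
    Submodule.smul_mem _ _ (Submodule.subset_span ⟨i, rfl⟩)⟩
  have hf : ∀ m, (f m : ι → ℝ) = fun i => (m i : ℝ) := by
    intro m
    ext i
    simp [f, b, Finset.sum_apply, Pi.single_apply]
  have hinj : Function.Injective f := by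
    intro m m' h
    have := congrArg (fun x : L => (x : ι → ℝ)) h
    simp only [hf] at this
    ext i
    exact_mod_cast congrFun this i
  have h2 := h.comp_injective hinj
  refine Summable.of_norm_bounded_eventually h2 ?_
  have : ({0} : Set (ι → ℤ)).Finite := Set.finite_singleton 0
  refine this.subset ?_
  intro m hm
  by_contra hne
  apply hm
  have hpos : 0 < ‖(fun i => (m i : ℝ))‖ := by
    rw [norm_pos_iff]
    intro h0
    refine hne ?_
    rw [Set.mem_singleton_iff]
    ext i
    simpa using congrFun h0 i
  have e : ‖f m‖ = ‖(fun i => (m i : ℝ))‖ := by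
    rw [← hf]; rfl
  simp only [Set.mem_ofPred_eq, Function.comp, e]
  rw [Real.norm_of_nonneg (by positivity), inv_pow]
  gcongr
  linarith

/-- Lift of a periodic function to the torus. -/
lemma exists_torus_lift (F : (ι → ℝ) → ℂ) (hF : Continuous F)
    (hper : ∀ x (m : ι → ℤ), F (fun i => x i + m i) = F x) :
    ∃ G : C(UnitAddTorus ι, ℂ), ∀ x : ι → ℝ, G (fun i => (x i : UnitAddCircle)) = F x := by
  let π : (ι → ℝ) → UnitAddTorus ι := fun x i => (x i : UnitAddCircle)
  have hπ : IsOpenQuotientMap π :=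
    IsOpenQuotientMap.piMap (fun _ => QuotientAddGroup.isOpenQuotientMap_mk)
  have hG : ∀ x y, π x = π y → F x = F y := by
    intro x y hxy
    have h : ∀ i, ∃ k : ℤ, x i = y i + k := by
      intro i
      have := congrFun hxy i
      simp only [π] at this
      rw [eq_comm, QuotientAddGroup.eq] at this
      obtain ⟨k, hk⟩ := AddSubgroup.mem_zmultiples_iff.mp this
      refine ⟨k, ?_⟩
      simp at hk
      linarith
    choose k hk using h
    rw [← hper y k]
    congr 1
    ext i
    exact hk i
  let sec := Function.surjInv hπ.surjective
  have key : ∀ x, F (sec (π x)) = F x := fun x => hG _ _ (Function.surjInv_eq hπ.surjective _)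
  refine ⟨⟨fun t => F (sec t), ?_⟩, key⟩
  rw [hπ.isQuotientMap.continuous_iff]
  have : (fun t => F (sec t)) ∘ π = F := funext key
  rw [this]
  exact hF

lemma norm_translate_le (φ : (ι → ℝ) → ℂ) (k : ℕ) (A : ℝ)
    (hφ : ∀ x, ‖φ x‖ ≤ A * ((1 + ‖x‖) ^ k)⁻¹) (R : ℝ) (x : ι → ℝ) (hx : ‖x‖ ≤ R)
    (m : ι → ℤ) :
    ‖φ (fun i => x i + m i)‖ ≤ A * (1 + R) ^ k * ((1 + ‖(fun i => (m i : ℝ))‖) ^ k)⁻¹ := by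
  have hA : 0 ≤ A := by
    have := (norm_nonneg _).trans (hφ 0)
    simpa using this
  refine (hφ _).trans ?_
  rw [mul_assoc]
  gcongr
  rw [← div_eq_mul_inv, inv_eq_one_div, div_le_div_iff₀ (by positivity) (by positivity), one_mul,
    ← mul_pow]
  gcongr
  have hR : 0 ≤ R := (norm_nonneg x).trans hx
  have h1 : ‖(fun i => (m i : ℝ))‖ ≤ ‖(fun i => x i + (m i : ℝ))‖ + ‖x‖ := by
    have : (fun i => (m i : ℝ)) = (fun i => x i + (m i : ℝ)) - x := by ext i; simp
    rw [this]
    exact (norm_sub_le _ _).trans (by simp)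
  nlinarith [norm_nonneg (fun i => x i + (m i : ℝ)), norm_nonneg x,
    mul_nonneg hR (norm_nonneg (fun i => x i + (m i : ℝ)))]

def intCube (m : ι → ℤ) : Set (ι → ℝ) := {x | ∀ i, x i ∈ Set.Ioc (m i : ℝ) (m i + 1)}

lemma intCube_eq_pi (m : ι → ℤ) :
    intCube m = Set.univ.pi fun i => Set.Ioc (m i : ℝ) (m i + 1) := by
  ext x; simp [intCube]

lemma measurableSet_intCube (m : ι → ℤ) : MeasurableSet (intCube m) := by
  rw [intCube_eq_pi]
  exact MeasurableSet.univ_pi fun i => measurableSet_Ioc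

lemma volume_intCube (m : ι → ℤ) : volume (intCube m) = 1 := by
  rw [intCube_eq_pi, volume_pi_pi]
  simp

lemma iUnion_intCube : ⋃ m : ι → ℤ, intCube m = Set.univ := by
  ext x
  simp only [Set.mem_iUnion, Set.mem_univ, iff_true]
  refine ⟨fun i => ⌈x i⌉ - 1, fun i => ?_⟩
  push_cast
  constructor
  · linarith [Int.ceil_lt_add_one (x i)]
  · linarith [Int.le_ceil (x i)]

lemma pairwise_disjoint_intCube : Pairwise (Function.onFun Disjoint (intCube (ι := ι))) := by
  intro m m' hne
  rw [Function.onFun, Set.disjoint_left]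
  intro x hx hx'
  apply hne
  ext i
  have h1 := hx i
  have h2 := hx' i
  have a : (m i : ℝ) < m' i + 1 := h1.1.trans_le h2.2
  have b : (m' i : ℝ) < m i + 1 := h2.1.trans_le h1.2
  norm_cast at a b
  omega

lemma integrable_of_decay (φ : (ι → ℝ) → ℂ) (hc : Continuous φ) (A : ℝ)
    (hφ : ∀ x, ‖φ x‖ ≤ A * ((1 + ‖x‖) ^ (Fintype.card ι + 1))⁻¹) : Integrable φ := by
  have h := integrable_one_add_norm (E := ι → ℝ) (μ := volume) (r := Fintype.card ι + 1)
    (by simp)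
  refine (h.const_mul A).mono' hc.aestronglyMeasurable (Eventually.of_forall fun x => ?_)
  refine (hφ x).trans (le_of_eq ?_)
  rw [Real.rpow_neg (by positivity)]
  norm_cast

lemma setIntegral_intCube (g : (ι → ℝ) → ℂ) (m : ι → ℤ) :
    ∫ x in intCube m, g x = ∫ x in intCube 0, g (fun i => x i + m i) := by
  have hmp := measurePreserving_add_right (volume : Measure (ι → ℝ)) (fun i => (m i : ℝ))
  have := hmp.setIntegral_preimage_emb (MeasurableEquiv.addRight _).measurableEmbedding g
    (intCube m)
  rw [← this]
  congr 2
  ext x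
  simp only [Set.mem_preimage, intCube, Set.mem_ofPred_eq, Pi.add_apply, Set.mem_Ioc, Pi.zero_apply,
    Int.cast_zero, zero_add]
  refine forall_congr' fun i => ?_
  constructor <;> rintro ⟨h1, h2⟩ <;> constructor <;> linarith

lemma norm_le_one_of_mem_intCube_zero {x : ι → ℝ} (hx : x ∈ intCube 0) : ‖x‖ ≤ 1 := by
  rw [pi_norm_le_iff_of_nonneg zero_le_one]
  intro i
  have := hx i
  simp at this
  rw [Real.norm_of_nonneg this.1.le]
  exact this.2

/-- Poisson summation over `ℤ^ι`. -/
theorem poisson_pi (φ : (ι → ℝ) → ℂ) (hc : Continuous φ) (A : ℝ)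
    (hφ : ∀ x, ‖φ x‖ ≤ A * ((1 + ‖x‖) ^ (Fintype.card ι + 1))⁻¹)
    (c : (ι → ℤ) → ℂ)
    (hcoef : ∀ n, c n = ∫ x : ι → ℝ, UnitAddTorus.mFourier (-n) (fun i => (x i : UnitAddCircle)) * φ x)
    (hsum : Summable c) :
    HasSum c (∑' m : ι → ℤ, φ (fun i => m i)) := by
  have hS := summable_one_add_norm_int_pow_inv (ι := ι)
  have hφint := integrable_of_decay φ hc A hφ
  generalize Fintype.card ι + 1 = k at hφ hS
  let F : (ι → ℝ) → ℂ := fun x => ∑' m : ι → ℤ, φ (fun i => x i + m i)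
  have hF : Continuous F := by
    rw [continuous_iff_continuousAt]
    intro x
    have hon : ContinuousOn F (Metric.ball 0 (‖x‖ + 1)) := by
      refine continuousOn_tsum (u := fun m => A * (1 + (‖x‖ + 1)) ^ k *
        ((1 + ‖(fun i => (m i : ℝ))‖) ^ k)⁻¹) (fun m => ?_) (hS.mul_left (A * (1 + (‖x‖ + 1)) ^ k)) ?_
      · exact Continuous.continuousOn (by fun_prop)
      · intro m y hy
        exact norm_translate_le φ k A hφ (‖x‖ + 1) y (by rw [← dist_zero_right]; exact (Metric.mem_ball.mp hy).le) m
    exact hon.continuousAt (Metric.isOpen_ball.mem_nhds (by simp))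
  have hper : ∀ x (m : ι → ℤ), F (fun i => x i + m i) = F x := by
    intro x m
    simp only [F]
    rw [← (Equiv.addLeft m).tsum_eq (fun n : ι → ℤ => φ (fun i => x i + n i))]
    refine tsum_congr fun n => ?_
    simp [add_assoc]
  obtain ⟨G, hG⟩ := exists_torus_lift F hF hper
  have hcoefG : ∀ n, UnitAddTorus.mFourierCoeff G n = c n := by
    intro n
    rw [UnitAddTorus.mFourierCoeff_eq_integral _ n (0 : ι → ℝ), hcoef]
    have hset : {x : ι → ℝ | ∀ i, x i ∈ Set.Ioc ((0 : ι → ℝ) i) ((0 : ι → ℝ) i + 1)} =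
        intCube 0 := by ext x; simp [intCube]
    rw [hset]
    let e : (ι → ℝ) → ℂ := fun x => UnitAddTorus.mFourier (-n) (fun i => (x i : UnitAddCircle))
    have he : Continuous e := (UnitAddTorus.mFourier (-n)).continuous.comp (by
      refine continuous_pi fun i => ?_
      exact (AddCircle.continuous_mk' 1).comp (continuous_apply i))
    have hen : ∀ x, ‖e x‖ ≤ 1 := fun x =>
      ((UnitAddTorus.mFourier (-n)).norm_coe_le_norm _).trans UnitAddTorus.mFourier_norm.le
    have heper : ∀ x (m : ι → ℤ), e (fun i => x i + m i) = e x := by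
      intro x m
      simp only [e]
      congr 1
      ext i
      simp
    have hint : Integrable (fun x => e x * φ x) := by
      refine hφint.bdd_mul (c := 1) he.aestronglyMeasurable ?_
      exact Eventually.of_forall hen
    have h1 : ∫ x, e x * φ x = ∑' m : ι → ℤ, ∫ x in intCube 0, e x * φ (fun i => x i + m i) := by
      rw [← setIntegral_univ, ← iUnion_intCube, integral_iUnion measurableSet_intCube
        pairwise_disjoint_intCube hint.integrableOn]
      refine tsum_congr fun m => ?_
      rw [setIntegral_intCube]
      simp only [heper]
    change (∫ x in intCube 0, e x * G _) = ∫ x, e x * φ x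
    rw [h1]
    simp only [hG]
    have h2 : ∀ x, e x * F x = ∑' m : ι → ℤ, e x * φ (fun i => x i + m i) := fun x =>
      tsum_mul_left.symm
    simp only [h2]
    have hfin : IsFiniteMeasure (volume.restrict (intCube (0 : ι → ℤ))) :=
      ⟨by rw [Measure.restrict_apply_univ, volume_intCube]; exact ENNReal.one_lt_top⟩
    have hb : ∀ m : ι → ℤ, ∀ x ∈ intCube (0 : ι → ℤ), ‖e x * φ (fun i => x i + m i)‖ ≤
        A * (1 + 1) ^ k * ((1 + ‖(fun i => (m i : ℝ))‖) ^ k)⁻¹ := by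
      intro m x hx
      rw [norm_mul]
      refine (mul_le_of_le_one_left (norm_nonneg _) (hen x)).trans ?_
      exact norm_translate_le φ k A hφ 1 x (norm_le_one_of_mem_intCube_zero hx) m
    symm
    refine (hasSum_integral_of_summable_integral_norm (fun m => ?_) ?_).tsum_eq
    · refine Integrable.of_bound (C := A * (1 + 1) ^ k * ((1 + ‖(fun i => (m i : ℝ))‖) ^ k)⁻¹)
        (Continuous.aestronglyMeasurable (by fun_prop)) ?_
      exact ae_restrict_of_forall_mem (measurableSet_intCube _) (hb m)
    · refine Summable.of_nonneg_of_le (fun m => integral_nonneg fun x => norm_nonneg _)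
        (fun m => ?_) (hS.mul_left (A * (1 + 1) ^ k))
      have := norm_setIntegral_le_of_norm_le_const (μ := volume) (s := intCube (0 : ι → ℤ))
        (f := fun x => ‖e x * φ (fun i => x i + m i)‖)
        (C := A * (1 + 1) ^ k * ((1 + ‖(fun i => (m i : ℝ))‖) ^ k)⁻¹)
        (by rw [volume_intCube]; exact ENNReal.one_lt_top)
        (fun x hx => by rw [norm_norm]; exact hb m x hx)
      rw [measureReal_def, volume_intCube] at this
      simpa using (le_abs_self _).trans this
  have hG0 := UnitAddTorus.hasSum_mFourier_series_apply_of_summable (f := G)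
    (by simpa [funext hcoefG] using hsum) 0
  have h0 : G 0 = ∑' m : ι → ℤ, φ (fun i => m i) := by
    have := hG 0
    simp only [Pi.zero_apply, QuotientAddGroup.mk_zero, F, zero_add] at this
    exact this
  rw [h0] at hG0
  refine hG0.congr_fun (fun n => ?_)
  rw [hcoefG]
  simp [UnitAddTorus.mFourier]

lemma exists_exp_neg_mul_sq_le (a : ℝ) (ha : 0 < a) (k : ℕ) :
    ∃ A : ℝ, ∀ t : ℝ, 0 ≤ t → Real.exp (-a * t ^ 2) ≤ A * ((1 + t) ^ k)⁻¹ := by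
  refine ⟨Real.exp a * (k.factorial * (2 / a) ^ k), fun t ht => ?_⟩
  have h1 := Real.pow_div_factorial_le_exp (x := a * (1 + t ^ 2)) (by positivity) k
  rw [← div_eq_mul_inv, le_div_iff₀ (by positivity)]
  have h2 : (1 + t) ^ k ≤ (2 * (1 + t ^ 2)) ^ k := by
    gcongr
    nlinarith [sq_nonneg (t - 1)]
  have h3 : Real.exp (-a * t ^ 2) = Real.exp a * Real.exp (-(a * (1 + t ^ 2))) := by
    rw [← Real.exp_add]; congr 1; ring
  have h4 : (2 * (1 + t ^ 2)) ^ k = (2 / a) ^ k * (a * (1 + t ^ 2)) ^ k := by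
    rw [← mul_pow]; congr 1; field_simp
  have h5 : (a * (1 + t ^ 2)) ^ k ≤ k.factorial * Real.exp (a * (1 + t ^ 2)) := by
    rw [div_le_iff₀ (by positivity)] at h1
    linarith
  calc Real.exp (-a * t ^ 2) * (1 + t) ^ k
      ≤ (Real.exp a * Real.exp (-(a * (1 + t ^ 2)))) *
        ((2 / a) ^ k * (k.factorial * Real.exp (a * (1 + t ^ 2)))) := by
        rw [h3]
        gcongr
        refine h2.trans ?_
        rw [h4]
        gcongr
    _ = Real.exp a * (k.factorial * (2 / a) ^ k) := by
        have : Real.exp (-(a * (1 + t ^ 2))) * Real.exp (a * (1 + t ^ 2)) = 1 := by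
          rw [← Real.exp_add]; simp
        linear_combination (Real.exp a * (k.factorial * (2 / a) ^ k)) * this

variable {E : Type*} [NormedAddCommGroup E] [InnerProductSpace ℝ E] [FiniteDimensional ℝ E]
  [MeasurableSpace E] [BorelSpace E]

lemma exists_lower_bound_basis (b : Module.Basis ι ℝ E) :
    ∃ c : ℝ, 0 < c ∧ ∀ x : ι → ℝ, c * ‖x‖ ≤ ‖∑ i, x i • b i‖ := by
  obtain ⟨c, hc, h⟩ : ∃ c : ℝ, 0 < c ∧ ∀ v, ‖b.equivFunL v‖ ≤ c * ‖v‖ := by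
    refine ⟨‖(b.equivFunL : E →L[ℝ] (ι → ℝ))‖ + 1, by positivity, fun v => ?_⟩
    refine ((b.equivFunL : E →L[ℝ] (ι → ℝ)).le_opNorm v).trans ?_
    gcongr
    simp
  refine ⟨c⁻¹, by positivity, fun x => ?_⟩
  have := h (b.equivFunL.symm x)
  rw [ContinuousLinearEquiv.apply_symm_apply] at this
  have e : b.equivFunL.symm x = ∑ i, x i • b i := by
    exact b.equivFun_symm_apply x
  rw [e] at this
  rw [inv_mul_le_iff₀ hc]
  exact this

lemma map_volume_basis (b : Module.Basis ι ℝ E) :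
    Measure.map (b.equivFun.symm : (ι → ℝ) → E) volume =
      (volume (ZSpan.fundamentalDomain b))⁻¹ • (volume : Measure E) := by
  have hcont : Continuous (b.equivFun.symm : (ι → ℝ) → E) :=
    LinearMap.continuous_of_finiteDimensional (b.equivFun.symm : (ι → ℝ) →ₗ[ℝ] E)
  have hemb : MeasurableEmbedding (b.equivFun.symm : (ι → ℝ) → E) :=
    b.equivFunL.symm.toHomeomorph.measurableEmbedding
  have hH : (Measure.map (b.equivFun.symm : (ι → ℝ) → E) volume).IsAddHaarMeasure :=
    b.equivFunL.symm.isAddHaarMeasure_map volume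
  have h := Measure.isAddLeftInvariant_eq_smul
    (Measure.map (b.equivFun.symm : (ι → ℝ) → E) volume) (volume : Measure E)
  set c := Measure.addHaarScalarFactor
    (Measure.map (b.equivFun.symm : (ι → ℝ) → E) volume) (volume : Measure E)
  have hFD := congrArg (fun μ : Measure E => μ (ZSpan.fundamentalDomain b)) h
  simp only [Measure.smul_apply, ENNReal.smul_def, smul_eq_mul] at hFD
  rw [hemb.map_apply] at hFD
  have hpre : (b.equivFun.symm : (ι → ℝ) → E) ⁻¹' (ZSpan.fundamentalDomain b) =
      Set.univ.pi fun _ => Set.Ico (0 : ℝ) 1 := by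
    ext x
    have : ∀ i, b.repr (b.equivFun.symm x) i = x i := fun i => by
      rw [← b.equivFun_apply, LinearEquiv.apply_symm_apply]
    simp only [Set.mem_preimage, ZSpan.mem_fundamentalDomain, this, Set.mem_pi, Set.mem_univ,
      true_imp_iff]
  rw [hpre, volume_pi_pi] at hFD
  simp at hFD
  have hc' : (c : ENNReal) = (volume (ZSpan.fundamentalDomain b))⁻¹ :=
    ENNReal.eq_inv_of_mul_eq_one_left hFD.symm
  rw [h, ← hc']
  rfl

/-- Poisson summation for Gaussians on a lattice in a Euclidean space. -/
theorem gaussian_poisson (b : Module.Basis ι ℝ E) (b' : Module.Basis ι ℝ E)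
    (hb : ∀ i j, inner ℝ (b i) (b' j) = if i = j then (1 : ℝ) else 0) :
    ∑' m : ι → ℤ, Real.exp (-Real.pi * ‖∑ i, (m i : ℝ) • b i‖ ^ 2) =
      (volume.real (ZSpan.fundamentalDomain b))⁻¹ *
      ∑' m : ι → ℤ, Real.exp (-Real.pi * ‖∑ i, (m i : ℝ) • b' i‖ ^ 2) := by
  have hdec : ∀ b : Module.Basis ι ℝ E, ∃ A : ℝ, ∀ x : ι → ℝ,
      Real.exp (-Real.pi * ‖∑ i, x i • b i‖ ^ 2) ≤ A * ((1 + ‖x‖) ^ (Fintype.card ι + 1))⁻¹ := by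
    intro b
    obtain ⟨c, hc, h⟩ := exists_lower_bound_basis b
    obtain ⟨A, hA⟩ := exists_exp_neg_mul_sq_le (Real.pi * c ^ 2) (by positivity)
      (Fintype.card ι + 1)
    refine ⟨A, fun x => le_trans ?_ (hA ‖x‖ (norm_nonneg x))⟩
    rw [Real.exp_le_exp]
    have h1 : (c * ‖x‖) ^ 2 ≤ ‖∑ i, x i • b i‖ ^ 2 := by
      gcongr
      exact h x
    nlinarith [Real.pi_pos]
  obtain ⟨A, hA⟩ := hdec b
  obtain ⟨A', hA'⟩ := hdec b'
  set V := volume.real (ZSpan.fundamentalDomain b) with hV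
  let φ : (ι → ℝ) → ℂ := fun x => (Real.exp (-Real.pi * ‖∑ i, x i • b i‖ ^ 2) : ℝ)
  have hφ : ∀ x, ‖φ x‖ ≤ A * ((1 + ‖x‖) ^ (Fintype.card ι + 1))⁻¹ := by
    intro x
    simp only [φ, Complex.norm_real, Real.norm_of_nonneg (Real.exp_nonneg _)]
    exact hA x
  let c : (ι → ℤ) → ℂ := fun n => (V⁻¹ * Real.exp (-Real.pi * ‖∑ i, (n i : ℝ) • b' i‖ ^ 2) : ℝ)
  have hsum' : Summable fun n : ι → ℤ => Real.exp (-Real.pi * ‖∑ i, (n i : ℝ) • b' i‖ ^ 2) :=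
    Summable.of_nonneg_of_le (fun _ => Real.exp_nonneg _) (fun m => hA' fun i => (m i : ℝ))
      (summable_one_add_norm_int_pow_inv.mul_left A')
  have hcs : Summable c := by
    exact Complex.ofRealCLM.summable (hsum'.mul_left V⁻¹)
  have hcoef : ∀ n, c n = ∫ x : ι → ℝ,
      UnitAddTorus.mFourier (-n) (fun i => (x i : UnitAddCircle)) * φ x := by
    intro n
    let w : E := ∑ i, (n i : ℝ) • b' i
    let g : E → ℂ := fun v => Complex.exp (-Real.pi * ‖v‖ ^ 2 + (-2 * Real.pi * I) * inner ℝ w v)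
    have h1 : ∀ x : ι → ℝ, UnitAddTorus.mFourier (-n) (fun i => (x i : UnitAddCircle)) * φ x =
        g (b.equivFun.symm x) := by
      intro x
      have e1 : inner ℝ w (b.equivFun.symm x) = ∑ i, (n i : ℝ) * x i := by
        rw [b.equivFun_symm_apply, sum_inner]
        refine Finset.sum_congr rfl fun i _ => ?_
        rw [inner_smul_left, inner_sum]
        simp only [inner_smul_right, real_inner_comm, hb]
        simp
      simp only [g, e1]
      rw [b.equivFun_symm_apply, add_comm, Complex.exp_add]
      congr 1
      · simp only [UnitAddTorus.mFourier, ContinuousMap.coe_mk, fourier_coe_apply]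
        rw [← Complex.exp_sum]
        congr 1
        push_cast
        rw [Finset.mul_sum]
        refine Finset.sum_congr rfl fun i _ => ?_
        simp
        ring
      · simp [φ]
    simp only [h1]
    have h2 : ∫ x : ι → ℝ, g (b.equivFun.symm x) =
        ∫ v, g v ∂(Measure.map (b.equivFun.symm : (ι → ℝ) → E) volume) :=
      ((show MeasurableEmbedding (b.equivFun.symm : (ι → ℝ) → E) from
        b.equivFunL.symm.toHomeomorph.measurableEmbedding).integral_map g).symm
    rw [h2, map_volume_basis, integral_smul_measure]
    have h3 := GaussianFourier.integral_cexp_neg_mul_sq_norm_add (V := E) (b := (Real.pi : ℂ))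
      (by simpa using Real.pi_pos) (-2 * Real.pi * I) w
    simp only [g]
    rw [h3]
    have hpi : (Real.pi : ℂ) ≠ 0 := by exact_mod_cast Real.pi_ne_zero
    have h4 : (-2 * (Real.pi : ℂ) * I) ^ 2 * (‖w‖ : ℂ) ^ 2 / (4 * Real.pi) =
        -Real.pi * (‖w‖ : ℂ) ^ 2 := by
      rw [mul_pow, I_sq]
      field_simp
      ring
    rw [h4, div_self hpi, Complex.one_cpow, one_mul, ENNReal.toReal_inv]
    simp only [c, w, hV, measureReal_def]
    rw [Complex.real_smul]
    push_cast
    rfl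
  have hc : Continuous φ := by fun_prop
  have h := (poisson_pi φ hc A hφ c hcoef hcs).tsum_eq
  have h' : ((∑' n : ι → ℤ, V⁻¹ * Real.exp (-Real.pi * ‖∑ i, (n i : ℝ) • b' i‖ ^ 2) : ℝ) : ℂ) =
      ((∑' m : ι → ℤ, Real.exp (-Real.pi * ‖∑ i, (m i : ℝ) • b i‖ ^ 2) : ℝ) : ℂ) := by
    rw [Complex.ofReal_tsum, Complex.ofReal_tsum]
    exact h
  rw [← tsum_mul_left]
  exact_mod_cast h'.symm

end Poisson

section PlaceForm
open mixedEmbedding Module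
variable {K : Type} [Field K] [NumberField K]

variable (K) in
/-- The Euclidean space on the real coordinates of the mixed space. -/
abbrev MixedEuclid := EuclideanSpace ℝ (mixedEmbedding.index K)

/-- The linear equivalence scaling each standard coordinate of the mixed space by `d j`. -/
def scaleEquiv (d : mixedEmbedding.index K → ℝ) (hd : ∀ j, IsUnit (d j)) :
    mixedSpace K ≃ₗ[ℝ] MixedEuclid K :=
  (stdBasis K).equiv
    ((EuclideanSpace.basisFun (mixedEmbedding.index K) ℝ).toBasis.isUnitSMul hd) (Equiv.refl _)

lemma scaleEquiv_apply (d : mixedEmbedding.index K → ℝ) (hd : ∀ j, IsUnit (d j)) (v : mixedSpace K) (j) :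
    scaleEquiv d hd v j = d j * (stdBasis K).repr v j := by
  have h : scaleEquiv d hd v = ∑ i, (stdBasis K).repr v i •
      (d i • EuclideanSpace.basisFun (mixedEmbedding.index K) ℝ i) := by
    conv_lhs => rw [← (stdBasis K).sum_repr v]
    rw [map_sum]
    refine Finset.sum_congr rfl fun i _ => ?_
    rw [map_smul]
    simp only [scaleEquiv, Basis.equiv_apply, Equiv.refl_apply]
    rw [Basis.isUnitSMul_apply]
    simp
  rw [h]
  simp only [WithLp.ofLp_sum, Finset.sum_apply, PiLp.smul_apply, smul_eq_mul]
  rw [Finset.sum_eq_single j]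
  · simp [mul_comm]
  · intro b _ hb
    simp [Ne.symm hb]
  · simp

lemma volume_fundamentalDomain_scaleEquiv {ι : Type*} [Fintype ι] (b : Basis ι ℝ (mixedSpace K))
    (d : mixedEmbedding.index K → ℝ) (hd : ∀ j, IsUnit (d j)) :
    volume (ZSpan.fundamentalDomain (b.map (scaleEquiv d hd))) =
      ENNReal.ofReal |∏ j, d j| * volume (ZSpan.fundamentalDomain b) := by
  let e : ι ≃ mixedEmbedding.index K := b.indexEquiv (stdBasis K)
  let e₀ := (EuclideanSpace.basisFun (mixedEmbedding.index K) ℝ).toBasis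
  have h1 : (stdBasis K).map (scaleEquiv d hd) = e₀.isUnitSMul hd := by
    ext1 j
    simp [scaleEquiv, Basis.equiv_apply, e₀]
  rw [← ZSpan.fundamentalDomain_reindex (b.map (scaleEquiv d hd)) e,
    ZSpan.measure_fundamentalDomain _ volume (e₀.isUnitSMul hd),
    ZSpan.measure_fundamentalDomain (e₀.isUnitSMul hd) volume e₀,
    ← ZSpan.fundamentalDomain_reindex b e,
    ZSpan.measure_fundamentalDomain (b.reindex e) volume (stdBasis K),
    volume_fundamentalDomain_stdBasis]
  have h2 : volume (ZSpan.fundamentalDomain e₀) = 1 := by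
    rw [measure_congr (ZSpan.fundamentalDomain_ae_parallelepiped e₀ volume)]
    exact (EuclideanSpace.basisFun (mixedEmbedding.index K) ℝ).volume_parallelepiped
  have h3 : e₀.det (e₀.isUnitSMul hd) = ∏ j, d j := by
    exact Basis.det_isUnitSMul _ hd
  have h4 : (e₀.isUnitSMul hd).det ((b.map (scaleEquiv d hd)).reindex e) =
      (stdBasis K).det (b.reindex e) := by
    rw [← h1, Basis.det_map]
    congr 1
    ext1 j
    simp
  rw [h2, h3, h4, mul_one, mul_one, mul_comm]

/-- Scaling factors with `w`-coordinates multiplied by `exp (u w)`. -/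
def placeScale (u : InfinitePlace K → ℝ) : mixedEmbedding.index K → ℝ
  | Sum.inl w => Real.exp (u w.1)
  | Sum.inr (w, _) => √2 * Real.exp (u w.1)

/-- The scaling factors dual to `placeScale u` for the trace pairing. -/
def placeScaleDual (u : InfinitePlace K → ℝ) : mixedEmbedding.index K → ℝ
  | Sum.inl w => Real.exp (-u w.1)
  | Sum.inr (w, i) => (if i = 0 then 1 else -1) * (√2 * Real.exp (-u w.1))

lemma isUnit_placeScale (u : InfinitePlace K → ℝ) (j) : IsUnit (placeScale u j) := by
  rw [isUnit_iff_ne_zero]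
  rcases j with w | ⟨w, i⟩ <;> simp [placeScale, Real.exp_ne_zero]

lemma isUnit_placeScaleDual (u : InfinitePlace K → ℝ) (j) : IsUnit (placeScaleDual u j) := by
  rw [isUnit_iff_ne_zero]
  rcases j with w | ⟨w, i⟩
  · simp [placeScaleDual, Real.exp_ne_zero]
  · fin_cases i <;> simp [placeScaleDual, Real.exp_ne_zero]

/-- The positive definite quadratic form `∑ m_w exp (2 u_w) |α|_w²` on `K`. -/
def placeForm (u : InfinitePlace K → ℝ) (α : K) : ℝ :=
  ∑ w : InfinitePlace K, (w.mult : ℝ) * Real.exp (2 * u w) * (w α) ^ 2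

lemma sum_places_split (f : InfinitePlace K → ℝ) :
    ∑ w, f w = ∑ w : {w : InfinitePlace K // w.IsReal}, f w.1 +
      ∑ w : {w : InfinitePlace K // w.IsComplex}, f w.1 := by
  rw [← Fintype.sum_subtype_add_sum_subtype (fun w : InfinitePlace K => w.IsReal) f]
  congr 1
  refine Fintype.sum_equiv (Equiv.subtypeEquivRight fun w => ?_) _ _ (fun w => rfl)
  exact InfinitePlace.not_isReal_iff_isComplex

lemma sum_index_split (g : mixedEmbedding.index K → ℝ) :
    ∑ j, g j = ∑ w : {w : InfinitePlace K // w.IsReal}, g (Sum.inl w) +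
      ∑ w : {w : InfinitePlace K // w.IsComplex}, (g (Sum.inr (w, 0)) + g (Sum.inr (w, 1))) := by
  rw [Fintype.sum_sum_type, Fintype.sum_prod_type]
  simp

lemma norm_scaleEquiv_sq (u : InfinitePlace K → ℝ) (α : K) :
    ‖scaleEquiv (placeScale u) (isUnit_placeScale u) (mixedEmbedding K α)‖ ^ 2 =
      placeForm u α := by
  rw [EuclideanSpace.norm_sq_eq, sum_index_split, placeForm, sum_places_split]
  simp only [scaleEquiv_apply, stdBasis_apply_isReal, stdBasis_apply_isComplex_fst,
    stdBasis_apply_isComplex_snd, mixedEmbedding_apply_isReal, mixedEmbedding_apply_isComplex]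
  congr 1
  · refine Finset.sum_congr rfl fun w _ => ?_
    rw [InfinitePlace.mult_isReal, ← InfinitePlace.norm_embedding_of_isReal w.2]
    simp only [placeScale, Real.norm_eq_abs, sq_abs, mul_pow]
    rw [← Real.exp_nat_mul]
    simp
  · refine Finset.sum_congr rfl fun w _ => ?_
    rw [InfinitePlace.mult_isComplex, ← InfinitePlace.norm_embedding_eq, Complex.sq_norm,
      Complex.normSq_apply]
    simp only [placeScale, Real.norm_eq_abs, sq_abs, mul_pow]
    rw [← Real.exp_nat_mul, Real.sq_sqrt (by norm_num)]
    push_cast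
    ring

lemma norm_scaleEquiv_dual_sq (u : InfinitePlace K → ℝ) (α : K) :
    ‖scaleEquiv (placeScaleDual u) (isUnit_placeScaleDual u) (mixedEmbedding K α)‖ ^ 2 =
      placeForm (-u) α := by
  rw [← norm_scaleEquiv_sq, EuclideanSpace.norm_sq_eq, EuclideanSpace.norm_sq_eq]
  refine Finset.sum_congr rfl fun j _ => ?_
  rw [scaleEquiv_apply, scaleEquiv_apply, norm_mul, norm_mul]
  congr 2
  rcases j with w | ⟨w, i⟩
  · simp [placeScaleDual, placeScale]
  · fin_cases i <;> simp [placeScaleDual, placeScale]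

lemma trace_eq_sum_places (x : K) :
    ((Algebra.trace ℚ K x : ℚ) : ℝ) = ∑ w : InfinitePlace K, (w.mult : ℝ) * (w.embedding x).re := by
  have h := congrArg Complex.re (trace_eq_sum_embeddings (K := ℚ) (L := K) ℂ (x := x))
  have h1 : (algebraMap ℚ ℂ (Algebra.trace ℚ K x)).re = ((Algebra.trace ℚ K x : ℚ) : ℝ) := by
    simp
  rw [← h1, h, Complex.re_sum]
  have e : ∑ σ : K →ₐ[ℚ] ℂ, (σ x).re = ∑ φ : K →+* ℂ, (φ x).re :=
    Fintype.sum_equiv (RingHom.equivRatAlgHom (R := K) (S := ℂ)).symm _ _ (fun σ => rfl)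
  rw [e, ← Finset.sum_fiberwise (s := Finset.univ) (g := InfinitePlace.mk)]
  refine Finset.sum_congr rfl fun w _ => ?_
  rw [Finset.sum_congr rfl (g := fun _ => (w.embedding x).re), Finset.sum_const,
    InfinitePlace.card_filter_mk_eq, nsmul_eq_mul]
  intro φ hφ
  have hφ' : InfinitePlace.mk φ = w := (Finset.mem_filter.mp hφ).2
  rw [← InfinitePlace.mk_embedding w, InfinitePlace.mk_eq_iff] at hφ'
  rcases hφ' with h | h
  · rw [h]
  · rw [← h]
    simp [ComplexEmbedding.conjugate_coe_eq]

lemma inner_scaleEquiv (u : InfinitePlace K → ℝ) (x y : K) :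
    inner ℝ (scaleEquiv (placeScale u) (isUnit_placeScale u) (mixedEmbedding K x))
      (scaleEquiv (placeScaleDual u) (isUnit_placeScaleDual u) (mixedEmbedding K y)) =
      ((Algebra.trace ℚ K (x * y) : ℚ) : ℝ) := by
  rw [trace_eq_sum_places, PiLp.inner_apply, sum_index_split, sum_places_split]
  simp only [scaleEquiv_apply, stdBasis_apply_isReal, stdBasis_apply_isComplex_fst,
    stdBasis_apply_isComplex_snd, mixedEmbedding_apply_isReal, mixedEmbedding_apply_isComplex]
  have hexp : ∀ t : ℝ, Real.exp t * Real.exp (-t) = 1 := fun t => by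
    rw [← Real.exp_add]; simp
  have h2 : √2 * √2 = (2 : ℝ) := Real.mul_self_sqrt (by norm_num)
  congr 1
  · refine Finset.sum_congr rfl fun w _ => ?_
    rw [InfinitePlace.mult_isReal]
    have : (w.1.embedding (x * y)).re = InfinitePlace.embedding_of_isReal w.2 x *
        InfinitePlace.embedding_of_isReal w.2 y := by
      have h := InfinitePlace.embedding_of_isReal_apply w.2 (x * y)
      rw [← h, Complex.ofReal_re, map_mul]
    rw [this]
    simp only [placeScale, placeScaleDual, RCLike.inner_apply, conj_trivial]
    push_cast
    linear_combination (InfinitePlace.embedding_of_isReal w.2 x *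
        InfinitePlace.embedding_of_isReal w.2 y) * hexp (u w.1)
  · refine Finset.sum_congr rfl fun w _ => ?_
    rw [InfinitePlace.mult_isComplex, map_mul, Complex.mul_re]
    simp only [placeScale, placeScaleDual, RCLike.inner_apply, conj_trivial]
    simp only [if_true, one_ne_zero, if_false]
    push_cast
    linear_combination ((w.1.embedding x).re * (w.1.embedding y).re -
      (w.1.embedding x).im * (w.1.embedding y).im) * (√2 * √2 * hexp (u w.1) + h2)

lemma prod_placeScale (u : InfinitePlace K → ℝ) :
    ∏ j, placeScale u j = 2 ^ InfinitePlace.nrComplexPlaces K *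
      Real.exp (∑ w : InfinitePlace K, (w.mult : ℝ) * u w) := by
  rw [Fintype.prod_sum_type, Fintype.prod_prod_type, sum_places_split, Real.exp_add,
    Real.exp_sum, Real.exp_sum]
  simp only [placeScale, Fin.prod_univ_two]
  have h1 : ∀ w : {w : InfinitePlace K // w.IsReal}, ((w.1.mult : ℕ) : ℝ) * u w.1 = u w.1 := by
    intro w; rw [InfinitePlace.mult_isReal]; simp
  have h2 : ∀ w : {w : InfinitePlace K // w.IsComplex}, √2 * Real.exp (u w.1) *
      (√2 * Real.exp (u w.1)) = 2 * Real.exp ((w.1.mult : ℕ) * u w.1) := by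
    intro w
    rw [InfinitePlace.mult_isComplex]
    push_cast
    rw [two_mul (u w.1), Real.exp_add]
    have h2 : √2 * √2 = (2 : ℝ) := Real.mul_self_sqrt (by norm_num)
    linear_combination (Real.exp (u w.1) * Real.exp (u w.1)) * h2
  simp only [h1, h2, Finset.prod_mul_distrib, Finset.prod_const, Finset.card_univ]
  rw [InfinitePlace.nrComplexPlaces]
  ring

end PlaceForm

section IdealTheta
open mixedEmbedding Module
open scoped nonZeroDivisors
variable {K : Type} [Field K] [NumberField K]

/-- The integer combinations of a `ℚ`-basis, as a parametrization of the lattice it spans. -/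
def latticeEquiv {ι : Type*} [Fintype ι] (a : Basis ι ℚ K) (I : FractionalIdeal (𝓞 K)⁰ K)
    (h : ∀ x, x ∈ Submodule.span ℤ (Set.range a) ↔ x ∈ I) : (ι → ℤ) ≃ {x // x ∈ I} :=
  Equiv.ofBijective (fun m => ⟨∑ i, m i • a i, (h _).mp (Submodule.sum_mem _ fun i _ =>
    Submodule.smul_mem _ _ (Submodule.subset_span ⟨i, rfl⟩))⟩) (by
    constructor
    · intro m m' hm
      have h1 : ∑ i, m i • a i = ∑ i, m' i • a i := congrArg Subtype.val hm
      ext i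
      have h2 := congrArg (fun x => a.repr x i) h1
      simp only [← Int.cast_smul_eq_zsmul ℚ, map_sum, map_smul, Basis.repr_self] at h2
      simpa [Finsupp.single_apply] using h2
    · rintro ⟨x, hx⟩
      obtain ⟨c, hc⟩ := (Submodule.mem_span_range_iff_exists_fun ℤ).mp ((h x).mpr hx)
      exact ⟨c, Subtype.ext hc⟩)

lemma latticeEquiv_apply {ι : Type*} [Fintype ι] (a : Basis ι ℚ K) (I : FractionalIdeal (𝓞 K)⁰ K)
    (h : ∀ x, x ∈ Submodule.span ℤ (Set.range a) ↔ x ∈ I) (m : ι → ℤ) :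
    (latticeEquiv a I h m : K) = ∑ i, m i • a i := rfl

/-- The theta series of a fractional ideal. -/
def idealTheta (I : FractionalIdeal (𝓞 K)⁰ K) (u : InfinitePlace K → ℝ) : ℝ :=
  ∑' α : {x // x ∈ I}, Real.exp (-Real.pi * placeForm u (α : K))

/-- The normalized covolume of the lattice of a fractional ideal. -/
def idealCovol (I : FractionalIdeal (𝓞 K)⁰ K) : ℝ :=
  (FractionalIdeal.absNorm I : ℝ) * √|(discr K : ℝ)|

lemma volume_fundamentalDomain_ideal (I : (FractionalIdeal (𝓞 K)⁰ K)ˣ)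
    (u : InfinitePlace K → ℝ) :
    volume.real (ZSpan.fundamentalDomain ((fractionalIdealLatticeBasis K I).map
      (scaleEquiv (placeScale u) (isUnit_placeScale u)))) =
      idealCovol (I : FractionalIdeal (𝓞 K)⁰ K) *
        Real.exp (∑ w : InfinitePlace K, (w.mult : ℝ) * u w) := by
  rw [measureReal_def, volume_fundamentalDomain_scaleEquiv,
    volume_fundamentalDomain_fractionalIdealLatticeBasis, volume_fundamentalDomain_latticeBasis,
    prod_placeScale, abs_of_nonneg (by positivity)]
  have hI : (0 : ℝ) ≤ (FractionalIdeal.absNorm (I : FractionalIdeal (𝓞 K)⁰ K) : ℝ) := by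
    exact_mod_cast FractionalIdeal.absNorm_nonneg _
  simp only [ENNReal.toReal_mul, ENNReal.toReal_pow, ENNReal.toReal_inv, ENNReal.toReal_ofNat]
  rw [ENNReal.toReal_ofReal (by positivity), ENNReal.toReal_ofReal hI]
  rw [idealCovol, ENNReal.coe_toReal, Real.coe_sqrt, coe_nnnorm, Int.norm_eq_abs]
  have : (2 : ℝ) ^ InfinitePlace.nrComplexPlaces K * 2⁻¹ ^ InfinitePlace.nrComplexPlaces K = 1 := by
    rw [← mul_pow]; norm_num
  linear_combination (Real.exp (∑ w : InfinitePlace K, (w.mult : ℝ) * u w) *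
    (FractionalIdeal.absNorm (I : FractionalIdeal (𝓞 K)⁰ K) : ℝ) * √|(discr K : ℝ)|) * this

lemma exists_lattice_params (I : (FractionalIdeal (𝓞 K)⁰ K)ˣ) (u : InfinitePlace K → ℝ) :
    ∃ (ι : Type) (_ : Fintype ι) (b b' : Basis ι ℝ (MixedEuclid K))
      (e : (ι → ℤ) ≃ {x // x ∈ I.1}) (e' : (ι → ℤ) ≃ {x // x ∈ FractionalIdeal.dual ℤ ℚ I.1}),
      (∀ i j, inner ℝ (b i) (b' j) = if i = j then (1 : ℝ) else 0) ∧
      (∀ m, placeForm u (e m : K) = ‖∑ i, (m i : ℝ) • b i‖ ^ 2) ∧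
      (∀ m, placeForm (-u) (e' m : K) = ‖∑ i, (m i : ℝ) • b' i‖ ^ 2) ∧
      volume.real (ZSpan.fundamentalDomain b) = idealCovol I.1 *
        Real.exp (∑ w : InfinitePlace K, (w.mult : ℝ) * u w) := by
  let a := basisOfFractionalIdeal K I
  let f := scaleEquiv (placeScale u) (isUnit_placeScale u)
  let f' := scaleEquiv (placeScaleDual u) (isUnit_placeScaleDual u)
  let b := (fractionalIdealLatticeBasis K I).map f
  have hb : ∀ i, b i = f (mixedEmbedding K (a i)) := fun i => by simp [b, a]
  let b' : Basis _ ℝ (MixedEuclid K) :=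
    LinearMap.BilinForm.dualBasis (innerₗ (MixedEuclid K)) (by
      refine ⟨fun x hx => ?_, fun x hx => ?_⟩
      · exact inner_self_eq_zero.mp (hx x)
      · exact inner_self_eq_zero.mp (hx x)) b
  have hbb' : ∀ i j, inner ℝ (b i) (b' j) = if i = j then (1 : ℝ) else 0 := by
    intro i j
    rw [real_inner_comm]
    exact LinearMap.BilinForm.apply_dualBasis_left (B := innerₗ (MixedEuclid K)) _ b j i
  have hb' : ∀ i, b' i = f' (mixedEmbedding K (a.traceDual i)) := by
    intro i
    refine ext_inner_left ℝ fun v => ?_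
    suffices h : ∀ j, inner ℝ (b j) (b' i) = inner ℝ (b j) (f' (mixedEmbedding K (a.traceDual i))) by
      rw [← b.sum_repr v, sum_inner, sum_inner]
      refine Finset.sum_congr rfl fun j _ => ?_
      rw [inner_smul_left, inner_smul_left, h]
    intro j
    rw [hbb', hb]
    simp only [f, f']
    rw [inner_scaleEquiv]
    have := Basis.trace_mul_traceDual a j i
    rw [this]
    split_ifs <;> simp
  refine ⟨_, inferInstance, b, b',
    latticeEquiv a I.1 (fun x => mem_span_basisOfFractionalIdeal K),
    latticeEquiv a.traceDual _ ?_, hbb', ?_, ?_, volume_fundamentalDomain_ideal I u⟩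
  · intro x
    have h := Submodule.traceDual_span_of_basis ℤ (K := ℚ) (L := K) (B := 𝓞 K)
      (I.1 : Submodule (𝓞 K) K) a (by
        ext x
        rw [mem_span_basisOfFractionalIdeal K]
        simp)
    rw [← h, ← FractionalIdeal.coe_dual ℤ ℚ (Units.ne_zero I)]
    rfl
  · intro m
    rw [latticeEquiv_apply, ← norm_scaleEquiv_sq]
    congr 2
    simp only [hb, map_sum, map_zsmul, Int.cast_smul_eq_zsmul]
    rfl
  · intro m
    rw [latticeEquiv_apply, ← norm_scaleEquiv_dual_sq]
    congr 2
    simp only [hb', map_sum, map_zsmul, Int.cast_smul_eq_zsmul]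
    rfl

theorem idealTheta_functional_equation (I : (FractionalIdeal (𝓞 K)⁰ K)ˣ)
    (u : InfinitePlace K → ℝ) :
    idealTheta I.1 u = (idealCovol I.1 * Real.exp (∑ w : InfinitePlace K, (w.mult : ℝ) * u w))⁻¹ *
      idealTheta (FractionalIdeal.dual ℤ ℚ I.1) (-u) := by
  obtain ⟨ι, _, b, b', e, e', h1, h2, h3, h4⟩ := exists_lattice_params I u
  rw [idealTheta, idealTheta, ← e.tsum_eq, ← e'.tsum_eq]
  simp only [h2, h3]
  rw [gaussian_poisson b b' h1, h4]

lemma exists_placeForm_bound (I : (FractionalIdeal (𝓞 K)⁰ K)ˣ) :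
    ∃ (ι : Type) (_ : Fintype ι) (e : (ι → ℤ) ≃ {x // x ∈ I.1}) (c : ℝ), 0 < c ∧ (e 0 : K) = 0 ∧
      ∀ m, c * ‖(fun i => (m i : ℝ))‖ ^ 2 ≤ placeForm 0 (e m : K) := by
  obtain ⟨ι, _, b, b', e, e', h1, h2, h3, h4⟩ := exists_lattice_params I 0
  obtain ⟨c, hc, h⟩ := exists_lower_bound_basis b
  refine ⟨ι, inferInstance, e, c ^ 2, by positivity, ?_, fun m => ?_⟩
  · have := h2 0
    simp only [Pi.zero_apply, Int.cast_zero, zero_smul, Finset.sum_const_zero, norm_zero] at this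
    rw [← norm_scaleEquiv_sq] at this
    simpa using this
  · rw [h2, ← mul_pow]
    gcongr
    exact h _

end IdealTheta

section LogSpace
open mixedEmbedding Module NumberField.Units NumberField.Units.dirichletUnitTheorem
open scoped nonZeroDivisors ENNReal
variable {K : Type} [Field K] [NumberField K]

/-- The sum-zero extension of a vector of the logarithmic space to all infinite places. -/
def logExtend (x : logSpace K) (w : InfinitePlace K) : ℝ :=
  if h : w = w₀ then -∑ v, x v else x ⟨w, h⟩

lemma sum_logExtend (x : logSpace K) : ∑ w, logExtend x w = 0 := by
  rw [Fintype.sum_eq_add_sum_subtype_ne _ (w₀ : InfinitePlace K)]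
  have : ∀ v : {w : InfinitePlace K // w ≠ w₀}, logExtend x v = x v := fun v => by
    simp [logExtend, v.2]
  simp only [this]
  simp [logExtend]

lemma logExtend_add (x y : logSpace K) (w) : logExtend (x + y) w = logExtend x w + logExtend y w := by
  unfold logExtend
  split_ifs
  · simp [Finset.sum_add_distrib]; ring
  · rfl

lemma logExtend_neg (x : logSpace K) (w) : logExtend (-x) w = -logExtend x w := by
  unfold logExtend
  split_ifs
  · simp
  · rfl

lemma logExtend_logEmbedding (ε : (𝓞 K)ˣ) (w : InfinitePlace K) :
    logExtend (logEmbedding K (Additive.ofMul ε)) w = w.mult * Real.log (w (ε : K)) := by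
  unfold logExtend
  split_ifs with h
  · rw [sum_logEmbedding_component, h]; ring
  · rfl

lemma continuous_logExtend (w : InfinitePlace K) : Continuous fun x : logSpace K => logExtend x w := by
  unfold logExtend
  split_ifs <;> fun_prop

lemma abs_logExtend_le (x : logSpace K) (w) :
    |logExtend x w| ≤ (Fintype.card (InfinitePlace K)) * ‖x‖ := by
  unfold logExtend
  have h1 : (1 : ℝ) ≤ Fintype.card (InfinitePlace K) := by
    exact_mod_cast Fintype.card_pos
  split_ifs with h
  · rw [abs_neg]
    refine (Finset.abs_sum_le_sum_abs _ _).trans ?_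
    refine (Finset.sum_le_card_nsmul _ _ ‖x‖ fun v _ => norm_le_pi_norm x v).trans ?_
    rw [nsmul_eq_mul]
    gcongr
    exact_mod_cast Fintype.card_subtype_le _
  · refine (norm_le_pi_norm x ⟨w, h⟩).trans ?_
    nlinarith [norm_nonneg x]

/-- The scaling parameters with total weight `τ - c` and direction `x`. -/
def placeCoord (c τ : ℝ) (x : logSpace K) (w : InfinitePlace K) : ℝ :=
  (τ - c) / (finrank ℚ K : ℝ) + logExtend x w / w.mult

lemma mult_pos' (w : InfinitePlace K) : (0 : ℝ) < w.mult := by exact_mod_cast w.mult_pos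

lemma sum_mult_mul_placeCoord (c τ : ℝ) (x : logSpace K) :
    ∑ w : InfinitePlace K, (w.mult : ℝ) * placeCoord c τ x w = τ - c := by
  have h : ∀ w : InfinitePlace K, (w.mult : ℝ) * placeCoord c τ x w =
      (w.mult : ℝ) * ((τ - c) / (finrank ℚ K : ℝ)) + logExtend x w := fun w => by
    rw [placeCoord, mul_add, mul_div_cancel₀ _ (mult_pos' w).ne']
  have hn : (finrank ℚ K : ℝ) ≠ 0 := by exact_mod_cast (finrank_pos (R := ℚ) (M := K)).ne'
  simp only [h, Finset.sum_add_distrib, sum_logExtend, ← Finset.sum_mul]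
  rw [← Nat.cast_sum, InfinitePlace.sum_mult_eq]
  field_simp
  ring

lemma placeCoord_neg (c τ : ℝ) (x : logSpace K) :
    placeCoord (-c) (-τ) (-x) = -placeCoord c τ x := by
  ext w
  simp only [placeCoord, logExtend_neg, Pi.neg_apply]
  ring

lemma placeCoord_add_logEmbedding (c τ : ℝ) (x : logSpace K) (ε : (𝓞 K)ˣ) :
    placeCoord c τ (x + logEmbedding K (Additive.ofMul ε)) =
      fun w => placeCoord c τ x w + Real.log (w (ε : K)) := by
  ext w
  rw [placeCoord, placeCoord, logExtend_add, logExtend_logEmbedding, add_div,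
    mul_div_cancel_left₀ _ (mult_pos' w).ne', add_assoc]

lemma continuous_placeCoord (c : ℝ) (w : InfinitePlace K) :
    Continuous fun p : ℝ × logSpace K => placeCoord c p.1 p.2 w := by
  unfold placeCoord
  have := (continuous_logExtend w).comp (continuous_snd (X := ℝ) (Y := logSpace K))
  simp only [Function.comp_def] at this
  fun_prop

lemma le_placeCoord (c τ : ℝ) (x : logSpace K) (w) :
    (τ - c) / (finrank ℚ K : ℝ) - (Fintype.card (InfinitePlace K)) * ‖x‖ ≤ placeCoord c τ x w := by
  have h1 : |logExtend x w / w.mult| ≤ (Fintype.card (InfinitePlace K)) * ‖x‖ := by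
    rw [abs_div, abs_of_pos (mult_pos' w)]
    refine (div_le_self (abs_nonneg _) ?_).trans (abs_logExtend_le x w)
    exact_mod_cast w.mult_pos
  have := (abs_le.mp h1).1
  rw [placeCoord]
  linarith

lemma placeForm_mul (u : InfinitePlace K → ℝ) (ε α : K) (hε : ε ≠ 0) :
    placeForm u (ε * α) = placeForm (fun w => u w + Real.log (w ε)) α := by
  refine Finset.sum_congr rfl fun w _ => ?_
  have h : 0 < w ε := w.pos_iff.mpr hε
  rw [mul_add, Real.exp_add, map_mul, mul_pow, two_mul (Real.log _), Real.exp_add, Real.exp_log h]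
  ring

lemma placeForm_mono {u u' : InfinitePlace K → ℝ} (h : ∀ w, u w ≤ u' w) (α : K) :
    placeForm u α ≤ placeForm u' α := by
  refine Finset.sum_le_sum fun w _ => ?_
  have := h w
  gcongr

lemma placeForm_const (a : ℝ) (α : K) :
    placeForm (fun _ => a) α = Real.exp (2 * a) * placeForm 0 α := by
  rw [placeForm, placeForm, Finset.mul_sum]
  refine Finset.sum_congr rfl fun w _ => ?_
  simp
  ring

/-- The theta series of a fractional ideal without its constant term. -/
def idealThetaAux (I : FractionalIdeal (𝓞 K)⁰ K) (u : InfinitePlace K → ℝ) : ℝ≥0∞ :=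
  ∑' α : {x : K // x ∈ I ∧ x ≠ 0}, ENNReal.ofReal (Real.exp (-Real.pi * placeForm u (α : K)))

lemma exists_idealThetaAux_le (I : (FractionalIdeal (𝓞 K)⁰ K)ˣ) (k : ℕ) :
    ∃ N : ℕ, k ≤ N ∧ ∃ C : ℝ, 0 ≤ C ∧ ∀ (a : ℝ) (u : InfinitePlace K → ℝ), (∀ w, a ≤ u w) →
      idealThetaAux I.1 u ≤ ENNReal.ofReal (C * Real.exp (-(2 * N * a))) := by
  obtain ⟨ι, _, e, c, hc, he0, he⟩ := exists_placeForm_bound I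
  set d := Fintype.card ι + 1
  set N := max k d
  set A : ℝ := (N.factorial : ℝ) * ((Real.pi * c) ^ N)⁻¹ * 2 ^ d
  have hs := summable_one_add_norm_int_pow_inv (ι := ι)
  refine ⟨N, le_max_left _ _, A * ∑' m : ι → ℤ, ((1 + ‖(fun i => (m i : ℝ))‖) ^ d)⁻¹,
    by positivity, fun a u hu => ?_⟩
  have hterm : ∀ m : ι → ℤ, m ≠ 0 → Real.exp (-Real.pi * placeForm u (e m : K)) ≤
      A * Real.exp (-(2 * N * a)) * ((1 + ‖(fun i => (m i : ℝ))‖) ^ d)⁻¹ := by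
    intro m hm
    have hm1 : 1 ≤ ‖(fun i => (m i : ℝ))‖ := by
      obtain ⟨i, hi⟩ := Function.ne_iff.mp hm
      refine le_trans ?_ (norm_le_pi_norm (fun i => (m i : ℝ)) i)
      rw [Real.norm_eq_abs]
      exact_mod_cast Int.one_le_abs hi
    set r := ‖(fun i => (m i : ℝ))‖
    have h1 : Real.exp (2 * a) * (c * r ^ 2) ≤ placeForm u (e m : K) :=
      calc _ ≤ Real.exp (2 * a) * placeForm 0 (e m : K) := by gcongr; exact he m
        _ = placeForm (fun _ => a) (e m : K) := (placeForm_const _ _).symm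
        _ ≤ _ := placeForm_mono hu _
    set y := Real.pi * c * Real.exp (2 * a) * r ^ 2 with hy
    have hypos : 0 < y := by positivity
    have h2 : Real.exp (-Real.pi * placeForm u (e m : K)) ≤ Real.exp (-y) := by
      apply Real.exp_le_exp.mpr
      rw [hy]
      nlinarith [Real.pi_pos]
    have h3 : Real.exp (-y) ≤ N.factorial * (y ^ N)⁻¹ := by
      have := Real.pow_div_factorial_le_exp y hypos.le N
      rw [Real.exp_neg]
      have h4 : 0 < y ^ N / N.factorial := by positivity
      calc (Real.exp y)⁻¹ ≤ (y ^ N / N.factorial)⁻¹ := inv_anti₀ h4 this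
        _ = _ := by rw [inv_div]; rfl
    refine h2.trans (h3.trans ?_)
    have h5 : y ^ N = (Real.pi * c) ^ N * Real.exp (2 * N * a) * r ^ (2 * N) := by
      rw [hy, mul_pow, mul_pow, ← pow_mul, ← Real.exp_nat_mul]
      congr 3
      ring
    have h6 : (r ^ (2 * N))⁻¹ ≤ 2 ^ d * ((1 + r) ^ d)⁻¹ := by
      have h7 : r ^ d ≤ r ^ (2 * N) := pow_le_pow_right₀ hm1 (by
        have := le_max_right k d
        show d ≤ 2 * max k d
        omega)
      have h8 : (1 + r) ^ d ≤ 2 ^ d * r ^ d := by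
        rw [← mul_pow]
        gcongr
        linarith
      rw [inv_le_comm₀ (by positivity) (by positivity), mul_inv, inv_inv]
      refine le_trans ?_ h7
      rw [inv_mul_le_iff₀ (by positivity)]
      exact h8
    rw [h5, mul_inv, mul_inv, ← Real.exp_neg]
    calc (N.factorial : ℝ) * (((Real.pi * c) ^ N)⁻¹ * Real.exp (-(2 * N * a)) * (r ^ (2 * N))⁻¹)
        ≤ (N.factorial : ℝ) * (((Real.pi * c) ^ N)⁻¹ * Real.exp (-(2 * N * a)) *
          (2 ^ d * ((1 + r) ^ d)⁻¹)) := by gcongr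
      _ = _ := by ring
  have hb : idealThetaAux I.1 u ≤ ∑' m : ι → ℤ, ENNReal.ofReal
      (A * Real.exp (-(2 * N * a)) * ((1 + ‖(fun i => (m i : ℝ))‖) ^ d)⁻¹) := by
    let j : {x : K // x ∈ I.1 ∧ x ≠ 0} → (ι → ℤ) := fun α => e.symm ⟨α.1, α.2.1⟩
    have hj : Function.Injective j := by
      intro α β h
      have := e.symm.injective h
      exact Subtype.ext (Subtype.mk.inj this)
    refine le_trans (ENNReal.tsum_le_tsum fun α => ?_)
      (ENNReal.tsum_comp_le_tsum_of_injective hj _)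
    have hα : (e (j α) : K) = α := by simp [j]
    have := hterm (j α) (by
      intro h0
      apply α.2.2
      rw [← hα, h0, he0])
    rw [hα] at this
    exact ENNReal.ofReal_le_ofReal this
  refine hb.trans (le_of_eq ?_)
  rw [← ENNReal.ofReal_tsum_of_nonneg (fun m => by positivity)
    (hs.mul_left (A * Real.exp (-(2 * N * a)))), tsum_mul_left]
  congr 1
  ring

lemma idealThetaAux_lt_top (I : (FractionalIdeal (𝓞 K)⁰ K)ˣ) (u : InfinitePlace K → ℝ) :
    idealThetaAux I.1 u < ⊤ := by
  obtain ⟨N, _, C, _, h⟩ := exists_idealThetaAux_le I 0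
  obtain ⟨a, ha⟩ := (Set.finite_range u).bddBelow
  exact (h a u fun w => ha ⟨w, rfl⟩).trans_lt ENNReal.ofReal_lt_top

lemma ofReal_idealTheta (I : (FractionalIdeal (𝓞 K)⁰ K)ˣ) (u : InfinitePlace K → ℝ) :
    ENNReal.ofReal (idealTheta I.1 u) = 1 + idealThetaAux I.1 u := by
  set F : K → ℝ≥0∞ := fun x => ENNReal.ofReal (Real.exp (-Real.pi * placeForm u x))
  have h1 : ∑' α : {x // x ∈ I.1}, F α = 1 + idealThetaAux I.1 u := by
    have e1 : ∑' α : {x // x ∈ I.1}, F α = ∑' x, Set.indicator {x | x ∈ I.1} F x :=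
      tsum_subtype {x | x ∈ I.1} F
    have e2 : idealThetaAux I.1 u = ∑' x, Set.indicator {x | x ∈ I.1 ∧ x ≠ 0} F x :=
      tsum_subtype {x | x ∈ I.1 ∧ x ≠ 0} F
    rw [e1, e2, ENNReal.tsum_eq_add_tsum_ite 0]
    congr 1
    · have : F 0 = 1 := by simp [F, placeForm]
      rw [Set.indicator_of_mem (by exact FractionalIdeal.zero_mem I.1), this]
    · refine tsum_congr fun x => ?_
      by_cases hx : x = 0 <;> simp [hx, Set.indicator]
  have hne : ∑' α : {x // x ∈ I.1}, F α ≠ ⊤ := by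
    rw [h1]
    exact (ENNReal.add_lt_top.mpr ⟨ENNReal.one_lt_top, idealThetaAux_lt_top I u⟩).ne
  rw [← h1, idealTheta, ENNReal.ofReal_tsum_of_nonneg (fun α => (Real.exp_pos _).le)]
  have := ENNReal.summable_toReal hne
  refine this.congr fun α => ?_
  exact ENNReal.toReal_ofReal (Real.exp_pos _).le

lemma idealThetaAux_antitone (I : FractionalIdeal (𝓞 K)⁰ K) {u u' : InfinitePlace K → ℝ}
    (h : ∀ w, u w ≤ u' w) : idealThetaAux I u' ≤ idealThetaAux I u := by
  refine ENNReal.tsum_le_tsum fun α => ENNReal.ofReal_le_ofReal (Real.exp_le_exp.mpr ?_)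
  have := placeForm_mono h α.1
  nlinarith [Real.pi_pos]

end LogSpace

section ThetaIntegral
open mixedEmbedding Module NumberField.Units NumberField.Units.dirichletUnitTheorem
open scoped nonZeroDivisors ENNReal Pointwise
variable {K : Type} [Field K] [NumberField K]

lemma idealCovol_pos (I : (FractionalIdeal (𝓞 K)⁰ K)ˣ) :
    0 < idealCovol (I : FractionalIdeal (𝓞 K)⁰ K) := by
  have h1 : (0 : ℝ) < (FractionalIdeal.absNorm (I : FractionalIdeal (𝓞 K)⁰ K) : ℝ) := by
    have h := FractionalIdeal.absNorm_nonneg (I : FractionalIdeal (𝓞 K)⁰ K)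
    have h2 : FractionalIdeal.absNorm (I : FractionalIdeal (𝓞 K)⁰ K) ≠ 0 := by
      rw [Ne, FractionalIdeal.absNorm_eq_zero_iff]
      exact I.ne_zero
    exact_mod_cast lt_of_le_of_ne h h2.symm
  have h2 : (0 : ℝ) < |(discr K : ℝ)| := abs_pos.mpr (by exact_mod_cast discr_ne_zero K)
  unfold idealCovol
  positivity

/-- The trace dual of an invertible fractional ideal. -/
def dualIdeal (I : (FractionalIdeal (𝓞 K)⁰ K)ˣ) : (FractionalIdeal (𝓞 K)⁰ K)ˣ :=
  Units.mk0 (FractionalIdeal.dual ℤ ℚ I.1) (FractionalIdeal.dual_ne_zero ℤ ℚ I.ne_zero)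

lemma coe_dualIdeal (I : (FractionalIdeal (𝓞 K)⁰ K)ˣ) :
    (dualIdeal I).1 = FractionalIdeal.dual ℤ ℚ I.1 := rfl

lemma dualIdeal_dualIdeal (I : (FractionalIdeal (𝓞 K)⁰ K)ˣ) : dualIdeal (dualIdeal I) = I := by
  apply Units.ext
  rw [coe_dualIdeal, coe_dualIdeal, FractionalIdeal.dual_dual]

lemma idealTheta_pos (I : (FractionalIdeal (𝓞 K)⁰ K)ˣ) (u : InfinitePlace K → ℝ) :
    0 < idealTheta I.1 u := by
  rw [← ENNReal.ofReal_pos, ofReal_idealTheta]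
  simp

lemma idealCovol_dualIdeal (I : (FractionalIdeal (𝓞 K)⁰ K)ˣ) :
    idealCovol (dualIdeal I).1 = (idealCovol I.1)⁻¹ := by
  have h1 := idealTheta_functional_equation I 0
  have h2 := idealTheta_functional_equation (dualIdeal I) 0
  rw [← coe_dualIdeal] at h1
  rw [← coe_dualIdeal, dualIdeal_dualIdeal] at h2
  simp only [Pi.zero_apply, mul_zero, Finset.sum_const_zero, Real.exp_zero, mul_one, neg_zero]
    at h1 h2
  have h3 := idealTheta_pos I 0
  have h4 := idealCovol_pos I
  have h5 := idealCovol_pos (dualIdeal I)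
  rw [h2] at h1
  have h6 : idealTheta I.1 0 * (1 - (idealCovol I.1)⁻¹ * (idealCovol (dualIdeal I).1)⁻¹) = 0 := by
    linear_combination h1
  rcases mul_eq_zero.mp h6 with h | h
  · exact absurd h h3.ne'
  · field_simp at h ⊢
    linarith

/-- The theta series along the coordinates normalized by the covolume of the ideal. -/
lemma one_add_idealThetaAux (I : (FractionalIdeal (𝓞 K)⁰ K)ˣ) (τ : ℝ) (x : logSpace K) :
    1 + idealThetaAux I.1 (placeCoord (Real.log (idealCovol I.1)) τ x) =
      ENNReal.ofReal (Real.exp (-τ)) * (1 + idealThetaAux (dualIdeal I).1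
        (placeCoord (Real.log (idealCovol (dualIdeal I).1)) (-τ) (-x))) := by
  rw [← ofReal_idealTheta, ← ofReal_idealTheta, ← ENNReal.ofReal_mul (Real.exp_pos _).le,
    idealTheta_functional_equation, sum_mult_mul_placeCoord, ← coe_dualIdeal,
    idealCovol_dualIdeal, Real.log_inv, placeCoord_neg]
  congr 2
  rw [Real.exp_sub, Real.exp_log (idealCovol_pos I), Real.exp_neg, mul_div_cancel₀ _
    (idealCovol_pos I).ne']

/-- The integral of the theta series over a set of directions. -/
def thetaInt (D : Set (logSpace K)) (I : (FractionalIdeal (𝓞 K)⁰ K)ˣ) (τ : ℝ) : ℝ≥0∞ :=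
  ∫⁻ x in D, idealThetaAux I.1 (placeCoord (Real.log (idealCovol I.1)) τ x)

lemma countable_of_numberField : Countable K := by
  let b := Module.finBasis ℚ K
  exact Countable.of_equiv _ b.equivFun.toEquiv.symm

lemma continuous_placeForm_placeCoord (c : ℝ) (α : K) :
    Continuous fun p : ℝ × logSpace K => placeForm (placeCoord c p.1 p.2) α := by
  unfold placeForm
  have := fun w => continuous_placeCoord (K := K) c w
  fun_prop

lemma measurable_idealThetaAux_right (I : FractionalIdeal (𝓞 K)⁰ K) (c τ : ℝ) :
    Measurable fun x : logSpace K => idealThetaAux I (placeCoord c τ x) := by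
  have := countable_of_numberField (K := K)
  unfold idealThetaAux
  refine Measurable.tsum fun α => ?_
  have h := (continuous_placeForm_placeCoord (K := K) c α).comp
    (Continuous.prodMk_right (Y := logSpace K) τ)
  have h' : Continuous fun x : logSpace K =>
      Real.exp (-Real.pi * placeForm (placeCoord c τ x) (α : K)) :=
    Real.continuous_exp.comp (continuous_const.mul h)
  exact h'.measurable.ennreal_ofReal

lemma volume_add_thetaInt (D : Set (logSpace K)) (hD : MeasurableSet D)
    (I : (FractionalIdeal (𝓞 K)⁰ K)ˣ) (τ : ℝ) :
    volume D + thetaInt D I τ =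
      ENNReal.ofReal (Real.exp (-τ)) * (volume D + thetaInt (-D) (dualIdeal I) (-τ)) := by
  have h1 : ∀ (J : (FractionalIdeal (𝓞 K)⁰ K)ˣ) (σ : ℝ) (E : Set (logSpace K)),
      volume E + thetaInt E J σ =
      ∫⁻ x in E, (1 + idealThetaAux J.1 (placeCoord (Real.log (idealCovol J.1)) σ x)) := by
    intro J σ E
    rw [lintegral_add_left measurable_const, lintegral_const, Measure.restrict_apply_univ, one_mul]
    rfl
  have h2 : volume D = volume (-D) := (Measure.measure_neg volume D).symm
  have h4 : ∀ (J : (FractionalIdeal (𝓞 K)⁰ K)ˣ) (σ : ℝ), Measurable fun x : logSpace K =>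
      1 + idealThetaAux J.1 (placeCoord (Real.log (idealCovol J.1)) σ x) := fun J σ =>
    measurable_const.add (measurable_idealThetaAux_right _ _ _)
  rw [h1, h2, ← h2, h2, h1, ← lintegral_const_mul _ (h4 _ _)]
  have h3 : D = (fun x => -x) ⁻¹' (-D) := by ext x; simp
  conv_lhs => rw [h3]
  rw [← (Measure.measurePreserving_neg (volume : Measure (logSpace K))).setLIntegral_comp_preimage
    hD.neg ((h4 _ _).const_mul _)]
  refine lintegral_congr fun x => ?_
  exact one_add_idealThetaAux I τ x

lemma exists_thetaInt_le (D : Set (logSpace K)) (hD : Bornology.IsBounded D)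
    (I : (FractionalIdeal (𝓞 K)⁰ K)ˣ) (r : ℝ) :
    ∃ q : ℝ, r ≤ q ∧ ∃ C : ℝ, 0 ≤ C ∧ ∀ τ, thetaInt D I τ ≤ ENNReal.ofReal (C * Real.exp (-(q * τ))) := by
  have hn : (0 : ℝ) < (finrank ℚ K : ℝ) := by exact_mod_cast (finrank_pos (R := ℚ) (M := K))
  obtain ⟨B, hB⟩ := hD.exists_norm_le
  obtain ⟨k, hk⟩ := exists_nat_ge (r * finrank ℚ K / 2)
  obtain ⟨N, hN, C, hC, h⟩ := exists_idealThetaAux_le I k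
  have hDv : volume D < ⊤ := hD.measure_lt_top
  set c := Real.log (idealCovol I.1)
  set n : ℝ := (finrank ℚ K : ℝ)
  set B' : ℝ := (Fintype.card (InfinitePlace K)) * B
  refine ⟨2 * N / n, ?_, C * Real.exp (2 * N * (c / n + B')) * (volume D).toReal, by positivity,
    fun τ => ?_⟩
  · rw [le_div_iff₀ hn]
    have : (k : ℝ) ≤ N := by exact_mod_cast hN
    linarith
  · have h1 : thetaInt D I τ ≤ ∫⁻ x in D,
        ENNReal.ofReal (C * Real.exp (-(2 * N * ((τ - c) / n - B')))) := by
      refine setLIntegral_mono measurable_const fun x hx => h _ _ fun w => ?_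
      refine le_trans ?_ (le_placeCoord c τ x w)
      have : (Fintype.card (InfinitePlace K)) * ‖x‖ ≤ B' := by
        have := hB x hx
        simp only [B']
        gcongr
      gcongr
    refine h1.trans (le_of_eq ?_)
    rw [lintegral_const, Measure.restrict_apply_univ]
    nth_rewrite 1 [← ENNReal.ofReal_toReal hDv.ne]
    rw [← ENNReal.ofReal_mul (by positivity)]
    congr 1
    have : Real.exp (-(2 * N * ((τ - c) / n - B'))) =
        Real.exp (2 * N * (c / n + B')) * Real.exp (-(2 * N / n * τ)) := by
      rw [← Real.exp_add]
      congr 1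
      ring
    rw [this]
    ring

lemma thetaInt_lt_top (D : Set (logSpace K)) (hD : Bornology.IsBounded D)
    (I : (FractionalIdeal (𝓞 K)⁰ K)ˣ) (τ : ℝ) : thetaInt D I τ < ⊤ := by
  obtain ⟨q, _, C, _, h⟩ := exists_thetaInt_le D hD I 0
  exact (h τ).trans_lt ENNReal.ofReal_lt_top

lemma thetaInt_antitone (D : Set (logSpace K)) (I : (FractionalIdeal (𝓞 K)⁰ K)ˣ) :
    Antitone (thetaInt D I) := by
  intro τ τ' h
  refine lintegral_mono fun x => idealThetaAux_antitone _ fun w => ?_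
  unfold placeCoord
  gcongr

/-- The sum of the integrated theta functions over a finite family of ideals. -/
def thetaSum {ι : Type*} [Fintype ι] (D : Set (logSpace K))
    (I : ι → (FractionalIdeal (𝓞 K)⁰ K)ˣ) (t : ℝ) : ℝ :=
  ∑ j, ((volume D).toReal + (thetaInt D (I j) (Real.log t)).toReal)

lemma thetaSum_antitoneOn {ι : Type*} [Fintype ι] (D : Set (logSpace K))
    (hD : Bornology.IsBounded D)
    (I : ι → (FractionalIdeal (𝓞 K)⁰ K)ˣ) : AntitoneOn (thetaSum D I) (Set.Ioi 0) := by
  intro s hs t ht hst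
  refine Finset.sum_le_sum fun j _ => ?_
  have := ENNReal.toReal_mono (thetaInt_lt_top D hD (I j) (Real.log s)).ne
    (thetaInt_antitone D (I j) (Real.log_le_log hs hst))
  linarith

lemma thetaSum_locallyIntegrableOn {ι : Type*} [Fintype ι] (D : Set (logSpace K))
    (hD : Bornology.IsBounded D) (I : ι → (FractionalIdeal (𝓞 K)⁰ K)ˣ) :
    LocallyIntegrableOn (fun t => (thetaSum D I t : ℂ)) (Set.Ioi 0) := by
  rw [locallyIntegrableOn_iff isOpen_Ioi.isLocallyClosed]
  intro k hk hkc
  exact (((thetaSum_antitoneOn D hD I).mono hk).integrableOn_isCompact hkc).ofReal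

lemma thetaSum_sub_isBigO {ι : Type*} [Fintype ι] (D : Set (logSpace K))
    (hD : Bornology.IsBounded D) (I : ι → (FractionalIdeal (𝓞 K)⁰ K)ˣ) (r : ℝ) :
    (fun t => (thetaSum D I t : ℂ) - ((Fintype.card ι * (volume D).toReal : ℝ) : ℂ))
      =O[atTop] (fun t : ℝ => t ^ r) := by
  have h1 : (fun t => (thetaSum D I t : ℂ) - ((Fintype.card ι * (volume D).toReal : ℝ) : ℂ)) =
      fun t => ∑ j, ((thetaInt D (I j) (Real.log t)).toReal : ℂ) := by
    ext t
    rw [thetaSum, Finset.sum_add_distrib]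
    push_cast
    simp
  rw [h1]
  refine Asymptotics.IsBigO.fun_sum fun j _ => ?_
  obtain ⟨q, hq, C, hC, h⟩ := exists_thetaInt_le D hD (I j) (-r)
  refine Asymptotics.IsBigO.of_bound C ?_
  filter_upwards [eventually_ge_atTop 1] with t ht
  have h0 : 0 < t := by linarith
  rw [Complex.norm_real, Real.norm_of_nonneg ENNReal.toReal_nonneg,
    Real.norm_of_nonneg (by positivity)]
  refine (ENNReal.toReal_mono ENNReal.ofReal_ne_top (h _)).trans ?_
  rw [ENNReal.toReal_ofReal (by positivity), Real.rpow_def_of_pos h0]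
  gcongr
  have := Real.log_nonneg ht
  nlinarith

/-- The functional equation pair of integrated theta functions. -/
def thetaPair {ι : Type*} [Fintype ι] (D : Set (logSpace K)) (hDm : MeasurableSet D)
    (hD : Bornology.IsBounded D) (I : ι → (FractionalIdeal (𝓞 K)⁰ K)ˣ) : WeakFEPair ℂ where
  f := fun t => (thetaSum D I t : ℂ)
  g := fun t => (thetaSum (-D) (fun j => dualIdeal (I j)) t : ℂ)
  k := 1
  ε := 1
  f₀ := ((Fintype.card ι * (volume D).toReal : ℝ) : ℂ)
  g₀ := ((Fintype.card ι * (volume (-D)).toReal : ℝ) : ℂ)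
  hf_int := thetaSum_locallyIntegrableOn D hD I
  hg_int := thetaSum_locallyIntegrableOn (-D) hD.neg _
  hk := one_pos
  hε := one_ne_zero
  hf_top := thetaSum_sub_isBigO D hD I
  hg_top := thetaSum_sub_isBigO (-D) hD.neg _
  h_feq := by
    intro t ht
    have ht : 0 < t := ht
    have hv : volume D ≠ ⊤ := hD.measure_lt_top.ne
    have hv' : volume (-D) ≠ ⊤ := hD.neg.measure_lt_top.ne
    have h2 : volume D = volume (-D) := (Measure.measure_neg volume D).symm
    simp only [one_mul, Real.rpow_one, smul_eq_mul]
    rw [← Complex.ofReal_mul]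
    congr 1
    rw [thetaSum, thetaSum, Finset.mul_sum]
    refine Finset.sum_congr rfl fun j _ => ?_
    have := congrArg ENNReal.toReal (volume_add_thetaInt D hDm (I j) (-Real.log t))
    rw [ENNReal.toReal_add hv (thetaInt_lt_top D hD _ _).ne, ENNReal.toReal_mul, h2,
      ENNReal.toReal_add hv' (thetaInt_lt_top (-D) hD.neg _ _).ne, neg_neg,
      ENNReal.toReal_ofReal (Real.exp_pos _).le, Real.exp_log ht] at this
    rw [one_div, Real.log_inv, h2, this]

end ThetaIntegral

section Unfolding
open mixedEmbedding Module NumberField.Units NumberField.Units.dirichletUnitTheorem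
open scoped nonZeroDivisors ENNReal Pointwise
variable {K : Type} [Field K] [NumberField K]

lemma finite_ker_logEmbedding : Finite (logEmbedding K).ker := by
  rw [logEmbedding_ker]
  have : Finite (torsion K) := inferInstance
  exact this

/-- A sum over units of a function of the logarithmic embedding. -/
lemma tsum_units_eq (F : logSpace K → ℝ≥0∞) :
    ∑' ε : (𝓞 K)ˣ, F (logEmbedding K (Additive.ofMul ε)) =
      (Nat.card (logEmbedding K).ker : ℝ≥0∞) * ∑' l : unitLattice K, F l := by
  have := finite_ker_logEmbedding (K := K)
  have := Fintype.ofFinite (logEmbedding K).ker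
  have hs : ∀ l : unitLattice K, ∃ ε : Additive (𝓞 K)ˣ, logEmbedding K ε = l := by
    rintro ⟨l, ε, -, h⟩
    exact ⟨ε, h⟩
  choose s hs using hs
  let e : (logEmbedding K).ker × unitLattice K → (𝓞 K)ˣ := fun p => (p.1.1 + s p.2).toMul
  have he : ∀ p, logEmbedding K (Additive.ofMul (e p)) = p.2 := by
    intro p
    simp only [e, ofMul_toMul, map_add, hs]
    rw [p.1.2, zero_add]
  have hb : Function.Bijective e := by
    constructor
    · intro p q h
      have h1 : p.2 = q.2 := Subtype.ext (by rw [← he, ← he, h])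
      have h2 : p.1.1 + s p.2 = q.1.1 + s q.2 := h
      rw [h1] at h2
      exact Prod.ext (Subtype.ext (add_right_cancel h2)) h1
    · intro ε
      let l : unitLattice K := ⟨logEmbedding K (Additive.ofMul ε), ⟨_, trivial, rfl⟩⟩
      refine ⟨(⟨Additive.ofMul ε - s l, ?_⟩, l), ?_⟩
      · rw [AddMonoidHom.mem_ker, map_sub, hs, sub_self]
      · simp [e]
  rw [← (Equiv.ofBijective e hb).tsum_eq]
  simp only [Equiv.ofBijective_apply, he]
  rw [ENNReal.tsum_prod' (f := fun p : (logEmbedding K).ker × unitLattice K => F p.2)]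
  simp only [Nat.card_eq_fintype_card, tsum_fintype, Finset.sum_const, Finset.card_univ,
    nsmul_eq_mul]

instance vaddInvariantMeasure_unitLattice :
    VAddInvariantMeasure (unitLattice K) (logSpace K) volume :=
  ⟨fun c s _ => measure_preimage_add volume (c : logSpace K) s⟩

/-- Unfolding an integral over a fundamental domain of the unit lattice. -/
lemma tsum_units_setLIntegral (D : Set (logSpace K))
    (hD : IsAddFundamentalDomain (unitLattice K) D) (h : logSpace K → ℝ≥0∞) :
    ∑' ε : (𝓞 K)ˣ, ∫⁻ x in D, h (x + logEmbedding K (Additive.ofMul ε)) =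
      (Nat.card (logEmbedding K).ker : ℝ≥0∞) * ∫⁻ x, h x := by
  rw [tsum_units_eq (fun l => ∫⁻ x in D, h (x + l)), hD.lintegral_eq_tsum'' h]
  congr 1
  refine tsum_congr fun l => ?_
  refine lintegral_congr fun x => ?_
  congr 1
  rw [add_comm]
  rfl

/-- An integral ideal as an invertible fractional ideal. -/
def idealUnit (a : {a : Ideal (𝓞 K) // a ≠ ⊥}) : (FractionalIdeal (𝓞 K)⁰ K)ˣ :=
  Units.mk0 (a.1 : FractionalIdeal (𝓞 K)⁰ K) (FractionalIdeal.coeIdeal_ne_zero.mpr a.2)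

lemma coe_idealUnit (a : {a : Ideal (𝓞 K) // a ≠ ⊥}) :
    (idealUnit a).1 = (a.1 : FractionalIdeal (𝓞 K)⁰ K) := rfl

lemma mk_eq_one_iff_exists (I : (FractionalIdeal (𝓞 K)⁰ K)ˣ) :
    ClassGroup.mk K I = 1 ↔ ∃ x : K, x ≠ 0 ∧ I.1 = FractionalIdeal.spanSingleton (𝓞 K)⁰ x := by
  rw [ClassGroup.mk_eq_one_iff, FractionalIdeal.isPrincipal_iff]
  refine ⟨fun ⟨x, hx⟩ => ⟨x, ?_, hx⟩, fun ⟨x, _, hx⟩ => ⟨x, hx⟩⟩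
  rintro rfl
  rw [FractionalIdeal.spanSingleton_zero] at hx
  exact I.ne_zero hx

section Orbit
variable {ι : Type} (I : ι → (FractionalIdeal (𝓞 K)⁰ K)ˣ)

lemma exists_generator (hI : Function.Bijective fun j => ClassGroup.mk K (I j))
    (a : {a : Ideal (𝓞 K) // a ≠ ⊥}) :
    ∃ p : ι × K, p.2 ≠ 0 ∧ (idealUnit a * I p.1).1 = FractionalIdeal.spanSingleton (𝓞 K)⁰ p.2 := by
  obtain ⟨j, hj⟩ := hI.2 (ClassGroup.mk K (idealUnit a))⁻¹
  have h : ClassGroup.mk K (idealUnit a * I j) = 1 := by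
    rw [map_mul]
    have hj : ClassGroup.mk K (I j) = (ClassGroup.mk K (idealUnit a))⁻¹ := hj
    rw [hj, mul_inv_cancel]
  obtain ⟨x, hx, h⟩ := (mk_eq_one_iff_exists _).mp h
  exact ⟨(j, x), hx, h⟩

/-- Nonzero elements of a system of ideals representing the classes correspond to
pairs of a unit and a nonzero integral ideal. -/
lemma exists_orbit_equiv (hI : Function.Bijective fun j => ClassGroup.mk K (I j)) :
    ∃ (q : {a : Ideal (𝓞 K) // a ≠ ⊥} → ι × K)
      (e : (𝓞 K)ˣ × {a : Ideal (𝓞 K) // a ≠ ⊥} ≃ (j : ι) × {x : K // x ∈ (I j).1 ∧ x ≠ 0}),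
      (∀ a, (q a).2 ≠ 0) ∧
      (∀ a, (idealUnit a * I (q a).1).1 = FractionalIdeal.spanSingleton (𝓞 K)⁰ (q a).2) ∧
      ∀ p, (e p).1 = (q p.2).1 ∧ ((e p).2 : K) = (p.1 : 𝓞 K) * (q p.2).2 := by
  choose q hq0 hq using exists_generator I hI
  have hle : ∀ a : {a : Ideal (𝓞 K) // a ≠ ⊥}, (idealUnit a).1 ≤ 1 := fun a =>
    FractionalIdeal.coeIdeal_le_one
  have hmem : ∀ p : (𝓞 K)ˣ × {a : Ideal (𝓞 K) // a ≠ ⊥},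
      ((p.1 : 𝓞 K) : K) * (q p.2).2 ∈ (I (q p.2).1).1 := by
    intro p
    have h1 : (q p.2).2 ∈ (I (q p.2).1).1 := by
      rw [← FractionalIdeal.spanSingleton_le_iff_mem (S := (𝓞 K)⁰), ← hq, Units.val_mul]
      calc _ ≤ 1 * (I (q p.2).1).1 := mul_le_mul_left (hle p.2) _
        _ = _ := one_mul _
    have := Submodule.smul_mem ((I (q p.2).1).1 : Submodule (𝓞 K) K) (p.1 : 𝓞 K) h1
    rwa [Algebra.smul_def] at this
  let f : (𝓞 K)ˣ × {a : Ideal (𝓞 K) // a ≠ ⊥} → (j : ι) × {x : K // x ∈ (I j).1 ∧ x ≠ 0} :=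
    fun p => ⟨(q p.2).1, ⟨((p.1 : 𝓞 K) : K) * (q p.2).2, hmem p,
      mul_ne_zero (by simp) (hq0 p.2)⟩⟩
  have hspan : ∀ (ε : (𝓞 K)ˣ) (x : K), FractionalIdeal.spanSingleton (𝓞 K)⁰ (((ε : 𝓞 K) : K) * x) =
      FractionalIdeal.spanSingleton (𝓞 K)⁰ x := by
    intro ε x
    symm
    rw [FractionalIdeal.spanSingleton_eq_spanSingleton]
    exact ⟨ε, by rw [Units.smul_def, Algebra.smul_def]⟩
  have hf : Function.Bijective f := by
    constructor
    · rintro ⟨ε, a⟩ ⟨ε', a'⟩ h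
      have h1 : (q a).1 = (q a').1 := congrArg Sigma.fst h
      have h2 : ((ε : 𝓞 K) : K) * (q a).2 = ((ε' : 𝓞 K) : K) * (q a').2 :=
        congrArg (fun z : (j : ι) × {x : K // x ∈ (I j).1 ∧ x ≠ 0} => (z.2 : K)) h
      have h3 : a = a' := by
        have h4 : (idealUnit a * I (q a).1).1 = (idealUnit a' * I (q a').1).1 := by
          rw [hq, hq, ← hspan ε, h2, hspan]
        rw [h1] at h4
        have h5 := mul_right_cancel (Units.ext h4)
        have h6 := congrArg Units.val h5
        rw [coe_idealUnit, coe_idealUnit] at h6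
        exact Subtype.ext (FractionalIdeal.coeIdeal_injective h6)
      subst h3
      have h7 := mul_right_cancel₀ (hq0 a) h2
      congr 1
      apply Units.ext
      exact_mod_cast h7
    · rintro ⟨j, x, hx, hx0⟩
      have hJ : FractionalIdeal.spanSingleton (𝓞 K)⁰ x * (I j)⁻¹.1 ≤ 1 := by
        calc _ ≤ (I j).1 * (I j)⁻¹.1 :=
              mul_le_mul_left (FractionalIdeal.spanSingleton_le_iff_mem.mpr hx) _
          _ = 1 := by rw [← Units.val_mul, mul_inv_cancel, Units.val_one]
      obtain ⟨a, ha⟩ := FractionalIdeal.le_one_iff_exists_coeIdeal.mp hJ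
      have ha0 : a ≠ ⊥ := by
        rintro rfl
        have : FractionalIdeal.spanSingleton (𝓞 K)⁰ x * (I j)⁻¹.1 = 0 := by
          rw [← ha]; simp
        rcases mul_eq_zero.mp this with h | h
        · exact hx0 (FractionalIdeal.spanSingleton_eq_zero_iff.mp h)
        · exact (I j)⁻¹.ne_zero h
      have h1 : (idealUnit ⟨a, ha0⟩ * I j).1 = FractionalIdeal.spanSingleton (𝓞 K)⁰ x := by
        rw [Units.val_mul, coe_idealUnit, ha, mul_assoc, ← Units.val_mul, inv_mul_cancel,
          Units.val_one, mul_one]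
      have h2 : (q ⟨a, ha0⟩).1 = j := by
        apply hI.1
        have e1 : ClassGroup.mk K (idealUnit ⟨a, ha0⟩ * I j) = 1 :=
          (mk_eq_one_iff_exists _).mpr ⟨x, hx0, h1⟩
        have e2 : ClassGroup.mk K (idealUnit ⟨a, ha0⟩ * I (q ⟨a, ha0⟩).1) = 1 :=
          (mk_eq_one_iff_exists _).mpr ⟨_, hq0 _, hq _⟩
        rw [map_mul] at e1 e2
        exact mul_left_cancel (e2.trans e1.symm)
      have h3 := hq ⟨a, ha0⟩
      rw [h2, h1] at h3
      obtain ⟨z, hz⟩ := FractionalIdeal.spanSingleton_eq_spanSingleton.mp h3.symm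
      rw [Units.smul_def, Algebra.smul_def] at hz
      refine ⟨(z, ⟨a, ha0⟩), ?_⟩
      subst h2
      simp only [f]
      congr
  exact ⟨q, Equiv.ofBijective f hf, hq0, hq, fun p => ⟨rfl, rfl⟩⟩

/-- Unfolding of the integrated theta functions as a sum over integral ideals. -/
lemma exists_unfold_thetaInt [Fintype ι] (hI : Function.Bijective fun j => ClassGroup.mk K (I j))
    (D : Set (logSpace K))
    (hD : IsAddFundamentalDomain (unitLattice K) D) :
    ∃ q : {a : Ideal (𝓞 K) // a ≠ ⊥} → ι × K, (∀ a, (q a).2 ≠ 0) ∧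
      (∀ a, (idealUnit a * I (q a).1).1 = FractionalIdeal.spanSingleton (𝓞 K)⁰ (q a).2) ∧
      ∀ τ, ∑ j, thetaInt D (I j) τ = (Nat.card (logEmbedding K).ker : ℝ≥0∞) *
        ∑' a, ∫⁻ x, ENNReal.ofReal (Real.exp (-Real.pi * placeForm
          (placeCoord (Real.log (idealCovol (I (q a).1).1)) τ x) (q a).2)) := by
  obtain ⟨q, e, h0, h1, he⟩ := exists_orbit_equiv I hI
  have hc := countable_of_numberField (K := K)
  refine ⟨q, h0, h1, fun τ => ?_⟩
  let g : ι → K → logSpace K → ℝ≥0∞ := fun j α x => ENNReal.ofReal (Real.exp (-Real.pi * placeForm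
          (placeCoord (Real.log (idealCovol (I j).1)) τ x) α))
  have hg : ∀ j α, Measurable (g j α) := by
    intro j α
    have h := (continuous_placeForm_placeCoord (K := K) (Real.log (idealCovol (I j).1)) α).comp
      (Continuous.prodMk_right (Y := logSpace K) τ)
    have h' : Continuous fun x : logSpace K => Real.exp (-Real.pi * placeForm
        (placeCoord (Real.log (idealCovol (I j).1)) τ x) (α : K)) :=
      Real.continuous_exp.comp (continuous_const.mul h)
    exact h'.measurable.ennreal_ofReal
  have hgε : ∀ j α x (ε : (𝓞 K)ˣ), g j (((ε : 𝓞 K) : K) * α) x =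
      g j α (x + logEmbedding K (Additive.ofMul ε)) := by
    intro j α x ε
    simp only [g]
    rw [placeForm_mul _ _ _ (by simp), placeCoord_add_logEmbedding]
  have e1 : ∀ j, thetaInt D (I j) τ = ∑' α : {x : K // x ∈ (I j).1 ∧ x ≠ 0}, ∫⁻ x in D, g j α x := by
    intro j
    exact lintegral_tsum fun α => (hg j α).aemeasurable
  simp only [e1]
  rw [← tsum_fintype (L := .unconditional ι),
    ← ENNReal.tsum_sigma (fun j (α : {x : K // x ∈ (I j).1 ∧ x ≠ 0}) => ∫⁻ x in D, g j α x),
    ← e.tsum_eq, ENNReal.tsum_prod', ENNReal.tsum_comm, ← ENNReal.tsum_mul_left]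
  refine tsum_congr fun a => ?_
  have e2 : ∀ ε : (𝓞 K)ˣ, ∫⁻ x in D, g (e (ε, a)).1 (e (ε, a)).2 x =
      ∫⁻ x in D, g (q a).1 (q a).2 (x + logEmbedding K (Additive.ofMul ε)) := by
    intro ε
    refine lintegral_congr fun x => ?_
    rw [(he (ε, a)).2, (he (ε, a)).1, hgε]
  simp only [e2]
  exact tsum_units_setLIntegral D hD _

end Orbit

end Unfolding

section GammaFactors
open mixedEmbedding Module NumberField.Units NumberField.Units.dirichletUnitTheorem
open scoped nonZeroDivisors ENNReal Pointwise

lemma exp_mul_rpow_mul_exp (r b v : ℝ) :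
    Real.exp v * (Real.exp v ^ (r - 1) * Real.exp (-b * Real.exp v ^ (2 : ℝ))) =
      Real.exp (r * v) * Real.exp (-b * Real.exp (2 * v)) := by
  rw [← Real.exp_mul, ← Real.exp_mul, ← mul_assoc, ← Real.exp_add, mul_comm v 2]
  congr 2
  ring

lemma integrable_exp_mul_exp_neg_exp {r b : ℝ} (hr : 0 < r) (hb : 0 < b) :
    Integrable fun v : ℝ => Real.exp (r * v) * Real.exp (-b * Real.exp (2 * v)) := by
  have h := integrableOn_rpow_mul_exp_neg_mul_rpow (p := 2) (s := r - 1) (b := b) (by linarith)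
    two_pos hb
  rw [← Real.range_exp, ← Set.image_univ, integrableOn_image_iff_integrableOn_abs_deriv_smul
    MeasurableSet.univ (fun x _ => (Real.hasDerivAt_exp x).hasDerivWithinAt)
    Real.exp_injective.injOn, integrableOn_univ] at h
  refine h.congr (Eventually.of_forall fun v => ?_)
  simp only [smul_eq_mul]
  rw [abs_of_pos (Real.exp_pos _), exp_mul_rpow_mul_exp]

lemma integral_exp_mul_exp_neg_exp {r b : ℝ} (hr : 0 < r) (hb : 0 < b) :
    ∫ v : ℝ, Real.exp (r * v) * Real.exp (-b * Real.exp (2 * v)) =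
      b ^ (-r / 2) * (1 / 2) * Real.Gamma (r / 2) := by
  have h := integral_rpow_mul_exp_neg_mul_rpow (p := 2) (q := r - 1) (b := b) two_pos
    (by linarith) hb
  rw [← Real.range_exp, ← Set.image_univ, integral_image_eq_integral_abs_deriv_smul
    MeasurableSet.univ (fun x _ => (Real.hasDerivAt_exp x).hasDerivWithinAt)
    Real.exp_injective.injOn, setIntegral_univ] at h
  rw [sub_add_cancel] at h
  rw [← h]
  refine integral_congr_ae (Eventually.of_forall fun v => ?_)
  simp only [smul_eq_mul]
  rw [abs_of_pos (Real.exp_pos _), exp_mul_rpow_mul_exp]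

variable {K : Type} [Field K] [NumberField K]

/-- The archimedean factor at a place of multiplicity `m`. -/
def gammaFactor (m : ℕ) (s : ℝ) : ℝ :=
  (Real.pi * m) ^ (-(m * s) / 2) * (1 / 2) * Real.Gamma (m * s / 2)

lemma gammaFactor_pos (m : ℕ) (hm : 0 < m) {s : ℝ} (hs : 0 < s) : 0 < gammaFactor m s := by
  have hm' : (0 : ℝ) < m := by exact_mod_cast hm
  have := Real.Gamma_pos_of_pos (show 0 < m * s / 2 by positivity)
  have := Real.pi_pos
  unfold gammaFactor
  positivity

lemma lintegral_placeForm (α : K) (hα : α ≠ 0) {s : ℝ} (hs : 0 < s) :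
    ∫⁻ u : InfinitePlace K → ℝ, ENNReal.ofReal (Real.exp (s * ∑ w, (w.mult : ℝ) * u w)) *
        ENNReal.ofReal (Real.exp (-Real.pi * placeForm u α)) =
      ENNReal.ofReal ((|Algebra.norm ℚ α| : ℚ) ^ (-s) * ∏ w : InfinitePlace K, gammaFactor w.mult s) := by
  let f : InfinitePlace K → ℝ → ℝ := fun w v => Real.exp ((w.mult * s) * v) *
    Real.exp (-(Real.pi * w.mult * (w α) ^ 2) * Real.exp (2 * v))
  have hw : ∀ w : InfinitePlace K, 0 < w α := fun w => w.pos_iff.mpr hα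
  have hb : ∀ w : InfinitePlace K, 0 < Real.pi * w.mult * (w α) ^ 2 := fun w => by
    have := mult_pos' w
    have := hw w
    have := Real.pi_pos
    positivity
  have hr : ∀ w : InfinitePlace K, 0 < w.mult * s := fun w => mul_pos (mult_pos' w) hs
  have e1 : ∀ u : InfinitePlace K → ℝ,
      ENNReal.ofReal (Real.exp (s * ∑ w, (w.mult : ℝ) * u w)) *
        ENNReal.ofReal (Real.exp (-Real.pi * placeForm u α)) = ENNReal.ofReal (∏ w, f w (u w)) := by
    intro u
    rw [← ENNReal.ofReal_mul (Real.exp_pos _).le, ← Real.exp_add]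
    simp only [f, ← Real.exp_add]
    rw [← Real.exp_sum, placeForm, Finset.mul_sum, Finset.mul_sum, ← Finset.sum_add_distrib]
    congr 3
    ext w
    ring
  simp only [e1]
  have hint : Integrable (fun u : InfinitePlace K → ℝ => ∏ w, f w (u w)) := by
    rw [volume_pi]
    exact Integrable.fintype_prod fun w => integrable_exp_mul_exp_neg_exp (hr w) (hb w)
  rw [← ofReal_integral_eq_lintegral_ofReal hint (Eventually.of_forall fun u =>
    Finset.prod_nonneg fun w _ => (mul_pos (Real.exp_pos _) (Real.exp_pos _)).le), volume_pi,
    integral_fintype_prod_eq_prod (𝕜 := ℝ)]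
  congr 1
  rw [← InfinitePlace.prod_eq_abs_norm, ← Real.finsetProd_rpow _ _ (fun w _ => by positivity),
    ← Finset.prod_mul_distrib]
  refine Finset.prod_congr rfl fun w _ => ?_
  rw [integral_exp_mul_exp_neg_exp (hr w) (hb w), Real.mul_rpow (by positivity) (by positivity),
    gammaFactor, ← Real.rpow_natCast (w α) 2, ← Real.rpow_natCast (w α) w.mult, ← Real.rpow_mul (hw w).le,
    ← Real.rpow_mul (hw w).le]
  push_cast
  rw [show (2 : ℝ) * (-(w.mult * s) / 2) = w.mult * -s by ring]
  ring

variable (K) in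
/-- The change of coordinates between weight-direction pairs and scaling parameters. -/
def placeEquiv : (ℝ × logSpace K) ≃ₗ[ℝ] (InfinitePlace K → ℝ) where
  toFun p := placeCoord 0 p.1 p.2
  map_add' p q := by
    ext w
    simp only [placeCoord, Prod.fst_add, Prod.snd_add, logExtend_add, Pi.add_apply]
    ring
  map_smul' c p := by
    ext w
    have : logExtend (c • p.2) w = c * logExtend p.2 w := by
      unfold logExtend
      split_ifs
      · simp [Finset.mul_sum]
      · simp
    simp only [placeCoord, Prod.smul_fst, Prod.smul_snd, this, Pi.smul_apply, smul_eq_mul,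
      RingHom.id_apply]
    ring
  invFun u := (∑ w, (w.mult : ℝ) * u w, fun v => v.1.mult *
    (u v.1 - (∑ w, (w.mult : ℝ) * u w) / (finrank ℚ K : ℝ)))
  left_inv p := by
    have h := sum_mult_mul_placeCoord 0 p.1 p.2
    rw [sub_zero] at h
    ext v
    · exact h
    · simp only [h]
      rw [placeCoord, sub_zero, add_sub_cancel_left, mul_div_cancel₀ _ (mult_pos' v.1).ne',
        logExtend, dif_neg v.2]
  right_inv u := by
    have hn : (finrank ℚ K : ℝ) ≠ 0 := by exact_mod_cast finrank_pos.ne'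
    have hs : ∑ w : InfinitePlace K, (w.mult : ℝ) = finrank ℚ K := by
      exact_mod_cast InfinitePlace.sum_mult_eq
    set S := ∑ w, (w.mult : ℝ) * u w with hS
    have h0 : ∑ w : InfinitePlace K, (w.mult : ℝ) * (u w - S / finrank ℚ K) = 0 := by
      simp only [mul_sub, Finset.sum_sub_distrib, ← Finset.sum_mul, hs]
      rw [← hS]
      field_simp
      ring
    ext w
    have key : logExtend (K := K) (fun v => v.1.mult * (u v.1 - S / (finrank ℚ K : ℝ))) w =
        w.mult * (u w - S / finrank ℚ K) := by
      have h1 := sum_logExtend (K := K) (fun v => v.1.mult * (u v.1 - S / (finrank ℚ K : ℝ)))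
      by_cases h : w = w₀
      · have h2 : ∀ v ∈ Finset.univ.erase w, logExtend (K := K)
            (fun v => v.1.mult * (u v.1 - S / (finrank ℚ K : ℝ))) v =
              v.mult * (u v - S / finrank ℚ K) := by
          intro v hv
          have hv : v ≠ w₀ := h ▸ Finset.ne_of_mem_erase hv
          rw [logExtend, dif_neg hv]
        rw [← Finset.add_sum_erase _ _ (Finset.mem_univ w), Finset.sum_congr rfl h2] at h1
        rw [← Finset.add_sum_erase _ _ (Finset.mem_univ w)] at h0
        linarith
      · rw [logExtend, dif_neg h]
    change (S - 0) / (finrank ℚ K : ℝ) + logExtend (K := K)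
      (fun v => v.1.mult * (u v.1 - S / (finrank ℚ K : ℝ))) w / w.mult = u w
    rw [key, sub_zero, mul_div_cancel_left₀ _ (mult_pos' w).ne']
    ring

variable (K) in
lemma exists_map_placeEquiv : ∃ κ : ℝ, 0 < κ ∧
    (volume : Measure (ℝ × logSpace K)).map (placeEquiv K) = ENNReal.ofReal κ • volume := by
  let L := (placeEquiv K).toContinuousLinearEquiv
  have h0 : (volume : Measure (ℝ × logSpace K)).IsAddHaarMeasure := by
    rw [Measure.volume_eq_prod]; infer_instance
  have h1 : ((volume : Measure (ℝ × logSpace K)).map L).IsAddHaarMeasure :=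
    L.isAddHaarMeasure_map _
  refine ⟨((volume : Measure (ℝ × logSpace K)).map L).addHaarScalarFactor volume, ?_, ?_⟩
  · exact_mod_cast Measure.addHaarScalarFactor_pos_of_isAddHaarMeasure _ _
  · rw [ENNReal.ofReal_coe_nnreal]
    exact Measure.isAddLeftInvariant_eq_smul ((volume : Measure (ℝ × logSpace K)).map L) _

end GammaFactors

section ThetaMellin
open mixedEmbedding Module NumberField.Units NumberField.Units.dirichletUnitTheorem
open scoped nonZeroDivisors ENNReal Pointwise
variable {K : Type} [Field K] [NumberField K]

lemma lintegral_lintegral_placeForm {κ : ℝ} (hκ : 0 < κ)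
    (hmap : (volume : Measure (ℝ × logSpace K)).map (placeEquiv K) = ENNReal.ofReal κ • volume)
    (c : ℝ) (α : K) (hα : α ≠ 0) {s : ℝ} (hs : 0 < s) :
    ∫⁻ τ : ℝ, ENNReal.ofReal (Real.exp (s * τ)) * ∫⁻ x : logSpace K,
        ENNReal.ofReal (Real.exp (-Real.pi * placeForm (placeCoord c τ x) α)) =
      ENNReal.ofReal (κ * (∏ w : InfinitePlace K, gammaFactor w.mult s) *
        (Real.exp (s * c) * (|Algebra.norm ℚ α| : ℚ) ^ (-s))) := by
  let G : (InfinitePlace K → ℝ) → ℝ≥0∞ := fun u =>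
    ENNReal.ofReal (Real.exp (s * ∑ w, (w.mult : ℝ) * u w)) *
        ENNReal.ofReal (Real.exp (-Real.pi * placeForm u α))
  have hG : Continuous fun u : InfinitePlace K → ℝ =>
      (Real.exp (s * ∑ w, (w.mult : ℝ) * u w), Real.exp (-Real.pi * placeForm u α)) := by
    unfold placeForm
    fun_prop
  have hGm : Measurable G := (hG.measurable.fst.ennreal_ofReal).mul hG.measurable.snd.ennreal_ofReal
  have hL : Measurable (placeEquiv K) :=
    (placeEquiv K).toContinuousLinearEquiv.continuous.measurable
  rw [← lintegral_add_right_eq_self _ c]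
  have e1 : ∀ τ : ℝ, ENNReal.ofReal (Real.exp (s * (τ + c))) * ∫⁻ x : logSpace K,
        ENNReal.ofReal (Real.exp (-Real.pi * placeForm (placeCoord c (τ + c) x) α)) =
      ENNReal.ofReal (Real.exp (s * c)) * ∫⁻ x, G (placeEquiv K (τ, x)) := by
    intro τ
    rw [← lintegral_const_mul' _ _ ENNReal.ofReal_ne_top,
      ← lintegral_const_mul' _ _ ENNReal.ofReal_ne_top]
    refine lintegral_congr fun x => ?_
    have h1 : placeCoord c (τ + c) x = placeEquiv K (τ, x) := by
      ext w
      change placeCoord c (τ + c) x w = placeCoord 0 τ x w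
      rw [placeCoord, placeCoord, add_sub_cancel_right, sub_zero]
    have h2 : ∑ w, (w.mult : ℝ) * (placeEquiv K (τ, x)) w = τ := by
      have := sum_mult_mul_placeCoord 0 τ x
      rwa [sub_zero] at this
    simp only [G]
    rw [h1, h2, mul_add, Real.exp_add, ENNReal.ofReal_mul (Real.exp_pos _).le]
    ring
  simp only [e1]
  rw [lintegral_const_mul' _ _ ENNReal.ofReal_ne_top,
    ← lintegral_prod (fun p : ℝ × logSpace K => G (placeEquiv K p)) (hGm.comp hL).aemeasurable,
    ← Measure.volume_eq_prod,
    ← lintegral_map hGm hL, hmap, lintegral_smul_measure, lintegral_placeForm α hα hs,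
    smul_eq_mul, ← ENNReal.ofReal_mul hκ.le, ← ENNReal.ofReal_mul (Real.exp_pos _).le]
  congr 1
  ring

lemma exp_log_covol_mul_norm (a : {a : Ideal (𝓞 K) // a ≠ ⊥})
    (I : (FractionalIdeal (𝓞 K)⁰ K)ˣ) (α : K)
    (h : (idealUnit a * I).1 = FractionalIdeal.spanSingleton (𝓞 K)⁰ α) (s : ℝ) :
    Real.exp (s * Real.log (idealCovol I.1)) * ((|Algebra.norm ℚ α| : ℚ) : ℝ) ^ (-s) =
      √|(discr K : ℝ)| ^ s * (Ideal.absNorm a.1 : ℝ) ^ (-s) := by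
  have h1 := congrArg FractionalIdeal.absNorm h
  rw [FractionalIdeal.absNorm_span_singleton, Units.val_mul, map_mul, coe_idealUnit,
    FractionalIdeal.coeIdeal_absNorm] at h1
  have hN : (0 : ℝ) < Ideal.absNorm a.1 := by
    have : Ideal.absNorm a.1 ≠ 0 := Ideal.absNorm_eq_zero_iff.not.mpr a.2
    positivity
  have hc := idealCovol_pos I
  have hI : (0 : ℝ) < (FractionalIdeal.absNorm I.1 : ℝ) :=
    pos_of_mul_pos_left hc (Real.sqrt_nonneg _)
  rw [← h1, mul_comm s, ← Real.rpow_def_of_pos hc, idealCovol,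
    Real.mul_rpow hI.le (Real.sqrt_nonneg _)]
  push_cast
  rw [Real.mul_rpow hN.le hI.le, Real.rpow_neg hI.le]
  have := (Real.rpow_pos_of_pos hI s).ne'
  field_simp

/-- The total integral of the theta functions over all scales. -/
lemma lintegral_exp_mul_sum_thetaInt {ι : Type} [Fintype ι]
    {κ : ℝ} (hκ : 0 < κ)
    (hmap : (volume : Measure (ℝ × logSpace K)).map (placeEquiv K) = ENNReal.ofReal κ • volume)
    (I : ι → (FractionalIdeal (𝓞 K)⁰ K)ˣ)
    (hI : Function.Bijective fun j => ClassGroup.mk K (I j)) (D : Set (logSpace K))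
    (hD : IsAddFundamentalDomain (unitLattice K) D) {s : ℝ} (hs : 0 < s) :
    ∫⁻ τ : ℝ, ENNReal.ofReal (Real.exp (s * τ)) * ∑ j, thetaInt D (I j) τ =
      ENNReal.ofReal ((Nat.card (logEmbedding K).ker : ℝ) * κ *
        (∏ w : InfinitePlace K, gammaFactor w.mult s) * √|(discr K : ℝ)| ^ s) *
        ∑' a : {a : Ideal (𝓞 K) // a ≠ ⊥}, ENNReal.ofReal ((Ideal.absNorm a.1 : ℝ) ^ (-s)) := by
  obtain ⟨q, h0, h1, h⟩ := exists_unfold_thetaInt I hI D hD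
  have hγ : 0 ≤ ∏ w : InfinitePlace K, gammaFactor w.mult s :=
    Finset.prod_nonneg fun w _ => (gammaFactor_pos _ w.mult_pos hs).le
  have hc : Countable {a : Ideal (𝓞 K) // a ≠ ⊥} := by
    have hc := countable_of_numberField (K := K)
    have : Function.Injective fun a : {a : Ideal (𝓞 K) // a ≠ ⊥} => q a := by
      intro a b hab
      have hab : q a = q b := hab
      have e1 := h1 a
      rw [hab, ← h1 b] at e1
      have h5 := mul_right_cancel (Units.ext e1)
      have h6 := congrArg Units.val h5
      rw [coe_idealUnit, coe_idealUnit] at h6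
      exact Subtype.ext (FractionalIdeal.coeIdeal_injective h6)
    exact this.countable
  simp only [h]
  have hm : ∀ a, Measurable fun τ : ℝ => ∫⁻ x : logSpace K,
      ENNReal.ofReal (Real.exp (-Real.pi * placeForm
          (placeCoord (Real.log (idealCovol (I (q a).1).1)) τ x) (q a).2)) := by
    intro a
    have h := continuous_placeForm_placeCoord (K := K) (Real.log (idealCovol (I (q a).1).1)) (q a).2
    have h' : Continuous fun p : ℝ × logSpace K => Real.exp (-Real.pi * placeForm
        (placeCoord (Real.log (idealCovol (I (q a).1).1)) p.1 p.2) (q a).2) :=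
      Real.continuous_exp.comp (continuous_const.mul h)
    exact Measurable.lintegral_prod_right' (ν := volume) h'.measurable.ennreal_ofReal
  have hm' : ∀ a, Measurable fun τ : ℝ => ENNReal.ofReal (Real.exp (s * τ)) *
      ∫⁻ x : logSpace K, ENNReal.ofReal (Real.exp (-Real.pi * placeForm
          (placeCoord (Real.log (idealCovol (I (q a).1).1)) τ x) (q a).2)) := fun a =>
    (Measurable.ennreal_ofReal (by fun_prop)).mul (hm a)
  have e1 : ∀ τ : ℝ, ENNReal.ofReal (Real.exp (s * τ)) *
      ((Nat.card (logEmbedding K).ker : ℝ≥0∞) *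
        ∑' a, ∫⁻ x, ENNReal.ofReal (Real.exp (-Real.pi * placeForm
          (placeCoord (Real.log (idealCovol (I (q a).1).1)) τ x) (q a).2))) =
      (Nat.card (logEmbedding K).ker : ℝ≥0∞) * ∑' a, ENNReal.ofReal (Real.exp (s * τ)) *
        ∫⁻ x, ENNReal.ofReal (Real.exp (-Real.pi * placeForm
          (placeCoord (Real.log (idealCovol (I (q a).1).1)) τ x) (q a).2)) := by
    intro τ
    rw [ENNReal.tsum_mul_left]
    ring
  simp only [e1]
  rw [lintegral_const_mul' _ _ (ENNReal.natCast_ne_top _), lintegral_tsum fun a =>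
    (hm' a).aemeasurable,
    ← ENNReal.tsum_mul_left, ← ENNReal.tsum_mul_left]
  refine tsum_congr fun a => ?_
  rw [lintegral_lintegral_placeForm hκ hmap _ _ (h0 a) hs,
    exp_log_covol_mul_norm a _ _ (h1 a), ← ENNReal.ofReal_natCast,
    ← ENNReal.ofReal_mul (Nat.cast_nonneg _), ← ENNReal.ofReal_mul (by positivity)]
  congr 1
  ring

/-- Passing between Mellin transforms and exponential integrals. -/
lemma lintegral_rpow_mul_comp_log (F : ℝ → ℝ≥0∞) (s : ℝ) :
    ∫⁻ t in Set.Ioi (0 : ℝ), ENNReal.ofReal (t ^ (s - 1)) * F (Real.log t) =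
      ∫⁻ τ : ℝ, ENNReal.ofReal (Real.exp (s * τ)) * F τ := by
  rw [← Real.range_exp, ← Set.image_univ, lintegral_image_eq_lintegral_abs_deriv_mul
    MeasurableSet.univ (fun x _ => (Real.hasDerivAt_exp x).hasDerivWithinAt)
    Real.exp_injective.injOn, setLIntegral_univ]
  refine lintegral_congr fun τ => ?_
  rw [abs_of_pos (Real.exp_pos _), Real.log_exp, ← mul_assoc, ← ENNReal.ofReal_mul
    (Real.exp_pos _).le, ← Real.exp_mul, ← Real.exp_add]
  congr 3
  ring

end ThetaMellin

section CompletedZeta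
open mixedEmbedding Module NumberField.Units NumberField.Units.dirichletUnitTheorem
open scoped nonZeroDivisors ENNReal Pointwise
variable {K : Type} [Field K] [NumberField K]

lemma IsAddFundamentalDomain.neg_unitLattice {D : Set (logSpace K)}
    (hD : IsAddFundamentalDomain (unitLattice K) D) :
    IsAddFundamentalDomain (unitLattice K) (-D) := by
  have h := hD.image_of_equiv (ν := volume) (Equiv.neg (logSpace K)) (by
    have := (Measure.measurePreserving_neg (volume : Measure (logSpace K))).quasiMeasurePreserving
    simpa using this) (Equiv.neg (unitLattice K)) (by
      intro g x
      change -(-(g : logSpace K) + x) = g + -x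
      abel)
  simpa using h

lemma bijective_mk_dualIdeal {ι : Type} (I : ι → (FractionalIdeal (𝓞 K)⁰ K)ˣ)
    (hI : Function.Bijective fun j => ClassGroup.mk K (I j)) :
    Function.Bijective fun j => ClassGroup.mk K (dualIdeal (I j)) := by
  have h : ∀ J : (FractionalIdeal (𝓞 K)⁰ K)ˣ, dualIdeal J = dualIdeal 1 * J⁻¹ := by
    intro J
    apply Units.ext
    rw [coe_dualIdeal, Units.val_mul, coe_dualIdeal, Units.val_inv_eq_inv_val,
      FractionalIdeal.dual_eq_mul_inv, Units.val_one]
  have h2 : (fun j => ClassGroup.mk K (dualIdeal (I j))) =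
      (fun x => ClassGroup.mk K (dualIdeal 1) * x⁻¹) ∘ fun j => ClassGroup.mk K (I j) := by
    ext j
    simp only [Function.comp_apply]
    rw [h, map_mul, map_inv]
  rw [h2]
  exact ((Group.mulLeft_bijective _).comp inv_involutive.bijective).comp hI

lemma mellin_thetaSum {ι : Type} [Fintype ι] {κ : ℝ} (hκ : 0 < κ)
    (hmap : (volume : Measure (ℝ × logSpace K)).map (placeEquiv K) = ENNReal.ofReal κ • volume)
    (I : ι → (FractionalIdeal (𝓞 K)⁰ K)ˣ)
    (hI : Function.Bijective fun j => ClassGroup.mk K (I j)) (D : Set (logSpace K))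
    (hDb : Bornology.IsBounded D)
    (hD : IsAddFundamentalDomain (unitLattice K) D) (P : WeakFEPair ℂ) (hPk : P.k = 1)
    (hPf : P.f = fun t => (thetaSum D I t : ℂ))
    (hP0 : P.f₀ = ((Fintype.card ι * (volume D).toReal : ℝ) : ℂ)) {s : ℝ} (hs : 1 < s) :
    Summable (fun a : {a : Ideal (𝓞 K) // a ≠ ⊥} => (Ideal.absNorm a.1 : ℝ) ^ (-s)) ∧
    P.Λ s = (((Nat.card (logEmbedding K).ker : ℝ) * κ *
        (∏ w : InfinitePlace K, gammaFactor w.mult s) * √|(discr K : ℝ)| ^ s *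
        ∑' a : {a : Ideal (𝓞 K) // a ≠ ⊥}, (Ideal.absNorm a.1 : ℝ) ^ (-s) : ℝ) : ℂ) := by
  have hs0 : 0 < s := by linarith
  obtain ⟨hc, hm⟩ := P.hasMellin (s := s) (by rw [hPk]; simpa using hs)
  let F : ℝ → ℝ := fun τ => (∑ j, thetaInt D (I j) τ).toReal
  have hF : ∀ t, P.f t - P.f₀ = (F (Real.log t) : ℂ) := by
    intro t
    rw [hPf, hP0]
    simp only [F]
    rw [thetaSum, Finset.sum_add_distrib, ENNReal.toReal_sum fun j _ => (thetaInt_lt_top D hDb _ _).ne]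
    push_cast
    simp
  have hFtop : ∀ τ, ∑ j, thetaInt D (I j) τ ≠ ⊤ := fun τ =>
    (ENNReal.sum_lt_top.mpr fun j _ => thetaInt_lt_top D hDb _ _).ne
  have e1 : ∀ t ∈ Set.Ioi (0 : ℝ), (t : ℂ) ^ ((s : ℂ) - 1) • (P.f t - P.f₀) =
      ((t ^ (s - 1) * F (Real.log t) : ℝ) : ℂ) := by
    intro t ht
    rw [hF, smul_eq_mul, ofReal_mul, ofReal_cpow (le_of_lt ht)]
    push_cast
    rfl
  have hint : IntegrableOn (fun t : ℝ => ((t ^ (s - 1) * F (Real.log t) : ℝ) : ℂ)) (Set.Ioi 0) :=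
    (integrableOn_congr_fun e1 measurableSet_Ioi).mp hc
  have hint' : IntegrableOn (fun t : ℝ => t ^ (s - 1) * F (Real.log t)) (Set.Ioi 0) := by
    have h : Integrable (fun t : ℝ => t ^ (s - 1) * F (Real.log t))
        (volume.restrict (Set.Ioi 0)) := by
      simpa using hint.re
    exact h
  have hnn : ∀ᵐ t ∂volume.restrict (Set.Ioi (0 : ℝ)), 0 ≤ t ^ (s - 1) * F (Real.log t) :=
    (ae_restrict_iff' measurableSet_Ioi).mpr (Eventually.of_forall fun t ht =>
      mul_nonneg (Real.rpow_nonneg (le_of_lt ht) _) ENNReal.toReal_nonneg)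
  have e2 : ∫⁻ t in Set.Ioi (0 : ℝ), ENNReal.ofReal (t ^ (s - 1) * F (Real.log t)) =
      ∫⁻ τ : ℝ, ENNReal.ofReal (Real.exp (s * τ)) * ∑ j, thetaInt D (I j) τ := by
    rw [← lintegral_rpow_mul_comp_log]
    refine setLIntegral_congr_fun measurableSet_Ioi fun t ht => ?_
    rw [ENNReal.ofReal_mul (Real.rpow_nonneg (le_of_lt ht) _), ENNReal.ofReal_toReal (hFtop _)]
  rw [lintegral_exp_mul_sum_thetaInt hκ hmap I hI D hD hs0] at e2
  have hγ : 0 < ∏ w : InfinitePlace K, gammaFactor w.mult s :=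
    Finset.prod_pos fun w _ => gammaFactor_pos _ w.mult_pos hs0
  have hd : (0 : ℝ) < √|(discr K : ℝ)| := by
    rw [Real.sqrt_pos, abs_pos]
    exact_mod_cast discr_ne_zero K
  have hcard : (0 : ℝ) < Nat.card (logEmbedding K).ker := by
    have := finite_ker_logEmbedding (K := K)
    exact_mod_cast Nat.card_pos
  have hpos : 0 < (Nat.card (logEmbedding K).ker : ℝ) * κ *
        (∏ w : InfinitePlace K, gammaFactor w.mult s) * √|(discr K : ℝ)| ^ s := by positivity
  have hfin : ∑' a : {a : Ideal (𝓞 K) // a ≠ ⊥}, ENNReal.ofReal ((Ideal.absNorm a.1 : ℝ) ^ (-s)) ≠ ⊤ := by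
    intro h
    rw [h, ENNReal.mul_top (by simpa using hpos)] at e2
    have h3 := hint'.lintegral_lt_top
    rw [e2] at h3
    exact lt_irrefl _ h3
  have hsum := ENNReal.summable_toReal hfin
  have e3 : ∀ a : {a : Ideal (𝓞 K) // a ≠ ⊥}, (ENNReal.ofReal ((Ideal.absNorm a.1 : ℝ) ^ (-s))).toReal =
      (Ideal.absNorm a.1 : ℝ) ^ (-s) := fun a => ENNReal.toReal_ofReal (by positivity)
  simp only [e3] at hsum
  refine ⟨hsum, ?_⟩
  rw [← hm, mellin, setIntegral_congr_fun measurableSet_Ioi e1, integral_complex_ofReal,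
    integral_eq_lintegral_of_nonneg_ae hnn hint'.aestronglyMeasurable, e2, ENNReal.toReal_mul,
    ENNReal.toReal_ofReal hpos.le, ENNReal.tsum_toReal_eq fun a => ENNReal.ofReal_ne_top]
  simp only [e3]

lemma exists_bound_Λ₀ (P : WeakFEPair ℂ) (a b : ℝ) :
    ∃ B : ℝ, ∀ s : ℂ, a ≤ s.re → s.re ≤ b → ‖P.Λ₀ s‖ ≤ B := by
  have h : ∀ s, MellinConvergent P.f_modif s := fun s =>
    (P.isStrongFEPair_toStrongFEPair.hasMellin s).1
  have ha := (h a).norm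
  have hb := (h b).norm
  refine ⟨(∫ t in Set.Ioi (0 : ℝ), ‖(t : ℂ) ^ ((a : ℂ) - 1) • P.f_modif t‖) +
    ∫ t in Set.Ioi (0 : ℝ), ‖(t : ℂ) ^ ((b : ℂ) - 1) • P.f_modif t‖, fun s h1 h2 => ?_⟩
  rw [← integral_add ha hb, WeakFEPair.Λ₀, mellin]
  refine norm_integral_le_of_norm_le (ha.add hb) ?_
  refine (ae_restrict_iff' measurableSet_Ioi).mpr (Eventually.of_forall fun t ht => ?_)
  have ht : 0 < t := ht
  simp only [_root_.norm_smul, Pi.add_apply]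
  rw [← add_mul]
  gcongr
  rw [norm_cpow_eq_rpow_re_of_pos ht, norm_cpow_eq_rpow_re_of_pos ht, norm_cpow_eq_rpow_re_of_pos ht]
  simp only [sub_re, ofReal_re, one_re]
  rcases le_total t 1 with h | h
  · have := Real.rpow_le_rpow_of_exponent_ge ht h (show a - 1 ≤ s.re - 1 by linarith)
    have := Real.rpow_nonneg ht.le (b - 1)
    linarith
  · have := Real.rpow_le_rpow_of_exponent_le h (show s.re - 1 ≤ b - 1 by linarith)
    have := Real.rpow_nonneg ht.le (a - 1)
    linarith

/-- The reciprocal of the archimedean factor at a place of multiplicity `m`. -/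
def gammaInv (m : ℕ) (s : ℂ) : ℂ :=
  2 * ((Real.pi * m : ℝ) : ℂ) ^ (m * s / 2) * (Gamma (m * s / 2))⁻¹

lemma differentiable_gammaInv (m : ℕ) (hm : 0 < m) : Differentiable ℂ (gammaInv m) := by
  have h : ((Real.pi * m : ℝ) : ℂ) ≠ 0 := by
    have : (0 : ℝ) < m := by exact_mod_cast hm
    exact_mod_cast (mul_pos Real.pi_pos this).ne'
  unfold gammaInv
  have h1 : Differentiable ℂ fun s : ℂ => (Gamma (m * s / 2))⁻¹ :=
    differentiable_one_div_Gamma.comp (by fun_prop : Differentiable ℂ fun s : ℂ => m * s / 2)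
  exact ((differentiable_const _).mul
    (Differentiable.const_cpow (by fun_prop) (Or.inl h))).mul h1

lemma gammaInv_mul_gammaFactor (m : ℕ) (hm : 0 < m) {s : ℝ} (hs : 0 < s) :
    gammaInv m s * gammaFactor m s = 1 := by
  have hm' : (0 : ℝ) < m := by exact_mod_cast hm
  have hp : (0 : ℝ) < Real.pi * m := mul_pos Real.pi_pos hm'
  have e : gammaInv m s = ((2 * (Real.pi * m) ^ (m * s / 2) * (Real.Gamma (m * s / 2))⁻¹ : ℝ) : ℂ) := by
    rw [gammaInv]
    rw [show ((m : ℂ) * (s : ℂ) / 2) = ((m * s / 2 : ℝ) : ℂ) by push_cast; ring, Gamma_ofReal,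
      ← ofReal_cpow hp.le]
    push_cast
    rfl
  rw [e, gammaFactor, ← ofReal_mul]
  have h1 := (Real.Gamma_pos_of_pos (show 0 < m * s / 2 by positivity)).ne'
  rw [show -(m * s) / 2 = -(m * s / 2) by ring, Real.rpow_neg hp.le]
  have h2 := (Real.rpow_pos_of_pos hp (m * s / 2)).ne'
  rw [ofReal_eq_one]
  field_simp

/-- Analytic continuation and functional equation of the Dedekind zeta function. -/
theorem exists_completed_zeta {Z : ℂ → ℂ} (hZ : IsDedekindZeta K Z) :
    (∀ s : ℝ, 1 < s →
      Summable (fun a : {a : Ideal (𝓞 K) // a ≠ ⊥} => (Ideal.absNorm a.1 : ℝ) ^ (-s))) ∧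
    ∃ (A c : ℝ) (L : ℂ → ℂ), 0 < A ∧ 0 < c ∧ Differentiable ℂ L ∧ (∀ s, L (1 - s) = L s) ∧
      (∀ a b : ℝ, ∃ B : ℝ, ∀ s : ℂ, a ≤ s.re → s.re ≤ b → ‖L s‖ ≤ B) ∧
      ∀ s, s ≠ 0 → s ≠ 1 → Z s = A * (√|(discr K : ℝ)| : ℂ) ^ (-s) *
        (∏ w : InfinitePlace K, gammaInv w.mult s) * (L s - c / s - c / (1 - s)) := by
  obtain ⟨κ, hκ, hmap⟩ := exists_map_placeEquiv K
  let b := (basisUnitLattice K).ofZLatticeBasis ℝ (unitLattice K)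
  let D := ZSpan.fundamentalDomain b
  have hD : IsAddFundamentalDomain (unitLattice K) D := ZLattice.isAddFundamentalDomain _ _
  have hDb : Bornology.IsBounded D := ZSpan.fundamentalDomain_isBounded _
  have hDm : MeasurableSet D := ZSpan.fundamentalDomain_measurableSet _
  have hDv : volume D ≠ 0 := ZSpan.measure_fundamentalDomain_ne_zero _
  have hsurj : ∀ C : ClassGroup (𝓞 K), ∃ J : (FractionalIdeal (𝓞 K)⁰ K)ˣ, ClassGroup.mk K J = C :=
    fun C => ClassGroup.induction K (fun J => ⟨J, rfl⟩) C
  choose I hI using hsurj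
  have hIb : Function.Bijective fun j => ClassGroup.mk K (I j) := by
    simp only [hI]
    exact Function.bijective_id
  let P := thetaPair D hDm hDb I
  have hv : volume (-D) = volume D := Measure.measure_neg volume D
  set c : ℝ := Fintype.card (ClassGroup (𝓞 K)) * (volume D).toReal with hc
  have hcpos : 0 < c := mul_pos (by exact_mod_cast Fintype.card_pos)
    (ENNReal.toReal_pos hDv hDb.measure_lt_top.ne)
  have hPΛ : ∀ s, P.Λ s = P.Λ₀ s - c / s - c / (1 - s) := by
    intro s
    rw [WeakFEPair.Λ]
    simp only [P, thetaPair, hv, hc, smul_eq_mul]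
    push_cast
    ring
  have hP'Λ : ∀ s, P.symm.Λ s = P.symm.Λ₀ s - c / s - c / (1 - s) := by
    intro s
    rw [WeakFEPair.Λ]
    simp only [P, thetaPair, hv, hc, smul_eq_mul, WeakFEPair.symm]
    push_cast
    ring
  have h1 : ∀ s : ℝ, 1 < s → _ := fun s hs =>
    mellin_thetaSum hκ hmap I hIb D hDb hD P rfl rfl rfl hs
  have h2 : ∀ s : ℝ, 1 < s → _ := fun s hs =>
    mellin_thetaSum hκ hmap _ (bijective_mk_dualIdeal I hIb) (-D) hDb.neg
      (IsAddFundamentalDomain.neg_unitLattice hD) P.symm rfl rfl rfl hs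
  have hfreq : ∀ {p : ℂ → Prop}, (∀ s : ℝ, 1 < s → p s) → ∃ᶠ z in 𝓝[≠] (2 : ℂ), p z := by
    intro p hp
    have ht : Tendsto (fun x : ℝ => (x : ℂ)) (𝓝[>] 2) (𝓝[≠] (2 : ℂ)) := by
      refine tendsto_nhdsWithin_iff.mpr ⟨?_, ?_⟩
      · have := (Complex.continuous_ofReal.tendsto 2).mono_left (nhdsWithin_le_nhds (s := Set.Ioi 2))
        simpa using this
      · filter_upwards [self_mem_nhdsWithin] with x hx
        have hx : 2 < x := hx
        simp only [Set.mem_compl_iff, Set.mem_singleton_iff]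
        exact_mod_cast hx.ne'
    refine ht.frequently (Eventually.frequently ?_)
    filter_upwards [self_mem_nhdsWithin] with x hx
    have hx : 2 < x := hx
    exact hp x (by linarith)
  have hsymm : ∀ s, P.symm.Λ₀ s = P.Λ₀ s := by
    have : Set.EqOn P.symm.Λ₀ P.Λ₀ Set.univ := by
      refine AnalyticOnNhd.eqOn_of_preconnected_of_frequently_eq
        (P.symm.differentiable_Λ₀.differentiableOn.analyticOnNhd isOpen_univ)
        (P.differentiable_Λ₀.differentiableOn.analyticOnNhd isOpen_univ)
        isPreconnected_univ (Set.mem_univ 2) (hfreq fun s hs => ?_)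
      have e1 := (h1 s hs).2
      rw [← (h2 s hs).2, hPΛ, hP'Λ] at e1
      linear_combination -e1
    exact fun s => this (Set.mem_univ s)
  refine ⟨fun s hs => (h1 s hs).1, ((Nat.card (logEmbedding K).ker : ℝ) * κ)⁻¹, c, P.Λ₀, ?_,
    hcpos, P.differentiable_Λ₀, ?_, exists_bound_Λ₀ P, ?_⟩
  · have : (0 : ℝ) < Nat.card (logEmbedding K).ker := by
      have := finite_ker_logEmbedding (K := K)
      exact_mod_cast Nat.card_pos
    positivity
  · intro s
    have := P.functional_equation₀ s
    rw [hsymm] at this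
    simpa [P, thetaPair] using this
  have hd : (0 : ℝ) < √|(discr K : ℝ)| := by
    rw [Real.sqrt_pos, abs_pos]
    exact_mod_cast discr_ne_zero K
  have hcard : (0 : ℝ) < Nat.card (logEmbedding K).ker := by
    have := finite_ker_logEmbedding (K := K)
    exact_mod_cast Nat.card_pos
  have key : Set.EqOn Z (fun s => (((Nat.card (logEmbedding K).ker : ℝ) * κ)⁻¹ : ℝ) *
      (√|(discr K : ℝ)| : ℂ) ^ (-s) *
        (∏ w : InfinitePlace K, gammaInv w.mult s) * (P.Λ₀ s - c / s - c / (1 - s)))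
        ({0, 1} : Set ℂ)ᶜ := by
    have hopen : IsOpen ({0, 1} : Set ℂ)ᶜ := (Set.toFinite _).isClosed.isOpen_compl
    refine AnalyticOnNhd.eqOn_of_preconnected_of_frequently_eq (z₀ := 2)
      (DifferentiableOn.analyticOnNhd (fun s hs => ?_) hopen)
      (DifferentiableOn.analyticOnNhd (fun s hs => ?_) hopen) ?_ (by simp) (hfreq fun s hs => ?_)
    · simp only [Set.mem_compl_iff, Set.mem_insert_iff, Set.mem_singleton_iff, not_or] at hs
      exact (hZ.1 s hs.2).differentiableWithinAt
    · simp only [Set.mem_compl_iff, Set.mem_insert_iff, Set.mem_singleton_iff, not_or] at hs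
      have hs1 : 1 - s ≠ 0 := sub_ne_zero.mpr (Ne.symm hs.2)
      have hγ : Differentiable ℂ fun s => ∏ w : InfinitePlace K, gammaInv w.mult s :=
        Differentiable.fun_finsetProd fun w _ => differentiable_gammaInv _ w.mult_pos
      have hdd : Differentiable ℂ fun s : ℂ => (√|(discr K : ℝ)| : ℂ) ^ (-s) :=
        Differentiable.const_cpow (by fun_prop) (Or.inl (by exact_mod_cast hd.ne'))
      refine DifferentiableAt.differentiableWithinAt ?_
      refine (((differentiableAt_const _).mul (hdd s)).mul (hγ s)).mul ?_
      refine ((P.differentiable_Λ₀ s).sub ?_).sub ?_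
      · exact (differentiableAt_const _).div differentiableAt_id hs.1
      · exact (differentiableAt_const _).div (by fun_prop) hs1
    · refine (Set.Countable.isPathConnected_compl_of_one_lt_rank ?_
        (Set.toFinite _).countable).isConnected.isPreconnected
      rw [Complex.rank_real_complex]
      exact Nat.one_lt_ofNat
    · rw [← hPΛ, (h1 s hs).2, hZ.2 s (by simpa using hs)]
      have e1 : ∀ a : {a : Ideal (𝓞 K) // a ≠ ⊥}, (Ideal.absNorm a.1 : ℂ) ^ (-(s : ℂ)) =
          (((Ideal.absNorm a.1 : ℝ) ^ (-s) : ℝ) : ℂ) := by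
        intro a
        rw [ofReal_cpow (Nat.cast_nonneg _)]
        push_cast
        rfl
      simp only [e1]
      rw [← ofReal_tsum]
      have e2 : (∏ w : InfinitePlace K, gammaInv w.mult s) *
          ((∏ w : InfinitePlace K, gammaFactor w.mult s : ℝ) : ℂ) = 1 := by
        rw [ofReal_prod, ← Finset.prod_mul_distrib]
        exact Finset.prod_eq_one fun w _ => gammaInv_mul_gammaFactor _ w.mult_pos (by linarith)
      have e3 : (√|(discr K : ℝ)| : ℂ) ^ (-(s : ℂ)) * ((√|(discr K : ℝ)| ^ s : ℝ) : ℂ) = 1 := by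
        rw [ofReal_cpow hd.le, ← cpow_add _ _ (by exact_mod_cast hd.ne'), neg_add_cancel, cpow_zero]
      have e4 : ((((Nat.card (logEmbedding K).ker : ℝ) * κ)⁻¹ : ℝ) : ℂ) *
          (((Nat.card (logEmbedding K).ker : ℝ) * κ : ℝ) : ℂ) = 1 := by
        rw [← ofReal_mul, inv_mul_cancel₀ (by positivity), ofReal_one]
      generalize (∑' a : {a : Ideal (𝓞 K) // a ≠ ⊥}, (Ideal.absNorm a.1 : ℝ) ^ (-s)) = T
      rw [ofReal_mul, ofReal_mul, ofReal_mul]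
      generalize (∏ w : InfinitePlace K, gammaInv w.mult s) = U at *
      generalize ((∏ w : InfinitePlace K, gammaFactor w.mult s : ℝ) : ℂ) = V at *
      generalize (√|(discr K : ℝ)| : ℂ) ^ (-(s : ℂ)) = P' at *
      generalize ((√|(discr K : ℝ)| ^ s : ℝ) : ℂ) = Q at *
      linear_combination (-(T : ℂ) * U * V * P' * Q) * e4 + (-T * (P' * Q)) * e2 - T * e3
  intro s h0 h1
  exact key (by simp [h0, h1])

end CompletedZeta

section GammaGrowth

lemma norm_Gamma_le_Gamma_re {z : ℂ} (hz : 0 < z.re) : ‖Gamma z‖ ≤ Real.Gamma z.re := by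
  rw [Complex.Gamma_eq_integral hz, Complex.GammaIntegral, Real.Gamma_eq_integral hz]
  refine (norm_integral_le_integral_norm _).trans (le_of_eq ?_)
  refine setIntegral_congr_fun measurableSet_Ioi fun x hx => ?_
  have hx0 : 0 < x := hx
  simp only [norm_mul, norm_cpow_eq_rpow_re_of_pos hx0, sub_re, one_re]
  rw [Complex.norm_real, Real.norm_of_nonneg (Real.exp_pos _).le]

lemma norm_sin_le_exp_abs_im (z : ℂ) : ‖Complex.sin z‖ ≤ Real.exp |z.im| := by
  rw [Complex.sin, norm_div, norm_mul, norm_I, mul_one, Complex.norm_two]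
  have h1 : ‖exp (-z * I) - exp (z * I)‖ ≤ Real.exp |z.im| + Real.exp |z.im| := by
    refine (norm_sub_le _ _).trans (add_le_add ?_ ?_)
    · rw [norm_exp]
      exact Real.exp_le_exp.mpr (by simpa using le_abs_self z.im)
    · rw [norm_exp]
      exact Real.exp_le_exp.mpr (by simpa using neg_le_abs z.im)
  linarith

lemma exists_bound_inv_Gamma : ∃ B : ℝ, 0 ≤ B ∧ ∀ z : ℂ, -1/2 ≤ z.re → z.re ≤ 3/2 → 1/2 ≤ |z.im| →
    ‖(Gamma z)⁻¹‖ ≤ B * Real.exp (Real.pi * |z.im|) := by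
  obtain ⟨M, hM⟩ : ∃ M : ℝ, ∀ x ∈ Set.Icc (1/2 : ℝ) (5/2), Real.Gamma x ≤ M := by
    have := (isCompact_Icc (a := (1/2:ℝ)) (b := 5/2)).bddAbove_image (f := Real.Gamma)
      (fun x hx => (Real.differentiableAt_Gamma (fun m => by
        have := hx.1
        have hm : (0:ℝ) ≤ m := Nat.cast_nonneg m
        linarith)).continuousAt.continuousWithinAt)
    obtain ⟨M, hM⟩ := this
    exact ⟨M, fun x hx => hM ⟨x, hx, rfl⟩⟩
  have hM0 : 0 ≤ M := (Real.Gamma_pos_of_pos one_pos).le.trans (hM 1 (by norm_num))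
  refine ⟨M, hM0, fun z h1 h2 h3 => ?_⟩
  have him : z.im ≠ 0 := by
    rintro h
    rw [h, abs_zero] at h3
    norm_num at h3
  have hz1 : 1 - z ≠ 0 := by
    intro h
    apply him
    have := congrArg Complex.im h
    simpa using this
  have hG : Gamma (2 - z) = (1 - z) * Gamma (1 - z) := by
    rw [← Gamma_add_one _ hz1]
    ring_nf
  have hrefl := Complex.Gamma_mul_Gamma_one_sub z
  have hsin : Complex.sin (Real.pi * z) ≠ 0 := by
    rw [Complex.sin_ne_zero_iff]
    intro k hk
    have hz : z = k := by
      have hpi : (Real.pi : ℂ) ≠ 0 := by exact_mod_cast Real.pi_ne_zero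
      apply mul_left_cancel₀ hpi
      rw [hk]; ring
    apply him
    rw [hz]; simp
  have hpi : (Real.pi : ℂ) ≠ 0 := by exact_mod_cast Real.pi_ne_zero
  have hGz : Gamma z ≠ 0 := by
    intro h
    rw [h, zero_mul] at hrefl
    exact (div_ne_zero hpi hsin) hrefl.symm
  have key : (Gamma z)⁻¹ = Gamma (2 - z) * Complex.sin (Real.pi * z) / (Real.pi * (1 - z)) := by
    rw [hG, eq_comm, div_eq_iff (mul_ne_zero hpi hz1), inv_mul_eq_div, eq_div_iff hGz]
    rw [eq_div_iff hsin] at hrefl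
    linear_combination (1 - z) * hrefl
  rw [key, norm_div, norm_mul, norm_mul]
  have b1 : ‖Gamma (2 - z)‖ ≤ M := by
    refine (norm_Gamma_le_Gamma_re (by simp; linarith)).trans (hM _ ⟨by simp; linarith, by simp; linarith⟩)
  have b2 : ‖Complex.sin (Real.pi * z)‖ ≤ Real.exp (Real.pi * |z.im|) := by
    refine (norm_sin_le_exp_abs_im _).trans (le_of_eq ?_)
    simp [abs_mul, abs_of_pos Real.pi_pos]
  have b3 : 1 ≤ ‖(Real.pi : ℂ)‖ * ‖1 - z‖ := by
    have : |z.im| ≤ ‖1 - z‖ := by simpa using Complex.abs_im_le_norm (1 - z)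
    rw [Complex.norm_real, Real.norm_of_nonneg Real.pi_pos.le]
    nlinarith [Real.pi_gt_three]
  rw [div_le_iff₀ (by linarith)]
  calc _ ≤ M * Real.exp (Real.pi * |z.im|) := by gcongr
    _ ≤ _ := le_mul_of_one_le_right (by positivity) b3

lemma norm_cpow_bound {x : ℝ} (hx : 1 ≤ x) {z : ℂ} {b : ℝ} (hz : z.re ≤ b) :
    ‖(x : ℂ) ^ z‖ ≤ x ^ b := by
  rw [norm_cpow_eq_rpow_re_of_pos (by linarith)]
  exact Real.rpow_le_rpow_of_exponent_le hx hz

lemma exists_bound_gammaInv : ∃ B : ℝ, 1 ≤ B ∧ ∀ m : ℕ, (m = 1 ∨ m = 2) → ∀ s : ℂ,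
    -1/2 ≤ s.re → s.re ≤ 3/2 → 1 ≤ |s.im| →
    ‖gammaInv m s‖ ≤ B * Real.exp (Real.pi * |s.im|) := by
  obtain ⟨B, hB0, hB⟩ := exists_bound_inv_Gamma
  refine ⟨2 * (2 * Real.pi) ^ (2 : ℝ) * B + 1, by
    have : 0 ≤ 2 * (2 * Real.pi) ^ (2 : ℝ) * B := by positivity
    linarith, fun m hm s h1 h2 h3 => ?_⟩
  have hpi := Real.pi_gt_three
  have hm1 : (1:ℝ) ≤ m ∧ (m:ℝ) ≤ 2 := by rcases hm with rfl | rfl <;> norm_num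
  have hre : ((m:ℂ) * s / 2).re = m * s.re / 2 := by
    rw [mul_div_assoc, ← ofReal_natCast, re_ofReal_mul]; simp; ring
  have him : ((m:ℂ) * s / 2).im = m * s.im / 2 := by
    rw [mul_div_assoc, ← ofReal_natCast, im_ofReal_mul]; simp; ring
  have g := hB ((m:ℂ) * s / 2) (by rw [hre]; nlinarith) (by rw [hre]; nlinarith) (by
    rw [him, abs_div, abs_mul, abs_of_nonneg (by linarith : (0:ℝ) ≤ m), abs_two]
    nlinarith)
  have g2 : Real.pi * |((m:ℂ) * s / 2).im| ≤ Real.pi * |s.im| := by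
    rw [him, abs_div, abs_mul, abs_of_nonneg (by linarith : (0:ℝ) ≤ m), abs_two]
    gcongr
    nlinarith
  have hb1 : 1 ≤ Real.pi * m := by nlinarith
  have c := norm_cpow_bound hb1 (z := (m:ℂ) * s / 2) (b := 2) (by rw [hre]; nlinarith)
  have c2 : (Real.pi * m) ^ (2:ℝ) ≤ (2 * Real.pi) ^ (2:ℝ) := by
    apply Real.rpow_le_rpow (by positivity) (by nlinarith) (by norm_num)
  rw [gammaInv, norm_mul, norm_mul, Complex.norm_two]
  calc _ ≤ 2 * (2 * Real.pi) ^ (2:ℝ) * (B * Real.exp (Real.pi * |s.im|)) := by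
        gcongr
        · exact c.trans c2
        · exact g.trans (by gcongr)
    _ ≤ _ := by
        have := Real.exp_pos (Real.pi * |s.im|)
        nlinarith

lemma norm_gammaInv_le_one_sub {m : ℕ} (hm : m = 1 ∨ m = 2) {s : ℂ} (hs : s.re = -1/2) :
    ‖gammaInv m s‖ ≤ ‖s + 2‖ ^ 2 * ‖gammaInv m (1 - s)‖ := by
  have hn : (3/2:ℝ) ≤ ‖s + 2‖ := by
    have := Complex.re_le_norm (s + 2)
    simp [hs] at this; linarith
  have hpi := Real.pi_gt_three
  have hm1 : (1:ℝ) ≤ m ∧ (m:ℝ) ≤ 2 := by rcases hm with rfl | rfl <;> norm_num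
  have hm0 : (0:ℝ) < m := by linarith
  have hre : ((m:ℂ) * s / 2).re = m * s.re / 2 := by
    rw [mul_div_assoc, ← ofReal_natCast, re_ofReal_mul]; simp; ring
  have hre2 : ((m:ℂ) * (1 - s) / 2).re = m * (1 - s.re) / 2 := by
    rw [mul_div_assoc, ← ofReal_natCast, re_ofReal_mul]; simp; ring
  have him : ((m:ℂ) * s / 2).im = m * s.im / 2 := by
    rw [mul_div_assoc, ← ofReal_natCast, im_ofReal_mul]; simp; ring
  have him2 : ((m:ℂ) * (1 - s) / 2).im = -(m * s.im / 2) := by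
    rw [mul_div_assoc, ← ofReal_natCast, im_ofReal_mul]; simp; ring
  have hG : ‖Gamma ((m:ℂ) * (1 - s) / 2)‖ ≤ ‖s + 2‖ ^ 2 * ‖Gamma ((m:ℂ) * s / 2)‖ := by
    have hc : ‖Gamma ((m:ℂ) * (1 - s) / 2)‖ = ‖Gamma ((m:ℂ) * s / 2 + m)‖ := by
      rw [← Complex.norm_conj, ← Gamma_conj]
      congr 2
      apply Complex.ext
      · rw [conj_re, hre2, add_re, hre, hs]
        simp; ring
      · rw [conj_im, add_im, him, him2]
        simp
    rw [hc]
    have hs0 : s ≠ 0 := by rintro rfl; norm_num at hs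
    rcases hm with rfl | rfl
    · simp only [Nat.cast_one, one_mul]
      rw [Gamma_add_one _ (by simpa using hs0), norm_mul]
      gcongr
      rw [norm_div, Complex.norm_two]
      have : ‖s‖ ≤ ‖s + 2‖ + 2 := by simpa using norm_sub_le (s + 2) 2
      nlinarith
    · simp only [Nat.cast_ofNat]
      rw [mul_div_cancel_left₀ _ (two_ne_zero), show s + 2 = s + 1 + 1 by ring, Gamma_add_one _ (by
        intro h
        have := congrArg Complex.re h
        simp [hs] at this
        norm_num at this), Gamma_add_one _ hs0, norm_mul, norm_mul, ← mul_assoc]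
      gcongr
      rw [pow_two]
      have e1 : ‖s + 1‖ ≤ ‖s + 1 + 1‖ := by
        rw [← sq_le_sq₀ (norm_nonneg _) (norm_nonneg _), Complex.sq_norm, Complex.sq_norm, normSq_apply, normSq_apply]
        simp [hs]; norm_num
      have e2 : ‖s‖ ≤ ‖s + 1 + 1‖ := by
        rw [← sq_le_sq₀ (norm_nonneg _) (norm_nonneg _), Complex.sq_norm, Complex.sq_norm, normSq_apply, normSq_apply]
        simp [hs]; norm_num
      gcongr
  have hG1 : Gamma ((m:ℂ) * (1 - s) / 2) ≠ 0 := Gamma_ne_zero_of_re_pos (by rw [hre2, hs]; nlinarith)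
  have hinv : ‖(Gamma ((m:ℂ) * s / 2))⁻¹‖ ≤ ‖s + 2‖ ^ 2 * ‖(Gamma ((m:ℂ) * (1 - s) / 2))⁻¹‖ := by
    have p1 : 0 < ‖Gamma ((m:ℂ) * (1 - s) / 2)‖ := norm_pos_iff.mpr hG1
    have p2 : 0 < ‖Gamma ((m:ℂ) * s / 2)‖ := by
      rcases (norm_nonneg (Gamma ((m:ℂ) * s / 2))).eq_or_lt with h | h
      · rw [← h, mul_zero] at hG; linarith
      · exact h
    rw [norm_inv, norm_inv, inv_le_iff_one_le_mul₀ p2, mul_assoc, inv_mul_eq_div, ← mul_div_assoc, le_div_iff₀ p1, one_mul]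
    exact hG
  rw [gammaInv, gammaInv, norm_mul, norm_mul, norm_mul, norm_mul]
  have q : ‖((Real.pi * m : ℝ) : ℂ) ^ ((m:ℂ) * s / 2)‖ ≤ ‖((Real.pi * m : ℝ) : ℂ) ^ ((m:ℂ) * (1 - s) / 2)‖ := by
    rw [norm_cpow_eq_rpow_re_of_pos (by positivity), norm_cpow_eq_rpow_re_of_pos (by positivity)]
    apply Real.rpow_le_rpow_of_exponent_le (by nlinarith)
    rw [hre, hre2, hs]; nlinarith
  calc _ ≤ ‖(2:ℂ)‖ * ‖((Real.pi * m : ℝ) : ℂ) ^ ((m:ℂ) * (1 - s) / 2)‖ * (‖s + 2‖ ^ 2 * ‖(Gamma ((m:ℂ) * (1 - s) / 2))⁻¹‖) := by gcongr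
    _ = _ := by ring

end GammaGrowth

section EntireZeta

lemma gammaInv_ne_zero {m : ℕ} (hm : 0 < m) {s : ℂ} (hs : 0 < s.re) : gammaInv m s ≠ 0 := by
  have hm' : (0:ℝ) < m := by exact_mod_cast hm
  rw [gammaInv]
  refine mul_ne_zero (mul_ne_zero two_ne_zero ?_) (inv_ne_zero (Gamma_ne_zero_of_re_pos ?_))
  · rw [Ne, cpow_eq_zero_iff, not_and_or]
    left
    exact_mod_cast (mul_pos Real.pi_pos hm').ne'
  · rw [mul_div_assoc, ← ofReal_natCast, re_ofReal_mul]
    simp; positivity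

variable {K : Type} [Field K] [NumberField K]

lemma InfinitePlace.mult_eq_one_or_two (w : InfinitePlace K) : w.mult = 1 ∨ w.mult = 2 := by
  unfold InfinitePlace.mult
  split_ifs <;> simp

lemma absNorm_pos' (a : {a : Ideal (𝓞 K) // a ≠ ⊥}) : 0 < Ideal.absNorm a.1 :=
  Nat.pos_of_ne_zero fun h => a.2 (Ideal.absNorm_eq_zero_iff.mp h)

lemma norm_absNorm_cpow (a : {a : Ideal (𝓞 K) // a ≠ ⊥}) (s : ℂ) :
    ‖(Ideal.absNorm a.1 : ℂ) ^ (-s)‖ = (Ideal.absNorm a.1 : ℝ) ^ (-s.re) := by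
  rw [← ofReal_natCast, norm_cpow_eq_rpow_re_of_pos (by exact_mod_cast absNorm_pos' a), neg_re]

/-- The Dirichlet series `∑ N(𝔞)^{-s}` converges absolutely on `Re s > 1`. -/
lemma summable_zeta {Z : ℂ → ℂ} (hZ : IsDedekindZeta K Z) {s : ℂ} (hs : 1 < s.re) :
    Summable fun a : {a : Ideal (𝓞 K) // a ≠ ⊥} => (Ideal.absNorm a.1 : ℂ) ^ (-s) := by
  refine Summable.of_norm ?_
  simp only [norm_absNorm_cpow]
  exact (exists_completed_zeta hZ).1 _ hs

lemma exists_bound_zeta {Z : ℂ → ℂ} (hZ : IsDedekindZeta K Z) {σ : ℝ} (hσ : 1 < σ) :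
    ∃ B : ℝ, 0 < B ∧ ∀ s : ℂ, σ ≤ s.re → ‖Z s‖ ≤ B := by
  have hs := (exists_completed_zeta hZ).1
  refine ⟨(∑' a : {a : Ideal (𝓞 K) // a ≠ ⊥}, (Ideal.absNorm a.1 : ℝ) ^ (-σ)) + 1, by
    have : 0 ≤ ∑' a : {a : Ideal (𝓞 K) // a ≠ ⊥}, (Ideal.absNorm a.1 : ℝ) ^ (-σ) :=
      tsum_nonneg fun _ => by positivity
    linarith, fun s h => ?_⟩
  rw [hZ.2 s (by linarith)]
  have h1 : ∀ a : {a : Ideal (𝓞 K) // a ≠ ⊥}, ‖(Ideal.absNorm a.1 : ℂ) ^ (-s)‖ ≤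
      (Ideal.absNorm a.1 : ℝ) ^ (-σ) := by
    intro a
    rw [norm_absNorm_cpow]
    exact Real.rpow_le_rpow_of_exponent_le (by exact_mod_cast absNorm_pos' a) (by linarith)
  have := tsum_of_norm_bounded (hs σ hσ).hasSum h1
  linarith

lemma exists_entire {Z : ℂ → ℂ} (hZ : IsDedekindZeta K Z) :
    ∃ E : ℂ → ℂ, Differentiable ℂ E ∧ E 1 ≠ 0 ∧ (∀ s, s ≠ 1 → E s = (s - 1) * Z s) ∧
      (∃ C : ℝ, ∃ N : ℕ, 0 < C ∧ ∀ s : ℂ, -1/2 ≤ s.re → ‖E s‖ ≤ C * (‖s‖ + 2) ^ N) ∧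
      (Z (1/2) = 0 → deriv Z (1/2) = 0) := by
  obtain ⟨hsum, A, c, L, hA, hc, hL, hLs, hLB, hform⟩ := exists_completed_zeta hZ
  have hd1 : (1 : ℝ) ≤ √|(discr K : ℝ)| := by
    rw [Real.one_le_sqrt]
    exact_mod_cast Int.one_le_abs (discr_ne_zero K)
  set d : ℝ := √|(discr K : ℝ)| with hd
  have hd0 : 0 < d := by linarith
  have hd0' : (d : ℂ) ≠ 0 := by exact_mod_cast hd0.ne'
  set W : ℂ → ℂ := fun s => A * (d : ℂ) ^ (-s) * ∏ w : InfinitePlace K, gammaInv w.mult s with hW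
  have hWd : Differentiable ℂ W := by
    have hγ : Differentiable ℂ fun s => ∏ w : InfinitePlace K, gammaInv w.mult s :=
      Differentiable.fun_finsetProd fun w _ => differentiable_gammaInv _ w.mult_pos
    have hdd : Differentiable ℂ fun s : ℂ => (d : ℂ) ^ (-s) :=
      Differentiable.const_cpow (by fun_prop) (Or.inl hd0')
    exact ((differentiable_const _).mul hdd).mul hγ
  have hW0 : ∀ s : ℂ, 0 < s.re → W s ≠ 0 := by
    intro s hs
    refine mul_ne_zero (mul_ne_zero (by exact_mod_cast hA.ne') ?_)
      (Finset.prod_ne_zero_iff.mpr fun w _ => gammaInv_ne_zero w.mult_pos hs)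
    rw [Ne, cpow_eq_zero_iff, not_and_or]
    exact Or.inl hd0'
  have hform' : ∀ s, s ≠ 0 → s ≠ 1 → Z s = W s * (L s - c / s - c / (1 - s)) := hform
  set F : ℂ → ℂ := fun s => W s * ((s - 1) * (L s - c / s) + c) with hF
  set E : ℂ → ℂ := Function.update (fun s => (s - 1) * Z s) 1 (F 1) with hE
  have hE1 : E 1 = F 1 := by simp [hE]
  have hEs : ∀ s, s ≠ 1 → E s = (s - 1) * Z s := fun s hs => by simp [hE, hs]
  have hEF : ∀ s, s ≠ 0 → E s = F s := by
    intro s hs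
    by_cases h1 : s = 1
    · rw [h1, hE1]
    · rw [hEs s h1, hform' s hs h1, hF]
      have : 1 - s ≠ 0 := sub_ne_zero.mpr (Ne.symm h1)
      field_simp
      ring
  have hEd : Differentiable ℂ E := by
    intro s
    by_cases h1 : s = 1
    · subst h1
      have : E =ᶠ[𝓝 1] F := by
        filter_upwards [isOpen_ne.mem_nhds (one_ne_zero (α := ℂ))] with s hs using hEF s hs
      refine DifferentiableAt.congr_of_eventuallyEq ?_ this
      refine (hWd 1).mul ((DifferentiableAt.mul (by fun_prop) ((hL 1).sub ?_)).add (by fun_prop))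
      exact (differentiableAt_const _).div differentiableAt_id one_ne_zero
    · have : E =ᶠ[𝓝 s] fun s => (s - 1) * Z s := by
        filter_upwards [isOpen_ne.mem_nhds h1] with u hu using hEs u hu
      exact DifferentiableAt.congr_of_eventuallyEq (DifferentiableAt.mul (by fun_prop) (hZ.1 s h1)) this
  refine ⟨E, hEd, ?_, hEs, ?_, ?_⟩
  · rw [hE1, hF]
    simp only [sub_self, zero_mul, zero_add]
    exact mul_ne_zero (hW0 1 (by simp)) (by exact_mod_cast hc.ne')
  · -- growth
    obtain ⟨B0, hB0, hB⟩ := exists_bound_zeta hZ (σ := 3/2) (by norm_num)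
    obtain ⟨B1, hB1, hBg⟩ := exists_bound_gammaInv
    obtain ⟨B2, hB2⟩ := hLB (-1/2) (3/2)
    set n := Fintype.card (InfinitePlace K) with hn
    set N := 2 * n + 1 with hN
    have hs2 : ∀ s : ℂ, -1/2 ≤ s.re → 3/2 ≤ ‖s + 2‖ := fun s hs => by
      have := Complex.re_le_norm (s + 2)
      simp at this; linarith
    have hs3 : ∀ s : ℂ, -1/2 ≤ s.re → ‖s - 1‖ ≤ ‖s + 2‖ := fun s hs => by
      rw [← sq_le_sq₀ (norm_nonneg _) (norm_nonneg _), Complex.sq_norm, Complex.sq_norm, normSq_apply,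
        normSq_apply]
      simp; nlinarith
    set f : ℂ → ℂ := fun s => E s / (s + 2) ^ N with hf
    have hEle : ∀ s : ℂ, -1/2 ≤ s.re → ‖s - 1‖ ≠ 0 → ‖f s‖ * ‖s + 2‖ ^ (2 * n) ≤ ‖Z s‖ := by
      intro s hs h1
      have h1' : s ≠ 1 := by rintro rfl; simp at h1
      have p : 0 < ‖s + 2‖ := by linarith [hs2 s hs]
      rw [hf]
      simp only [norm_div, norm_pow, hEs s h1', norm_mul, hN, pow_succ ‖s + 2‖ (2 * n)]
      rw [div_mul_eq_mul_div, div_le_iff₀ (by positivity)]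
      have := hs3 s hs
      calc ‖s - 1‖ * ‖Z s‖ * ‖s + 2‖ ^ (2 * n) ≤ ‖s + 2‖ * ‖Z s‖ * ‖s + 2‖ ^ (2 * n) := by gcongr
        _ = _ := by ring
    have hfZ : ∀ s : ℂ, -1/2 ≤ s.re → ‖s - 1‖ ≠ 0 → ‖f s‖ ≤ ‖Z s‖ := by
      intro s hs h1
      refine le_trans ?_ (hEle s hs h1)
      exact le_mul_of_one_le_right (norm_nonneg _) (one_le_pow₀ (by linarith [hs2 s hs]))
    have hWd' : ∀ s : ℂ, -1/2 ≤ s.re → ‖(d:ℂ) ^ (-s)‖ ≤ d ^ (1/2 : ℝ) := fun s hs =>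
      norm_cpow_bound hd1 (by simp; linarith)
    have hleft : ∀ s : ℂ, s.re = -1/2 → ‖f s‖ ≤ d ^ (2:ℝ) * B0 := by
      intro s hs
      have hs0 : s ≠ 0 := by rintro rfl; norm_num at hs
      have hs1 : s ≠ 1 := by rintro rfl; norm_num at hs
      have hZ1 : ‖Z (1 - s)‖ ≤ B0 := hB _ (by simp [hs]; norm_num)
      have e1 := hform' s hs0 hs1
      have e2 := hform' (1 - s) (sub_ne_zero.mpr (Ne.symm hs1)) (by simpa using hs0)
      have e3 : L (1 - s) - c / (1 - s) - c / (1 - (1 - s)) = L s - c / s - c / (1 - s) := by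
        rw [hLs]; ring_nf
      rw [e3] at e2
      have hWW : ‖W s‖ ≤ d ^ (2:ℝ) * ‖s + 2‖ ^ (2 * n) * ‖W (1 - s)‖ := by
        rw [hW]
        simp only [norm_mul, norm_prod]
        have a1 : ‖(d:ℂ) ^ (-s)‖ = d ^ (2:ℝ) * ‖(d:ℂ) ^ (-(1 - s))‖ := by
          rw [norm_cpow_eq_rpow_re_of_pos hd0, norm_cpow_eq_rpow_re_of_pos hd0, ← Real.rpow_add hd0]
          congr 1
          simp [hs]; norm_num
        have a2 : ∏ w : InfinitePlace K, ‖gammaInv w.mult s‖ ≤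
            ‖s + 2‖ ^ (2 * n) * ∏ w : InfinitePlace K, ‖gammaInv w.mult (1 - s)‖ := by
          rw [pow_mul, hn, ← Finset.card_univ, ← Finset.prod_const, ← Finset.prod_mul_distrib]
          exact Finset.prod_le_prod (fun _ _ => norm_nonneg _) fun w _ =>
            norm_gammaInv_le_one_sub (InfinitePlace.mult_eq_one_or_two w) hs
        rw [a1]
        calc _ ≤ ‖(A:ℂ)‖ * (d ^ (2:ℝ) * ‖(d:ℂ) ^ (-(1 - s))‖) * (‖s + 2‖ ^ (2 * n) *
              ∏ w : InfinitePlace K, ‖gammaInv w.mult (1 - s)‖) := by gcongr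
          _ = _ := by ring
      have hZZ : ‖Z s‖ ≤ d ^ (2:ℝ) * ‖s + 2‖ ^ (2 * n) * B0 := by
        rw [e1, norm_mul]
        calc _ ≤ d ^ (2:ℝ) * ‖s + 2‖ ^ (2 * n) * ‖W (1 - s)‖ * ‖L s - c / s - c / (1 - s)‖ := by gcongr
          _ = d ^ (2:ℝ) * ‖s + 2‖ ^ (2 * n) * ‖Z (1 - s)‖ := by
              rw [e2, norm_mul (W (1 - s)), mul_assoc]
          _ ≤ _ := by gcongr
      have h5 := (hEle s hs.ge (by simpa [sub_eq_zero] using hs1)).trans hZZ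
      have p : 0 < ‖s + 2‖ ^ (2 * n) := by
        have := hs2 s hs.ge
        positivity
      nlinarith
    have hright : ∀ s : ℂ, 3/2 ≤ s.re → ‖f s‖ ≤ B0 := fun s hs =>
      (hfZ s (by linarith) (by
        intro h
        have : s = 1 := by rwa [norm_eq_zero, sub_eq_zero] at h
        rw [this] at hs; norm_num at hs)).trans (hB s hs)
    have hmid : ∀ s : ℂ, s.re ∈ Set.Ioo (-1/2:ℝ) (3/2) → 1 ≤ |s.im| → ‖f s‖ ≤
        (A * d ^ (1/2:ℝ) * B1 ^ n * (|B2| + 2 * c)) * Real.exp ((n * Real.pi) * Real.exp (1 * |s.im|)) := by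
      intro s hs him
      have him0 : s.im ≠ 0 := by intro h; simp [h] at him; norm_num at him
      have hs0 : s ≠ 0 := by rintro rfl; simp at him0
      have hs1 : s ≠ 1 := by rintro rfl; simp at him0
      refine (hfZ s hs.1.le (by simpa [sub_eq_zero] using hs1)).trans ?_
      rw [hform' s hs0 hs1, hW]
      simp only [norm_mul, norm_prod]
      have a1 : ∏ w : InfinitePlace K, ‖gammaInv w.mult s‖ ≤ B1 ^ n * Real.exp ((n * Real.pi) * Real.exp (1 * |s.im|)) := by
        calc _ ≤ ∏ w : InfinitePlace K, (B1 * Real.exp (Real.pi * |s.im|)) :=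
              Finset.prod_le_prod (fun _ _ => norm_nonneg _) fun w _ =>
                hBg _ (InfinitePlace.mult_eq_one_or_two w) s hs.1.le hs.2.le him
          _ = B1 ^ n * Real.exp ((n * Real.pi) * |s.im|) := by
              rw [Finset.prod_const, Finset.card_univ, mul_pow, ← Real.exp_nat_mul, ← mul_assoc]
          _ ≤ _ := by
              gcongr
              linarith [Real.add_one_le_exp (1 * |s.im|)]
      have a2 : ‖L s - c / s - c / (1 - s)‖ ≤ |B2| + 2 * c := by
        have b1 : ‖(c:ℂ) / s‖ ≤ c := by
          rw [norm_div, Complex.norm_real, Real.norm_of_nonneg hc.le]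
          exact div_le_self hc.le (him.trans (abs_im_le_norm s))
        have b2 : ‖(c:ℂ) / (1 - s)‖ ≤ c := by
          rw [norm_div, Complex.norm_real, Real.norm_of_nonneg hc.le]
          refine div_le_self hc.le (him.trans ?_)
          simpa using abs_im_le_norm (1 - s)
        calc _ ≤ ‖L s‖ + ‖(c:ℂ) / s‖ + ‖(c:ℂ) / (1 - s)‖ :=
              (norm_sub_le _ _).trans (by gcongr; exact norm_sub_le _ _)
          _ ≤ |B2| + c + c := by
              gcongr
              exact (hB2 s hs.1.le hs.2.le).trans (le_abs_self _)
          _ = _ := by ring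
      calc _ ≤ A * d ^ (1/2:ℝ) * (B1 ^ n * Real.exp ((n * Real.pi) * Real.exp (1 * |s.im|))) * (|B2| + 2 * c) := by
            gcongr
            · rw [Complex.norm_real, Real.norm_of_nonneg hA.le]
            · exact hWd' s hs.1.le
        _ = _ := by ring
    have hfd : ∀ s : ℂ, -1/2 ≤ s.re → DifferentiableAt ℂ f s := by
      intro s hs
      refine (hEd s).div (by fun_prop) (pow_ne_zero _ ?_)
      intro h
      have := hs2 s hs
      rw [h] at this; norm_num at this
    have hcl : closure (re ⁻¹' Set.Ioo (-1/2 : ℝ) (3/2)) = re ⁻¹' Set.Icc (-1/2 : ℝ) (3/2) := by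
      rw [Complex.closure_preimage_re, closure_Ioo (by norm_num)]
    have hPL : ∀ s : ℂ, -1/2 ≤ s.re → s.re ≤ 3/2 → ‖f s‖ ≤ d ^ (2:ℝ) * B0 + B0 := by
      intro s h1 h2
      have q1 : 0 ≤ d ^ (2:ℝ) * B0 := by positivity
      refine PhragmenLindelof.vertical_strip (a := -1/2) (b := 3/2) (f := f) ?_ ?_ ?_ ?_ h1 h2
      · refine ⟨fun s hs => (hfd s hs.1.le).differentiableWithinAt, ?_⟩
        rw [hcl]
        exact fun s hs => (hfd s hs.1).continuousAt.continuousWithinAt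
      · refine ⟨1, by have := Real.pi_gt_three; norm_num; linarith, n * Real.pi, ?_⟩
        refine Asymptotics.IsBigO.of_bound (A * d ^ (1/2:ℝ) * B1 ^ n * (|B2| + 2 * c)) ?_
        rw [Filter.eventually_inf_principal]
        have : ∀ᶠ s : ℂ in comap (_root_.abs ∘ im) atTop, 1 ≤ |s.im| :=
          (eventually_ge_atTop (1:ℝ)).comap _
        filter_upwards [this] with s hs hs'
        rw [Real.norm_of_nonneg (Real.exp_pos _).le]
        exact hmid s hs' hs
      · intro s hs
        linarith [hleft s hs]
      · intro s hs
        linarith [hright s hs.ge]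
    refine ⟨d ^ (2:ℝ) * B0 + B0, N, by positivity, fun s hs => ?_⟩
    have hfs : ‖f s‖ ≤ d ^ (2:ℝ) * B0 + B0 := by
      rcases le_total s.re (3/2) with h | h
      · exact hPL s hs h
      · have q1 : 0 ≤ d ^ (2:ℝ) * B0 := by positivity
        linarith [hright s h]
    have p : s + 2 ≠ 0 := by
      intro h
      have := hs2 s hs
      rw [h] at this; norm_num at this
    have : E s = f s * (s + 2) ^ N := by rw [hf]; field_simp
    rw [this, norm_mul, norm_pow]
    gcongr
    simpa using norm_add_le s 2
  · intro h0
    have hne : (1/2 : ℂ) ≠ 0 ∧ (1/2:ℂ) ≠ 1 ∧ (1 - 1/2 : ℂ) ≠ 0 := by norm_num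
    set G : ℂ → ℂ := fun s => L s - c / s - c / (1 - s) with hG
    have hGd : DifferentiableAt ℂ G (1/2) := by
      refine ((hL _).sub ?_).sub ?_
      · exact (differentiableAt_const _).div differentiableAt_id hne.1
      · exact (differentiableAt_const _).div (by fun_prop) hne.2.2
    have hGsym : ∀ s, G (1 - s) = G s := by
      intro s
      simp only [hG]
      rw [hLs]; ring_nf
    have hG' : deriv G (1/2) = 0 := by
      have h1 : deriv (fun s => G (1 - s)) (1/2) = - deriv G (1 - 1/2) := deriv_comp_const_sub G 1 (1/2)
      rw [funext hGsym] at h1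
      norm_num at h1
      have h2 : deriv G (1/2) = - deriv G (1/2) := by simpa using h1
      linear_combination h2 / 2
    have hev : Z =ᶠ[𝓝 (1/2)] fun s => W s * G s := by
      filter_upwards [isOpen_ne.mem_nhds hne.1, isOpen_ne.mem_nhds hne.2.1] with s h1 h2 using hform' s h1 h2
    have hG0 : G (1/2) = 0 := by
      have := hev.eq_of_nhds
      rw [h0] at this
      exact (mul_eq_zero.mp this.symm).resolve_left (hW0 _ (by norm_num))
    rw [hev.deriv_eq, deriv_fun_mul (hWd _) hGd, hG0, hG']
    ring

end EntireZeta

section InverseZeta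
variable {K : Type} [Field K] [NumberField K]

/-- Multiplication of a Dirichlet series over ideals by the zeta series. -/
lemma hasSum_dirichlet_mul {ι : Type*} (φ : ι → {a : Ideal (𝓞 K) // a ≠ ⊥}) (f : ι → ℂ) (s : ℂ)
    (hf : Summable fun i => f i * (Ideal.absNorm (φ i).1 : ℂ) ^ (-s))
    (hs : Summable fun a : {a : Ideal (𝓞 K) // a ≠ ⊥} => (Ideal.absNorm a.1 : ℂ) ^ (-s)) :
    HasSum (fun c : {a : Ideal (𝓞 K) // a ≠ ⊥} =>
      (∑' i : {i // (φ i).1 ∣ c.1}, f i) * (Ideal.absNorm c.1 : ℂ) ^ (-s))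
      ((∑' i, f i * (Ideal.absNorm (φ i).1 : ℂ) ^ (-s)) *
        ∑' a : {a : Ideal (𝓞 K) // a ≠ ⊥}, (Ideal.absNorm a.1 : ℂ) ^ (-s)) := by
  have hprod := summable_mul_of_summable_norm hf.norm hs.norm
  have hsum := hprod.hasSum
  rw [← tsum_mul_tsum_of_summable_norm hf.norm hs.norm] at hsum
  set T : (ι × {a : Ideal (𝓞 K) // a ≠ ⊥}) →
      (Σ c : {a : Ideal (𝓞 K) // a ≠ ⊥}, {i // (φ i).1 ∣ c.1}) := fun p =>
    ⟨⟨(φ p.1).1 * p.2.1, mul_ne_zero (φ p.1).2 p.2.2⟩, ⟨p.1, dvd_mul_right _ _⟩⟩ with hT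
  have hbij : Function.Bijective T := by
    constructor
    · rintro ⟨i, a⟩ ⟨j, b⟩ h
      have hij : i = j := congrArg (fun x => x.2.1) h
      have h1 : (φ i).1 * a.1 = (φ j).1 * b.1 := congrArg (fun x => x.1.1) h
      subst hij
      rw [Prod.mk.injEq]
      exact ⟨rfl, Subtype.ext (mul_left_cancel₀ (φ i).2 h1)⟩
    · rintro ⟨⟨c, hc⟩, ⟨i, hi⟩⟩
      obtain ⟨b, hb⟩ := hi
      have hb0 : b ≠ ⊥ := by
        rintro rfl
        exact hc (by simpa using hb)
      refine ⟨⟨i, ⟨b, hb0⟩⟩, ?_⟩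
      simp only at hb
      subst hb
      rfl
  set e := Equiv.ofBijective T hbij
  have h2 := (Equiv.hasSum_iff e.symm).mpr hsum
  have hval : ∀ (c : {a : Ideal (𝓞 K) // a ≠ ⊥}) (i : {i // (φ i).1 ∣ c.1}),
      ((fun x : ι × {a : Ideal (𝓞 K) // a ≠ ⊥} => f x.1 * (Ideal.absNorm (φ x.1).1 : ℂ) ^ (-s) *
        (Ideal.absNorm x.2.1 : ℂ) ^ (-s)) ∘ e.symm) ⟨c, i⟩ = f i * (Ideal.absNorm c.1 : ℂ) ^ (-s) := by
    intro c i
    obtain ⟨⟨j, a⟩, hj⟩ := e.surjective ⟨c, i⟩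
    have e1 : e.symm ⟨c, i⟩ = (j, a) := by rw [← hj, Equiv.symm_apply_apply]
    have e2 : j = i.1 := congrArg (fun x => x.2.1) hj
    have e3 : (φ j).1 * a.1 = c.1 := congrArg (fun x => x.1.1) hj
    rw [Function.comp_apply, e1, ← e2, ← e3]
    simp only [map_mul, Nat.cast_mul]
    rw [natCast_mul_natCast_cpow, mul_assoc]
  refine HasSum.sigma h2 fun c => ?_
  have h4 := h2.summable.sigma_factor c
  simp only [hval] at h4 ⊢
  have := h4.hasSum
  rwa [tsum_mul_right] at this

lemma sum_moebius_dvd {c : Ideal (𝓞 K)} (hc : c ≠ ⊥) :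
    (∑' i : {i : {a : Ideal (𝓞 K) // a ≠ ⊥} // i.1 ∣ c}, (moebiusK K i.1.1 : ℂ)) =
      if c = 1 then 1 else 0 := by
  have hfin : Finite {b : Ideal (𝓞 K) // b ∣ c} :=
    @Finite.of_fintype _ (UniqueFactorizationMonoid.fintypeSubtypeDvd c hc)
  let emb : {i : {a : Ideal (𝓞 K) // a ≠ ⊥} // i.1 ∣ c} ≃ {b : Ideal (𝓞 K) // b ∣ c} :=
    { toFun := fun i => ⟨i.1.1, i.2⟩
      invFun := fun b => ⟨⟨b.1, fun h => hc (by
        have := b.2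
        rw [h] at this
        exact zero_dvd_iff.mp this)⟩, b.2⟩
      left_inv := fun _ => rfl
      right_inv := fun _ => rfl }
  rw [← Equiv.tsum_eq emb.symm]
  have : Fintype {b : Ideal (𝓞 K) // b ∣ c} := Fintype.ofFinite _
  rw [tsum_fintype]
  have hval : ∀ b, ((moebiusK K (emb.symm b).1.1 : ℤ) : ℂ) = ((UniqueFactorizationMonoid.moebius b.1 : ℤ) : ℂ) :=
    fun b => rfl
  simp only [hval]
  by_cases h1 : c = 1
  · subst h1
    rw [if_pos rfl]
    have : ∀ b : {b : Ideal (𝓞 K) // b ∣ 1}, b = ⟨1, dvd_rfl⟩ := fun b =>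
      Subtype.ext (isUnit_iff_eq_one.mp (isUnit_of_dvd_one b.2))
    rw [Fintype.sum_eq_single ⟨1, dvd_rfl⟩ (fun b hb => absurd (this b) hb)]
    rw [UniqueFactorizationMonoid.moebius_one, Int.cast_one]
  rw [if_neg h1]
  obtain ⟨p, hp, hpc⟩ := WfDvdMonoid.exists_irreducible_factor (fun h => h1 (isUnit_iff_eq_one.mp h)) hc
  have hpp : Prime p := hp.prime
  have hmul : ∀ b, ¬ p ∣ b → UniqueFactorizationMonoid.moebius (p * b) = - UniqueFactorizationMonoid.moebius b := by
    intro b hb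
    rw [IsRelPrime.moebius_mul ((hp.isRelPrime_iff_not_dvd).mpr hb), hp.moebius_eq, neg_one_mul]
  have hdiv : ∀ b, b ∣ c → ¬ p ∣ b → p * b ∣ c := fun b hb hpb =>
    ((hp.isRelPrime_iff_not_dvd).mpr hpb).mul_dvd hpc hb
  have hsq : ∀ b, p ∣ b → UniqueFactorizationMonoid.moebius (p * b) = 0 := by
    intro b hb
    apply UniqueFactorizationMonoid.moebius_of_not_squarefree
    intro hs
    exact hp.not_isUnit (hs p (mul_dvd_mul_left p hb))
  -- the involution exchanging `b` and `p * b`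
  let q : {b : Ideal (𝓞 K) // b ∣ c} → {b : Ideal (𝓞 K) // b ∣ c} := fun b =>
    if h : p ∣ b.1 then
      (if p ∣ h.choose then b else ⟨h.choose, (Dvd.intro_left p h.choose_spec.symm).trans b.2⟩)
    else ⟨p * b.1, hdiv b.1 b.2 h⟩
  have q1 : ∀ (b : {b : Ideal (𝓞 K) // b ∣ c}), ¬ p ∣ b.1 → (q b).1 = p * b.1 := by
    intro b h
    simp only [q, dif_neg h]
  have q2 : ∀ (b : {b : Ideal (𝓞 K) // b ∣ c}) (x : Ideal (𝓞 K)), b.1 = p * x → ¬ p ∣ x → (q b).1 = x := by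
    intro b x h hx
    have hd : p ∣ b.1 := ⟨x, h⟩
    have hx' : hd.choose = x := mul_left_cancel₀ hp.ne_zero (hd.choose_spec.symm.trans h)
    simp only [q, dif_pos hd, hx', if_neg hx]
  have q3 : ∀ (b : {b : Ideal (𝓞 K) // b ∣ c}) (x : Ideal (𝓞 K)), b.1 = p * x → p ∣ x → q b = b := by
    intro b x h hx
    have hd : p ∣ b.1 := ⟨x, h⟩
    have hx' : hd.choose = x := mul_left_cancel₀ hp.ne_zero (hd.choose_spec.symm.trans h)
    simp only [q, dif_pos hd, hx', if_pos hx]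
  have cases3 : ∀ b : {b : Ideal (𝓞 K) // b ∣ c}, (¬ p ∣ b.1) ∨ (∃ x, b.1 = p * x ∧ ¬ p ∣ x) ∨ ∃ x, b.1 = p * x ∧ p ∣ x := by
    intro b
    by_cases h : p ∣ b.1
    · obtain ⟨x, hx⟩ := h
      by_cases h' : p ∣ x
      · exact Or.inr (Or.inr ⟨x, hx, h'⟩)
      · exact Or.inr (Or.inl ⟨x, hx, h'⟩)
    · exact Or.inl h
  refine Finset.sum_involution (fun b _ => q b) ?_ ?_ (fun _ _ => Finset.mem_univ _) ?_
  · intro b _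
    rcases cases3 b with h | ⟨x, h, hx⟩ | ⟨x, h, hx⟩
    · rw [q1 b h, hmul _ h]; simp
    · rw [q2 b x h hx, h, hmul _ hx]; simp
    · rw [q3 b x h hx, h, hsq _ hx]; simp
  · intro b _ h0 hqb
    have hqb' := congrArg Subtype.val hqb
    rcases cases3 b with h | ⟨x, h, hx⟩ | ⟨x, h, hx⟩
    · rw [q1 b h] at hqb'
      exact h ⟨b.1, hqb'.symm⟩
    · rw [q2 b x h hx] at hqb'
      exact hx (hqb' ▸ ⟨x, h⟩)
    · apply h0
      rw [h, hsq _ hx]; simp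
  · intro b _
    apply Subtype.ext
    rcases cases3 b with h | ⟨x, h, hx⟩ | ⟨x, h, hx⟩
    · exact q2 _ _ (q1 b h) h
    · have e := q2 b x h hx
      rw [q1 _ (by rwa [e]), e, h]
    · rw [q3 b x h hx, q3 b x h hx]

lemma norm_moebiusK_le (I : Ideal (𝓞 K)) : ‖(moebiusK K I : ℂ)‖ ≤ 1 := by
  unfold moebiusK
  split_ifs <;> simp

lemma summable_moebius {Z : ℂ → ℂ} (hZ : IsDedekindZeta K Z) {s : ℂ} (hs : 1 < s.re) :
    Summable fun a : {a : Ideal (𝓞 K) // a ≠ ⊥} => (moebiusK K a.1 : ℂ) * (Ideal.absNorm a.1 : ℂ) ^ (-s) := by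
  refine Summable.of_norm_bounded (summable_zeta hZ hs).norm fun a => ?_
  rw [norm_mul]
  exact mul_le_of_le_one_left (norm_nonneg _) (norm_moebiusK_le _)

lemma zeta_mul_moebius {Z : ℂ → ℂ} (hZ : IsDedekindZeta K Z) {s : ℂ} (hs : 1 < s.re) :
    (∑' a : {a : Ideal (𝓞 K) // a ≠ ⊥}, (moebiusK K a.1 : ℂ) * (Ideal.absNorm a.1 : ℂ) ^ (-s)) * Z s = 1 := by
  rw [hZ.2 s hs]
  have h := hasSum_dirichlet_mul (K := K) id (fun a => (moebiusK K a.1 : ℂ)) s (summable_moebius hZ hs)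
    (summable_zeta hZ hs)
  refine h.tsum_eq.symm.trans ?_
  rw [tsum_eq_single ⟨1, one_ne_zero⟩]
  · have := sum_moebius_dvd (K := K) (c := 1) one_ne_zero
    simp only [id]
    rw [this]
    simp
  · intro c hc
    have := sum_moebius_dvd (K := K) c.2
    simp only [id]
    rw [this, if_neg, zero_mul]
    intro h
    exact hc (Subtype.ext h)

/-- `1 / Z` is bounded on half planes to the right of `1`. -/
lemma exists_bound_inv_zeta {Z : ℂ → ℂ} (hZ : IsDedekindZeta K Z) {σ : ℝ} (hσ : 1 < σ) :
    ∃ B : ℝ, 0 < B ∧ ∀ s : ℂ, σ ≤ s.re → ‖(Z s)⁻¹‖ ≤ B := by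
  have hs := (exists_completed_zeta hZ).1
  refine ⟨(∑' a : {a : Ideal (𝓞 K) // a ≠ ⊥}, (Ideal.absNorm a.1 : ℝ) ^ (-σ)) + 1, by
    have : 0 ≤ ∑' a : {a : Ideal (𝓞 K) // a ≠ ⊥}, (Ideal.absNorm a.1 : ℝ) ^ (-σ) :=
      tsum_nonneg fun _ => by positivity
    linarith, fun s h => ?_⟩
  rw [← eq_inv_of_mul_eq_one_left (zeta_mul_moebius hZ (by linarith : 1 < s.re))]
  have h1 : ∀ a : {a : Ideal (𝓞 K) // a ≠ ⊥}, ‖(moebiusK K a.1 : ℂ) * (Ideal.absNorm a.1 : ℂ) ^ (-s)‖ ≤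
      (Ideal.absNorm a.1 : ℝ) ^ (-σ) := by
    intro a
    rw [norm_mul, norm_absNorm_cpow]
    refine (mul_le_of_le_one_left (by positivity) (norm_moebiusK_le _)).trans ?_
    exact Real.rpow_le_rpow_of_exponent_le (by exact_mod_cast absNorm_pos' a) (by linarith)
  have := tsum_of_norm_bounded (hs σ hσ).hasSum h1
  linarith

end InverseZeta

section NonvanishingRight

lemma entire_not_eventually_zero {E : ℂ → ℂ} (hE : Differentiable ℂ E) {w : ℂ} (hw : E w ≠ 0) (z : ℂ) :
    ¬ ∀ᶠ s in 𝓝 z, E s = 0 := by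
  intro h
  have hA : AnalyticOnNhd ℂ E Set.univ := hE.differentiableOn.analyticOnNhd isOpen_univ
  have := hA.eqOn_zero_of_preconnected_of_eventuallyEq_zero isPreconnected_univ (Set.mem_univ z) h
  exact hw (this (Set.mem_univ w))

lemma exists_tendsto_mul_logDeriv {E : ℂ → ℂ} (hE : Differentiable ℂ E) {w : ℂ} (hw : E w ≠ 0) (z : ℂ) :
    ∃ n : ℕ, (E z = 0 → 1 ≤ n) ∧
      Tendsto (fun s => (s - z) * (deriv E s / E s)) (𝓝[≠] z) (𝓝 n) := by
  have hA : AnalyticAt ℂ E z := hE.analyticAt z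
  obtain ⟨n, g, hg, hg0, hev⟩ := hA.exists_eventuallyEq_pow_smul_nonzero_iff.mpr
    (entire_not_eventually_zero hE hw z)
  refine ⟨n, fun h0 => ?_, ?_⟩
  · rcases Nat.eq_zero_or_pos n with rfl | h
    · have := hev.self_of_nhds
      simp at this
      exact absurd (this.symm.trans h0) hg0
    · exact h
  · have h1 : ∀ᶠ s in 𝓝 z, deriv E s = deriv (fun s => (s - z) ^ n • g s) s := by
      have : E =ᶠ[𝓝 z] fun s => (s - z) ^ n • g s := hev
      exact this.deriv
    have h2 : ∀ᶠ s in 𝓝 z, DifferentiableAt ℂ g s := hg.eventually_analyticAt.mono fun s hs => hs.differentiableAt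
    have h3 : ∀ᶠ s in 𝓝 z, g s ≠ 0 := hg.continuousAt.eventually_ne hg0
    have h4 : ∀ᶠ s in 𝓝[≠] z, (n : ℂ) + (s - z) * (deriv g s / g s) = (s - z) * (deriv E s / E s) := by
      filter_upwards [h1.filter_mono nhdsWithin_le_nhds, h2.filter_mono nhdsWithin_le_nhds,
        h3.filter_mono nhdsWithin_le_nhds, hev.filter_mono nhdsWithin_le_nhds, self_mem_nhdsWithin]
        with s a1 a2 a3 a4 a5
      have hsz : s - z ≠ 0 := sub_ne_zero.mpr a5
      rw [a1, a4]
      simp only [smul_eq_mul]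
      rw [deriv_fun_mul (by fun_prop) a2, deriv_fun_pow (by fun_prop)]
      simp only [deriv_sub_const, deriv_id'', mul_one]
      rcases n with _ | n
      · simp
      · simp only [Nat.add_sub_cancel]
        field_simp
        ring
    refine Tendsto.congr' h4 ?_
    have h5 : ContinuousAt (fun s => (n : ℂ) + (s - z) * (deriv g s / g s)) z := by
      have : ContinuousAt (deriv g) z := hg.deriv.continuousAt
      exact continuousAt_const.add ((by fun_prop : ContinuousAt (fun s => s - z) z).mul (this.div hg.continuousAt hg0))
    have := h5.tendsto.mono_left (nhdsWithin_le_nhds (s := {z}ᶜ))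
    simpa using this

variable {K : Type} [Field K] [NumberField K]

lemma hasSum_neg_deriv_zeta {Z : ℂ → ℂ} (hZ : IsDedekindZeta K Z) {s : ℂ} (hs : 1 < s.re) :
    HasSum (fun a : {a : Ideal (𝓞 K) // a ≠ ⊥} =>
      (Real.log (Ideal.absNorm a.1) : ℂ) * (Ideal.absNorm a.1 : ℂ) ^ (-s)) (-deriv Z s) := by
  obtain ⟨σ, h1, h2⟩ := exists_between hs
  have hU : IsOpen {s : ℂ | σ < s.re} := isOpen_lt continuous_const continuous_re
  have hN : ∀ a : {a : Ideal (𝓞 K) // a ≠ ⊥}, (Ideal.absNorm a.1 : ℂ) ≠ 0 := fun a => by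
    exact_mod_cast (absNorm_pos' a).ne'
  have hd : ∀ (a : {a : Ideal (𝓞 K) // a ≠ ⊥}) (s : ℂ),
      HasDerivAt (fun s : ℂ => (Ideal.absNorm a.1 : ℂ) ^ (-s))
        (-((Real.log (Ideal.absNorm a.1) : ℂ) * (Ideal.absNorm a.1 : ℂ) ^ (-s))) s := by
    intro a s
    have := (hasDerivAt_neg s).const_cpow (c := (Ideal.absNorm a.1 : ℂ)) (Or.inl (hN a))
    convert this using 1
    rw [natCast_log]
    ring
  have key := Complex.hasSum_deriv_of_summable_norm (F := fun (a : {a : Ideal (𝓞 K) // a ≠ ⊥}) (s : ℂ) =>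
      (Ideal.absNorm a.1 : ℂ) ^ (-s)) ((exists_completed_zeta hZ).1 σ h1)
      (fun a w _ => (hd a w).differentiableAt.differentiableWithinAt) hU
      (fun a w hw => by
        simp only [norm_absNorm_cpow]
        exact Real.rpow_le_rpow_of_exponent_le (by exact_mod_cast absNorm_pos' a) (by
          have : σ < w.re := hw
          linarith)) (show s ∈ {s : ℂ | σ < s.re} from h2)
  have hev : Z =ᶠ[𝓝 s] fun w => ∑' a : {a : Ideal (𝓞 K) // a ≠ ⊥}, (Ideal.absNorm a.1 : ℂ) ^ (-w) := by
    filter_upwards [hU.mem_nhds h2] with w hw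
    have : σ < w.re := hw
    exact hZ.2 w (by linarith)
  rw [hev.deriv_eq]
  have h := key.neg
  simp only [(hd _ _).deriv, neg_neg] at h
  exact h

/-- The prime ideal powers `𝔭 ^ (k + 1)`. -/
def primePow (i : {p : Ideal (𝓞 K) // Prime p} × ℕ) : {a : Ideal (𝓞 K) // a ≠ ⊥} :=
  ⟨i.1.1 ^ (i.2 + 1), pow_ne_zero _ i.1.2.ne_zero⟩

lemma one_lt_absNorm_prime (p : {p : Ideal (𝓞 K) // Prime p}) : 1 < Ideal.absNorm p.1 := by
  have h0 := absNorm_pos' ⟨p.1, p.2.ne_zero⟩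
  have h1 : Ideal.absNorm p.1 ≠ 1 := by
    intro h
    rw [Ideal.absNorm_eq_one_iff] at h
    exact p.2.not_isUnit (by rw [h, ← Ideal.one_eq_top]; exact isUnit_one)
  simp only at h0
  omega

lemma primePow_injective : Function.Injective (primePow (K := K)) := by
  rintro ⟨p, k⟩ ⟨q, l⟩ h
  have h' : p.1 ^ (k + 1) = q.1 ^ (l + 1) := congrArg Subtype.val h
  have hpq : p = q := by
    have : p.1 ∣ q.1 := p.2.dvd_of_dvd_pow (h' ▸ dvd_pow_self p.1 (Nat.succ_ne_zero k))
    exact Subtype.ext (associated_iff_eq.mp ((p.2.irreducible.dvd_irreducible_iff_associated q.2.irreducible).mp this))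
  subst hpq
  have h2 := congrArg Ideal.absNorm h'
  rw [map_pow, map_pow] at h2
  have := Nat.pow_right_injective (one_lt_absNorm_prime p) h2
  simp at this
  rw [this]

lemma tsum_primePow_dvd {c : Ideal (𝓞 K)} (hc : c ≠ ⊥) :
    (∑' i : {i : {p : Ideal (𝓞 K) // Prime p} × ℕ // (primePow i).1 ∣ c},
      (Real.log (Ideal.absNorm i.1.1.1) : ℂ)) = Real.log (Ideal.absNorm c) := by
  set nf := UniqueFactorizationMonoid.normalizedFactors c with hnf
  set T : Finset {p : Ideal (𝓞 K) // Prime p} := nf.toFinset.subtype _ with hT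
  set S : Finset ({p : Ideal (𝓞 K) // Prime p} × ℕ) :=
    T.biUnion fun p => (Finset.range (nf.count p.1)).image (Prod.mk p) with hS
  have hmem : ∀ i, (primePow i).1 ∣ c ↔ i ∈ S := by
    rintro ⟨p, k⟩
    have h1 : (primePow (p, k)).1 ∣ c ↔ k < nf.count p.1 := by
      simp only [primePow]
      rw [pow_dvd_iff_le_emultiplicity, UniqueFactorizationMonoid.emultiplicity_eq_count_normalizedFactors
        p.2.irreducible hc, normalize_eq]
      norm_cast
    rw [h1]
    simp only [hS, hT, Finset.mem_biUnion, Finset.mem_subtype, Multiset.mem_toFinset, Finset.mem_image,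
      Finset.mem_range, Prod.mk.injEq]
    constructor
    · intro h
      exact ⟨p, Multiset.count_pos.mp (by omega), k, h, rfl, rfl⟩
    · rintro ⟨q, _, l, hl, h1, h2⟩
      rw [← h1, ← h2]
      exact hl
  have e : (∑' i : {i : {p : Ideal (𝓞 K) // Prime p} × ℕ // (primePow i).1 ∣ c},
      (Real.log (Ideal.absNorm i.1.1.1) : ℂ)) = ∑ i ∈ S, (Real.log (Ideal.absNorm i.1.1) : ℂ) := by
    rw [← Finset.tsum_subtype S (fun i => (Real.log (Ideal.absNorm i.1.1) : ℂ))]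
    exact Equiv.tsum_eq (Equiv.subtypeEquivRight hmem) (fun i : {i // i ∈ S} => (Real.log (Ideal.absNorm i.1.1.1) : ℂ))
  rw [e, hS, Finset.sum_biUnion]
  · have e2 : ∀ p ∈ T, ∑ i ∈ (Finset.range (nf.count p.1)).image (Prod.mk p),
        (Real.log (Ideal.absNorm i.1.1) : ℂ) = nf.count p.1 • (Real.log (Ideal.absNorm p.1) : ℂ) := by
      intro p _
      rw [Finset.sum_image (fun a _ b _ h => (Prod.mk.inj h).2)]
      simp
    rw [Finset.sum_congr rfl e2, hT, Finset.sum_subtype_of_mem (fun p => nf.count p • (Real.log (Ideal.absNorm p) : ℂ))]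
    · rw [← Finset.sum_multiset_map_count nf (fun p => (Real.log (Ideal.absNorm p) : ℂ))]
      conv_rhs => rw [← Ideal.prod_normalizedFactors_eq_self hc, ← hnf]
      have : ∀ m : Multiset (Ideal (𝓞 K)), (∀ p ∈ m, p ≠ ⊥) →
          (m.map fun p => (Real.log (Ideal.absNorm p) : ℂ)).sum = Real.log (Ideal.absNorm m.prod) := by
        intro m
        induction m using Multiset.induction_on with
        | empty => simp
        | cons p m ih =>
          intro h
          rw [Multiset.map_cons, Multiset.sum_cons, Multiset.prod_cons, map_mul, Nat.cast_mul, Real.log_mul,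
            ih (fun q hq => h q (Multiset.mem_cons_of_mem hq)), ofReal_add]
          · exact_mod_cast (absNorm_pos' ⟨p, h p (Multiset.mem_cons_self _ _)⟩).ne'
          · have : m.prod ≠ ⊥ := by
              intro h0
              exact h ⊥ (Multiset.mem_cons_of_mem (Multiset.prod_eq_zero_iff.mp h0)) rfl
            exact_mod_cast (absNorm_pos' ⟨_, this⟩).ne'
      exact this nf fun p hp => (UniqueFactorizationMonoid.prime_of_normalized_factor p hp).ne_zero
    · intro p hp
      exact UniqueFactorizationMonoid.prime_of_normalized_factor p (Multiset.mem_toFinset.mp hp)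
  · intro p _ q _ hpq
    rw [Function.onFun, Finset.disjoint_left]
    intro i hi hj
    simp only [Finset.mem_image] at hi hj
    obtain ⟨_, _, rfl⟩ := hi
    obtain ⟨_, _, h⟩ := hj
    exact hpq (congrArg Prod.fst h).symm

lemma summable_vonMangoldt {Z : ℂ → ℂ} (hZ : IsDedekindZeta K Z) {s : ℂ} (hs : 1 < s.re) :
    Summable fun i : {p : Ideal (𝓞 K) // Prime p} × ℕ =>
      (Real.log (Ideal.absNorm i.1.1) : ℂ) * (Ideal.absNorm (primePow i).1 : ℂ) ^ (-s) := by
  have h := ((hasSum_neg_deriv_zeta hZ hs).summable.norm).comp_injective (primePow_injective (K := K))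
  refine Summable.of_norm_bounded h fun i => ?_
  simp only [Function.comp_apply, norm_mul]
  gcongr
  have h1 : (1:ℝ) < Ideal.absNorm i.1.1 := by exact_mod_cast one_lt_absNorm_prime i.1
  have h0 := Real.log_pos h1
  simp only [primePow, map_pow, Nat.cast_pow, Real.log_pow, Complex.norm_real]
  rw [Real.norm_of_nonneg h0.le, Real.norm_of_nonneg (by positivity)]
  refine le_mul_of_one_le_left h0.le ?_
  push_cast
  have : (0:ℝ) ≤ i.2 := Nat.cast_nonneg _
  linarith

lemma vonMangoldt_mul_zeta {Z : ℂ → ℂ} (hZ : IsDedekindZeta K Z) {s : ℂ} (hs : 1 < s.re) :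
    (∑' i : {p : Ideal (𝓞 K) // Prime p} × ℕ,
      (Real.log (Ideal.absNorm i.1.1) : ℂ) * (Ideal.absNorm (primePow i).1 : ℂ) ^ (-s)) * Z s = -deriv Z s := by
  rw [hZ.2 s hs]
  refine (hasSum_dirichlet_mul primePow _ s (summable_vonMangoldt hZ hs) (summable_zeta hZ hs)).unique ?_
  have := hasSum_neg_deriv_zeta hZ hs
  convert this using 2 with c
  exact congrArg (· * _) (tsum_primePow_dvd c.2)

lemma zeta_ne_zero_of_one_lt_re {Z : ℂ → ℂ} (hZ : IsDedekindZeta K Z) {s : ℂ} (hs : 1 < s.re) : Z s ≠ 0 := by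
  intro h
  have := zeta_mul_moebius hZ hs
  rw [h, mul_zero] at this
  exact zero_ne_one this

end NonvanishingRight

section NonvanishingOne
variable {K : Type} [Field K] [NumberField K]

lemma three_four_one_nonneg {x : ℝ} (hx : 1 ≤ x) (σ u : ℝ) :
    0 ≤ (3 * (x : ℂ) ^ (-(σ : ℂ)) + 4 * (x : ℂ) ^ (-(σ + u * I : ℂ)) + (x : ℂ) ^ (-(σ + 2 * u * I : ℂ))).re := by
  have hx0 : (x : ℂ) ≠ 0 := by exact_mod_cast (by linarith : x ≠ 0)
  set w : ℂ := (x : ℂ) ^ (-(u * I) : ℂ) with hw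
  have h1 : (x : ℂ) ^ (-(σ + u * I : ℂ)) = (x : ℂ) ^ (-(σ : ℂ)) * w := by
    rw [hw, ← cpow_add _ _ hx0]; ring_nf
  have h2 : (x : ℂ) ^ (-(σ + 2 * u * I : ℂ)) = (x : ℂ) ^ (-(σ : ℂ)) * w ^ 2 := by
    rw [hw, pow_two, ← cpow_add _ _ hx0, ← cpow_add _ _ hx0]; ring_nf
  have h3 : (x : ℂ) ^ (-(σ : ℂ)) = ((x ^ (-σ) : ℝ) : ℂ) := by
    rw [ofReal_cpow (by linarith)]; push_cast; rfl
  have hn : ‖w‖ = 1 := by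
    rw [hw, norm_cpow_eq_rpow_re_of_pos (by linarith)]; simp
  have hn2 : w.re * w.re + w.im * w.im = 1 := by
    rw [← normSq_apply, normSq_eq_norm_sq, hn, one_pow]
  have h4 : 3 * (x : ℂ) ^ (-(σ : ℂ)) + 4 * (x : ℂ) ^ (-(σ + u * I : ℂ)) + (x : ℂ) ^ (-(σ + 2 * u * I : ℂ)) =
      ((x ^ (-σ) : ℝ) : ℂ) * (3 + 4 * w + w ^ 2) := by
    rw [h1, h2, h3]; ring
  rw [h4, re_ofReal_mul]
  refine mul_nonneg (Real.rpow_nonneg (by linarith) _) ?_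
  have : (3 + 4 * w + w ^ 2).re = 2 * (1 + w.re) ^ 2 := by
    simp [pow_two]
    nlinarith
  rw [this]
  positivity

/-- The zeta function does not vanish on the line `Re s = 1`. -/
lemma zeta_ne_zero_on_one {Z E : ℂ → ℂ} (hZ : IsDedekindZeta K Z) (hE : Differentiable ℂ E) (h1 : E 1 ≠ 0)
    (hEZ : ∀ s, s ≠ 1 → E s = (s - 1) * Z s) (u : ℝ) : E (1 + u * I) ≠ 0 := by
  intro h0
  have hu : u ≠ 0 := by
    rintro rfl
    simp at h0
    exact h1 h0
  set D : ℂ → ℂ := fun s => ∑' i : {p : Ideal (𝓞 K) // Prime p} × ℕ,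
      (Real.log (Ideal.absNorm i.1.1) : ℂ) * (Ideal.absNorm (primePow i).1 : ℂ) ^ (-s) with hD
  have hDE : ∀ s : ℂ, 1 < s.re → D s = 1 / (s - 1) - deriv E s / E s := by
    intro s hs
    have hs1 : s ≠ 1 := by rintro rfl; simp at hs
    have hs1' : s - 1 ≠ 0 := sub_ne_zero.mpr hs1
    have hZ0 := zeta_ne_zero_of_one_lt_re hZ hs
    have e1 : D s * Z s = - deriv Z s := vonMangoldt_mul_zeta hZ hs
    have e2 : deriv E s = Z s + (s - 1) * deriv Z s := by
      have : E =ᶠ[𝓝 s] fun s => (s - 1) * Z s := by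
        filter_upwards [isOpen_ne.mem_nhds hs1] with w hw using hEZ w hw
      rw [this.deriv_eq, deriv_fun_mul (by fun_prop) (hZ.1 s hs1)]
      simp
    rw [e2, hEZ s hs1]
    have : deriv Z s = - (D s * Z s) := by rw [e1, neg_neg]
    rw [this]
    field_simp
    ring
  have hlim : ∀ v : ℝ, ∃ n : ℕ, (E (1 + v * I) = 0 → 1 ≤ n) ∧
      Tendsto (fun x : ℝ => (x : ℂ) * D ((1 + x : ℝ) + v * I)) (𝓝[>] 0) (𝓝 ((if v = 0 then 1 else 0) - n)) := by
    intro v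
    obtain ⟨n, hn0, hn⟩ := exists_tendsto_mul_logDeriv hE h1 (1 + v * I)
    refine ⟨n, hn0, ?_⟩
    have hmap : Tendsto (fun x : ℝ => ((1 + x : ℝ) + v * I : ℂ)) (𝓝[>] 0) (𝓝[≠] (1 + v * I)) := by
      refine tendsto_nhdsWithin_iff.mpr ⟨?_, ?_⟩
      · have : Continuous (fun x : ℝ => ((1 + x : ℝ) + v * I : ℂ)) := by fun_prop
        have := (this.tendsto 0).mono_left (nhdsWithin_le_nhds (s := Set.Ioi (0:ℝ)))
        simpa using this
      · filter_upwards [self_mem_nhdsWithin] with x hx h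
        have hx' : (0:ℝ) < x := hx
        have := congrArg Complex.re h
        simp at this
        linarith
    have h2 := hn.comp hmap
    have h3 : Tendsto (fun x : ℝ => (x : ℂ) * (1 / (x + v * I))) (𝓝[>] 0) (𝓝 (if v = 0 then 1 else 0)) := by
      by_cases hv : v = 0
      · rw [if_pos hv]
        refine tendsto_const_nhds.congr' ?_
        filter_upwards [self_mem_nhdsWithin] with x hx
        have hx' : (x:ℂ) ≠ 0 := by exact_mod_cast (ne_of_gt hx)
        simp [hv, hx']
      · rw [if_neg hv]
        have : ContinuousAt (fun x : ℝ => (x : ℂ) * (1 / (x + v * I))) 0 := by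
          refine ContinuousAt.mul (by fun_prop) (ContinuousAt.div continuousAt_const (by fun_prop) ?_)
          simp [hv]
        have := this.tendsto.mono_left (nhdsWithin_le_nhds (s := Set.Ioi (0:ℝ)))
        simpa using this
    refine (h3.sub h2).congr' ?_
    filter_upwards [self_mem_nhdsWithin] with x hx
    have hx' : (0:ℝ) < x := hx
    rw [hDE _ (by simpa using hx')]
    simp only [Function.comp_apply]
    push_cast
    rw [show (1 + (x:ℂ) + v * I - 1) = x + v * I by ring,
      show (1 + (x:ℂ) + v * I - (1 + v * I)) = x by ring, mul_sub]
  obtain ⟨n0, -, l0⟩ := hlim 0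
  obtain ⟨n1, hn1, l1⟩ := hlim u
  obtain ⟨n2, -, l2⟩ := hlim (2 * u)
  have hn1' := hn1 h0
  have hcomb := ((l0.const_mul 3).add (l1.const_mul 4)).add l2
  have hre := (continuous_re.tendsto _).comp hcomb
  have hnn : ∀ᶠ x : ℝ in 𝓝[>] 0, 0 ≤ (re ∘ fun x : ℝ => 3 * ((x:ℂ) * D ((1 + x : ℝ) + (0:ℝ) * I)) +
      4 * ((x:ℂ) * D ((1 + x : ℝ) + u * I)) + (x:ℂ) * D ((1 + x : ℝ) + (2 * u : ℝ) * I)) x := by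
    filter_upwards [self_mem_nhdsWithin] with x hx
    have hx' : (0:ℝ) < x := hx
    have s0 := summable_vonMangoldt hZ (s := (1 + x : ℝ) + (0:ℝ) * I) (by simpa using hx')
    have s1 := summable_vonMangoldt hZ (s := (1 + x : ℝ) + u * I) (by simpa using hx')
    have s2 := summable_vonMangoldt hZ (s := (1 + x : ℝ) + (2 * u : ℝ) * I) (by simpa using hx')
    have e : 3 * ((x:ℂ) * D ((1 + x : ℝ) + (0:ℝ) * I)) +
      4 * ((x:ℂ) * D ((1 + x : ℝ) + u * I)) + (x:ℂ) * D ((1 + x : ℝ) + (2 * u : ℝ) * I) =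
      x * (3 * D ((1 + x : ℝ) + (0:ℝ) * I) + 4 * D ((1 + x : ℝ) + u * I) + D ((1 + x : ℝ) + (2 * u : ℝ) * I)) := by
      ring
    simp only [Function.comp_apply]
    rw [e, re_ofReal_mul]
    refine mul_nonneg hx'.le ?_
    have hsum := ((s0.hasSum.mul_left 3).add (s1.hasSum.mul_left 4)).add s2.hasSum
    have hsre := Complex.hasSum_re hsum
    refine hsre.nonneg fun i => ?_
    have h1N : (1:ℝ) ≤ Ideal.absNorm (primePow i).1 := by exact_mod_cast absNorm_pos' (primePow i)
    have h2N : (1:ℝ) ≤ Ideal.absNorm i.1.1 := by exact_mod_cast (one_lt_absNorm_prime i.1).le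
    have h341 := three_four_one_nonneg h1N (1 + x) u
    have e2 : ∀ (l A B C : ℂ), 3 * (l * A) + 4 * (l * B) + l * C = l * (3 * A + 4 * B + C) := by
      intros; ring
    rw [e2, re_ofReal_mul]
    refine mul_nonneg (Real.log_nonneg h2N) ?_
    rw [ofReal_natCast, show ((2:ℂ) * (u:ℂ)) = ((2 * u : ℝ) : ℂ) by push_cast; rfl] at h341
    rw [show (((1 + x : ℝ) : ℂ) + ((0:ℝ) : ℂ) * I) = ((1 + x : ℝ) : ℂ) by simp]
    exact h341
  have hfin := ge_of_tendsto hre hnn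
  simp [hu] at hfin
  have c0 : (0:ℝ) ≤ n0 := Nat.cast_nonneg _
  have c2 : (0:ℝ) ≤ n2 := Nat.cast_nonneg _
  have c1 : (1:ℝ) ≤ n1 := by exact_mod_cast hn1'
  linarith

/-- Complex conjugation symmetry of the zeta function. -/
lemma zeta_conj {Z : ℂ → ℂ} (hZ : IsDedekindZeta K Z) {s : ℂ} (hs : s ≠ 1) :
    Z ((starRingEnd ℂ) s) = (starRingEnd ℂ) (Z s) := by
  have hopen : IsOpen ({1} : Set ℂ)ᶜ := isOpen_compl_singleton
  have key : Set.EqOn Z (fun s => (starRingEnd ℂ) (Z ((starRingEnd ℂ) s))) ({1} : Set ℂ)ᶜ := by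
    refine AnalyticOnNhd.eqOn_of_preconnected_of_eventuallyEq (z₀ := 2)
      (DifferentiableOn.analyticOnNhd (fun s hs => (hZ.1 s hs).differentiableWithinAt) hopen)
      (DifferentiableOn.analyticOnNhd (fun s hs => ?_) hopen) ?_ (by simp) ?_
    · have h1 : (starRingEnd ℂ) s ≠ 1 := by
        intro h
        apply hs
        have := congrArg (starRingEnd ℂ) h
        simpa using this
      have h2 := (hZ.1 _ h1).conj_conj
      rw [conj_conj] at h2
      exact h2.differentiableWithinAt
    · refine (Set.Countable.isPathConnected_compl_of_one_lt_rank ?_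
        (Set.countable_singleton _)).isConnected.isPreconnected
      rw [Complex.rank_real_complex]
      exact Nat.one_lt_ofNat
    · have hU : IsOpen {s : ℂ | 1 < s.re} := isOpen_lt continuous_const continuous_re
      filter_upwards [hU.mem_nhds (show (2:ℂ) ∈ {s : ℂ | 1 < s.re} by simp)] with w hw
      have hw' : 1 < w.re := hw
      rw [hZ.2 w hw', hZ.2 _ (by simpa using hw'), conj_tsum]
      refine tsum_congr fun a => ?_
      rw [← ofReal_natCast, ← map_neg, cpow_conj _ _ (by
        rw [arg_ofReal_of_nonneg (Nat.cast_nonneg _)]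
        exact Real.pi_ne_zero.symm), conj_ofReal, conj_conj]
  have := key (x := (starRingEnd ℂ) s) (by
    intro h
    apply hs
    have := congrArg (starRingEnd ℂ) h
    simpa using this)
  simpa using this

end NonvanishingOne

section BorelCaratheodory

/-- Hadamard's three circles theorem. -/
lemma three_circles {g : ℂ → ℂ} {z₀ : ℂ} {r₁ r₂ r₃ M₁ M₃ : ℝ} (h1 : 0 < r₁) (h12 : r₁ < r₂) (h23 : r₂ < r₃)
    (hg : DifferentiableOn ℂ g (Metric.closedBall z₀ r₃)) (hM1 : 0 < M₁) (hM : M₁ ≤ M₃)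
    (hb1 : ∀ z, ‖z - z₀‖ ≤ r₁ → ‖g z‖ ≤ M₁) (hb3 : ∀ z, ‖z - z₀‖ ≤ r₃ → ‖g z‖ ≤ M₃)
    {z : ℂ} (hz : ‖z - z₀‖ ≤ r₂) :
    ‖g z‖ ≤ M₁ ^ (1 - Real.log (r₂ / r₁) / Real.log (r₃ / r₁)) *
      M₃ ^ (Real.log (r₂ / r₁) / Real.log (r₃ / r₁)) := by
  have h2 : 0 < r₂ := h1.trans h12
  have h3 : 0 < r₃ := h2.trans h23
  have hM3 : 0 < M₃ := hM1.trans_le hM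
  have hl3 : 0 < Real.log (r₃ / r₁) := Real.log_pos (by rw [one_lt_div h1]; linarith)
  have hl2 : 0 < Real.log (r₂ / r₁) := Real.log_pos (by rw [one_lt_div h1]; linarith)
  have hmono : ∀ x y : ℝ, x ≤ y → M₁ ^ (1 - x) * M₃ ^ x ≤ M₁ ^ (1 - y) * M₃ ^ y := by
    intro x y hxy
    have e : ∀ x : ℝ, M₁ ^ (1 - x) * M₃ ^ x = M₁ * (M₃ / M₁) ^ x := by
      intro x
      rw [Real.rpow_sub hM1, Real.div_rpow hM3.le hM1.le, Real.rpow_one]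
      field_simp
    rw [e, e]
    exact mul_le_mul_of_nonneg_left (Real.rpow_le_rpow_of_exponent_le (by rwa [one_le_div hM1]) hxy) hM1.le
  rcases le_total ‖z - z₀‖ r₁ with hzr | hzr
  · have := hmono 0 (Real.log (r₂ / r₁) / Real.log (r₃ / r₁)) (by positivity)
    simp only [sub_zero, Real.rpow_one, Real.rpow_zero, mul_one] at this
    exact (hb1 z hzr).trans this
  have hz0 : 0 < ‖z - z₀‖ := h1.trans_le hzr
  have hz0' : z - z₀ ≠ 0 := norm_pos_iff.mp hz0
  have hexp : ∀ w : ℂ, ‖z₀ + cexp w - z₀‖ = Real.exp w.re := fun w => by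
    rw [add_sub_cancel_left, norm_exp]
  have hul : Real.log r₁ < Real.log r₃ := Real.log_lt_log h1 (by linarith)
  have key := HadamardThreeLines.norm_le_interp_of_mem_verticalClosedStrip'
    (f := fun w => g (z₀ + cexp w)) (z := Complex.log (z - z₀)) (a := M₁) (b := M₃)
    hul ?_ ?_ ?_ ?_ ?_
  · simp only [exp_log hz0', add_sub_cancel, log_re] at key
    refine key.trans ?_
    rw [← Real.log_div hz0.ne' h1.ne', ← Real.log_div h3.ne' h1.ne']
    apply hmono
    gcongr
  · simp only [HadamardThreeLines.verticalClosedStrip, Set.mem_preimage, log_re, Set.mem_Icc]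
    exact ⟨Real.log_le_log h1 hzr, Real.log_le_log hz0 (by linarith)⟩
  · apply DifferentiableOn.diffContOnCl
    have hcl : closure (HadamardThreeLines.verticalStrip (Real.log r₁) (Real.log r₃)) ⊆
        {w : ℂ | w.re ≤ Real.log r₃} := by
      refine closure_minimal (fun w hw => hw.2.le) (isClosed_le continuous_re continuous_const)
    refine DifferentiableOn.comp (t := Metric.closedBall z₀ r₃) hg (by fun_prop) fun w hw => ?_
    have := hcl hw
    rw [Metric.mem_closedBall, dist_eq_norm, hexp]
    calc _ ≤ Real.exp (Real.log r₃) := Real.exp_le_exp.mpr this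
      _ = _ := Real.exp_log h3
  · refine ⟨M₃, ?_⟩
    rintro _ ⟨w, hw, rfl⟩
    refine hb3 _ ?_
    rw [hexp]
    calc _ ≤ Real.exp (Real.log r₃) := Real.exp_le_exp.mpr hw.2
      _ = _ := Real.exp_log h3
  · intro w hw
    refine hb1 _ ?_
    rw [hexp, show w.re = Real.log r₁ from hw, Real.exp_log h1]
  · intro w hw
    refine hb3 _ ?_
    rw [hexp, show w.re = Real.log r₃ from hw, Real.exp_log h3]

/-- A holomorphic logarithm of a nonvanishing function on a disc. -/
lemma exists_log_on_ball {f : ℂ → ℂ} {z₀ : ℂ} {R : ℝ} (hR : 0 < R) (hf : DifferentiableOn ℂ f (Metric.ball z₀ R))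
    (h0 : ∀ z ∈ Metric.ball z₀ R, f z ≠ 0) :
    ∃ g : ℂ → ℂ, DifferentiableOn ℂ g (Metric.ball z₀ R) ∧ g z₀ = Complex.log (f z₀) ∧
      ∀ z ∈ Metric.ball z₀ R, f z = cexp (g z) := by
  have hd : DifferentiableOn ℂ (fun z => deriv f z / f z) (Metric.ball z₀ R) :=
    (hf.deriv Metric.isOpen_ball).div hf h0
  have hz₀ : z₀ ∈ Metric.ball z₀ R := Metric.mem_ball_self hR
  obtain ⟨g, hg0, hg⟩ := hd.isExactOn_ball.with_val_at z₀ (Complex.log (f z₀))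
  refine ⟨g, fun z hz => (hg z hz).differentiableAt.differentiableWithinAt, hg0, ?_⟩
  have hder : ∀ z ∈ Metric.ball z₀ R, HasDerivAt (fun z => f z * cexp (-g z)) 0 z := by
    intro z hz
    have hfz := (hf.differentiableAt (Metric.isOpen_ball.mem_nhds hz)).hasDerivAt
    refine (hfz.mul (hg z hz).neg.cexp).congr_deriv ?_
    have := h0 z hz
    simp only [Pi.neg_apply]
    field_simp
    ring
  intro z hz
  have := (convex_ball z₀ R).is_const_of_fderivWithin_eq_zero (𝕜 := ℂ) (f := fun z => f z * cexp (-g z))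
    (fun w hw => (hder w hw).differentiableAt.differentiableWithinAt) (fun w hw => by
      rw [fderivWithin_of_isOpen Metric.isOpen_ball hw, (hder w hw).hasFDerivAt.fderiv]
      ext
      simp) hz hz₀
  simp only [hg0, exp_neg, exp_log (h0 _ hz₀), mul_inv_cancel₀ (h0 _ hz₀)] at this
  rw [← div_eq_mul_inv, div_eq_one_iff_eq (exp_ne_zero _)] at this
  exact this

lemma borelCaratheodory_at {f : ℂ → ℂ} {z₀ z : ℂ} {R M : ℝ} (hM : 0 < M)
    (hf : DifferentiableOn ℂ f (Metric.ball z₀ R)) (hre : ∀ w ∈ Metric.ball z₀ R, (f w).re ≤ M) (hR : 0 < R)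
    (hz : z ∈ Metric.ball z₀ R) :
    ‖f z‖ ≤ 2 * M * ‖z - z₀‖ / (R - ‖z - z₀‖) + ‖f z₀‖ * (R + ‖z - z₀‖) / (R - ‖z - z₀‖) := by
  have hmaps : ∀ w ∈ Metric.ball (0:ℂ) R, z₀ + w ∈ Metric.ball z₀ R := by
    intro w hw
    rw [Metric.mem_ball, dist_eq_norm, add_sub_cancel_left]
    exact mem_ball_zero_iff.mp hw
  have := borelCaratheodory (f := fun w => f (z₀ + w)) (z := z - z₀) hM
    (DifferentiableOn.comp (t := Metric.ball z₀ R) hf (by fun_prop) hmaps)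
    (fun w hw => hre _ (hmaps w hw)) hR (by rwa [mem_ball_zero_iff, ← dist_eq_norm])
  simpa using this

end BorelCaratheodory

section Lindelof

lemma im_close_of_norm_sub_le {w z : ℂ} {r : ℝ} (h : ‖w - z‖ ≤ r) : z.im - r ≤ w.im ∧ w.im ≤ z.im + r := by
  have := (abs_im_le_norm (w - z)).trans h
  rw [sub_im, abs_le] at this
  constructor <;> linarith

lemma re_close_of_norm_sub_le {w z : ℂ} {r : ℝ} (h : ‖w - z‖ ≤ r) : z.re - r ≤ w.re ∧ w.re ≤ z.re + r := by
  have := (abs_re_le_norm (w - z)).trans h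
  rw [sub_re, abs_le] at this
  constructor <;> linarith

lemma norm_log_le {z : ℂ} {B : ℝ} (hz : z ≠ 0) (h1 : ‖z‖ ≤ B) (h2 : ‖z⁻¹‖ ≤ B) :
    ‖Complex.log z‖ ≤ Real.log B + Real.pi := by
  have hz' : 0 < ‖z‖ := norm_pos_iff.mpr hz
  have hre : |(Complex.log z).re| ≤ Real.log B := by
    rw [log_re, abs_le]
    constructor
    · have := Real.log_le_log (norm_pos_iff.mpr (inv_ne_zero hz)) h2
      rw [norm_inv, Real.log_inv] at this
      linarith
    · exact Real.log_le_log hz' h1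
  have him : |(Complex.log z).im| ≤ Real.pi := by
    rw [log_im]; exact abs_arg_le_pi z
  exact (norm_le_abs_re_add_abs_im _).trans (add_le_add hre him)

set_option maxHeartbeats 1000000 in
/-- On the Riemann hypothesis, `|Z|` and `|1/Z|` are `O(t^ε)` to the right of the critical line. -/
lemma zeta_subpower_right {Z : ℂ → ℂ} (hd : ∀ s, s ≠ 1 → DifferentiableAt ℂ Z s)
    (hne : ∀ s : ℂ, 1 / 2 < s.re → s ≠ 1 → Z s ≠ 0) {B : ℝ} (hB1 : 1 ≤ B)
    (hB : ∀ s : ℂ, 3 / 2 ≤ s.re → ‖Z s‖ ≤ B ∧ ‖(Z s)⁻¹‖ ≤ B) {A T : ℝ} (hA : 0 < A)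
    (hP : ∀ s : ℂ, -1 / 2 ≤ s.re → s.re ≤ 6 → T ≤ s.im → ‖Z s‖ ≤ s.im ^ A)
    {c ε : ℝ} (hc : 0 < c) (hε : 0 < ε) :
    ∀ᶠ t : ℝ in atTop, ∀ s : ℂ, s.im = t → 1 / 2 + c ≤ s.re → t ^ (-ε) ≤ ‖Z s‖ ∧ ‖Z s‖ ≤ t ^ ε := by
  wlog hc1 : c < 1 generalizing c
  · filter_upwards [this (c := 1 / 2) (by norm_num) (by norm_num)] with t ht s hs hs2
    exact ht s hs (by linarith)
  set a : ℝ := Real.log B + Real.pi with ha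
  have hlB : 0 ≤ Real.log B := Real.log_nonneg hB1
  have ha0 : 0 < a := by have := Real.pi_pos; linarith
  set C₃ : ℝ := max ((20 * A + 10) / c) (5 * a) with hC₃
  have hC₃0 : 0 < C₃ := lt_max_of_lt_right (by positivity)
  set θ : ℝ := Real.log ((5 / 2 - c) / (1 / 2)) / Real.log ((5 / 2 - c / 2) / (1 / 2)) with hθ
  have hθ1 : θ < 1 := by
    rw [hθ, div_lt_one (Real.log_pos (by norm_num; linarith))]
    apply Real.log_lt_log (by linarith)
    linarith
  have hlim : ∀ᶠ t : ℝ in atTop, (5 * a) ^ (1 - θ) * (C₃ * Real.log t) ^ θ ≤ ε * Real.log t := by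
    have h1 : Tendsto (fun x : ℝ => (5 * a) ^ (1 - θ) * C₃ ^ θ * x ^ (-(1 - θ))) atTop (𝓝 0) := by
      simpa using (tendsto_rpow_neg_atTop (by linarith : 0 < 1 - θ)).const_mul ((5 * a) ^ (1 - θ) * C₃ ^ θ)
    have h2 := (h1.eventually_le_const hε)
    filter_upwards [Real.tendsto_log_atTop.eventually h2, Real.tendsto_log_atTop.eventually_gt_atTop 0] with t ht ht0
    rw [Real.mul_rpow hC₃0.le ht0.le]
    have e : Real.log t ^ θ = Real.log t ^ (-(1 - θ)) * Real.log t := by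
      nth_rewrite 3 [← Real.rpow_one (Real.log t)]
      rw [← Real.rpow_add ht0]; ring_nf
    rw [e]
    calc _ = (5 * a) ^ (1 - θ) * C₃ ^ θ * Real.log t ^ (-(1 - θ)) * Real.log t := by ring
      _ ≤ _ := mul_le_mul_of_nonneg_right ht ht0.le
  filter_upwards [hlim, eventually_ge_atTop (T + 5 / 2), eventually_ge_atTop (6 : ℝ),
    Real.tendsto_log_atTop.eventually_ge_atTop (max a 1),
    (tendsto_rpow_atTop hε).eventually_ge_atTop B] with t hlt htT ht4 hta htB s hst hsc
  have ht0 : 0 < t := by linarith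
  have ht1 : 1 ≤ t := by linarith
  have hta' : a ≤ Real.log t := (le_max_left _ _).trans hta
  have hta1 : 1 ≤ Real.log t := (le_max_right _ _).trans hta
  have hs1 : s ≠ 1 := by rintro rfl; simp at hst; linarith
  have hZs := hne s (by linarith) hs1
  by_cases hs2 : 3 / 2 ≤ s.re
  · have := hB s hs2
    refine ⟨?_, this.1.trans htB⟩
    rw [Real.rpow_neg ht0.le, inv_le_comm₀ (by positivity) (norm_pos_iff.mpr hZs), ← norm_inv]
    exact this.2.trans htB
  push Not at hs2
  set z₀ : ℂ := 3 + t * I with hz₀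
  have hz₀re : z₀.re = 3 := by simp [hz₀]
  have hz₀im : z₀.im = t := by simp [hz₀]
  have hmem : ∀ w ∈ Metric.ball z₀ (5 / 2), 1 / 2 < w.re ∧ w.re ≤ 6 ∧ t - 5 / 2 ≤ w.im ∧ w.im ≤ t + 5 / 2 ∧ w ≠ 1 := by
    intro w hw
    rw [Metric.mem_ball, dist_eq_norm] at hw
    have h1 := im_close_of_norm_sub_le hw.le
    have h2 := re_close_of_norm_sub_le hw.le
    have h3 : 1 / 2 < w.re := by
      have := (abs_re_le_norm (w - z₀)).trans_lt hw
      rw [sub_re, abs_lt] at this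
      linarith
    rw [hz₀im] at h1
    rw [hz₀re] at h2
    refine ⟨h3, by linarith, h1.1, h1.2, ?_⟩
    rintro rfl
    simp at h1
    linarith
  obtain ⟨g, hg, hg0, hge⟩ := exists_log_on_ball (f := Z) (z₀ := z₀) (R := 5 / 2) (by norm_num)
    (fun w hw => (hd w (hmem w hw).2.2.2.2).differentiableWithinAt)
    (fun w hw => hne w (hmem w hw).1 (hmem w hw).2.2.2.2)
  have hgre : ∀ w ∈ Metric.ball z₀ (5 / 2), (g w).re = Real.log ‖Z w‖ := by
    intro w hw
    rw [hge w hw, norm_exp, Real.log_exp]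
  have hZz₀ := hB z₀ (by rw [hz₀re]; norm_num)
  have hg0' : ‖g z₀‖ ≤ a := by
    rw [hg0]
    exact norm_log_le (hne z₀ (by rw [hz₀re]; norm_num) (hmem _ (Metric.mem_ball_self (by norm_num))).2.2.2.2)
      hZz₀.1 hZz₀.2
  have hpos : ∀ w ∈ Metric.ball z₀ (5 / 2), 0 < ‖Z w‖ := fun w hw => by
    rw [hge w hw, norm_exp]; positivity
  have hsmall : ∀ z, ‖z - z₀‖ ≤ 1 / 2 → ‖g z‖ ≤ 5 * a := by
    intro z hz
    have hsub : Metric.ball z₀ 1 ⊆ Metric.ball z₀ (5 / 2) := Metric.ball_subset_ball (by norm_num)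
    have := borelCaratheodory_at (z := z) (R := 1) ha0 (hg.mono hsub) (fun w hw => by
      rw [hgre w (hsub hw)]
      have h2 : ‖w - z₀‖ ≤ 1 := by
        rw [Metric.mem_ball, dist_eq_norm] at hw; exact hw.le
      have h3 := (re_close_of_norm_sub_le h2).1
      rw [hz₀re] at h3
      have := Real.log_le_log (hpos w (hsub hw)) (hB w (by linarith)).1
      have := Real.pi_pos
      linarith) one_pos (by rw [Metric.mem_ball, dist_eq_norm]; linarith)
    refine this.trans ?_
    have hn := norm_nonneg (z - z₀)
    rw [← add_div, div_le_iff₀ (by linarith)]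
    have := mul_le_mul_of_nonneg_right hg0' (by linarith : 0 ≤ 1 + ‖z - z₀‖)
    nlinarith
  have hbig : ∀ z, ‖z - z₀‖ ≤ 5 / 2 - c / 2 → ‖g z‖ ≤ C₃ * Real.log t := by
    intro z hz
    have hM : 0 < 2 * A * Real.log t := by positivity
    have := borelCaratheodory_at (z := z) (R := 5 / 2) hM hg (fun w hw => by
      rw [hgre w hw]
      obtain ⟨h1, h2, h3, h4, -⟩ := hmem w hw
      have := Real.log_le_log (hpos w hw) (hP w (by linarith) h2 (by linarith))
      rw [Real.log_rpow (by linarith)] at this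
      refine this.trans ?_
      have h5 : Real.log w.im ≤ 2 * Real.log t := by
        rw [← Real.log_rpow ht0]
        refine Real.log_le_log (by linarith) (h4.trans ?_)
        rw [Real.rpow_two]; nlinarith
      nlinarith) (by norm_num) (by rw [Metric.mem_ball, dist_eq_norm]; linarith)
    refine this.trans ?_
    have hn := norm_nonneg (z - z₀)
    have h2 : C₃ * Real.log t ≥ (20 * A + 10) / c * Real.log t :=
      mul_le_mul_of_nonneg_right (le_max_left _ _) (by linarith)
    refine le_trans ?_ h2
    rw [← add_div, div_le_iff₀ (by linarith)]
    have h3 := mul_le_mul_of_nonneg_right (hg0'.trans hta') (by linarith : 0 ≤ 5 / 2 + ‖z - z₀‖)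
    have h4 : (20 * A + 10) / c * Real.log t * (c / 2) ≤ (20 * A + 10) / c * Real.log t * (5 / 2 - ‖z - z₀‖) := by
      apply mul_le_mul_of_nonneg_left (by linarith) (by positivity)
    refine le_trans ?_ h4
    have h5 : (20 * A + 10) / c * Real.log t * (c / 2) = (10 * A + 5) * Real.log t := by
      field_simp; ring
    rw [h5]
    have h6 : 2 * (2 * A * Real.log t) * ‖z - z₀‖ ≤ 2 * (2 * A * Real.log t) * (5 / 2) :=
      mul_le_mul_of_nonneg_left (by linarith) (by positivity)
    have h7 : Real.log t * (5 / 2 + ‖z - z₀‖) ≤ Real.log t * 5 :=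
      mul_le_mul_of_nonneg_left (by linarith) (by linarith)
    linarith
  have hsz : ‖s - z₀‖ ≤ 5 / 2 - c := by
    have : s - z₀ = ((s.re - 3 : ℝ) : ℂ) := by
      apply Complex.ext
      · simp [hz₀]
      · simp [hz₀, hst]
    rw [this, norm_real, Real.norm_eq_abs, abs_le]
    constructor <;> linarith
  have h3c := three_circles (g := g) (z₀ := z₀) (r₁ := 1 / 2) (r₂ := 5 / 2 - c) (r₃ := 5 / 2 - c / 2)
    (M₁ := 5 * a) (M₃ := C₃ * Real.log t) (by norm_num) (by linarith) (by linarith)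
    (hg.mono (Metric.closedBall_subset_ball (by linarith))) (by positivity)
    ((le_max_right _ _).trans (le_mul_of_one_le_right hC₃0.le hta1)) hsmall hbig hsz
  have hfin : ‖g s‖ ≤ ε * Real.log t := h3c.trans hlt
  have hsb : s ∈ Metric.ball z₀ (5 / 2) := by
    rw [Metric.mem_ball, dist_eq_norm]; linarith
  have hre := (abs_re_le_norm (g s)).trans hfin
  rw [abs_le] at hre
  rw [hge s hsb, norm_exp, Real.rpow_def_of_pos ht0, Real.rpow_def_of_pos ht0]
  constructor
  · apply Real.exp_le_exp.mpr; linarith [hre.1]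
  · apply Real.exp_le_exp.mpr; linarith [hre.2]

/-- On the Riemann hypothesis, `|Z|` is `O(t^ε)` slightly to the left of the critical line. -/
lemma zeta_subpower_left {Z : ℂ → ℂ} (hd : ∀ s, s ≠ 1 → DifferentiableAt ℂ Z s)
    (hne : ∀ s : ℂ, 1 / 2 < s.re → s ≠ 1 → Z s ≠ 0) {B : ℝ} (hB1 : 1 ≤ B)
    (hB : ∀ s : ℂ, 3 / 2 ≤ s.re → ‖Z s‖ ≤ B ∧ ‖(Z s)⁻¹‖ ≤ B) {A T : ℝ} (hA : 0 < A)
    (hP : ∀ s : ℂ, -1 / 2 ≤ s.re → s.re ≤ 6 → T ≤ s.im → ‖Z s‖ ≤ s.im ^ A)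
    {ε : ℝ} (hε : 0 < ε) :
    ∃ c : ℝ, 0 < c ∧ c ≤ 1 / 8 ∧
      ∀ᶠ t : ℝ in atTop, ∀ s : ℂ, s.im = t → 1 / 2 - c ≤ s.re → ‖Z s‖ ≤ t ^ ε := by
  set A' : ℝ := 2 * A + ε with hA'
  have hcont : ContinuousAt (fun c : ℝ => Real.log ((3 / 2 + c) / (3 / 2 - c)) / Real.log ((5 / 2) / (3 / 2 - c))) 0 := by
    refine ContinuousAt.div (ContinuousAt.log (ContinuousAt.div (by fun_prop) (by fun_prop) (by norm_num)) (by norm_num))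
      (ContinuousAt.log (ContinuousAt.div (by fun_prop) (by fun_prop) (by norm_num)) (by norm_num)) ?_
    exact (Real.log_pos (by norm_num)).ne'
  have hsmall : ∀ᶠ c : ℝ in 𝓝[>] 0, Real.log ((3 / 2 + c) / (3 / 2 - c)) / Real.log ((5 / 2) / (3 / 2 - c)) < ε / (2 * A') := by
    refine (hcont.mono_left nhdsWithin_le_nhds).eventually_lt_const ?_
    norm_num
    positivity
  obtain ⟨c, hcθ, hc0, hc8⟩ := (hsmall.and (Ioc_mem_nhdsGT (show (0:ℝ) < 1 / 8 by norm_num))).exists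
  refine ⟨c, hc0, hc8, ?_⟩
  set θ := Real.log ((3 / 2 + c) / (3 / 2 - c)) / Real.log ((5 / 2) / (3 / 2 - c)) with hθ
  have hθ0 : 0 ≤ θ := div_nonneg
    (Real.log_nonneg (by rw [one_le_div (by linarith)]; linarith))
    (Real.log_nonneg (by rw [one_le_div (by linarith)]; linarith))
  obtain ⟨T₁, hT₁⟩ := eventually_atTop.mp (zeta_subpower_right hd hne hB1 hB hA hP hc0 (show 0 < ε / 4 by linarith))
  filter_upwards [eventually_ge_atTop (T₁ + 5 / 2), eventually_ge_atTop (T + 5 / 2), eventually_ge_atTop (6 : ℝ),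
    (tendsto_rpow_atTop hε).eventually_ge_atTop B] with t htT₁ htT ht6 htB s hst hsc
  by_cases hs2 : 3 / 2 ≤ s.re
  · exact (hB s hs2).1.trans htB
  push Not at hs2
  have ht0 : 0 < t := by linarith
  have ht1 : 1 ≤ t := by linarith
  set z₀ : ℂ := 2 + t * I with hz₀
  have hz₀re : z₀.re = 2 := by simp [hz₀]
  have hz₀im : z₀.im = t := by simp [hz₀]
  have htsq : ∀ u, u ≤ t + 5 / 2 → u ≤ t ^ (2:ℝ) := fun u hu => by
    rw [Real.rpow_two]; nlinarith
  have hsz : ‖s - z₀‖ ≤ 3 / 2 + c := by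
    have : s - z₀ = ((s.re - 2 : ℝ) : ℂ) := by
      apply Complex.ext
      · simp [hz₀]
      · simp [hz₀, hst]
    rw [this, norm_real, Real.norm_eq_abs, abs_le]
    constructor <;> linarith
  have h3c := three_circles (g := Z) (z₀ := z₀) (r₁ := 3 / 2 - c) (r₂ := 3 / 2 + c) (r₃ := 5 / 2)
    (M₁ := t ^ (ε / 2)) (M₃ := t ^ A') (by linarith) (by linarith) (by linarith)
    (fun w hw => (hd w (by
      rintro rfl
      rw [Metric.mem_closedBall, dist_eq_norm] at hw
      have := im_close_of_norm_sub_le hw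
      rw [hz₀im] at this
      simp at this
      linarith)).differentiableWithinAt) (by positivity)
    (Real.rpow_le_rpow_of_exponent_le ht1 (by linarith)) (fun z hz => by
      have h1 := im_close_of_norm_sub_le hz
      have h2 := re_close_of_norm_sub_le hz
      rw [hz₀im] at h1
      rw [hz₀re] at h2
      refine (hT₁ z.im (by linarith) z rfl (by linarith)).2.trans ?_
      calc z.im ^ (ε / 4) ≤ (t ^ (2:ℝ)) ^ (ε / 4) :=
            Real.rpow_le_rpow (by linarith) (htsq _ (by linarith)) (by linarith)
        _ = t ^ (ε / 2) := by rw [← Real.rpow_mul ht0.le]; ring_nf) (fun z hz => by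
      have h1 := im_close_of_norm_sub_le hz
      have h2 := re_close_of_norm_sub_le hz
      rw [hz₀im] at h1
      rw [hz₀re] at h2
      refine (hP z (by linarith) (by linarith) (by linarith)).trans ?_
      calc z.im ^ A ≤ (t ^ (2:ℝ)) ^ A :=
            Real.rpow_le_rpow (by linarith) (htsq _ (by linarith)) (by linarith)
        _ = t ^ (2 * A) := by rw [← Real.rpow_mul ht0.le]
        _ ≤ t ^ A' := Real.rpow_le_rpow_of_exponent_le ht1 (by linarith)) hsz
  refine h3c.trans ?_
  rw [← Real.rpow_mul ht0.le, ← Real.rpow_mul ht0.le, ← Real.rpow_add ht0]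
  refine Real.rpow_le_rpow_of_exponent_le ht1 ?_
  have hA'0 : 0 < A' := by positivity
  have h1 : A' * θ ≤ ε / 2 := by
    have := mul_le_mul_of_nonneg_left hcθ.le hA'0.le
    have e : A' * (ε / (2 * A')) = ε / 2 := by field_simp
    linarith
  have h2 : ε / 2 * (1 - θ) ≤ ε / 2 := by nlinarith
  linarith

end Lindelof

section ZeroSpacing

lemma differentiable_dslope {f : ℂ → ℂ} (hf : Differentiable ℂ f) (a : ℂ) : Differentiable ℂ (dslope f a) := by
  rw [← differentiableOn_univ] at hf ⊢
  exact (Complex.differentiableOn_dslope univ_mem).mpr hf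

lemma exists_factor_zeros {W : ℂ → ℂ} (hW : Differentiable ℂ W) (S : Finset ℂ) (hS : ∀ ρ ∈ S, W ρ = 0) :
    ∃ h : ℂ → ℂ, Differentiable ℂ h ∧ ∀ s, W s = (∏ ρ ∈ S, (s - ρ)) * h s := by
  induction S using Finset.induction_on with
  | empty => exact ⟨W, hW, fun s => by simp⟩
  | insert ρ S hρ ih =>
    obtain ⟨h, hh, hWh⟩ := ih fun r hr => hS r (Finset.mem_insert_of_mem hr)
    have h0 : h ρ = 0 := by
      have h1 := hS ρ (Finset.mem_insert_self _ _)
      rw [hWh, mul_eq_zero] at h1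
      refine h1.resolve_left ?_
      refine Finset.prod_ne_zero_iff.mpr ?_
      rintro r hr h2
      rw [sub_eq_zero] at h2
      exact hρ (h2 ▸ hr)
    refine ⟨dslope h ρ, differentiable_dslope hh ρ, fun s => ?_⟩
    have h2 := sub_smul_dslope h ρ s
    rw [h0, sub_zero, smul_eq_mul] at h2
    rw [hWh, Finset.prod_insert hρ, ← h2]
    ring

lemma deriv_of_factor {W h : ℂ → ℂ} (hh : Differentiable ℂ h) {S : Finset ℂ}
    (hWh : ∀ s, W s = (∏ ρ ∈ S, (s - ρ)) * h s) {ρ : ℂ} (hρ : ρ ∈ S) :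
    deriv W ρ = (∏ r ∈ S.erase ρ, (ρ - r)) * h ρ := by
  have e : W = fun s => (s - ρ) * ((∏ r ∈ S.erase ρ, (s - r)) * h s) := by
    funext s
    rw [hWh, ← Finset.mul_prod_erase S _ hρ]
    ring
  have hd : Differentiable ℂ fun s => (∏ r ∈ S.erase ρ, (s - r)) * h s := by fun_prop
  rw [e, deriv_fun_mul (by fun_prop) (hd ρ)]
  simp

lemma inv_prod_eq_sum {S : Finset ℂ} (hS : S.Nonempty) {s : ℂ} (hs : s ∉ S) :
    (∏ ρ ∈ S, (s - ρ))⁻¹ = ∑ ρ ∈ S, (∏ r ∈ S.erase ρ, (ρ - r))⁻¹ * (s - ρ)⁻¹ := by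
  have h := Lagrange.eval_interpolate_not_at_node (s := S) (v := id) (x := s) (1 : ℂ → ℂ)
    (fun i hi h => hs (h ▸ hi))
  rw [Lagrange.interpolate_one Function.injective_id.injOn hS, Polynomial.eval_one, Lagrange.eval_nodal] at h
  simp only [Lagrange.nodalWeight, id, Pi.one_apply, mul_one, Finset.prod_inv_distrib] at h
  exact inv_eq_of_mul_eq_one_right h.symm

/-- A local bound for the inverse of a function with simple zeros by the polar parts at the nearby zeros. -/
lemma local_inverse_bound {W : ℂ → ℂ} (hW : Differentiable ℂ W) {s₀ : ℂ} {c A : ℝ} (hc : 0 < c) (hA : 1 < A)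
    (hWA : ∀ s, ‖s - s₀‖ ≤ c → ‖W s‖ ≤ A) (hW0 : A⁻¹ ≤ ‖W s₀‖) (S : Finset ℂ)
    (hS : ∀ ρ, ρ ∈ S ↔ ‖ρ - s₀‖ ≤ c / 3 ∧ W ρ = 0) (hsimple : ∀ ρ ∈ S, deriv W ρ ≠ 0)
    {s : ℂ} (hs : ‖s - s₀‖ ≤ c / 4) (hWs : W s ≠ 0) :
    ‖(W s)⁻¹‖ ^ 2 ≤ A ^ 30 * (1 + ∑ ρ ∈ S, 1 / (‖deriv W ρ‖ ^ 2 * ‖s - ρ‖ ^ 2)) := by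
  have hA0 : 0 < A := by linarith
  obtain ⟨h, hh, hWh⟩ := exists_factor_zeros hW S fun ρ hρ => ((hS ρ).mp hρ).2
  set N := S.card with hN
  have hne : ∀ z, ‖z - s₀‖ ≤ c / 3 → h z ≠ 0 := by
    intro z hz h0
    have hz0 : W z = 0 := by rw [hWh, h0, mul_zero]
    have hzS : z ∈ S := (hS z).mpr ⟨hz, hz0⟩
    apply hsimple z hzS
    rw [deriv_of_factor hh hWh hzS, h0, mul_zero]
  have hh0 : h s₀ ≠ 0 := hne s₀ (by simp; positivity)
  have hh0' : 0 < ‖h s₀‖ := norm_pos_iff.mpr hh0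
  have hlow : A⁻¹ ≤ (c / 3) ^ N * ‖h s₀‖ := by
    refine hW0.trans ?_
    rw [hWh, norm_mul]
    refine mul_le_mul_of_nonneg_right ?_ (norm_nonneg _)
    rw [norm_prod]
    calc _ ≤ ∏ ρ ∈ S, (c / 3) := Finset.prod_le_prod (fun _ _ => norm_nonneg _) fun ρ hρ => by
          rw [norm_sub_rev]; exact ((hS ρ).mp hρ).1
      _ = _ := by rw [Finset.prod_const]
  have hup : ∀ z, ‖z - s₀‖ ≤ c → 2 ^ N * ‖h z‖ ≤ A ^ 2 * ‖h s₀‖ := by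
    intro z hz
    have hmax : ‖h z‖ ≤ A / (2 * c / 3) ^ N := by
      refine Complex.norm_le_of_forall_mem_frontier_norm_le (U := Metric.ball s₀ c) Metric.isBounded_ball
        hh.diffContOnCl (fun w hw => ?_) (by
          rw [closure_ball _ hc.ne', Metric.mem_closedBall, dist_eq_norm]; exact hz)
      rw [frontier_ball _ hc.ne', mem_sphere_iff_norm] at hw
      rw [le_div_iff₀ (by positivity)]
      refine le_trans ?_ (hWA w hw.le)
      rw [hWh, norm_mul, mul_comm]
      refine mul_le_mul_of_nonneg_right ?_ (norm_nonneg _)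
      rw [norm_prod]
      calc _ = ∏ ρ ∈ S, (2 * c / 3) := by rw [Finset.prod_const]
        _ ≤ _ := Finset.prod_le_prod (fun _ _ => by positivity) fun ρ hρ => by
          have h1 := ((hS ρ).mp hρ).1
          have h2 := norm_sub_le_norm_sub_add_norm_sub w ρ s₀
          linarith
    have e : (2 * c / 3 : ℝ) ^ N = 2 ^ N * (c / 3) ^ N := by rw [← mul_pow]; ring_nf
    rw [e, le_div_iff₀ (by positivity)] at hmax
    have h1 : 1 ≤ A * ((c / 3) ^ N * ‖h s₀‖) := by
      have := mul_le_mul_of_nonneg_left hlow hA0.le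
      rwa [mul_inv_cancel₀ hA0.ne'] at this
    have hc3 : 0 < (c / 3) ^ N := by positivity
    refine le_of_mul_le_mul_left (a := (c / 3) ^ N) ?_ hc3
    calc (c / 3) ^ N * (2 ^ N * ‖h z‖) = ‖h z‖ * (2 ^ N * (c / 3) ^ N) := by ring
      _ ≤ A := hmax
      _ ≤ A * (A * ((c / 3) ^ N * ‖h s₀‖)) := le_mul_of_one_le_right hA0.le h1
      _ = _ := by ring
  have h2N : (2:ℝ) ^ N ≤ A ^ 2 := le_of_mul_le_mul_right (hup s₀ (by simp; positivity)) hh0'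
  have hNA : (N : ℝ) ≤ A ^ 2 := by
    have : (N:ℝ) ≤ 2 ^ N := by exact_mod_cast (Nat.lt_two_pow_self (n := N)).le
    linarith
  have hup' : ∀ z, ‖z - s₀‖ ≤ c → ‖h z‖ ≤ A ^ 2 * ‖h s₀‖ := fun z hz =>
    (le_mul_of_one_le_left (norm_nonneg _) (one_le_pow₀ (by norm_num))).trans (hup z hz)
  have hlogA : 0 < Real.log A := Real.log_pos hA
  have hdown : ∀ z, ‖z - s₀‖ ≤ c / 4 → ‖h s₀‖ ≤ A ^ 12 * ‖h z‖ := by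
    intro z hz
    obtain ⟨g, hg, hg0, hge⟩ := exists_log_on_ball (f := fun w => h w / h s₀) (z₀ := s₀) (R := c / 3) (by positivity)
      (by fun_prop) (fun w hw => div_ne_zero (hne w (by
        rw [Metric.mem_ball, dist_eq_norm] at hw; exact hw.le)) hh0)
    have hg0' : g s₀ = 0 := by rw [hg0, div_self hh0, Complex.log_one]
    have hzb : z ∈ Metric.ball s₀ (c / 3) := by
      rw [Metric.mem_ball, dist_eq_norm]; linarith
    have := borelCaratheodory_at (f := g) (M := 2 * Real.log A) (z := z) (by positivity) hg (fun w hw => by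
      have e : (g w).re = Real.log ‖h w / h s₀‖ := by rw [hge w hw, norm_exp, Real.log_exp]
      have hpos : 0 < ‖h w / h s₀‖ := by rw [hge w hw, norm_exp]; positivity
      rw [e]
      have h1 : ‖h w / h s₀‖ ≤ A ^ 2 := by
        rw [norm_div, div_le_iff₀ hh0']
        refine hup' w ?_
        rw [Metric.mem_ball, dist_eq_norm] at hw
        linarith
      have := Real.log_le_log hpos h1
      rwa [Real.log_pow] at this) (by positivity) hzb
    rw [hg0', norm_zero, zero_mul, zero_div, add_zero] at this
    have hb : ‖g z‖ ≤ 12 * Real.log A := by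
      refine this.trans ?_
      rw [div_le_iff₀ (by linarith)]
      nlinarith
    have hre := (abs_le.mp ((abs_re_le_norm (g z)).trans hb)).1
    have hz1 := hge z hzb
    have hz2 : ‖h z‖ = Real.exp (g z).re * ‖h s₀‖ := by
      rw [← norm_exp, ← hz1, norm_div]; field_simp
    rw [hz2, ← mul_assoc]
    refine le_mul_of_one_le_left hh0'.le ?_
    have : A ^ 12 = Real.exp (12 * Real.log A) := by
      rw [← Real.exp_log hA0, ← Real.exp_nat_mul, Real.exp_log hA0]; norm_num
    rw [this, ← Real.exp_add]
    exact Real.one_le_exp (by linarith)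
  have hsc : ‖s - s₀‖ ≤ c / 3 := by linarith
  have hhs : 0 < ‖h s‖ := norm_pos_iff.mpr (hne s hsc)
  have hsum0 : 0 ≤ ∑ ρ ∈ S, 1 / (‖deriv W ρ‖ ^ 2 * ‖s - ρ‖ ^ 2) := Finset.sum_nonneg fun _ _ => by positivity
  rcases S.eq_empty_or_nonempty with hSe | hSne
  · have hWeq : ∀ z, W z = h z := fun z => by rw [hWh, hSe]; simp
    have h1 : 1 ≤ A ^ 13 * ‖W s‖ := by
      have h2 := hdown s hs
      rw [← hWeq, ← hWeq] at h2
      have h3 := mul_le_mul_of_nonneg_left (hW0.trans h2) hA0.le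
      rw [mul_inv_cancel₀ hA0.ne'] at h3
      calc _ ≤ _ := h3
        _ = _ := by ring
    have h4 : ‖(W s)⁻¹‖ ≤ A ^ 13 := by
      rw [norm_inv, inv_le_iff_one_le_mul₀ (norm_pos_iff.mpr hWs)]
      exact h1
    calc ‖(W s)⁻¹‖ ^ 2 ≤ (A ^ 13) ^ 2 := pow_le_pow_left₀ (norm_nonneg _) h4 2
      _ = A ^ 26 := by ring
      _ ≤ A ^ 30 := pow_le_pow_right₀ hA.le (by norm_num)
      _ ≤ _ := le_mul_of_one_le_right (by positivity) (by linarith)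
  · have hsS : s ∉ S := fun h => hWs ((hS s).mp h).2
    have e1 : ‖(W s)⁻¹‖ ≤ A ^ 14 * ∑ ρ ∈ S, 1 / (‖deriv W ρ‖ * ‖s - ρ‖) := by
      rw [hWh, mul_inv, inv_prod_eq_sum hSne hsS, Finset.sum_mul, Finset.mul_sum]
      refine (norm_sum_le _ _).trans (Finset.sum_le_sum fun ρ hρ => ?_)
      have hρ1 := ((hS ρ).mp hρ).1
      have hPρ : ‖∏ r ∈ S.erase ρ, (ρ - r)‖ * ‖h ρ‖ = ‖deriv W ρ‖ := by
        rw [deriv_of_factor hh hWh hρ, norm_mul]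
      have hρs : 0 < ‖s - ρ‖ := norm_pos_iff.mpr (sub_ne_zero.mpr (by rintro rfl; exact hsS hρ))
      have hd0 : 0 < ‖deriv W ρ‖ := norm_pos_iff.mpr (hsimple ρ hρ)
      have hhρ : 0 < ‖h ρ‖ := norm_pos_iff.mpr (hne ρ hρ1)
      have hPρ' : ‖∏ r ∈ S.erase ρ, (ρ - r)‖ = ‖deriv W ρ‖ / ‖h ρ‖ := by
        rw [← hPρ]; field_simp
      rw [norm_mul, norm_mul, norm_inv, norm_inv, norm_inv, hPρ', inv_div]
      have h1 : ‖h ρ‖ ≤ A ^ 14 * ‖h s‖ := by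
        calc ‖h ρ‖ ≤ A ^ 2 * ‖h s₀‖ := hup' ρ (by linarith)
          _ ≤ A ^ 2 * (A ^ 12 * ‖h s‖) := mul_le_mul_of_nonneg_left (hdown s hs) (by positivity)
          _ = _ := by ring
      calc ‖h ρ‖ / ‖deriv W ρ‖ * ‖s - ρ‖⁻¹ * ‖h s‖⁻¹ = (‖h ρ‖ / ‖h s‖) * (1 / (‖deriv W ρ‖ * ‖s - ρ‖)) := by
            field_simp
        _ ≤ _ := mul_le_mul_of_nonneg_right (by rwa [div_le_iff₀ hhs]) (by positivity)
    calc ‖(W s)⁻¹‖ ^ 2 ≤ (A ^ 14 * ∑ ρ ∈ S, 1 / (‖deriv W ρ‖ * ‖s - ρ‖)) ^ 2 :=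
          pow_le_pow_left₀ (norm_nonneg _) e1 2
      _ = A ^ 28 * (∑ ρ ∈ S, 1 / (‖deriv W ρ‖ * ‖s - ρ‖)) ^ 2 := by ring
      _ ≤ A ^ 28 * (N * ∑ ρ ∈ S, (1 / (‖deriv W ρ‖ * ‖s - ρ‖)) ^ 2) :=
          mul_le_mul_of_nonneg_left sq_sum_le_card_mul_sum_sq (by positivity)
      _ = A ^ 28 * (N * ∑ ρ ∈ S, 1 / (‖deriv W ρ‖ ^ 2 * ‖s - ρ‖ ^ 2)) := by
          congr 2
          exact Finset.sum_congr rfl fun ρ _ => by rw [div_pow, mul_pow, one_pow]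
      _ ≤ A ^ 28 * (A ^ 2 * ∑ ρ ∈ S, 1 / (‖deriv W ρ‖ ^ 2 * ‖s - ρ‖ ^ 2)) :=
          mul_le_mul_of_nonneg_left (mul_le_mul_of_nonneg_right hNA hsum0) (by positivity)
      _ = A ^ 30 * ∑ ρ ∈ S, 1 / (‖deriv W ρ‖ ^ 2 * ‖s - ρ‖ ^ 2) := by ring
      _ ≤ _ := mul_le_mul_of_nonneg_left (by linarith) (by positivity)

end ZeroSpacing

section RiemannData

/-- Analytic facts about a zeta function `Z` and the entire function `E s = (s - 1) Z s`, under the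
Riemann hypothesis and the simplicity of the nontrivial zeros. -/
structure RHData (Z E : ℂ → ℂ) : Prop where
  diff : Differentiable ℂ E
  eq_mul : ∀ s, s ≠ 1 → E s = (s - 1) * Z s
  ne_zero : ∀ s : ℂ, 1 / 2 < s.re → E s ≠ 0
  crit : ∀ ρ : ℂ, E ρ = 0 → 0 < ρ.re → ρ.re = 1 / 2
  simple : ∀ ρ : ℂ, E ρ = 0 → ρ.re = 1 / 2 → deriv E ρ ≠ 0
  half : E (1 / 2) ≠ 0
  conj : ∀ s, E ((starRingEnd ℂ) s) = (starRingEnd ℂ) (E s)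
  bound : ∃ B : ℝ, 1 ≤ B ∧ ∀ s : ℂ, 3 / 2 ≤ s.re → ‖Z s‖ ≤ B ∧ ‖(Z s)⁻¹‖ ≤ B
  growth : ∃ A T : ℝ, 0 < A ∧ ∀ s : ℂ, -1 / 2 ≤ s.re → s.re ≤ 6 → T ≤ s.im → ‖Z s‖ ≤ s.im ^ A

/-- The zeros in the upper half of the critical line. -/
def critZeros (E : ℂ → ℂ) : Set ℂ := {ρ | E ρ = 0 ∧ ρ.re = 1 / 2 ∧ 0 < ρ.im}

lemma finite_zeros_of_isCompact {E : ℂ → ℂ} (hE : Differentiable ℂ E) {w : ℂ} (hw : E w ≠ 0) {D : Set ℂ}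
    (hD : IsCompact D) : {ρ | ρ ∈ D ∧ E ρ = 0}.Finite := by
  by_contra hinf
  obtain ⟨z, -, hz⟩ := Set.Infinite.exists_accPt_of_subset_isCompact hinf hD (fun ρ h => h.1)
  have hf : ∃ᶠ s in 𝓝[≠] z, E s = 0 := (accPt_iff_frequently_nhdsNE.mp hz).mono fun s hs => hs.2
  have han : AnalyticAt ℂ E z := hE.analyticAt z
  exact entire_not_eventually_zero hE hw z (han.frequently_zero_iff_eventually_zero.mp hf)

lemma integrable_poisson {δ : ℝ} (hδ : 0 < δ) (γ : ℝ) : Integrable fun t : ℝ => δ / (δ ^ 2 + (t - γ) ^ 2) := by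
  have h1 := (integrable_inv_one_add_sq.comp_div hδ.ne').comp_sub_right γ
  have h2 := h1.const_mul δ⁻¹
  refine h2.congr (Eventually.of_forall fun t => ?_)
  have h3 : 0 < δ ^ 2 + (t - γ) ^ 2 := by positivity
  simp only
  field_simp

lemma integral_poisson {δ : ℝ} (hδ : 0 < δ) (γ : ℝ) : ∫ t : ℝ, δ / (δ ^ 2 + (t - γ) ^ 2) = Real.pi := by
  have e : (fun t : ℝ => δ / (δ ^ 2 + (t - γ) ^ 2)) = fun t => (fun u : ℝ => δ⁻¹ * (1 + (u / δ) ^ 2)⁻¹) (t - γ) := by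
    funext t
    have h3 : 0 < δ ^ 2 + (t - γ) ^ 2 := by positivity
    simp only
    field_simp
  rw [e, integral_sub_right_eq_self (fun u : ℝ => δ⁻¹ * (1 + (u / δ) ^ 2)⁻¹) γ, integral_const_mul,
    Measure.integral_comp_div (fun u : ℝ => (1 + u ^ 2)⁻¹), integral_univ_inv_one_add_sq, abs_of_pos hδ, smul_eq_mul]
  field_simp

lemma norm_sq_sub_zero {δ t : ℝ} {ρ : ℂ} (hρ : ρ.re = 1 / 2) :
    ‖((1 / 2 + δ : ℝ) + t * I : ℂ) - ρ‖ ^ 2 = δ ^ 2 + (t - ρ.im) ^ 2 := by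
  rw [← normSq_eq_norm_sq, normSq_apply]
  simp only [sub_re, add_re, mul_re, sub_im, add_im, mul_im, ofReal_re, ofReal_im, I_re, I_im, hρ]
  ring

/-- Polar-part bound for `1 / E` near height `t₀`. -/
lemma RHData.window_pointwise {Z E : ℂ → ℂ} (H : RHData Z E) :
    ∃ c : ℝ, 0 < c ∧ c ≤ 1 / 8 ∧ ∀ᶠ t₀ : ℝ in atTop, ∀ S : Finset ℂ,
      (∀ ρ, ρ ∈ S ↔ ‖ρ - ((1 / 2 + c / 8 : ℝ) + t₀ * I)‖ ≤ c / 3 ∧ E ρ = 0) →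
      ∀ s : ℂ, ‖s - ((1 / 2 + c / 8 : ℝ) + t₀ * I)‖ ≤ c / 4 → E s ≠ 0 →
        ‖(E s)⁻¹‖ ^ 2 ≤ 4 ^ 30 * t₀ ^ (1 / 4 : ℝ) *
          (t₀ ^ (-2 : ℝ) + ∑ ρ ∈ S, 1 / (‖deriv E ρ‖ ^ 2 * ‖s - ρ‖ ^ 2)) := by
  obtain ⟨B, hB1, hB⟩ := H.bound
  obtain ⟨A, T, hA, hP⟩ := H.growth
  have hd : ∀ s, s ≠ 1 → DifferentiableAt ℂ Z s := by
    intro s hs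
    have hs' : s - 1 ≠ 0 := sub_ne_zero.mpr hs
    have : Z =ᶠ[𝓝 s] fun w => E w / (w - 1) := by
      filter_upwards [isOpen_ne.mem_nhds hs] with w hw
      rw [H.eq_mul w hw]
      have : w - 1 ≠ 0 := sub_ne_zero.mpr hw
      field_simp
    rw [this.differentiableAt_iff]
    exact (H.diff s).div (by fun_prop) hs'
  have hne : ∀ s : ℂ, 1 / 2 < s.re → s ≠ 1 → Z s ≠ 0 := by
    intro s hs hs1 h0
    apply H.ne_zero s hs
    rw [H.eq_mul s hs1, h0, mul_zero]
  obtain ⟨c, hc0, hc8, hU⟩ := zeta_subpower_left hd hne hB1 hB hA hP (show (0:ℝ) < 1 / 120 by norm_num)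
  have hL := zeta_subpower_right hd hne hB1 hB hA hP (show 0 < c / 8 by positivity) (show (0:ℝ) < 1 / 120 by norm_num)
  refine ⟨c, hc0, hc8, ?_⟩
  obtain ⟨T₁, hT₁⟩ := eventually_atTop.mp hU
  filter_upwards [eventually_ge_atTop (T₁ + 1), eventually_ge_atTop (6:ℝ), hL] with t₀ ht₁ ht6 hLt S hS s hs hEs
  have ht0 : 0 < t₀ := by linarith
  set s₀ : ℂ := (1 / 2 + c / 8 : ℝ) + t₀ * I with hs₀
  have hs₀re : s₀.re = 1 / 2 + c / 8 := by simp [hs₀]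
  have hs₀im : s₀.im = t₀ := by simp [hs₀]
  have hτ : 1 ≤ t₀ ^ (1 / 120 : ℝ) := Real.one_le_rpow (by linarith) (by norm_num)
  have ht0' : (t₀ : ℂ) ≠ 0 := by exact_mod_cast ht0.ne'
  set W : ℂ → ℂ := fun s => E s / t₀ with hW
  have hnW : ∀ s, ‖W s‖ = ‖E s‖ / t₀ := fun s => by
    rw [hW, norm_div, norm_real, Real.norm_of_nonneg ht0.le]
  have hdW : ∀ ρ, deriv W ρ = deriv E ρ / t₀ := fun ρ => by
    rw [hW, deriv_div_const]
  have hWd : Differentiable ℂ W := H.diff.div_const _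
  have hs01 : s₀ ≠ 1 := by
    intro h; rw [h] at hs₀im; simp at hs₀im; linarith
  have key := local_inverse_bound (W := W) hWd (s₀ := s₀) (c := c) (A := 4 * t₀ ^ (1 / 120 : ℝ)) hc0
    (by linarith) (fun w hw => ?_) ?_ S (fun ρ => ?_) (fun ρ hρ => ?_) hs (by
      rw [hW]; exact div_ne_zero hEs ht0')
  · have e1 : ‖(W s)⁻¹‖ = t₀ * ‖(E s)⁻¹‖ := by
      rw [norm_inv, hnW, norm_inv, inv_div, div_eq_mul_inv]
    have e2 : (4 * t₀ ^ (1 / 120 : ℝ)) ^ 30 = 4 ^ 30 * t₀ ^ (1 / 4 : ℝ) := by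
      rw [mul_pow, ← Real.rpow_natCast (t₀ ^ (1 / 120 : ℝ)), ← Real.rpow_mul ht0.le]; norm_num
    have e3 : ∀ ρ, 1 / (‖deriv W ρ‖ ^ 2 * ‖s - ρ‖ ^ 2) = t₀ ^ 2 * (1 / (‖deriv E ρ‖ ^ 2 * ‖s - ρ‖ ^ 2)) := by
      intro ρ
      rw [hdW, norm_div, norm_real, Real.norm_of_nonneg ht0.le]
      rcases eq_or_ne (‖deriv E ρ‖) 0 with h | h
      · simp [h]
      · rcases eq_or_ne (‖s - ρ‖) 0 with h' | h'
        · simp [h']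
        · field_simp
    rw [e1, e2, Finset.sum_congr rfl fun ρ _ => e3 ρ, ← Finset.mul_sum, mul_pow] at key
    have e4 : t₀ ^ (-2 : ℝ) = (t₀ ^ 2)⁻¹ := by
      rw [Real.rpow_neg ht0.le, Real.rpow_two]
    rw [e4]
    have ht2 : 0 < t₀ ^ 2 := by positivity
    refine le_of_mul_le_mul_left (a := t₀ ^ 2) (key.trans_eq ?_) ht2
    field_simp
  · have h1 := im_close_of_norm_sub_le hw
    have h2 := re_close_of_norm_sub_le hw
    rw [hs₀im] at h1
    rw [hs₀re] at h2
    have hw1 : w ≠ 1 := by rintro rfl; simp at h1; linarith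
    have hZ := hT₁ w.im (by linarith) w rfl (by linarith)
    rw [hnW, div_le_iff₀ ht0, H.eq_mul w hw1, norm_mul]
    have h3 : ‖w - 1‖ ≤ 2 * t₀ := by
      have := norm_sub_le_norm_sub_add_norm_sub w s₀ 1
      have h5 : ‖s₀ - 1‖ ≤ 1 + t₀ := by
        refine (norm_le_abs_re_add_abs_im _).trans (add_le_add ?_ ?_)
        · rw [sub_re, hs₀re, one_re, abs_le]; constructor <;> linarith
        · rw [sub_im, hs₀im, one_im, sub_zero, abs_of_pos ht0]
      linarith
    have h4 : w.im ^ (1 / 120 : ℝ) ≤ 2 * t₀ ^ (1 / 120 : ℝ) := by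
      calc w.im ^ (1 / 120 : ℝ) ≤ (2 * t₀) ^ (1 / 120 : ℝ) :=
            Real.rpow_le_rpow (by linarith) (by linarith) (by norm_num)
        _ = 2 ^ (1 / 120 : ℝ) * t₀ ^ (1 / 120 : ℝ) := Real.mul_rpow (by norm_num) ht0.le
        _ ≤ 2 * t₀ ^ (1 / 120 : ℝ) := by
          refine mul_le_mul_of_nonneg_right ?_ (by positivity)
          calc (2:ℝ) ^ (1 / 120 : ℝ) ≤ 2 ^ (1:ℝ) := Real.rpow_le_rpow_of_exponent_le (by norm_num) (by norm_num)
            _ = 2 := Real.rpow_one _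
    calc ‖w - 1‖ * ‖Z w‖ ≤ (2 * t₀) * (2 * t₀ ^ (1 / 120 : ℝ)) :=
          mul_le_mul h3 (hZ.trans h4) (norm_nonneg _) (by positivity)
      _ = _ := by ring
  · have hZ := (hLt s₀ hs₀im (by rw [hs₀re])).1
    rw [hnW, le_div_iff₀ ht0, H.eq_mul s₀ hs01, norm_mul]
    have h3 : t₀ ≤ ‖s₀ - 1‖ := by
      have := abs_im_le_norm (s₀ - 1)
      rwa [sub_im, hs₀im, one_im, sub_zero, abs_of_pos ht0] at this
    have h4 : (4 * t₀ ^ (1 / 120 : ℝ))⁻¹ ≤ t₀ ^ (-(1 / 120) : ℝ) := by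
      rw [Real.rpow_neg ht0.le]
      exact inv_anti₀ (by positivity) (by linarith)
    calc (4 * t₀ ^ (1 / 120 : ℝ))⁻¹ * t₀ ≤ t₀ ^ (-(1 / 120) : ℝ) * t₀ := mul_le_mul_of_nonneg_right h4 ht0.le
      _ = t₀ * t₀ ^ (-(1 / 120) : ℝ) := mul_comm _ _
      _ ≤ _ := mul_le_mul h3 hZ (by positivity) (norm_nonneg _)
  · rw [hS ρ, hW]
    simp [ht0']
  · rw [hdW]
    have h1 := (hS ρ).mp hρ
    have h2 := re_close_of_norm_sub_le h1.1
    rw [hs₀re] at h2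
    exact div_ne_zero (H.simple ρ h1.2 (H.crit ρ h1.2 (by linarith))) ht0'

end RiemannData

section Partial

lemma lintegral_poisson_le {δ : ℝ} (hδ : 0 < δ) (γ : ℝ) (D : Set ℝ) :
    ∫⁻ t in D, ENNReal.ofReal (δ / (δ ^ 2 + (t - γ) ^ 2)) ≤ ENNReal.ofReal Real.pi := by
  refine (setLIntegral_le_lintegral _ _).trans ?_
  rw [← ofReal_integral_eq_lintegral_ofReal (integrable_poisson hδ γ)
    (Eventually.of_forall fun t => by positivity), integral_poisson hδ]

/-- Windowed mean square bound for `1 / E` just to the right of the critical line. -/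
lemma RHData.window_integral {Z E : ℂ → ℂ} (H : RHData Z E) :
    ∃ c Q : ℝ, 0 < c ∧ c ≤ 1 / 8 ∧ 0 < Q ∧ ∀ᶠ t₀ : ℝ in atTop, ∀ δ : ℝ, 0 < δ → δ ≤ c / 8 →
      ∫⁻ t in Set.Icc (t₀ - c / 8) (t₀ + c / 8), ENNReal.ofReal (δ * ‖(E ((1 / 2 + δ : ℝ) + t * I))⁻¹‖ ^ 2) ≤
        ENNReal.ofReal (Q * t₀ ^ (1 / 4 : ℝ)) * (ENNReal.ofReal (t₀ ^ (-2 : ℝ)) +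
          ∑' ρ : critZeros E, if |ρ.1.im - t₀| ≤ c / 3 then ENNReal.ofReal (1 / ‖deriv E ρ.1‖ ^ 2) else 0) := by
  obtain ⟨c, hc0, hc8, hw⟩ := H.window_pointwise
  refine ⟨c, 4 ^ 30 * Real.pi, hc0, hc8, by positivity, ?_⟩
  filter_upwards [hw, eventually_ge_atTop (1:ℝ)] with t₀ hw ht1 δ hδ0 hδ
  have ht0 : 0 < t₀ := by linarith
  set s₀ : ℂ := (1 / 2 + c / 8 : ℝ) + t₀ * I with hs₀
  have hs₀re : s₀.re = 1 / 2 + c / 8 := by simp [hs₀]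
  have hs₀im : s₀.im = t₀ := by simp [hs₀]
  have hfin : {ρ | ρ ∈ Metric.closedBall s₀ (c / 3) ∧ E ρ = 0}.Finite :=
    finite_zeros_of_isCompact H.diff H.half (isCompact_closedBall _ _)
  set S : Finset ℂ := hfin.toFinset with hS
  have hmemS : ∀ ρ, ρ ∈ S ↔ ‖ρ - s₀‖ ≤ c / 3 ∧ E ρ = 0 := fun ρ => by
    rw [hS, Set.Finite.mem_toFinset, Set.mem_ofPred_eq, Metric.mem_closedBall, dist_eq_norm]
  have hScrit : ∀ ρ ∈ S, ρ ∈ critZeros E ∧ |ρ.im - t₀| ≤ c / 3 := by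
    intro ρ hρ
    have h1 := (hmemS ρ).mp hρ
    have h2 := re_close_of_norm_sub_le h1.1
    have h3 := im_close_of_norm_sub_le h1.1
    rw [hs₀re] at h2
    rw [hs₀im] at h3
    refine ⟨⟨h1.2, H.crit ρ h1.2 (by linarith), by linarith⟩, ?_⟩
    rw [abs_le]; constructor <;> linarith
  have hpt : ∀ t ∈ Set.Icc (t₀ - c / 8) (t₀ + c / 8),
      ENNReal.ofReal (δ * ‖(E ((1 / 2 + δ : ℝ) + t * I))⁻¹‖ ^ 2) ≤
      ENNReal.ofReal (4 ^ 30 * t₀ ^ (1 / 4 : ℝ)) * (ENNReal.ofReal (t₀ ^ (-2 : ℝ)) +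
        ∑ ρ ∈ S, ENNReal.ofReal (1 / ‖deriv E ρ‖ ^ 2) * ENNReal.ofReal (δ / (δ ^ 2 + (t - ρ.im) ^ 2))) := by
    intro t ht
    set s : ℂ := (1 / 2 + δ : ℝ) + t * I with hs
    have hsre : s.re = 1 / 2 + δ := by simp [hs]
    have hss : ‖s - s₀‖ ≤ c / 4 := by
      refine (norm_le_abs_re_add_abs_im _).trans ?_
      have h1 : |(s - s₀).re| ≤ c / 8 := by
        rw [sub_re, hsre, hs₀re, abs_le]; constructor <;> linarith
      have h2 : |(s - s₀).im| ≤ c / 8 := by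
        have : s.im = t := by simp [hs]
        rw [sub_im, this, hs₀im, abs_le]; constructor <;> linarith [ht.1, ht.2]
      linarith
    have h1 := hw S hmemS s hss (H.ne_zero s (by rw [hsre]; linarith))
    have h2 : δ * ‖(E s)⁻¹‖ ^ 2 ≤ 4 ^ 30 * t₀ ^ (1 / 4 : ℝ) * (t₀ ^ (-2 : ℝ) +
        ∑ ρ ∈ S, 1 / ‖deriv E ρ‖ ^ 2 * (δ / (δ ^ 2 + (t - ρ.im) ^ 2))) := by
      calc δ * ‖(E s)⁻¹‖ ^ 2 ≤ δ * (4 ^ 30 * t₀ ^ (1 / 4 : ℝ) *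
            (t₀ ^ (-2 : ℝ) + ∑ ρ ∈ S, 1 / (‖deriv E ρ‖ ^ 2 * ‖s - ρ‖ ^ 2))) := mul_le_mul_of_nonneg_left h1 hδ0.le
        _ = 4 ^ 30 * t₀ ^ (1 / 4 : ℝ) * (δ * t₀ ^ (-2 : ℝ) +
            ∑ ρ ∈ S, 1 / ‖deriv E ρ‖ ^ 2 * (δ / (δ ^ 2 + (t - ρ.im) ^ 2))) := by
          have : ∑ ρ ∈ S, 1 / ‖deriv E ρ‖ ^ 2 * (δ / (δ ^ 2 + (t - ρ.im) ^ 2)) =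
              δ * ∑ ρ ∈ S, 1 / (‖deriv E ρ‖ ^ 2 * ‖s - ρ‖ ^ 2) := by
            rw [Finset.mul_sum]
            refine Finset.sum_congr rfl fun ρ hρ => ?_
            rw [hs, norm_sq_sub_zero (hScrit ρ hρ).1.2.1, one_div_mul_eq_div, div_div, mul_one_div]
            rw [mul_comm (δ ^ 2 + _)]
          rw [this]; ring
        _ ≤ _ := by
          refine mul_le_mul_of_nonneg_left (add_le_add_left ?_ _) (by positivity)
          exact mul_le_of_le_one_left (by positivity) (by linarith)
    refine (ENNReal.ofReal_le_ofReal h2).trans_eq ?_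
    rw [ENNReal.ofReal_mul (by positivity), ENNReal.ofReal_add (by positivity)
      (Finset.sum_nonneg fun _ _ => by positivity), ENNReal.ofReal_sum_of_nonneg fun _ _ => by positivity]
    congr 2
    exact Finset.sum_congr rfl fun ρ _ => ENNReal.ofReal_mul (by positivity)
  have hpi1 : (1:ENNReal) ≤ ENNReal.ofReal Real.pi := by
    rw [ENNReal.one_le_ofReal]; linarith [Real.pi_gt_three]
  calc _ ≤ ∫⁻ t in Set.Icc (t₀ - c / 8) (t₀ + c / 8),
        ENNReal.ofReal (4 ^ 30 * t₀ ^ (1 / 4 : ℝ)) * (ENNReal.ofReal (t₀ ^ (-2 : ℝ)) +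
        ∑ ρ ∈ S, ENNReal.ofReal (1 / ‖deriv E ρ‖ ^ 2) * ENNReal.ofReal (δ / (δ ^ 2 + (t - ρ.im) ^ 2))) :=
        setLIntegral_mono' measurableSet_Icc hpt
    _ = ENNReal.ofReal (4 ^ 30 * t₀ ^ (1 / 4 : ℝ)) *
        (ENNReal.ofReal (t₀ ^ (-2 : ℝ)) * volume (Set.Icc (t₀ - c / 8) (t₀ + c / 8)) +
        ∑ ρ ∈ S, ENNReal.ofReal (1 / ‖deriv E ρ‖ ^ 2) *
          ∫⁻ t in Set.Icc (t₀ - c / 8) (t₀ + c / 8), ENNReal.ofReal (δ / (δ ^ 2 + (t - ρ.im) ^ 2))) := by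
        rw [lintegral_const_mul _ (by fun_prop), lintegral_add_left (by fun_prop), setLIntegral_const,
          lintegral_finsetSum _ (fun _ _ => by fun_prop)]
        congr 2
        exact Finset.sum_congr rfl fun ρ _ => lintegral_const_mul _ (by fun_prop)
    _ ≤ ENNReal.ofReal (4 ^ 30 * t₀ ^ (1 / 4 : ℝ)) *
        (ENNReal.ofReal (t₀ ^ (-2 : ℝ)) * ENNReal.ofReal Real.pi +
        ∑ ρ ∈ S, ENNReal.ofReal (1 / ‖deriv E ρ‖ ^ 2) * ENNReal.ofReal Real.pi) := by
        gcongr with ρ hρ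
        · rw [Real.volume_Icc]
          apply ENNReal.ofReal_le_ofReal
          linarith [Real.pi_gt_three]
        · exact lintegral_poisson_le hδ0 _ _
    _ = ENNReal.ofReal (4 ^ 30 * Real.pi * t₀ ^ (1 / 4 : ℝ)) * (ENNReal.ofReal (t₀ ^ (-2 : ℝ)) +
        ∑ ρ ∈ S, ENNReal.ofReal (1 / ‖deriv E ρ‖ ^ 2)) := by
        rw [← Finset.sum_mul, ← add_mul, mul_comm _ (ENNReal.ofReal Real.pi), ← mul_assoc,
          ← ENNReal.ofReal_mul (by positivity)]
        congr 2; ring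
    _ ≤ _ := by
        gcongr
        have : ∑ ρ ∈ S, ENNReal.ofReal (1 / ‖deriv E ρ‖ ^ 2) =
            ∑ ρ : S, if h : ρ.1 ∈ critZeros E then
              (if |ρ.1.im - t₀| ≤ c / 3 then ENNReal.ofReal (1 / ‖deriv E ρ.1‖ ^ 2) else 0) else 0 := by
          rw [← Finset.sum_coe_sort S]
          refine Finset.sum_congr rfl fun ρ _ => ?_
          rw [dif_pos (hScrit ρ.1 ρ.2).1, if_pos (hScrit ρ.1 ρ.2).2]
        rw [← Finset.sum_coe_sort S, ← tsum_fintype (L := .unconditional _)]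
        refine (ENNReal.tsum_le_tsum (f := fun ρ : S => ENNReal.ofReal (1 / ‖deriv E ρ.1‖ ^ 2))
          (g := fun ρ : S => (fun ρ : critZeros E => if |ρ.1.im - t₀| ≤ c / 3 then
            ENNReal.ofReal (1 / ‖deriv E ρ.1‖ ^ 2) else 0) ⟨ρ.1, (hScrit ρ.1 ρ.2).1⟩) fun ρ => ?_).trans ?_
        · simp only
          rw [if_pos (hScrit ρ.1 ρ.2).2]
        · exact ENNReal.tsum_comp_le_tsum_of_injective (f := fun ρ : S => (⟨ρ.1, (hScrit ρ.1 ρ.2).1⟩ : critZeros E))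
            (fun a b h => Subtype.ext (congrArg (fun x : critZeros E => x.1) h)) _

end Partial

section WeightedSum

/-- Dyadic partial summation: a power bound of exponent `3/2` for the partial sums of `a` gives
convergence against the weight `(γ + 1) ^ (-7/4)`. -/
lemma tsum_dyadic_ne_top {ι : Type*} (a : ι → ENNReal) (γ : ι → ℝ) (hγ : ∀ ρ, 0 < γ ρ) {C : ℝ}
    (h : ∀ T : ℝ, 2 ≤ T → ∑' ρ, (if γ ρ ≤ T then a ρ else 0) ≤ ENNReal.ofReal (C * T ^ (3 / 2 : ℝ))) :
    ∑' ρ, a ρ * ENNReal.ofReal ((γ ρ + 1) ^ (-(7 / 4) : ℝ)) ≠ ⊤ := by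
  have h1 : ∀ ρ, a ρ * ENNReal.ofReal ((γ ρ + 1) ^ (-(7 / 4) : ℝ)) ≤
      ∑' k : ℕ, (if γ ρ ≤ 2 ^ (k + 1) then a ρ else 0) * ENNReal.ofReal (((2:ℝ) ^ k) ^ (-(7 / 4) : ℝ)) := by
    intro ρ
    obtain ⟨k, hk1, hk2⟩ := exists_nat_pow_near (x := γ ρ + 1) (y := (2:ℝ)) (by linarith [hγ ρ]) (by norm_num)
    have h2 : a ρ * ENNReal.ofReal ((γ ρ + 1) ^ (-(7 / 4) : ℝ)) ≤
        (if γ ρ ≤ 2 ^ (k + 1) then a ρ else 0) * ENNReal.ofReal (((2:ℝ) ^ k) ^ (-(7 / 4) : ℝ)) := by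
      rw [if_pos (show γ ρ ≤ 2 ^ (k + 1) by linarith)]
      exact mul_le_mul_right (ENNReal.ofReal_le_ofReal (Real.rpow_le_rpow_of_nonpos (by positivity) hk1 (by norm_num))) _
    exact h2.trans (ENNReal.le_tsum (f := fun k : ℕ => (if γ ρ ≤ 2 ^ (k + 1) then a ρ else 0) * ENNReal.ofReal (((2:ℝ) ^ k) ^ (-(7 / 4) : ℝ))) k)
  refine ne_top_of_le_ne_top ?_ (ENNReal.tsum_le_tsum h1)
  rw [ENNReal.tsum_comm]
  simp_rw [ENNReal.tsum_mul_right]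
  have hr : (2:ℝ) ^ (-(1 / 4) : ℝ) < 1 := Real.rpow_lt_one_of_one_lt_of_neg (by norm_num) (by norm_num)
  have hsum : Summable fun k : ℕ => (max C 0 * 2 ^ (3 / 2 : ℝ)) * ((2:ℝ) ^ (-(1 / 4) : ℝ)) ^ k :=
    (summable_geometric_of_lt_one (by positivity) hr).mul_left (max C 0 * 2 ^ (3 / 2 : ℝ))
  refine ne_top_of_le_ne_top hsum.tsum_ofReal_ne_top (ENNReal.tsum_le_tsum fun k => ?_)
  calc _ ≤ ENNReal.ofReal (max C 0 * ((2:ℝ) ^ (k + 1)) ^ (3 / 2 : ℝ)) * ENNReal.ofReal (((2:ℝ) ^ k) ^ (-(7 / 4) : ℝ)) := by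
        gcongr
        refine (h _ ?_).trans (ENNReal.ofReal_le_ofReal ?_)
        · calc (2:ℝ) = 2 ^ 1 := by norm_num
            _ ≤ _ := pow_le_pow_right₀ (by norm_num) (by omega)
        · exact mul_le_mul_of_nonneg_right (le_max_left _ _) (by positivity)
    _ = _ := by
        rw [← ENNReal.ofReal_mul (by positivity)]
        congr 1
        rw [← Real.rpow_natCast, ← Real.rpow_natCast, ← Real.rpow_natCast, ← Real.rpow_mul (by norm_num),
          ← Real.rpow_mul (by norm_num), ← Real.rpow_mul (by norm_num), mul_assoc, mul_assoc,
          ← Real.rpow_add (by norm_num), ← Real.rpow_add (by norm_num)]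
        congr 2
        push_cast
        ring

lemma RHData.differentiableAt_zeta {Z E : ℂ → ℂ} (H : RHData Z E) {s : ℂ} (hs : s ≠ 1) : DifferentiableAt ℂ Z s := by
  have hs' : s - 1 ≠ 0 := sub_ne_zero.mpr hs
  have : Z =ᶠ[𝓝 s] fun w => E w / (w - 1) := by
    filter_upwards [isOpen_ne.mem_nhds hs] with w hw
    rw [H.eq_mul w hw]
    have : w - 1 ≠ 0 := sub_ne_zero.mpr hw
    field_simp
  rw [this.differentiableAt_iff]
  exact (H.diff s).div (by fun_prop) hs'

lemma deriv_mul_at_zero {Z E : ℂ → ℂ} (hEZ : ∀ s, s ≠ 1 → E s = (s - 1) * Z s) {s : ℂ} (hs : s ≠ 1)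
    (hd : DifferentiableAt ℂ Z s) (h0 : Z s = 0) : deriv E s = (s - 1) * deriv Z s := by
  have : E =ᶠ[𝓝 s] fun w => (w - 1) * Z w := by
    filter_upwards [isOpen_ne.mem_nhds hs] with w hw using hEZ w hw
  rw [this.deriv_eq]
  have h1 : HasDerivAt (fun w : ℂ => w - 1) 1 s := (hasDerivAt_id s).sub_const 1
  have h2 : HasDerivAt (fun w => (w - 1) * Z w) (1 * Z s + (s - 1) * deriv Z s) s := h1.mul hd.hasDerivAt
  rw [h2.deriv, h0]
  ring

lemma ne_one_of_re_half {ρ : ℂ} (h : ρ.re = 1 / 2) : ρ ≠ 1 := by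
  rintro rfl; norm_num at h

lemma norm_sub_one_of_re_half {ρ : ℂ} (h : ρ.re = 1 / 2) : ‖ρ - 1‖ = ‖ρ‖ := by
  rw [← sq_eq_sq₀ (norm_nonneg _) (norm_nonneg _), ← normSq_eq_norm_sq, ← normSq_eq_norm_sq, normSq_apply, normSq_apply]
  simp only [sub_re, one_re, sub_im, one_im, h]
  ring

lemma RHData.zeta_eq_zero_iff {Z E : ℂ → ℂ} (H : RHData Z E) {ρ : ℂ} (h : ρ ≠ 1) : Z ρ = 0 ↔ E ρ = 0 := by
  rw [H.eq_mul ρ h, mul_eq_zero, or_iff_right (sub_ne_zero.mpr h)]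

/-- The negative moment bound makes `∑ (γ + 1) ^ (1/4) / |E'(ρ)| ^ 2` converge. -/
lemma RHData.tsum_weighted_ne_top {Z E : ℂ → ℂ} (H : RHData Z E) {C α : ℝ} (hα : α ≤ 1 / 2)
    (hJ : ∀ T : ℝ, 2 ≤ T →
      (∑' ρ : {ρ : ℂ // Z ρ = 0 ∧ ρ.re = 1 / 2 ∧ 0 ≤ ρ.im ∧ ρ.im ≤ T}, 1 / ‖deriv Z ρ.1‖ ^ 2) ≤ C * T ^ (1 + α)) :
    ∑' ρ : critZeros E, ENNReal.ofReal ((ρ.1.im + 1) ^ (1 / 4 : ℝ) / ‖deriv E ρ.1‖ ^ 2) ≠ ⊤ := by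
  have h1 := tsum_dyadic_ne_top (fun ρ : critZeros E => ENNReal.ofReal (1 / ‖deriv Z ρ.1‖ ^ 2))
    (fun ρ => ρ.1.im) (fun ρ => ρ.2.2.2) (C := max C 0) (fun T hT => ?_)
  · refine ne_top_of_le_ne_top (ENNReal.mul_ne_top (ENNReal.ofReal_ne_top (r := 8)) h1) ?_
    rw [← ENNReal.tsum_mul_left]
    refine ENNReal.tsum_le_tsum fun ρ => ?_
    rw [← ENNReal.ofReal_mul (by positivity), ← ENNReal.ofReal_mul (by norm_num)]
    refine ENNReal.ofReal_le_ofReal ?_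
    obtain ⟨ρ, h0, hre, him⟩ := ρ
    simp only
    have hρ1 := ne_one_of_re_half hre
    rw [deriv_mul_at_zero H.eq_mul hρ1 (H.differentiableAt_zeta hρ1) ((H.zeta_eq_zero_iff hρ1).mpr h0), norm_mul, mul_pow]
    have e1 : ‖ρ - 1‖ ^ 2 = 1 / 4 + ρ.im ^ 2 := by
      rw [← normSq_eq_norm_sq, normSq_apply]
      simp only [sub_re, one_re, sub_im, one_im, hre]
      ring
    have e2 : (ρ.im + 1) ^ (1 / 4 : ℝ) = (ρ.im + 1) ^ (-(7 / 4) : ℝ) * (ρ.im + 1) ^ 2 := by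
      rw [← Real.rpow_two, ← Real.rpow_add (by linarith)]; norm_num
    have e3 : (ρ.im + 1) ^ 2 ≤ 8 * ‖ρ - 1‖ ^ 2 := by rw [e1]; nlinarith [sq_nonneg (ρ.im - 1)]
    have e4 : 0 < ‖ρ - 1‖ ^ 2 := by rw [e1]; positivity
    rw [e2]
    calc (ρ.im + 1) ^ (-(7 / 4) : ℝ) * (ρ.im + 1) ^ 2 / (‖ρ - 1‖ ^ 2 * ‖deriv Z ρ‖ ^ 2)
        ≤ (ρ.im + 1) ^ (-(7 / 4) : ℝ) * (8 * ‖ρ - 1‖ ^ 2) / (‖ρ - 1‖ ^ 2 * ‖deriv Z ρ‖ ^ 2) := by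
          gcongr
      _ = 8 * (1 / ‖deriv Z ρ‖ ^ 2 * (ρ.im + 1) ^ (-(7 / 4) : ℝ)) := by
          rw [show (ρ.im + 1) ^ (-(7 / 4) : ℝ) * (8 * ‖ρ - 1‖ ^ 2) = ‖ρ - 1‖ ^ 2 * ((ρ.im + 1) ^ (-(7 / 4) : ℝ) * 8) by ring,
            mul_div_mul_left _ _ e4.ne']
          ring
  · set S : Set ℂ := {ρ : ℂ | Z ρ = 0 ∧ ρ.re = 1 / 2 ∧ 0 ≤ ρ.im ∧ ρ.im ≤ T} with hS
    have hSfin : S.Finite := by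
      have hc : IsCompact (Metric.closedBall (0:ℂ) (1 / 2 + T)) := isCompact_closedBall _ _
      refine (finite_zeros_of_isCompact H.diff H.half hc).subset fun ρ hρ => ⟨?_, ?_⟩
      · rw [mem_closedBall_zero_iff]
        refine (norm_le_abs_re_add_abs_im _).trans ?_
        rw [hρ.2.1, abs_of_nonneg hρ.2.2.1, abs_of_pos (by norm_num)]
        linarith [hρ.2.2.2]
      · exact (H.zeta_eq_zero_iff (ne_one_of_re_half hρ.2.1)).mp hρ.1
    have : Finite S := hSfin
    set F : ℂ → ENNReal := S.indicator fun ρ => ENNReal.ofReal (1 / ‖deriv Z ρ‖ ^ 2) with hF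
    calc _ = ∑' ρ : critZeros E, F ρ.1 := by
          refine tsum_congr fun ρ => ?_
          have hmem : ρ.1 ∈ S ↔ ρ.1.im ≤ T :=
            ⟨fun h => h.2.2.2, fun h => ⟨(H.zeta_eq_zero_iff (ne_one_of_re_half ρ.2.2.1)).mpr ρ.2.1, ρ.2.2.1, ρ.2.2.2.le, h⟩⟩
          rw [hF, Set.indicator_apply]
          simp only [hmem]
      _ ≤ ∑' ρ : ℂ, F ρ := ENNReal.tsum_comp_le_tsum_of_injective Subtype.val_injective F
      _ = ∑' ρ : S, ENNReal.ofReal (1 / ‖deriv Z ρ.1‖ ^ 2) := by rw [hF, tsum_subtype S (fun ρ => ENNReal.ofReal (1 / ‖deriv Z ρ‖ ^ 2))]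
      _ = ENNReal.ofReal (∑' ρ : S, 1 / ‖deriv Z ρ.1‖ ^ 2) := by
          rw [ENNReal.ofReal_tsum_of_nonneg (fun _ => by positivity) Summable.of_finite]
      _ ≤ ENNReal.ofReal (max C 0 * T ^ (3 / 2 : ℝ)) := by
          refine ENNReal.ofReal_le_ofReal ((hJ T hT).trans ?_)
          calc C * T ^ (1 + α) ≤ max C 0 * T ^ (1 + α) := mul_le_mul_of_nonneg_right (le_max_left _ _) (by positivity)
            _ ≤ _ := mul_le_mul_of_nonneg_left (Real.rpow_le_rpow_of_exponent_le (by linarith) (by linarith)) (le_max_right _ _)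

lemma tsum_window_le {c : ℝ} (hc : 0 < c) (hc8 : c ≤ 1 / 8) {γ : ℝ} (f : ℕ → ENNReal) {B : ENNReal}
    (hf : ∀ k : ℕ, |γ - k * (c / 4)| ≤ c / 3 → f k ≤ B) :
    ∑' k : ℕ, (if |γ - k * (c / 4)| ≤ c / 3 then f k else 0) ≤ 4 * B := by
  set m := ⌈(γ - c / 3) * (4 / c)⌉₊ with hm
  rw [tsum_eq_sum (s := Finset.Icc m (m + 3)) fun k hk => ?_]
  · calc _ ≤ ∑ k ∈ Finset.Icc m (m + 3), B := by
          refine Finset.sum_le_sum fun k _ => ?_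
          split_ifs with h
          · exact hf k h
          · exact zero_le
      _ = 4 * B := by
          rw [Finset.sum_const, Nat.card_Icc, show m + 3 + 1 - m = 4 by omega, nsmul_eq_mul]; norm_num
  · refine if_neg fun h => hk ?_
    rw [abs_le] at h
    rw [Finset.mem_Icc, hm]
    have h4 : c * (4 / c) = 4 := by field_simp
    have h40 : 0 < 4 / c := by positivity
    constructor
    · rw [Nat.ceil_le]
      have := mul_le_mul_of_nonneg_right (show γ - c / 3 ≤ k * (c / 4) by linarith) h40.le
      calc _ ≤ _ := this
        _ = k := by field_simp
    · have h5 := Nat.le_ceil ((γ - c / 3) * (4 / c))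
      have := mul_le_mul_of_nonneg_right (show k * (c / 4) ≤ γ + c / 3 by linarith) h40.le
      have e : (k:ℝ) * (c / 4) * (4 / c) = k := by field_simp
      have e2 : (γ + c / 3) * (4 / c) = (γ - c / 3) * (4 / c) + 8 / 3 := by field_simp; ring
      rw [e, e2] at this
      have : (k:ℝ) ≤ (⌈(γ - c / 3) * (4 / c)⌉₊ : ℝ) + 3 := by linarith
      exact_mod_cast this

/-- Uniform smallness of the tail of the mean square of `1 / E`. -/
lemma RHData.tail_small {Z E : ℂ → ℂ} (H : RHData Z E)
    (hW : ∑' ρ : critZeros E, ENNReal.ofReal ((ρ.1.im + 1) ^ (1 / 4 : ℝ) / ‖deriv E ρ.1‖ ^ 2) ≠ ⊤) :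
    ∃ δ₀ : ℝ, 0 < δ₀ ∧ ∀ η : ENNReal, 0 < η → ∃ T₁ : ℝ, ∀ δ : ℝ, 0 < δ → δ ≤ δ₀ →
      ∫⁻ t in Set.Ioi T₁, ENNReal.ofReal (δ * ‖(E ((1 / 2 + δ : ℝ) + t * I))⁻¹‖ ^ 2) ≤ η := by
  obtain ⟨c, Q, hc0, hc8, hQ, hw⟩ := H.window_integral
  obtain ⟨T₀, hT₀⟩ := eventually_atTop.mp hw
  refine ⟨c / 8, by positivity, fun η hη => ?_⟩
  set x : ℕ → ℝ := fun k => k * (c / 4) with hx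
  have hx0 : ∀ k, 0 ≤ x k := fun k => by rw [hx]; positivity
  set b : ℕ → ENNReal := fun k => ENNReal.ofReal (Q * x k ^ (1 / 4 : ℝ)) * (ENNReal.ofReal (x k ^ (-2 : ℝ)) +
          ∑' ρ : critZeros E, if |ρ.1.im - x k| ≤ c / 3 then ENNReal.ofReal (1 / ‖deriv E ρ.1‖ ^ 2) else 0) with hb
  have hbsum : ∑' k, b k ≠ ⊤ := by
    simp only [hb, mul_add]
    rw [ENNReal.tsum_add, ENNReal.add_ne_top]
    constructor
    · have hs : Summable fun k : ℕ => (Q * (c / 4) ^ (1 / 4 : ℝ) * (c / 4) ^ (-2 : ℝ)) * (k:ℝ) ^ (-(7 / 4) : ℝ) :=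
        (Real.summable_nat_rpow.mpr (by norm_num)).mul_left (Q * (c / 4) ^ (1 / 4 : ℝ) * (c / 4) ^ (-2 : ℝ))
      refine ne_top_of_le_ne_top hs.tsum_ofReal_ne_top (ENNReal.tsum_le_tsum fun k => ?_)
      rw [← ENNReal.ofReal_mul (mul_nonneg hQ.le (Real.rpow_nonneg (hx0 k) _))]
      refine ENNReal.ofReal_le_ofReal (le_of_eq ?_)
      simp only [hx]
      rw [Real.mul_rpow (by positivity) (by positivity), Real.mul_rpow (by positivity) (by positivity)]
      have : (k:ℝ) ^ (-(7 / 4) : ℝ) = (k:ℝ) ^ (1 / 4 : ℝ) * (k:ℝ) ^ (-2 : ℝ) := by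
        rcases Nat.eq_zero_or_pos k with rfl | hk
        · rw [Nat.cast_zero, Real.zero_rpow (by norm_num), Real.zero_rpow (by norm_num), zero_mul]
        · rw [← Real.rpow_add (by exact_mod_cast hk)]; norm_num
      rw [this]; ring
    · simp_rw [← ENNReal.tsum_mul_left]
      rw [ENNReal.tsum_comm]
      refine ne_top_of_le_ne_top (ENNReal.mul_ne_top (ENNReal.mul_ne_top (show (4:ENNReal) ≠ ⊤ by norm_num)
        (ENNReal.ofReal_ne_top (r := Q))) hW) ?_
      rw [← ENNReal.tsum_mul_left]
      refine ENNReal.tsum_le_tsum fun ρ => ?_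
      rw [mul_assoc]
      simp_rw [mul_ite, mul_zero]
      refine tsum_window_le hc0 hc8 _ fun k hk => ?_
      have hk' := (abs_le.mp hk).1
      rw [← ENNReal.ofReal_mul (mul_nonneg hQ.le (Real.rpow_nonneg (hx0 k) _)), ← ENNReal.ofReal_mul hQ.le]
      refine ENNReal.ofReal_le_ofReal ?_
      rw [mul_assoc, mul_one_div]
      gcongr
      simp only [hx]; linarith
  have htend := ENNReal.tendsto_sum_nat_add b hbsum
  have hxt : Tendsto x atTop atTop := tendsto_natCast_atTop_atTop.atTop_mul_const (by positivity)
  obtain ⟨i, hi1, hi2⟩ := ((htend.eventually_lt_const hη).and (hxt.eventually_ge_atTop T₀)).exists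
  refine ⟨x i - c / 8, fun δ hδ hδc => ?_⟩
  have hcover : Set.Ioi (x i - c / 8) ⊆ ⋃ k : ℕ, Set.Icc (x (k + i) - c / 8) (x (k + i) + c / 8) := by
    intro t ht
    rw [Set.mem_Ioi] at ht
    have h0 : 0 ≤ (t - (x i - c / 8)) * (4 / c) := mul_nonneg (by linarith) (by positivity)
    rw [Set.mem_iUnion]
    refine ⟨⌊(t - (x i - c / 8)) * (4 / c)⌋₊, ?_⟩
    have h1 := Nat.floor_le h0
    have h2 := (Nat.lt_floor_add_one ((t - (x i - c / 8)) * (4 / c))).le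
    set k := ⌊(t - (x i - c / 8)) * (4 / c)⌋₊
    have hc4 : 0 ≤ c / 4 := by positivity
    have h3 := mul_le_mul_of_nonneg_right h1 hc4
    have h4 := mul_le_mul_of_nonneg_right h2 hc4
    have e : (t - (x i - c / 8)) * (4 / c) * (c / 4) = t - (x i - c / 8) := by field_simp
    rw [e] at h3 h4
    have e2 : x (k + i) = k * (c / 4) + x i := by simp only [hx]; push_cast; ring
    rw [e2]
    constructor <;> linarith
  calc _ ≤ ∫⁻ t in ⋃ k : ℕ, Set.Icc (x (k + i) - c / 8) (x (k + i) + c / 8),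
          ENNReal.ofReal (δ * ‖(E ((1 / 2 + δ : ℝ) + t * I))⁻¹‖ ^ 2) := lintegral_mono_set hcover
    _ ≤ ∑' k : ℕ, ∫⁻ t in Set.Icc (x (k + i) - c / 8) (x (k + i) + c / 8),
          ENNReal.ofReal (δ * ‖(E ((1 / 2 + δ : ℝ) + t * I))⁻¹‖ ^ 2) := lintegral_iUnion_le _ _
    _ ≤ ∑' k, b (k + i) := ENNReal.tsum_le_tsum fun k => by
        refine hT₀ (x (k + i)) (hi2.trans ?_) δ hδ hδc
        simp only [hx]
        gcongr
        omega
    _ ≤ η := hi1.le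

end WeightedSum

section MeanSquareTail

lemma continuousOn_section {g : ℝ → ℝ → ℝ} {T δ : ℝ} (hg : ContinuousOn (Function.uncurry g) (Set.Icc 0 1 ×ˢ Set.Icc 0 T))
    (hδ : δ ∈ Set.Icc (0:ℝ) 1) : ContinuousOn (g δ) (Set.Icc 0 T) := by
  have : ContinuousOn (fun t : ℝ => ((δ, t) : ℝ × ℝ)) (Set.Icc 0 T) := by fun_prop
  exact hg.comp this fun t ht => ⟨hδ, ht⟩

/-- The Poisson kernel is an approximate identity, also for jointly continuous integrands. -/
lemma poisson_limit {g : ℝ → ℝ → ℝ} {T γ : ℝ} (hg : ContinuousOn (Function.uncurry g) (Set.Icc 0 1 ×ˢ Set.Icc 0 T))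
    (hγ0 : 0 < γ) (hγT : γ < T) :
    Tendsto (fun δ => ∫ t in (0:ℝ)..T, g δ t * (δ / (δ ^ 2 + (t - γ) ^ 2))) (𝓝[>] 0) (𝓝 (Real.pi * g 0 γ)) := by
  have hT : 0 ≤ T := by linarith
  obtain ⟨M, hM⟩ := (isCompact_Icc.prod isCompact_Icc).exists_bound_of_continuousOn hg
  have hM0 : 0 ≤ M := (norm_nonneg _).trans (hM (0, 0) ⟨⟨le_rfl, zero_le_one⟩, ⟨le_rfl, hT⟩⟩)
  have key : ∀ δ : ℝ, 0 < δ → ∫ t in (0:ℝ)..T, g δ t * (δ / (δ ^ 2 + (t - γ) ^ 2)) =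
      ∫ u : ℝ, (Set.Ioc 0 T).indicator (g δ) (γ + δ * u) * (1 + u ^ 2)⁻¹ := by
    intro δ hδ
    set φ : ℝ → ℝ := fun t => (Set.Ioc 0 T).indicator (g δ) t * (δ / (δ ^ 2 + (t - γ) ^ 2)) with hφ
    have e1 : ∫ t in (0:ℝ)..T, g δ t * (δ / (δ ^ 2 + (t - γ) ^ 2)) = ∫ t, φ t := by
      rw [intervalIntegral.integral_of_le hT, ← integral_indicator measurableSet_Ioc]
      refine integral_congr_ae (Eventually.of_forall fun t => ?_)
      simp only [hφ, Set.indicator_apply]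
      split_ifs <;> simp
    have e2 : ∫ u, φ (γ + δ * u) = δ⁻¹ * ∫ t, φ t := by
      have := Measure.integral_comp_mul_left (fun t => φ (γ + t)) δ
      rw [this, integral_add_left_eq_self φ γ, abs_of_pos (inv_pos.mpr hδ), smul_eq_mul]
    have e3 : ∫ t, φ t = δ * ∫ u, φ (γ + δ * u) := by rw [e2]; field_simp
    rw [e1, e3, ← integral_const_mul]
    refine integral_congr_ae (Eventually.of_forall fun u => ?_)
    simp only [hφ]
    have : 0 < 1 + u ^ 2 := by positivity
    rw [show δ ^ 2 + (γ + δ * u - γ) ^ 2 = δ ^ 2 * (1 + u ^ 2) by ring]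
    field_simp
  have hlim : Tendsto (fun δ : ℝ => ∫ u : ℝ, (Set.Ioc 0 T).indicator (g δ) (γ + δ * u) * (1 + u ^ 2)⁻¹) (𝓝[>] 0)
      (𝓝 (∫ u : ℝ, g 0 γ * (1 + u ^ 2)⁻¹)) := by
    refine tendsto_integral_filter_of_dominated_convergence (fun u => M * (1 + u ^ 2)⁻¹) ?_ ?_
      (integrable_inv_one_add_sq.const_mul M) ?_
    · filter_upwards [Ioo_mem_nhdsGT (show (0:ℝ) < 1 by norm_num)] with δ hδ
      have hc : ContinuousOn (g δ) (Set.Ioc 0 T) :=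
        (continuousOn_section hg ⟨hδ.1.le, hδ.2.le⟩).mono Set.Ioc_subset_Icc_self
      have hm : Measurable ((Set.Ioc 0 T).indicator (g δ)) := by
        rw [← Set.piecewise_eq_indicator]
        exact hc.measurable_piecewise continuousOn_const measurableSet_Ioc
      exact ((hm.comp (by fun_prop)).mul (by fun_prop)).aestronglyMeasurable
    · filter_upwards [Ioo_mem_nhdsGT (show (0:ℝ) < 1 by norm_num)] with δ hδ
      refine Eventually.of_forall fun u => ?_
      have h1 : 0 < 1 + u ^ 2 := by positivity
      rw [norm_mul, Real.norm_of_nonneg (inv_nonneg.mpr h1.le)]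
      refine mul_le_mul_of_nonneg_right ?_ (inv_nonneg.mpr h1.le)
      rw [Set.indicator_apply]
      split_ifs with h
      · exact hM (δ, γ + δ * u) ⟨⟨hδ.1.le, hδ.2.le⟩, ⟨h.1.le, h.2⟩⟩
      · simpa using hM0
    · refine Eventually.of_forall fun u => Tendsto.mul_const _ ?_
      have ht : Tendsto (fun δ : ℝ => γ + δ * u) (𝓝[>] 0) (𝓝 γ) := by
        have : Continuous fun δ : ℝ => γ + δ * u := by fun_prop
        simpa using this.tendsto 0 |>.mono_left nhdsWithin_le_nhds
      have hev : ∀ᶠ δ : ℝ in 𝓝[>] 0, γ + δ * u ∈ Set.Ioc 0 T := by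
        filter_upwards [ht (Ioo_mem_nhds hγ0 hγT)] with δ hδ using Set.Ioo_subset_Ioc_self hδ
      have hcw := hg (0, γ) ⟨⟨le_rfl, zero_le_one⟩, ⟨hγ0.le, hγT.le⟩⟩
      have hpair : Tendsto (fun δ : ℝ => ((δ, γ + δ * u) : ℝ × ℝ)) (𝓝[>] 0) (𝓝[Set.Icc 0 1 ×ˢ Set.Icc 0 T] (0, γ)) := by
        refine tendsto_nhdsWithin_iff.mpr ⟨?_, ?_⟩
        · rw [nhds_prod_eq]
          exact (tendsto_nhdsWithin_of_tendsto_nhds tendsto_id).prodMk ht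
        · filter_upwards [hev, Ioo_mem_nhdsGT (show (0:ℝ) < 1 by norm_num)] with δ hδ hδ1
          exact ⟨⟨hδ1.1.le, hδ1.2.le⟩, ⟨hδ.1.le, hδ.2⟩⟩
      refine (hcw.tendsto.comp hpair).congr' ?_
      filter_upwards [hev] with δ hδ
      rw [Set.indicator_of_mem hδ]
      rfl
  rw [integral_const_mul, integral_univ_inv_one_add_sq, mul_comm] at hlim
  refine hlim.congr' ?_
  filter_upwards [self_mem_nhdsWithin] with δ hδ using (key δ hδ).symm

lemma tendsto_mul_integral_zero {g : ℝ → ℝ → ℝ} {T : ℝ} (hT : 0 ≤ T)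
    (hg : ContinuousOn (Function.uncurry g) (Set.Icc 0 1 ×ˢ Set.Icc 0 T)) :
    Tendsto (fun δ => ∫ t in (0:ℝ)..T, g δ t * δ) (𝓝[>] 0) (𝓝 0) := by
  obtain ⟨M, hM⟩ := (isCompact_Icc.prod isCompact_Icc).exists_bound_of_continuousOn hg
  refine squeeze_zero_norm' (a := fun δ => M * |δ| * |T - 0|) ?_ ?_
  · filter_upwards [Ioo_mem_nhdsGT (show (0:ℝ) < 1 by norm_num)] with δ hδ
    refine intervalIntegral.norm_integral_le_of_norm_le_const fun t ht => ?_
    rw [Set.uIoc_of_le hT] at ht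
    rw [norm_mul, Real.norm_eq_abs δ]
    exact mul_le_mul_of_nonneg_right (hM (δ, t) ⟨⟨hδ.1.le, hδ.2.le⟩, ⟨ht.1.le, ht.2⟩⟩) (abs_nonneg _)
  · have : Continuous fun δ : ℝ => M * |δ| * |T - 0| := by fun_prop
    simpa using this.tendsto 0 |>.mono_left nhdsWithin_le_nhds

set_option maxHeartbeats 1000000 in
/-- The mean square of `(s - 1) / (s E(s))` up to a height `T` near the critical line. -/
lemma RHData.low_limit {Z E : ℂ → ℂ} (H : RHData Z E) {T : ℝ} (hT : 0 < T) (hTne : ∀ ρ ∈ critZeros E, ρ.im ≠ T)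
    (S : Finset ℂ) (hS : ∀ ρ, ρ ∈ S ↔ ρ ∈ critZeros E ∧ ρ.im < T) :
    Tendsto (fun δ : ℝ => ∫ t in (0:ℝ)..T, δ * ‖(((1 / 2 + δ : ℝ) + t * I : ℂ) - 1) /
      (((1 / 2 + δ : ℝ) + t * I) * E ((1 / 2 + δ : ℝ) + t * I))‖ ^ 2) (𝓝[>] 0)
      (𝓝 (∑ ρ ∈ S, Real.pi * (1 / ‖deriv E ρ‖ ^ 2))) := by
  set D : ℂ → ℝ := fun s => ‖E s‖ ^ 2 + ∑ ρ ∈ S, ‖dslope E ρ s‖ ^ 2 with hD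
  have hDc : Continuous D := by
    refine (H.diff.continuous.norm.pow 2).add (continuous_finsetSum _ fun ρ _ => ?_)
    exact (differentiable_dslope H.diff ρ).continuous.norm.pow 2
  have hSz : ∀ ρ ∈ S, E ρ = 0 := fun ρ hρ => ((hS ρ).mp hρ).1.1
  set p : ℝ → ℝ → ℂ := fun δ t => (1 / 2 + δ : ℝ) + t * I with hp
  have hpre : ∀ δ t, (p δ t).re = 1 / 2 + δ := fun δ t => by simp [hp]
  have hpim : ∀ δ t, (p δ t).im = t := fun δ t => by simp [hp]
  have hDpos : ∀ δ t, δ ∈ Set.Icc (0:ℝ) 1 → t ∈ Set.Icc (0:ℝ) T → 0 < D (p δ t) := by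
    intro δ t hδ ht
    have hnn : 0 ≤ ∑ ρ ∈ S, ‖dslope E ρ (p δ t)‖ ^ 2 := Finset.sum_nonneg fun _ _ => by positivity
    by_cases h0 : E (p δ t) = 0
    · have hδ0 : δ = 0 := by
        by_contra hne
        have : 0 < δ := lt_of_le_of_ne hδ.1 (Ne.symm hne)
        exact H.ne_zero _ (by rw [hpre]; linarith) h0
      have ht0 : t ≠ 0 := by
        rintro rfl
        apply H.half
        rw [← h0, hp, hδ0]; simp
      have hcz : p δ t ∈ critZeros E := ⟨h0, by rw [hpre, hδ0, add_zero], by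
        rw [hpim]; exact lt_of_le_of_ne ht.1 (Ne.symm ht0)⟩
      have hmem : p δ t ∈ S := (hS _).mpr ⟨hcz, by
        have := hTne _ hcz
        rw [hpim] at this ⊢
        exact lt_of_le_of_ne ht.2 this⟩
      have h1 := Finset.single_le_sum (f := fun ρ => ‖dslope E ρ (p δ t)‖ ^ 2) (fun _ _ => by positivity) hmem
      simp only [dslope_same] at h1
      have h2 : 0 < ‖deriv E (p δ t)‖ ^ 2 := by
        have := norm_pos_iff.mpr (H.simple _ h0 hcz.2.1)
        positivity
      have h3 : 0 ≤ ‖E (p δ t)‖ ^ 2 := by positivity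
      simp only [hD]
      linarith
    · have : 0 < ‖E (p δ t)‖ ^ 2 := by have := norm_pos_iff.mpr h0; positivity
      simp only [hD]
      linarith
  set g : ℝ → ℝ → ℝ := fun δ t => ‖p δ t - 1‖ ^ 2 / (‖p δ t‖ ^ 2 * D (p δ t)) with hg
  have hpc : Continuous (Function.uncurry p) := by
    simp only [hp]
    unfold Function.uncurry
    fun_prop
  have hp0 : ∀ δ t, 0 ≤ δ → p δ t ≠ 0 := by
    intro δ t hδ h
    have := hpre δ t
    rw [h, zero_re] at this
    linarith
  have hgc : ContinuousOn (Function.uncurry g) (Set.Icc 0 1 ×ˢ Set.Icc 0 T) := by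
    have e : Function.uncurry g = fun x => ‖Function.uncurry p x - 1‖ ^ 2 / (‖Function.uncurry p x‖ ^ 2 * D (Function.uncurry p x)) := by
      funext x; rfl
    rw [e]
    refine ContinuousOn.div ?_ ?_ ?_
    · exact ((hpc.sub continuous_const).norm.pow 2).continuousOn
    · exact ((hpc.norm.pow 2).mul (hDc.comp hpc)).continuousOn
    · rintro ⟨δ, t⟩ ⟨hδ, ht⟩
      have h1 := hDpos δ t hδ ht
      have h2 := norm_pos_iff.mpr (hp0 δ t hδ.1)
      simp only [Function.uncurry]
      positivity
  have hgval : ∀ ρ ∈ S, g 0 ρ.im = 1 / ‖deriv E ρ‖ ^ 2 := by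
    intro ρ hρ
    have hre := ((hS ρ).mp hρ).1.2.1
    have e : p 0 ρ.im = ρ := by
      apply Complex.ext
      · rw [hpre, hre, add_zero]
      · rw [hpim]
    have e2 : D ρ = ‖deriv E ρ‖ ^ 2 := by
      simp only [hD]
      rw [hSz ρ hρ, norm_zero, zero_pow two_ne_zero, zero_add, Finset.sum_eq_single ρ]
      · rw [dslope_same]
      · intro ρ' hρ' hne
        rw [dslope_of_ne _ (Ne.symm hne), slope_def_field, hSz ρ hρ, hSz ρ' hρ', sub_zero, zero_div, norm_zero, zero_pow two_ne_zero]
      · exact fun h => absurd hρ h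
    have h0 : 0 < ‖ρ‖ ^ 2 := by
      have := norm_pos_iff.mpr (show ρ ≠ 0 by rintro rfl; simp at hre)
      positivity
    simp only [hg]
    rw [e, e2, norm_sub_one_of_re_half hre, div_mul_eq_div_div, div_self h0.ne']
  have hsum := (tendsto_mul_integral_zero hT.le hgc).add (tendsto_finsetSum S fun ρ hρ =>
    poisson_limit hgc (γ := ρ.im) ((hS ρ).mp hρ).1.2.2 ((hS ρ).mp hρ).2)
  rw [zero_add, Finset.sum_congr rfl fun ρ hρ => by rw [hgval ρ hρ]] at hsum
  refine hsum.congr' ?_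
  filter_upwards [Ioo_mem_nhdsGT (show (0:ℝ) < 1 by norm_num)] with δ hδ
  have hcont : ContinuousOn (g δ) (Set.uIcc 0 T) := by
    rw [Set.uIcc_of_le hT.le]
    exact continuousOn_section hgc ⟨hδ.1.le, hδ.2.le⟩
  have hpc' : ∀ ρ : ℂ, Continuous fun t : ℝ => δ / (δ ^ 2 + (t - ρ.im) ^ 2) := by
    intro ρ
    refine Continuous.div continuous_const (by fun_prop) fun t => ?_
    have := hδ.1
    positivity
  rw [← intervalIntegral.integral_finsetSum, ← intervalIntegral.integral_add]
  · refine intervalIntegral.integral_congr fun t ht => ?_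
    rw [Set.uIcc_of_le hT.le] at ht
    have hE0 : E (p δ t) ≠ 0 := H.ne_zero _ (by rw [hpre]; linarith [hδ.1])
    have hDE : D (p δ t) = ‖E (p δ t)‖ ^ 2 * (1 + ∑ ρ ∈ S, 1 / (δ ^ 2 + (t - ρ.im) ^ 2)) := by
      simp only [hD]
      rw [mul_add, mul_one, Finset.mul_sum]
      congr 1
      refine Finset.sum_congr rfl fun ρ hρ => ?_
      have hne : p δ t ≠ ρ := fun h => hE0 (h ▸ hSz ρ hρ)
      rw [dslope_of_ne _ hne, slope_def_field, hSz ρ hρ, sub_zero, norm_div, div_pow,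
        ← norm_sq_sub_zero ((hS ρ).mp hρ).1.2.1, mul_one_div]
    have h1 : 0 < ‖E (p δ t)‖ ^ 2 := by have := norm_pos_iff.mpr hE0; positivity
    have h2 : 0 < 1 + ∑ ρ ∈ S, 1 / (δ ^ 2 + (t - ρ.im) ^ 2) :=
      add_pos_of_pos_of_nonneg one_pos (Finset.sum_nonneg fun _ _ => by positivity)
    have h3 : 0 < ‖p δ t‖ ^ 2 := by have := norm_pos_iff.mpr (hp0 δ t hδ.1.le); positivity
    have e1 : ∑ ρ ∈ S, g δ t * (δ / (δ ^ 2 + (t - ρ.im) ^ 2)) = g δ t * δ * ∑ ρ ∈ S, 1 / (δ ^ 2 + (t - ρ.im) ^ 2) := by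
      rw [Finset.mul_sum]
      exact Finset.sum_congr rfl fun ρ _ => by ring
    rw [e1, show g δ t * δ + g δ t * δ * ∑ ρ ∈ S, 1 / (δ ^ 2 + (t - ρ.im) ^ 2) =
      g δ t * δ * (1 + ∑ ρ ∈ S, 1 / (δ ^ 2 + (t - ρ.im) ^ 2)) by ring]
    simp only [hg]
    have ep : ((1 / 2 + δ : ℝ) : ℂ) + t * I = p δ t := rfl
    rw [ep, hDE, norm_div, norm_mul (p δ t) (E (p δ t)), div_pow, mul_pow]
    clear_value p
    generalize 1 + ∑ ρ ∈ S, 1 / (δ ^ 2 + (t - ρ.im) ^ 2) = X at h2 ⊢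
    field_simp
  · exact (hcont.mul continuousOn_const).intervalIntegrable
  · exact (continuousOn_finsetSum _ fun ρ _ => hcont.mul (hpc' ρ).continuousOn).intervalIntegrable
  · exact fun ρ _ => (hcont.mul (hpc' ρ).continuousOn).intervalIntegrable

end MeanSquareTail

section MeanSquare

lemma finite_critZeros_lt {E : ℂ → ℂ} (hE : Differentiable ℂ E) {w : ℂ} (hw : E w ≠ 0) (T : ℝ) :
    {ρ | ρ ∈ critZeros E ∧ ρ.im < T}.Finite := by
  have hc : IsCompact (Metric.closedBall (0:ℂ) (1 / 2 + T)) := isCompact_closedBall _ _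
  refine (finite_zeros_of_isCompact hE hw hc).subset fun ρ hρ => ⟨?_, hρ.1.1⟩
  rw [mem_closedBall_zero_iff]
  refine (norm_le_abs_re_add_abs_im _).trans ?_
  rw [hρ.1.2.1, abs_of_pos hρ.1.2.2, abs_of_pos (by norm_num)]
  linarith [hρ.2]

lemma exists_height_ne {E : ℂ → ℂ} (hE : Differentiable ℂ E) {w : ℂ} (hw : E w ≠ 0) (T₁ : ℝ) :
    ∃ T, T₁ < T ∧ ∀ ρ ∈ critZeros E, ρ.im ≠ T := by
  have hfin := (finite_critZeros_lt hE hw (T₁ + 1)).image Complex.im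
  obtain ⟨T, hT, hTn⟩ := (Set.Ioo_infinite (show T₁ < T₁ + 1 by linarith)).exists_notMem_finite hfin
  exact ⟨T, hT.1, fun ρ hρ h => hTn ⟨ρ, ⟨hρ, h ▸ hT.2⟩, h⟩⟩

/-- The transform `1 / (s Z(s))`, written through `E s = (s - 1) Z s`. -/
def invZetaDiv (E : ℂ → ℂ) (s : ℂ) : ℂ := (s - 1) / (s * E s)

lemma norm_sub_one_le {s : ℂ} (hs : 1 / 2 ≤ s.re) : ‖s - 1‖ ≤ ‖s‖ := by
  refine le_of_sq_le_sq ?_ (norm_nonneg _)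
  rw [← normSq_eq_norm_sq, ← normSq_eq_norm_sq, normSq_apply, normSq_apply]
  simp only [sub_re, one_re, sub_im, one_im]
  nlinarith

lemma norm_invZetaDiv_le (E : ℂ → ℂ) {s : ℂ} (hs : 1 / 2 ≤ s.re) : ‖invZetaDiv E s‖ ≤ ‖(E s)⁻¹‖ := by
  have h0 : 0 < ‖s‖ := norm_pos_iff.mpr (by rintro rfl; norm_num at hs)
  rw [invZetaDiv, norm_div, norm_mul, norm_inv, div_mul_eq_div_div, ← one_div]
  gcongr
  exact (div_le_one h0).mpr (norm_sub_one_le hs)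

lemma RHData.continuous_invZetaDiv_line {Z E : ℂ → ℂ} (H : RHData Z E) {δ : ℝ} (hδ : 0 < δ) :
    Continuous fun t : ℝ => invZetaDiv E ((1 / 2 + δ : ℝ) + t * I) := by
  simp only [invZetaDiv]
  have hc : Continuous fun t : ℝ => ((1 / 2 + δ : ℝ) + t * I : ℂ) := by fun_prop
  have hre : ∀ t : ℝ, ((1 / 2 + δ : ℝ) + t * I : ℂ).re = 1 / 2 + δ := fun t => by simp
  refine (hc.sub continuous_const).div (hc.mul (H.diff.continuous.comp hc)) fun t => mul_ne_zero ?_ (H.ne_zero _ ?_)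
  · intro h
    have := hre t
    rw [h, zero_re] at this
    linarith
  · rw [hre]; linarith

lemma RHData.low_limit_lintegral {Z E : ℂ → ℂ} (H : RHData Z E) {T : ℝ} (hT : 0 < T) (hTne : ∀ ρ ∈ critZeros E, ρ.im ≠ T)
    (S : Finset ℂ) (hS : ∀ ρ, ρ ∈ S ↔ ρ ∈ critZeros E ∧ ρ.im < T) :
    Tendsto (fun δ : ℝ => ∫⁻ t in Set.Ioc 0 T, ENNReal.ofReal (δ * ‖invZetaDiv E ((1 / 2 + δ : ℝ) + t * I)‖ ^ 2)) (𝓝[>] 0)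
      (𝓝 (∑ ρ ∈ S, ENNReal.ofReal (Real.pi * (1 / ‖deriv E ρ‖ ^ 2)))) := by
  rw [← ENNReal.ofReal_sum_of_nonneg fun _ _ => by positivity]
  refine (ENNReal.tendsto_ofReal (H.low_limit hT hTne S hS)).congr' ?_
  filter_upwards [self_mem_nhdsWithin] with δ hδ
  rw [intervalIntegral.integral_of_le hT.le, ofReal_integral_eq_lintegral_ofReal]
  · rfl
  · exact ((((H.continuous_invZetaDiv_line hδ).norm.pow 2).const_mul δ).integrableOn_Icc (a := 0) (b := T)).mono_set
      Set.Ioc_subset_Icc_self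
  · exact Eventually.of_forall fun t => mul_nonneg (le_of_lt hδ) (by positivity)

lemma tsum_critZeros_lt_le {E : ℂ → ℂ} {T : ℝ} (S : Finset ℂ) (hS : ∀ ρ, ρ ∈ S ↔ ρ ∈ critZeros E ∧ ρ.im < T)
    (f : ℂ → ENNReal) : ∑ ρ ∈ S, f ρ ≤ ∑' ρ : critZeros E, f ρ.1 := by
  calc ∑ ρ ∈ S, f ρ = ∑' ρ : S, f ρ.1 := (Finset.tsum_subtype S f).symm
    _ ≤ ∑' ρ : critZeros E, f ρ.1 :=
      ENNReal.tsum_comp_le_tsum_of_injective (f := fun ρ : S => (⟨ρ.1, ((hS ρ.1).mp ρ.2).1⟩ : critZeros E))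
        (fun a b hab => Subtype.ext (congrArg (fun x : critZeros E => x.1) hab)) (fun ρ : critZeros E => f ρ.1)

/-- Mean square of `1 / (s Z(s))` near the critical line. -/
lemma RHData.mean_square_limit {Z E : ℂ → ℂ} (H : RHData Z E)
    (hW : ∑' ρ : critZeros E, ENNReal.ofReal ((ρ.1.im + 1) ^ (1 / 4 : ℝ) / ‖deriv E ρ.1‖ ^ 2) ≠ ⊤) :
    Tendsto (fun δ : ℝ => ∫⁻ t in Set.Ioi (0:ℝ), ENNReal.ofReal (δ * ‖invZetaDiv E ((1 / 2 + δ : ℝ) + t * I)‖ ^ 2)) (𝓝[>] 0)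
      (𝓝 (∑' ρ : critZeros E, ENNReal.ofReal (Real.pi * (1 / ‖deriv E ρ.1‖ ^ 2)))) := by
  obtain ⟨δ₀, hδ₀, htail⟩ := H.tail_small hW
  set L := ∑' ρ : critZeros E, ENNReal.ofReal (Real.pi * (1 / ‖deriv E ρ.1‖ ^ 2)) with hL
  have hLtop : L ≠ ⊤ := by
    refine ne_top_of_le_ne_top (ENNReal.mul_ne_top (ENNReal.ofReal_ne_top (r := Real.pi)) hW) ?_
    rw [hL, ← ENNReal.tsum_mul_left]
    refine ENNReal.tsum_le_tsum fun ρ => ?_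
    rw [← ENNReal.ofReal_mul Real.pi_pos.le]
    refine ENNReal.ofReal_le_ofReal ?_
    have : 1 ≤ (ρ.1.im + 1) ^ (1 / 4 : ℝ) := Real.one_le_rpow (by linarith [ρ.2.2.2]) (by norm_num)
    gcongr
  refine tendsto_order.mpr ⟨fun a ha => ?_, fun b hb => ?_⟩
  · rw [hL, ENNReal.tsum_eq_iSup_sum, lt_iSup_iff] at ha
    obtain ⟨F, hF⟩ := ha
    obtain ⟨T₁, hT₁⟩ := (F.image fun ρ => ρ.1.im).bddAbove
    obtain ⟨T, hT, hTne⟩ := exists_height_ne H.diff H.half (max T₁ 1)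
    have hT0 : 0 < T := lt_trans (lt_of_lt_of_le one_pos (le_max_right _ _)) hT
    set S := (finite_critZeros_lt H.diff H.half T).toFinset with hS
    have hSm : ∀ ρ, ρ ∈ S ↔ ρ ∈ critZeros E ∧ ρ.im < T := fun ρ => by
      rw [hS, Set.Finite.mem_toFinset, Set.mem_ofPred_eq]
    have hlow := H.low_limit_lintegral hT0 hTne S hSm
    have hle : ∑ ρ ∈ F, ENNReal.ofReal (Real.pi * (1 / ‖deriv E ρ.1‖ ^ 2)) ≤
        ∑ ρ ∈ S, ENNReal.ofReal (Real.pi * (1 / ‖deriv E ρ‖ ^ 2)) := by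
      rw [← Finset.sum_image (f := fun ρ : ℂ => ENNReal.ofReal (Real.pi * (1 / ‖deriv E ρ‖ ^ 2))) (g := Subtype.val)
        (fun a _ b _ h => Subtype.ext h)]
      refine Finset.sum_le_sum_of_subset fun ρ hρ => ?_
      obtain ⟨ρ', hρ', rfl⟩ := Finset.mem_image.mp hρ
      refine (hSm _).mpr ⟨ρ'.2, lt_of_le_of_lt ?_ hT⟩
      exact (hT₁ (Finset.mem_coe.mpr (Finset.mem_image_of_mem _ hρ'))).trans (le_max_left _ _)
    filter_upwards [hlow.eventually_const_lt (hF.trans_le hle)] with δ hδ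
    exact hδ.trans_le (lintegral_mono_set Set.Ioc_subset_Ioi_self)
  · obtain ⟨r, hr0, hr⟩ := ENNReal.lt_iff_exists_add_pos_lt.mp hb
    have hr2 : (0:ENNReal) < r / 2 := ENNReal.div_pos (by exact_mod_cast hr0.ne') (by norm_num)
    obtain ⟨T₁, hT₁⟩ := htail (r / 2) hr2
    obtain ⟨T, hT, hTne⟩ := exists_height_ne H.diff H.half (max T₁ 1)
    have hT0 : 0 < T := lt_trans (lt_of_lt_of_le one_pos (le_max_right _ _)) hT
    set S := (finite_critZeros_lt H.diff H.half T).toFinset with hS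
    have hSm : ∀ ρ, ρ ∈ S ↔ ρ ∈ critZeros E ∧ ρ.im < T := fun ρ => by
      rw [hS, Set.Finite.mem_toFinset, Set.mem_ofPred_eq]
    have hlow := H.low_limit_lintegral hT0 hTne S hSm
    have hlt : ∑ ρ ∈ S, ENNReal.ofReal (Real.pi * (1 / ‖deriv E ρ‖ ^ 2)) < L + r / 2 :=
      (tsum_critZeros_lt_le S hSm fun ρ => ENNReal.ofReal (Real.pi * (1 / ‖deriv E ρ‖ ^ 2))).trans_lt
        (ENNReal.lt_add_right hLtop hr2.ne')
    filter_upwards [hlow.eventually_lt_const hlt, Ioo_mem_nhdsGT hδ₀] with δ hδ hδ1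
    rw [← Set.Ioc_union_Ioi_eq_Ioi hT0.le]
    refine (lintegral_union_le _ _ _).trans_lt (lt_of_le_of_lt ?_ hr)
    have h3 : ∫⁻ t in Set.Ioi T, ENNReal.ofReal (δ * ‖invZetaDiv E ((1 / 2 + δ : ℝ) + t * I)‖ ^ 2) ≤ r / 2 := by
      refine le_trans ?_ (hT₁ δ hδ1.1 hδ1.2.le)
      refine (lintegral_mono_set (Set.Ioi_subset_Ioi ((le_max_left _ _).trans hT.le))).trans ?_
      refine lintegral_mono fun t => ENNReal.ofReal_le_ofReal ?_
      refine mul_le_mul_of_nonneg_left ?_ hδ1.1.le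
      have := norm_invZetaDiv_le E (s := (1 / 2 + δ : ℝ) + t * I) (by
        simp only [add_re, ofReal_re, mul_re, I_re, I_im, ofReal_im]; linarith [hδ1.1])
      gcongr
    calc _ ≤ (L + r / 2) + r / 2 := add_le_add hδ.le h3
      _ = L + r := by rw [add_assoc, ENNReal.add_halves]

end MeanSquare

section MertensLaplace

variable {K : Type} [Field K] [NumberField K]

/-- The contribution of one ideal to `y ↦ M_K(e^y)`. -/
def mertensTerm (a : {a : Ideal (𝓞 K) // a ≠ ⊥}) (y : ℝ) : ℝ :=
  if (Ideal.absNorm a.1 : ℝ) < Real.exp y then (moebiusK K a.1 : ℝ)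
  else if (Ideal.absNorm a.1 : ℝ) = Real.exp y then (moebiusK K a.1 : ℝ) / 2 else 0

lemma mertensK_exp_eq (y : ℝ) : mertensK K (Real.exp y) = ∑' a : {a : Ideal (𝓞 K) // a ≠ ⊥}, mertensTerm a y := by
  rw [mertensK]
  set f : Ideal (𝓞 K) → ℝ := fun I => if (Ideal.absNorm I : ℝ) < Real.exp y then (moebiusK K I : ℝ)
    else if (Ideal.absNorm I : ℝ) = Real.exp y then (moebiusK K I : ℝ) / 2 else 0 with hf
  have h1 : ∑' a : {a : Ideal (𝓞 K) // a ≠ ⊥}, mertensTerm a y = ∑' a : {a : Ideal (𝓞 K) | a ≠ ⊥}, f a.1 := rfl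
  rw [h1, tsum_subtype {a : Ideal (𝓞 K) | a ≠ ⊥} f]
  refine tsum_congr fun I => ?_
  by_cases hI : I = ⊥
  · have : I ∉ {a : Ideal (𝓞 K) | a ≠ ⊥} := fun h => h hI
    simp [Set.indicator_of_notMem this, hI]
  · rw [Set.indicator_of_mem (show I ∈ {a : Ideal (𝓞 K) | a ≠ ⊥} from hI)]
    simp [hf, hI]

lemma abs_moebiusK_le (I : Ideal (𝓞 K)) : |(moebiusK K I : ℝ)| ≤ 1 := by
  have := norm_moebiusK_le I
  rwa [norm_intCast] at this

lemma absNorm_real_pos (a : {a : Ideal (𝓞 K) // a ≠ ⊥}) : (0:ℝ) < Ideal.absNorm a.1 := by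
  exact_mod_cast absNorm_pos' a

lemma mertensTerm_of_log_lt {a : {a : Ideal (𝓞 K) // a ≠ ⊥}} {y : ℝ} (h : Real.log (Ideal.absNorm a.1) < y) :
    mertensTerm a y = moebiusK K a.1 :=
  if_pos ((Real.log_lt_iff_lt_exp (absNorm_real_pos a)).mp h)

lemma mertensTerm_of_lt_log {a : {a : Ideal (𝓞 K) // a ≠ ⊥}} {y : ℝ} (h : y < Real.log (Ideal.absNorm a.1)) :
    mertensTerm a y = 0 := by
  have h1 := (Real.lt_log_iff_exp_lt (absNorm_real_pos a)).mp h
  rw [mertensTerm, if_neg h1.not_gt, if_neg h1.ne']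

lemma abs_mertensTerm_le (a : {a : Ideal (𝓞 K) // a ≠ ⊥}) (y : ℝ) {σ : ℝ} (hσ : 0 ≤ σ) :
    |mertensTerm a y| ≤ (Ideal.absNorm a.1 : ℝ) ^ (-σ) * Real.exp (σ * y) := by
  rcases lt_or_ge y (Real.log (Ideal.absNorm a.1)) with h | h
  · rw [mertensTerm_of_lt_log h, abs_zero]; positivity
  · have h1 : |mertensTerm a y| ≤ 1 := by
      have := abs_moebiusK_le a.1
      rw [mertensTerm]
      split_ifs
      · exact this
      · rw [abs_div, abs_two]; linarith
      · simp
    refine h1.trans ?_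
    rw [Real.rpow_def_of_pos (absNorm_real_pos a), ← Real.exp_add]
    refine Real.one_le_exp ?_
    nlinarith

lemma measurable_mertensTerm (a : {a : Ideal (𝓞 K) // a ≠ ⊥}) : Measurable (mertensTerm a) := by
  unfold mertensTerm
  refine Measurable.ite (measurableSet_lt measurable_const Real.measurable_exp) measurable_const
    (Measurable.ite ?_ measurable_const measurable_const)
  exact measurableSet_eq_fun measurable_const Real.measurable_exp

lemma mertensK_exp_of_neg {y : ℝ} (hy : y < 0) : mertensK K (Real.exp y) = 0 := by
  rw [mertensK_exp_eq]
  have : ∀ a : {a : Ideal (𝓞 K) // a ≠ ⊥}, mertensTerm a y = 0 := fun a => by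
    refine mertensTerm_of_lt_log (hy.trans_le (Real.log_nonneg ?_))
    exact_mod_cast absNorm_pos' a
  simp [this]

variable {Z : ℂ → ℂ}

lemma countable_ideals (hZ : IsDedekindZeta K Z) : Countable {a : Ideal (𝓞 K) // a ≠ ⊥} := by
  have h := ((exists_completed_zeta hZ).1 2 (by norm_num)).countable_support
  refine Set.countable_univ_iff.mp (h.mono fun a _ => ?_)
  exact (Real.rpow_pos_of_pos (absNorm_real_pos a) _).ne'

lemma summable_mertensTerm (hZ : IsDedekindZeta K Z) (y : ℝ) :
    Summable fun a : {a : Ideal (𝓞 K) // a ≠ ⊥} => mertensTerm a y := by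
  refine Summable.of_norm_bounded (((exists_completed_zeta hZ).1 2 (by norm_num)).mul_right (Real.exp (2 * y))) fun a => ?_
  exact abs_mertensTerm_le a y (by norm_num)

lemma measurable_mertensK_exp (hZ : IsDedekindZeta K Z) : Measurable fun y : ℝ => mertensK K (Real.exp y) := by
  have := countable_ideals hZ
  refine measurable_of_tendsto_metrizable' (atTop : Filter (Finset {a : Ideal (𝓞 K) // a ≠ ⊥}))
    (f := fun s y => ∑ a ∈ s, mertensTerm a y) (fun s => Finset.measurable_sum s fun a _ => measurable_mertensTerm a) ?_
  rw [tendsto_pi_nhds]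
  intro y
  rw [mertensK_exp_eq]
  exact (summable_mertensTerm hZ y).hasSum

lemma abs_mertensK_exp_le (hZ : IsDedekindZeta K Z) {σ : ℝ} (hσ : 1 < σ) :
    ∃ B : ℝ, 0 ≤ B ∧ ∀ y, |mertensK K (Real.exp y)| ≤ B * Real.exp (σ * y) := by
  refine ⟨∑' a : {a : Ideal (𝓞 K) // a ≠ ⊥}, (Ideal.absNorm a.1 : ℝ) ^ (-σ), tsum_nonneg fun _ => by positivity, fun y => ?_⟩
  have hs := (exists_completed_zeta hZ).1 σ hσ
  rw [mertensK_exp_eq, ← tsum_mul_right, ← Real.norm_eq_abs]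
  exact tsum_of_norm_bounded (hs.mul_right (Real.exp (σ * y))).hasSum fun a =>
    abs_mertensTerm_le a y (zero_le_one.trans hσ.le)

/-- The Laplace transform of `y ↦ M_K(e^y)`. -/
lemma laplace_mertensK (hZ : IsDedekindZeta K Z) {s : ℂ} (hs : 1 < s.re) :
    ∫ y : ℝ, (mertensK K (Real.exp y) : ℂ) * cexp (-s * y) = 1 / (s * Z s) := by
  have := countable_ideals hZ
  have hs0 : s ≠ 0 := by rintro rfl; norm_num at hs
  have hneg : (-s).re < 0 := by rw [neg_re]; linarith
  set F : {a : Ideal (𝓞 K) // a ≠ ⊥} → ℝ → ℂ := fun a y => (mertensTerm a y : ℂ) * cexp (-s * y) with hF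
  set G : {a : Ideal (𝓞 K) // a ≠ ⊥} → ℝ → ℂ := fun a =>
    (Set.Ioi (Real.log (Ideal.absNorm a.1))).indicator fun y => (moebiusK K a.1 : ℂ) * cexp (-s * y) with hG
  have hFG : ∀ a, F a =ᵐ[volume] G a := by
    intro a
    have : ∀ᵐ y : ℝ, y ≠ Real.log (Ideal.absNorm a.1) := Measure.ae_ne _ _
    filter_upwards [this] with y hy
    rcases lt_or_gt_of_ne hy with h | h
    · simp only [hF, hG]
      rw [mertensTerm_of_lt_log h, Set.indicator_of_notMem (by simpa using h.le)]
      simp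
    · simp only [hF, hG]
      rw [mertensTerm_of_log_lt h, Set.indicator_of_mem (Set.mem_Ioi.mpr h)]
      simp
  have hGint : ∀ a, Integrable (G a) := fun a =>
    IntegrableOn.integrable_indicator ((integrableOn_exp_mul_complex_Ioi hneg _).const_mul _) measurableSet_Ioi
  have hexp : ∀ a : {a : Ideal (𝓞 K) // a ≠ ⊥}, cexp (-s * (Real.log (Ideal.absNorm a.1) : ℝ)) = (Ideal.absNorm a.1 : ℂ) ^ (-s) := by
    intro a
    rw [cpow_def_of_ne_zero (by exact_mod_cast (absNorm_pos' a).ne'), ← natCast_log, mul_comm]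
  have hGval : ∀ a, ∫ y, G a y = (moebiusK K a.1 : ℂ) * (Ideal.absNorm a.1 : ℂ) ^ (-s) / s := by
    intro a
    rw [hG, integral_indicator measurableSet_Ioi, integral_const_mul, integral_exp_mul_complex_Ioi hneg, hexp, neg_div_neg_eq]
    ring
  have hGnorm : ∀ a, ∫ y, ‖G a y‖ ≤ (Ideal.absNorm a.1 : ℝ) ^ (-s.re) / s.re := by
    intro a
    have e : (fun y => ‖G a y‖) = (Set.Ioi (Real.log (Ideal.absNorm a.1))).indicator
        fun y => |(moebiusK K a.1 : ℝ)| * Real.exp (-s.re * y) := by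
      funext y
      simp only [hG]
      rw [norm_indicator_eq_indicator_norm]
      congr 1
      funext y
      rw [norm_mul, norm_exp, norm_intCast]
      congr 2
      simp
    rw [e, integral_indicator measurableSet_Ioi, integral_const_mul, integral_exp_mul_Ioi (by linarith)]
    have e2 : -Real.exp (-s.re * Real.log (Ideal.absNorm a.1)) / -s.re = (Ideal.absNorm a.1 : ℝ) ^ (-s.re) / s.re := by
      rw [Real.rpow_def_of_pos (absNorm_real_pos a), neg_div_neg_eq, mul_comm]
    rw [e2]
    exact mul_le_of_le_one_left (by positivity) (abs_moebiusK_le _)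
  have h := hasSum_integral_of_summable_integral_norm (F := F) (fun a => (hGint a).congr (hFG a).symm) (by
    refine Summable.of_nonneg_of_le (fun a => integral_nonneg fun _ => norm_nonneg _) (fun a => ?_)
      (((exists_completed_zeta hZ).1 s.re hs).div_const s.re)
    refine (integral_congr_ae ((hFG a).fun_comp norm)).trans_le (hGnorm a))
  have e1 : ∀ y : ℝ, ∑' a, F a y = (mertensK K (Real.exp y) : ℂ) * cexp (-s * y) := by
    intro y
    simp only [hF]
    rw [tsum_mul_right, mertensK_exp_eq, ofReal_tsum]
  simp only [e1] at h
  rw [← h.tsum_eq]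
  have e2 : ∀ a, ∫ y, F a y = (moebiusK K a.1 : ℂ) * (Ideal.absNorm a.1 : ℂ) ^ (-s) / s := fun a => by
    rw [integral_congr_ae (hFG a), hGval]
  simp only [e2]
  rw [tsum_div_const]
  have h3 := zeta_mul_moebius hZ hs
  have hZ0 : Z s ≠ 0 := right_ne_zero_of_mul_eq_one h3
  rw [eq_div_iff (mul_ne_zero hs0 hZ0), div_mul_eq_mul_div, div_eq_iff hs0, one_mul, mul_left_comm, h3, mul_one]

end MertensLaplace

section FourierLp

open scoped FourierTransform SchwartzMap

/-- Plancherel for integrable square-integrable functions whose Fourier integral is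
square-integrable. -/
lemma eLpNorm_fourier_eq {f : ℝ → ℂ} (h1 : Integrable f) (h2 : MemLp f 2) (h3 : MemLp (𝓕 f) 2) :
    eLpNorm (𝓕 f) 2 volume = eLpNorm f 2 volume := by
  have key : 𝓕 (h2.toLp f) = h3.toLp (𝓕 f) := by
    have hinj : Function.Injective (Lp.toTemperedDistributionCLM ℂ (volume : Measure ℝ) 2) :=
      LinearMap.ker_eq_bot.mp (Lp.ker_toTemperedDistributionCLM_eq_bot)
    apply hinj
    have e := Lp.fourier_toTemperedDistribution_eq (h2.toLp f)
    change ((𝓕 (h2.toLp f) : Lp ℂ 2 (volume : Measure ℝ)) : 𝓢'(ℝ, ℂ)) = _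
    rw [← e]
    ext g
    rw [TemperedDistribution.fourier_apply]
    change Lp.toTemperedDistribution _ _ = Lp.toTemperedDistribution _ _
    rw [Lp.toTemperedDistribution_apply, Lp.toTemperedDistribution_apply]
    have a1 : ∫ x, (𝓕 g) x • (h2.toLp f) x = ∫ x, f x * 𝓕 (g : ℝ → ℂ) x := by
      refine integral_congr_ae ?_
      filter_upwards [h2.coeFn_toLp] with x hx
      rw [hx, SchwartzMap.fourier_coe, smul_eq_mul, mul_comm]
    have a2 : ∫ x, g x • (h3.toLp (𝓕 f)) x = ∫ x, 𝓕 f x * g x := by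
      refine integral_congr_ae ?_
      filter_upwards [h3.coeFn_toLp] with x hx
      rw [hx, smul_eq_mul, mul_comm]
    rw [a1, a2]
    have := VectorFourier.integral_fourierIntegral_smul_eq_flip (μ := volume) (ν := volume)
      (L := innerₗ ℝ) Real.continuous_fourierChar (by exact continuous_inner) h1 g.integrable
    rw [flip_innerₗ] at this
    exact this.symm
  have h := Lp.norm_fourier_eq (h2.toLp f)
  rw [key, Lp.norm_toLp, Lp.norm_toLp] at h
  exact (ENNReal.toReal_eq_toReal_iff' h3.2.ne h2.2.ne).mp h

end FourierLp

section MertensParseval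

open scoped FourierTransform

variable {K : Type} [Field K] [NumberField K] {Z E : ℂ → ℂ}

lemma integrable_of_mertensK_bound (hZ : IsDedekindZeta K Z) {σ : ℝ} (hσ : 1 < σ) {n : ℕ} (hn : n ≠ 0) :
    Integrable fun y : ℝ => |mertensK K (Real.exp y) * Real.exp (-σ * y)| ^ n := by
  obtain ⟨B, hB0, hB⟩ := abs_mertensK_exp_le hZ (σ := (1 + σ) / 2) (by linarith)
  have hneg : (n:ℝ) * ((1 - σ) / 2) < 0 :=
    mul_neg_of_pos_of_neg (by positivity) (by linarith)
  have hi : Integrable ((Set.Ici (0:ℝ)).indicator fun y => B ^ n * Real.exp ((n:ℝ) * ((1 - σ) / 2) * y)) := by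
    refine IntegrableOn.integrable_indicator ?_ measurableSet_Ici
    rw [integrableOn_Ici_iff_integrableOn_Ioi]
    exact (integrableOn_exp_mul_Ioi hneg 0).const_mul _
  refine hi.mono' ?_ (Eventually.of_forall fun y => ?_)
  · exact ((((measurable_mertensK_exp hZ).mul (by fun_prop)).abs).pow_const n).aestronglyMeasurable
  · rcases lt_or_ge y 0 with hy | hy
    · rw [mertensK_exp_of_neg hy, Set.indicator_of_notMem (by simpa using hy)]
      simp [hn]
    · rw [Set.indicator_of_mem (Set.mem_Ici.mpr hy), Real.norm_of_nonneg (by positivity), mul_assoc,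
        Real.exp_nat_mul, ← mul_pow]
      refine pow_le_pow_left₀ (abs_nonneg _) ?_ n
      rw [abs_mul, abs_of_pos (Real.exp_pos _)]
      refine (mul_le_mul_of_nonneg_right (hB y) (Real.exp_pos _).le).trans_eq ?_
      rw [mul_assoc, ← Real.exp_add]
      ring_nf

lemma invZetaDiv_eq (H : RHData Z E) {s : ℂ} (hs : 1 < s.re) :
    invZetaDiv E s = 1 / (s * Z s) := by
  have h1 : s ≠ 1 := by rintro rfl; simp at hs
  rw [invZetaDiv, H.eq_mul s h1, mul_left_comm, div_mul_eq_div_div, div_self (sub_ne_zero.mpr h1)]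

lemma norm_vertical_sq (σ t : ℝ) : ‖(σ:ℂ) + t * I‖ ^ 2 = σ ^ 2 + t ^ 2 := by
  rw [← normSq_eq_norm_sq, normSq_add_mul_I]

lemma exists_bound_invZetaDiv_vertical (hZ : IsDedekindZeta K Z) (H : RHData Z E) {σ : ℝ} (hσ : 1 < σ) :
    ∃ B, 0 ≤ B ∧ ∀ t : ℝ, ‖invZetaDiv E (σ + t * I)‖ ^ 2 ≤ B * (1 + t ^ 2)⁻¹ := by
  obtain ⟨B, hB0, hB⟩ := exists_bound_inv_zeta hZ hσ
  refine ⟨B ^ 2, by positivity, fun t => ?_⟩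
  have hre : ((σ:ℂ) + t * I).re = σ := by simp
  rw [invZetaDiv_eq H (by rw [hre]; exact hσ), one_div, mul_inv, norm_mul, mul_pow, norm_inv, inv_pow,
    norm_vertical_sq, mul_comm]
  have h2 : 1 + t ^ 2 ≤ σ ^ 2 + t ^ 2 := by nlinarith
  gcongr
  exact hB _ hre.ge

lemma integral_mertensK_sq (hZ : IsDedekindZeta K Z) (H : RHData Z E) {σ : ℝ} (hσ : 1 < σ) :
    ∫ y : ℝ, mertensK K (Real.exp y) ^ 2 * Real.exp (-(2 * σ) * y) =
      (2 * Real.pi)⁻¹ * ∫ t : ℝ, ‖invZetaDiv E (σ + t * I)‖ ^ 2 := by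
  set f : ℝ → ℂ := fun y => ((mertensK K (Real.exp y) * Real.exp (-σ * y) : ℝ) : ℂ) with hf
  have hfn : ∀ y, ‖f y‖ = |mertensK K (Real.exp y) * Real.exp (-σ * y)| := fun y => by
    simp only [hf]; rw [norm_real, Real.norm_eq_abs]
  have hfm : AEStronglyMeasurable f volume := by
    refine Measurable.aestronglyMeasurable ?_
    exact measurable_ofReal.comp ((measurable_mertensK_exp hZ).mul (by fun_prop))
  have h1 : Integrable f := by
    refine (integrable_norm_iff hfm).mp ?_
    refine (integrable_of_mertensK_bound hZ hσ one_ne_zero).congr (Eventually.of_forall fun y => ?_)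
    simp only [hfn, pow_one]
  have h2 : MemLp f 2 := by
    rw [memLp_two_iff_integrable_sq_norm hfm]
    simp only [hfn]
    exact integrable_of_mertensK_bound hZ hσ two_ne_zero
  have hF : ∀ ξ : ℝ, 𝓕 f ξ = invZetaDiv E (σ + (2 * Real.pi * ξ : ℝ) * I) := by
    intro ξ
    have hre : ((σ:ℂ) + (2 * Real.pi * ξ : ℝ) * I).re = σ := by
      rw [add_re, ofReal_re, mul_I_re, ofReal_im, neg_zero, add_zero]
    rw [invZetaDiv_eq H (by rw [hre]; exact hσ), ← laplace_mertensK hZ (by rw [hre]; exact hσ),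
      Real.fourier_real_eq_integral_exp_smul]
    refine integral_congr_ae (Eventually.of_forall fun y => ?_)
    simp only [hf, smul_eq_mul]
    push_cast
    rw [mul_left_comm, ← Complex.exp_add]
    congr 2
    ring
  have hcont : Continuous fun t : ℝ => invZetaDiv E (σ + t * I) := by
    have := H.continuous_invZetaDiv_line (δ := σ - 1 / 2) (by linarith)
    simpa using this
  obtain ⟨B, hB0, hB⟩ := exists_bound_invZetaDiv_vertical hZ H hσ
  have hint : Integrable fun t : ℝ => ‖invZetaDiv E (σ + t * I)‖ ^ 2 := by
    refine (integrable_inv_one_add_sq.const_mul B).mono' (hcont.norm.pow 2).aestronglyMeasurable (Eventually.of_forall fun t => ?_)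
    rw [Real.norm_of_nonneg (by positivity)]
    exact hB t
  have hpi : (2 * Real.pi) ≠ 0 := by positivity
  have h3 : MemLp (𝓕 f) 2 := by
    have hm : AEStronglyMeasurable (𝓕 f) volume := by
      rw [show 𝓕 f = _ from funext hF]
      exact (hcont.comp (continuous_const.mul continuous_id)).aestronglyMeasurable
    rw [memLp_two_iff_integrable_sq_norm hm]
    simp only [hF]
    exact hint.comp_mul_left' hpi
  have h := eLpNorm_fourier_eq h1 h2 h3
  rw [h3.eLpNorm_eq_integral_rpow_norm two_ne_zero ENNReal.ofNat_ne_top,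
    h2.eLpNorm_eq_integral_rpow_norm two_ne_zero ENNReal.ofNat_ne_top,
    ENNReal.ofReal_eq_ofReal_iff (by positivity) (by positivity),
    Real.rpow_left_inj (by positivity) (by positivity) (by norm_num)] at h
  simp only [ENNReal.toReal_ofNat, Real.rpow_two, hF, hfn, sq_abs] at h
  have e := Measure.integral_comp_mul_left (fun t : ℝ => ‖invZetaDiv E (σ + t * I)‖ ^ 2) (2 * Real.pi)
  simp only [smul_eq_mul] at e
  rw [abs_of_pos (by positivity)] at e
  rw [← e, h]
  refine integral_congr_ae (Eventually.of_forall fun y => ?_)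
  simp only
  rw [mul_pow, ← Real.exp_nat_mul]
  push_cast
  ring_nf

end MertensParseval

section StripBounds

/-- A parametric integral of holomorphic functions, dominated near a point, is differentiable
there. -/
lemma differentiableAt_integral_of_dominated {F : ℂ → ℝ → ℂ} {c : ℂ} {r : ℝ} (hr : 0 < r) {b : ℝ → ℝ}
    (hb : Integrable b) (hm : ∀ w ∈ Metric.ball c r, Continuous (F w))
    (hd : ∀ t, DifferentiableOn ℂ (fun w => F w t) (Metric.ball c r))
    (hF : ∀ w ∈ Metric.ball c r, ∀ t, ‖F w t‖ ≤ b t) :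
    DifferentiableAt ℂ (fun w => ∫ t, F w t) c := by
  have hcr : c ∈ Metric.ball c r := Metric.mem_ball_self hr
  have hD : ∀ t, ∀ w ∈ Metric.ball c r, HasDerivAt (fun w => F w t) (deriv (fun w => F w t) w) w := fun t w hw =>
    ((hd t).differentiableAt (Metric.isOpen_ball.mem_nhds hw)).hasDerivAt
  have hmeas : AEStronglyMeasurable (fun t => deriv (fun w => F w t) c) volume := by
    set u : ℕ → ℂ := fun n => c + ((r / (n + 2) : ℝ) : ℂ) with hu
    have hun : ∀ n, u n ∈ Metric.ball c r := fun n => by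
      rw [mem_ball_iff_norm, hu, add_sub_cancel_left, norm_real, Real.norm_of_nonneg (by positivity),
        div_lt_iff₀ (by positivity)]
      nlinarith [show (0:ℝ) ≤ n from n.cast_nonneg]
    have hlim : Tendsto u atTop (𝓝[≠] c) := by
      refine tendsto_nhdsWithin_iff.mpr ⟨?_, Eventually.of_forall fun n => ?_⟩
      · have h1 : Tendsto (fun n : ℕ => r / ((n:ℝ) + 2)) atTop (𝓝 0) :=
          tendsto_const_nhds.div_atTop (tendsto_atTop_add_const_right _ _ tendsto_natCast_atTop_atTop)
        have h2 := (continuous_ofReal.tendsto 0).comp h1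
        have h3 := h2.const_add c
        simpa [hu] using h3
      · have : ((r / (n + 2) : ℝ) : ℂ) ≠ 0 := by
          rw [ofReal_ne_zero]; positivity
        simpa [hu] using this
    refine aestronglyMeasurable_of_tendsto_ae atTop (f := fun n t => slope (fun w => F w t) c (u n)) (fun n => ?_)
      (Eventually.of_forall fun t => ?_)
    · have : Continuous fun t => slope (fun w => F w t) c (u n) := by
        simp only [slope_def_field]
        exact ((hm _ (hun n)).sub (hm _ hcr)).div_const _
      exact this.aestronglyMeasurable
    · exact (hD t c hcr).tendsto_slope.comp hlim
  have hs : Metric.ball c (r / 2) ∈ 𝓝 c := Metric.ball_mem_nhds c (by positivity)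
  refine (hasDerivAt_integral_of_dominated_loc_of_deriv_le (F' := fun w t => deriv (fun w => F w t) w) (bound := fun t => b t / (r / 4)) hs ?_ ?_ hmeas ?_
    (hb.div_const _) ?_).2.differentiableAt
  · filter_upwards [Metric.ball_mem_nhds c hr] with w hw
    exact (hm w hw).aestronglyMeasurable
  · exact hb.mono' (hm c hcr).aestronglyMeasurable (Eventually.of_forall (hF c hcr))
  · refine Eventually.of_forall fun t w hw => ?_
    have hsub : Metric.closedBall w (r / 4) ⊆ Metric.ball c r := by
      refine Metric.closedBall_subset_ball' ?_
      rw [Metric.mem_ball] at hw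
      linarith
    refine norm_deriv_le_of_forall_mem_sphere_norm_le (by positivity) ?_ fun z hz =>
      hF z (hsub (Metric.sphere_subset_closedBall hz)) t
    refine DifferentiableOn.diffContOnCl ?_
    refine (hd t).mono ?_
    rw [closure_ball w (by positivity)]
    exact hsub
  · exact Eventually.of_forall fun t w hw => hD t w (Metric.ball_subset_ball (by linarith) hw)

lemma RHData.invZetaDiv_conj {Z E : ℂ → ℂ} (H : RHData Z E) (s : ℂ) :
    invZetaDiv E ((starRingEnd ℂ) s) = (starRingEnd ℂ) (invZetaDiv E s) := by
  rw [invZetaDiv, invZetaDiv, H.conj, map_div₀, map_mul, map_sub, map_one]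

lemma RHData.differentiableAt_invZetaDiv {Z E : ℂ → ℂ} (H : RHData Z E) {s : ℂ} (hs : 1 / 2 < s.re) :
    DifferentiableAt ℂ (invZetaDiv E) s := by
  unfold invZetaDiv
  have h0 : s ≠ 0 := by rintro rfl; norm_num at hs
  have := H.diff s
  exact DifferentiableAt.div (by fun_prop) (by fun_prop) (mul_ne_zero h0 (H.ne_zero s hs))

/-- On closed strips to the right of the critical line, `1 / (s Z(s))` decays like `|t| ^ (-3/4)`. -/
lemma RHData.exists_bound_strip {Z E : ℂ → ℂ} (H : RHData Z E) {c : ℝ} (hc : 0 < c) (R : ℝ) :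
    ∃ D : ℝ, 0 < D ∧ ∀ s : ℂ, 1 / 2 + c ≤ s.re → s.re ≤ R →
      ‖invZetaDiv E s‖ ≤ D * (1 + |s.im|) ^ (-3 / 4 : ℝ) := by
  obtain ⟨B, hB1, hB⟩ := H.bound
  obtain ⟨A, T, hA, hP⟩ := H.growth
  have hne : ∀ s : ℂ, 1 / 2 < s.re → s ≠ 1 → Z s ≠ 0 := by
    intro s hs hs1 h0
    apply H.ne_zero s hs
    rw [H.eq_mul s hs1, h0, mul_zero]
  obtain ⟨T₁, hT₁⟩ := eventually_atTop.mp (zeta_subpower_right (fun s hs => H.differentiableAt_zeta hs) hne hB1 hB hA hP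
    hc (show (0:ℝ) < 1 / 4 by norm_num))
  set T₂ : ℝ := max T₁ 1 with hT₂
  have hT₂1 : 1 ≤ T₂ := le_max_right _ _
  have hcomp : IsCompact (Set.Icc (1 / 2 + c) R ×ℂ Set.Icc (-T₂) T₂) :=
    isCompact_Icc.reProdIm isCompact_Icc
  obtain ⟨M, hM⟩ := hcomp.exists_bound_of_continuousOn (f := invZetaDiv E) (fun s hs =>
    (H.differentiableAt_invZetaDiv (s := s) (by have := hs.1.1; linarith)).continuousAt.continuousWithinAt)
  have hpos : ∀ s : ℂ, 1 / 2 + c ≤ s.re → T₂ ≤ s.im → ‖invZetaDiv E s‖ ≤ 2 * (1 + s.im) ^ (-3 / 4 : ℝ) := by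
    intro s hs him
    have hi0 : 0 < s.im := by linarith
    have h1 : s ≠ 1 := by rintro rfl; simp at hi0
    have h2 : invZetaDiv E s = s⁻¹ * (Z s)⁻¹ := by
      rw [invZetaDiv, H.eq_mul s h1, mul_left_comm, div_mul_eq_div_div, div_self (sub_ne_zero.mpr h1), one_div, mul_inv]
    have h3 := (hT₁ s.im ((le_max_left _ _).trans him) s rfl hs).1
    have h4 : s.im ≤ ‖s‖ := (le_abs_self _).trans (abs_im_le_norm s)
    rw [h2, norm_mul, norm_inv, norm_inv]
    calc ‖s‖⁻¹ * ‖Z s‖⁻¹ ≤ s.im⁻¹ * (s.im ^ (-(1 / 4) : ℝ))⁻¹ := by gcongr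
      _ = s.im ^ (-3 / 4 : ℝ) := by
          rw [← Real.rpow_neg hi0.le, ← Real.rpow_neg_one, ← Real.rpow_add hi0]; norm_num
      _ ≤ ((1 + s.im) / 2) ^ (-3 / 4 : ℝ) :=
          Real.rpow_le_rpow_of_nonpos (by positivity) (by linarith) (by norm_num)
      _ = (1 / 2) ^ (-3 / 4 : ℝ) * (1 + s.im) ^ (-3 / 4 : ℝ) := by
          rw [div_eq_inv_mul, Real.mul_rpow (by norm_num) (by positivity), one_div]
      _ ≤ 2 * (1 + s.im) ^ (-3 / 4 : ℝ) := by
          gcongr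
          calc ((1:ℝ) / 2) ^ (-3 / 4 : ℝ) ≤ (1 / 2) ^ (-1 : ℝ) :=
                Real.rpow_le_rpow_of_exponent_ge (by norm_num) (by norm_num) (by norm_num)
            _ = 2 := by norm_num [Real.rpow_neg_one]
  refine ⟨2 + |M| * (1 + T₂) ^ (3 / 4 : ℝ), by positivity, fun s hs hsR => ?_⟩
  have hx : 0 ≤ (1 + |s.im|) ^ (-3 / 4 : ℝ) := by positivity
  by_cases h : |s.im| ≤ T₂
  · have h1 := hM s ⟨⟨hs, hsR⟩, abs_le.mp h⟩
    have h2 : 1 ≤ (1 + T₂) ^ (3 / 4 : ℝ) * (1 + |s.im|) ^ (-3 / 4 : ℝ) := by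
      rw [neg_div, Real.rpow_neg (by positivity), ← div_eq_mul_inv, one_le_div (by positivity)]
      gcongr
    calc ‖invZetaDiv E s‖ ≤ |M| * 1 := by rw [mul_one]; exact h1.trans (le_abs_self M)
      _ ≤ |M| * ((1 + T₂) ^ (3 / 4 : ℝ) * (1 + |s.im|) ^ (-3 / 4 : ℝ)) := by gcongr
      _ ≤ _ := by linarith
  · push Not at h
    have h3 : ‖invZetaDiv E s‖ ≤ 2 * (1 + |s.im|) ^ (-3 / 4 : ℝ) := by
      rcases le_or_gt 0 s.im with h0 | h0
      · rw [abs_of_nonneg h0] at h ⊢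
        exact hpos s hs h.le
      · rw [abs_of_neg h0] at h ⊢
        have := hpos ((starRingEnd ℂ) s) (by simpa using hs) (by simpa using h.le)
        rw [H.invZetaDiv_conj, RCLike.norm_conj] at this
        simpa using this
    have : 0 ≤ |M| * (1 + T₂) ^ (3 / 4 : ℝ) * (1 + |s.im|) ^ (-3 / 4 : ℝ) := by positivity
    linarith

/-- The Parseval integral of `1 / (s Z(s))`, extended analytically in the abscissa. -/
def parsevalInvZeta (E : ℂ → ℂ) (w : ℂ) : ℂ :=
  ∫ t : ℝ, invZetaDiv E (w + t * I) * invZetaDiv E (w - t * I)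

lemma RHData.differentiableAt_parsevalInvZeta {Z E : ℂ → ℂ} (H : RHData Z E) {w : ℂ} (hw : 1 / 2 < w.re) :
    DifferentiableAt ℂ (parsevalInvZeta E) w := by
  set c : ℝ := (w.re - 1 / 2) / 2 with hc
  have hc0 : 0 < c := by rw [hc]; linarith
  obtain ⟨D, hD0, hD⟩ := H.exists_bound_strip hc0 (w.re + c)
  have hball : ∀ z ∈ Metric.ball w c, 1 / 2 + c ≤ z.re ∧ z.re ≤ w.re + c ∧ |z.im| ≤ |w.im| + c := by
    intro z hz
    rw [mem_ball_iff_norm] at hz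
    have h1 := abs_le.mp ((abs_re_le_norm (z - w)).trans hz.le)
    have h2 := (abs_im_le_norm (z - w)).trans hz.le
    rw [sub_re] at h1
    rw [sub_im] at h2
    refine ⟨by linarith, by linarith, ?_⟩
    have := abs_sub_abs_le_abs_sub z.im w.im
    linarith
  set V : ℝ := 1 + |w.im| + c with hV
  have hV0 : 0 < V := by positivity
  have hshift : ∀ v t : ℝ, |v| ≤ |w.im| + c → (1 + |v + t|) ^ (-3 / 4 : ℝ) ≤ V ^ (3 / 4 : ℝ) * (1 + ‖t‖) ^ (-3 / 4 : ℝ) := by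
    intro v t hv
    have h1 : 1 + ‖t‖ ≤ V * (1 + |v + t|) := by
      rw [Real.norm_eq_abs]
      have h2 : |t| ≤ |v + t| + |v| := by
        have := abs_sub (v + t) v
        rwa [add_sub_cancel_left] at this
      have h3 : 0 ≤ (|w.im| + c) * |v + t| := by positivity
      rw [hV]
      linarith
    rw [neg_div, Real.rpow_neg (by positivity), Real.rpow_neg (by positivity), ← div_eq_mul_inv,
      le_div_iff₀ (by positivity), inv_mul_le_iff₀ (by positivity), ← Real.mul_rpow (by positivity) (by positivity)]
    rw [mul_comm]
    gcongr
  have hre1 : ∀ (z : ℂ) (t : ℝ), (z + t * I).re = z.re := fun z t => by simp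
  have hre2 : ∀ (z : ℂ) (t : ℝ), (z - t * I).re = z.re := fun z t => by simp
  have hb : ∀ z ∈ Metric.ball w c, ∀ t : ℝ,
      ‖invZetaDiv E (z + t * I)‖ ≤ D * (V ^ (3 / 4 : ℝ) * (1 + ‖t‖) ^ (-3 / 4 : ℝ)) ∧
      ‖invZetaDiv E (z - t * I)‖ ≤ D * (V ^ (3 / 4 : ℝ) * (1 + ‖t‖) ^ (-3 / 4 : ℝ)) := by
    intro z hz t
    obtain ⟨h1, h2, h3⟩ := hball z hz
    constructor
    · refine (hD _ (by rw [hre1]; exact h1) (by rw [hre1]; exact h2)).trans ?_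
      refine mul_le_mul_of_nonneg_left ?_ hD0.le
      have := hshift z.im t h3
      simpa using this
    · refine (hD _ (by rw [hre2]; exact h1) (by rw [hre2]; exact h2)).trans ?_
      refine mul_le_mul_of_nonneg_left ?_ hD0.le
      have := hshift z.im (-t) h3
      rw [norm_neg, ← sub_eq_add_neg] at this
      simpa using this
  have hdiff : ∀ z ∈ Metric.ball w c, 1 / 2 < z.re := fun z hz => by
    have := (hball z hz).1
    linarith
  refine differentiableAt_integral_of_dominated hc0
    (b := fun t => (D * V ^ (3 / 4 : ℝ)) ^ 2 * (1 + ‖t‖) ^ (-(3 / 2) : ℝ)) ?_ ?_ ?_ ?_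
  · refine Integrable.const_mul (integrable_one_add_norm ?_) _
    simp; norm_num
  · intro z hz
    refine Continuous.mul ?_ ?_
    · refine continuous_iff_continuousAt.mpr fun t => ?_
      refine ContinuousAt.comp (f := fun t : ℝ => z + t * I) (g := invZetaDiv E) ?_ (by fun_prop)
      exact (H.differentiableAt_invZetaDiv (by rw [hre1]; exact hdiff z hz)).continuousAt
    · refine continuous_iff_continuousAt.mpr fun t => ?_
      refine ContinuousAt.comp (f := fun t : ℝ => z - t * I) (g := invZetaDiv E) ?_ (by fun_prop)
      exact (H.differentiableAt_invZetaDiv (by rw [hre2]; exact hdiff z hz)).continuousAt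
  · intro t z hz
    refine DifferentiableAt.differentiableWithinAt ?_
    refine DifferentiableAt.mul ?_ ?_
    · exact DifferentiableAt.comp z (f := fun z : ℂ => z + t * I) (g := invZetaDiv E)
        (H.differentiableAt_invZetaDiv (by rw [hre1]; exact hdiff z hz)) (by fun_prop)
    · exact DifferentiableAt.comp z (f := fun z : ℂ => z - t * I) (g := invZetaDiv E)
        (H.differentiableAt_invZetaDiv (by rw [hre2]; exact hdiff z hz)) (by fun_prop)
  · intro z hz t
    obtain ⟨h1, h2⟩ := hb z hz t
    rw [norm_mul]
    refine (mul_le_mul h1 h2 (norm_nonneg _) (by positivity)).trans_eq ?_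
    have : (1 + ‖t‖) ^ (-(3 / 2) : ℝ) = (1 + ‖t‖) ^ (-3 / 4 : ℝ) * (1 + ‖t‖) ^ (-3 / 4 : ℝ) := by
      rw [← Real.rpow_add (by positivity)]; norm_num
    rw [this]
    ring

lemma RHData.parsevalInvZeta_ofReal {Z E : ℂ → ℂ} (H : RHData Z E) (σ : ℝ) :
    parsevalInvZeta E σ = ((∫ t : ℝ, ‖invZetaDiv E (σ + t * I)‖ ^ 2 : ℝ) : ℂ) := by
  rw [parsevalInvZeta, ← integral_complex_ofReal]
  refine integral_congr_ae (Eventually.of_forall fun t => ?_)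
  have e : (σ:ℂ) - t * I = (starRingEnd ℂ) (σ + t * I) := by simp [sub_eq_add_neg]
  simp only
  rw [e, H.invZetaDiv_conj, mul_conj, normSq_eq_norm_sq]

end StripBounds

section ParsevalShift

/-- Landau's lemma for Laplace transforms of nonnegative functions: an analytic continuation to
`Re w > 1/2` of the transform forces convergence there. -/
lemma lintegral_laplace_of_continuation {g : ℝ → ℝ} (hg : Measurable g) (hg0 : ∀ y, 0 ≤ g y)
    (hneg : ∀ y < 0, g y = 0) {Φ : ℂ → ℂ} (hΦ : ∀ w : ℂ, 1 / 2 < w.re → DifferentiableAt ℂ Φ w)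
    (hint : ∀ σ : ℝ, 1 < σ → Integrable fun y => g y * Real.exp (-(2 * σ) * y))
    (heq : ∀ σ : ℝ, 1 < σ → Φ σ = ((∫ y, g y * Real.exp (-(2 * σ) * y) : ℝ) : ℂ))
    {a : ℝ} (ha : 1 / 2 < a) (ha2 : a < 2) :
    ∫⁻ y, ENNReal.ofReal (g y * Real.exp (-(2 * a) * y)) = ENNReal.ofReal (Φ a).re := by
  set G : ℝ → ENNReal := fun y => ENNReal.ofReal (g y) with hG
  have hGm : Measurable G := hg.ennreal_ofReal
  have hGt : ∀ᵐ y : ℝ, G y < ⊤ := Eventually.of_forall fun y => ENNReal.ofReal_lt_top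
  have hGr : ∀ y, (G y).toReal = g y := fun y => ENNReal.toReal_ofReal (hg0 y)
  set μ : Measure ℝ := volume.withDensity G with hμ
  set X : ℝ → ℝ := fun y => -2 * y with hX
  have hsub : Set.Ioi (1:ℝ) ⊆ interior (ProbabilityTheory.integrableExpSet X μ) := by
    refine interior_maximal (fun t ht => ?_) isOpen_Ioi
    change Integrable (fun y => Real.exp (t * X y)) μ
    rw [hμ, integrable_withDensity_iff hGm hGt]
    refine (hint t ht).congr (Eventually.of_forall fun y => ?_)
    simp only [hGr, hX]
    rw [mul_comm]
    congr 2
    ring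
  have hval : ∀ σ : ℝ, 1 < σ → Φ σ = ProbabilityTheory.complexMGF X μ σ := by
    intro σ hσ
    rw [heq σ hσ, ProbabilityTheory.complexMGF, hμ, integral_withDensity_eq_integral_toReal_smul hGm hGt,
      ← integral_complex_ofReal]
    refine integral_congr_ae (Eventually.of_forall fun y => ?_)
    simp only [hGr, hX, real_smul]
    push_cast
    congr 2
    ring
  have hopen : IsOpen {w : ℂ | 1 < w.re} := isOpen_lt continuous_const continuous_re
  have hEq : Set.EqOn Φ (ProbabilityTheory.complexMGF X μ) {w : ℂ | 1 < w.re} := by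
    refine AnalyticOnNhd.eqOn_of_preconnected_of_frequently_eq (z₀ := 2) ?_ ?_ ?_ (by simp) ?_
    · refine DifferentiableOn.analyticOnNhd (fun w hw => ?_) hopen
      refine (hΦ w ?_).differentiableWithinAt
      have : 1 < w.re := hw
      linarith
    · exact fun w hw => ProbabilityTheory.analyticOnNhd_complexMGF w (hsub hw)
    · exact (convex_halfSpace_re_gt 1).isPreconnected
    · have hlim : Tendsto (fun x : ℝ => (x : ℂ)) (𝓝[≠] 2) (𝓝[≠] (2:ℂ)) := by
        refine tendsto_nhdsWithin_iff.mpr ⟨?_, ?_⟩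
        · exact (continuous_ofReal.tendsto' 2 2 (by simp)).mono_left nhdsWithin_le_nhds
        · filter_upwards [self_mem_nhdsWithin] with x hx
          have hx' : x ≠ 2 := hx
          change (x:ℂ) ≠ 2
          exact_mod_cast hx'
      refine hlim.frequently (Eventually.frequently ?_)
      filter_upwards [nhdsWithin_le_nhds (lt_mem_nhds (show (1:ℝ) < 2 by norm_num))] with x hx
      exact hval x hx
  have h2mem : (2:ℂ) ∈ {w : ℂ | 1 < w.re} := by simp
  have hev : Φ =ᶠ[𝓝 2] ProbabilityTheory.complexMGF X μ :=
    Filter.eventuallyEq_of_mem (hopen.mem_nhds h2mem) hEq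
  have h2int : (2:ℝ) ∈ interior (ProbabilityTheory.integrableExpSet X μ) := hsub (by simp)
  set h : ℕ → ℝ → ℝ := fun n y => ((n.factorial : ℝ))⁻¹ * ((a - 2) ^ n * (g y * (X y ^ n * Real.exp (2 * X y)))) with hh
  have hpow : ∀ n y, h n y = g y * Real.exp (-4 * y) * (((2 - a) * (2 * y)) ^ n / n.factorial) := by
    intro n y
    simp only [hh, hX]
    have e1 : (2 - a) * (2 * y) = (a - 2) * (-2 * y) := by ring
    have e2 : 2 * (-2 * y) = -4 * y := by ring
    rw [e1, e2, mul_pow (a - 2)]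
    ring
  have hh0 : ∀ n y, 0 ≤ h n y := by
    intro n y
    rw [hpow]
    rcases lt_or_ge y 0 with hy | hy
    · rw [hneg y hy]; simp
    · have : 0 ≤ 2 - a := by linarith
      have := hg0 y
      positivity
  have hhint : ∀ n, Integrable (h n) := by
    intro n
    have h1 := ProbabilityTheory.integrable_pow_mul_exp_of_mem_interior_integrableExpSet h2int n
    rw [hμ, integrable_withDensity_iff hGm hGt] at h1
    refine (h1.const_mul (((n.factorial : ℝ))⁻¹ * (a - 2) ^ n)).congr (Eventually.of_forall fun y => ?_)
    simp only [hGr, hh]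
    ring
  have hsum : HasSum (fun n => ((∫ y, h n y : ℝ) : ℂ)) (Φ a) := by
    have hT := Complex.hasSum_taylorSeries_on_ball (f := Φ) (c := 2) (r := 3 / 2) (fun w hw => by
      refine (hΦ w ?_).differentiableWithinAt
      rw [mem_ball_iff_norm] at hw
      have := abs_lt.mp ((abs_re_le_norm (w - 2)).trans_lt hw)
      simp only [sub_re, re_ofNat] at this
      linarith) (z := (a:ℂ)) (by
      rw [mem_ball_iff_norm, show (a:ℂ) - 2 = ((a - 2 : ℝ) : ℂ) by push_cast; ring, norm_real, Real.norm_eq_abs, abs_lt]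
      constructor <;> linarith)
    refine hT.congr_fun fun n => ?_
    rw [hev.iteratedDeriv_eq n, ProbabilityTheory.iteratedDeriv_complexMGF (by simpa using h2int), hμ,
      integral_withDensity_eq_integral_toReal_smul hGm hGt]
    simp only [smul_eq_mul]
    rw [← integral_const_mul, ← integral_const_mul, ← integral_complex_ofReal]
    refine integral_congr_ae (Eventually.of_forall fun y => ?_)
    simp only [hGr, hh, real_smul]
    push_cast
    rfl
  have hsumR : HasSum (fun n => ∫ y, h n y) (Φ a).re := by
    have := Complex.hasSum_re hsum
    simpa using this
  have hexp : ∀ y, HasSum (fun n => h n y) (g y * Real.exp (-(2 * a) * y)) := by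
    intro y
    have h1 := (NormedSpace.expSeries_div_hasSum_exp ((2 - a) * (2 * y))).mul_left (g y * Real.exp (-4 * y))
    rw [← Real.exp_eq_exp_ℝ, mul_assoc, ← Real.exp_add] at h1
    have e1 : -4 * y + (2 - a) * (2 * y) = -(2 * a) * y := by ring
    rw [e1] at h1
    exact h1.congr_fun fun n => hpow n y
  calc ∫⁻ y, ENNReal.ofReal (g y * Real.exp (-(2 * a) * y))
      = ∫⁻ y, ∑' n, ENNReal.ofReal (h n y) := by
        refine lintegral_congr fun y => ?_
        rw [← (hexp y).tsum_eq, ENNReal.ofReal_tsum_of_nonneg (fun n => hh0 n y) (hexp y).summable]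
    _ = ∑' n, ∫⁻ y, ENNReal.ofReal (h n y) :=
        lintegral_tsum fun n => (hhint n).aestronglyMeasurable.aemeasurable.ennreal_ofReal
    _ = ∑' n, ENNReal.ofReal (∫ y, h n y) := by
        congr 1
        funext n
        rw [ofReal_integral_eq_lintegral_ofReal (hhint n) (Eventually.of_forall (hh0 n))]
    _ = ENNReal.ofReal (Φ a).re := by
        rw [← ENNReal.ofReal_tsum_of_nonneg (fun n => integral_nonneg (hh0 n)) hsumR.summable, hsumR.tsum_eq]

variable {K : Type} [Field K] [NumberField K] {Z E : ℂ → ℂ}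

lemma integral_mertensK_sq_of_half_lt (hZ : IsDedekindZeta K Z) (H : RHData Z E) {a : ℝ} (ha : 1 / 2 < a)
    (ha2 : a < 2) :
    ∫⁻ y : ℝ, ENNReal.ofReal (mertensK K (Real.exp y) ^ 2 * Real.exp (-(2 * a) * y)) =
      ENNReal.ofReal ((2 * Real.pi)⁻¹ * ∫ t : ℝ, ‖invZetaDiv E (a + t * I)‖ ^ 2) := by
  have h := lintegral_laplace_of_continuation (g := fun y => mertensK K (Real.exp y) ^ 2)
    ((measurable_mertensK_exp hZ).pow_const 2) (fun y => sq_nonneg _)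
    (fun y hy => by rw [mertensK_exp_of_neg hy]; simp)
    (Φ := fun w => ((2 * Real.pi)⁻¹ : ℝ) * parsevalInvZeta E w)
    (fun w hw => (H.differentiableAt_parsevalInvZeta hw).const_mul _)
    (fun σ hσ => by
      refine (integrable_of_mertensK_bound hZ hσ two_ne_zero).congr (Eventually.of_forall fun y => ?_)
      simp only
      rw [sq_abs, mul_pow, ← Real.exp_nat_mul]
      push_cast
      ring_nf)
    (fun σ hσ => by rw [integral_mertensK_sq hZ H hσ, H.parsevalInvZeta_ofReal, ofReal_mul]) ha ha2
  rw [h, H.parsevalInvZeta_ofReal, ← ofReal_mul, ofReal_re]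

end ParsevalShift

section Tauberian

lemma integrable_laplace_mul {f : ℝ → ℝ} (hneg : ∀ y < 0, f y = 0) {δ : ℝ} (hδ : 0 < δ)
    (hint : Integrable fun y => f y * Real.exp (-δ * y)) {q : ℝ → ℝ} (hq : Continuous q) :
    Integrable fun y => f y * Real.exp (-δ * y) * q (Real.exp (-δ * y)) := by
  obtain ⟨C, hC⟩ := isCompact_Icc.exists_bound_of_continuousOn (f := q) (s := Set.Icc (0:ℝ) 1) hq.continuousOn
  refine (hint.norm.const_mul C).mono' (hint.aestronglyMeasurable.mul (by fun_prop))
    (Eventually.of_forall fun y => ?_)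
  rw [norm_mul, mul_comm]
  rcases lt_or_ge y 0 with hy | hy
  · simp [hneg y hy]
  · refine mul_le_mul_of_nonneg_right (hC _ ⟨(Real.exp_pos _).le, Real.exp_le_one_iff.mpr ?_⟩) (norm_nonneg _)
    nlinarith

lemma tendsto_laplace_polynomial {f : ℝ → ℝ} (hneg : ∀ y < 0, f y = 0)
    (hint : ∀ δ : ℝ, 0 < δ → Integrable fun y => f y * Real.exp (-δ * y)) {A : ℝ}
    (hlim : Tendsto (fun δ : ℝ => δ * ∫ y, f y * Real.exp (-δ * y)) (𝓝[>] 0) (𝓝 A)) (p : Polynomial ℝ) :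
    Tendsto (fun δ : ℝ => δ * ∫ y, f y * Real.exp (-δ * y) * p.eval (Real.exp (-δ * y))) (𝓝[>] 0)
      (𝓝 (A * ∫ x in (0:ℝ)..1, p.eval x)) := by
  induction p using Polynomial.induction_on' with
  | add p q hp hq =>
    have e1 : ∫ x in (0:ℝ)..1, (p + q).eval x = (∫ x in (0:ℝ)..1, p.eval x) + ∫ x in (0:ℝ)..1, q.eval x := by
      simp only [Polynomial.eval_add]
      exact intervalIntegral.integral_add (p.continuous.intervalIntegrable _ _) (q.continuous.intervalIntegrable _ _)
    rw [e1, mul_add]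
    refine (hp.add hq).congr' ?_
    filter_upwards [self_mem_nhdsWithin] with δ hδ
    rw [← mul_add, ← integral_add (integrable_laplace_mul hneg hδ (hint δ hδ) p.continuous)
      (integrable_laplace_mul hneg hδ (hint δ hδ) q.continuous)]
    simp only [Polynomial.eval_add, mul_add]
  | monomial n c =>
    have hn : (0:ℝ) < n + 1 := by positivity
    have e1 : A * ∫ x in (0:ℝ)..1, (Polynomial.monomial n c).eval x = c / (n + 1) * A := by
      simp only [Polynomial.eval_monomial]
      rw [intervalIntegral.integral_const_mul, integral_pow]
      simp
      ring
    rw [e1]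
    have h1 : Tendsto (fun δ : ℝ => (n + 1) * δ) (𝓝[>] 0) (𝓝[>] 0) := by
      refine tendsto_nhdsWithin_iff.mpr ⟨?_, ?_⟩
      · exact ((continuous_const.mul continuous_id).tendsto' 0 0 (by simp)).mono_left nhdsWithin_le_nhds
      · filter_upwards [self_mem_nhdsWithin] with δ hδ
        exact mul_pos hn hδ
    refine ((hlim.comp h1).const_mul (c / (n + 1))).congr fun δ => ?_
    have e2 : ∀ y, f y * Real.exp (-δ * y) * (Polynomial.monomial n c).eval (Real.exp (-δ * y)) =
        c * (f y * Real.exp (-((n + 1) * δ) * y)) := by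
      intro y
      rw [Polynomial.eval_monomial, ← Real.exp_nat_mul,
        show -((n + 1) * δ) * y = -δ * y + n * (-δ * y) by ring, Real.exp_add]
      ring
    simp only [e2, Function.comp_apply]
    rw [integral_const_mul]
    field_simp

lemma tendsto_laplace_continuous {f : ℝ → ℝ} (hf0 : ∀ y, 0 ≤ f y) (hneg : ∀ y < 0, f y = 0)
    (hint : ∀ δ : ℝ, 0 < δ → Integrable fun y => f y * Real.exp (-δ * y)) {A : ℝ}
    (hlim : Tendsto (fun δ : ℝ => δ * ∫ y, f y * Real.exp (-δ * y)) (𝓝[>] 0) (𝓝 A)) {q : ℝ → ℝ}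
    (hq : Continuous q) :
    Tendsto (fun δ : ℝ => δ * ∫ y, f y * Real.exp (-δ * y) * q (Real.exp (-δ * y))) (𝓝[>] 0)
      (𝓝 (A * ∫ x in (0:ℝ)..1, q x)) := by
  have hA : 0 ≤ A := by
    refine ge_of_tendsto hlim ?_
    filter_upwards [self_mem_nhdsWithin] with δ hδ
    exact mul_nonneg (le_of_lt hδ) (integral_nonneg fun y => mul_nonneg (hf0 y) (Real.exp_pos _).le)
  rw [Metric.tendsto_nhds]
  intro ε hε
  set η : ℝ := ε / (2 * A + 2) with hη
  have hη0 : 0 < η := by positivity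
  obtain ⟨p, hp⟩ := exists_polynomial_near_of_continuousOn 0 1 q hq.continuousOn η hη0
  have h1 := tendsto_laplace_polynomial hneg hint hlim p
  have hJ : |(∫ x in (0:ℝ)..1, p.eval x) - ∫ x in (0:ℝ)..1, q x| ≤ η := by
    rw [← intervalIntegral.integral_sub (p.continuous.intervalIntegrable _ _) (hq.intervalIntegrable _ _)]
    have := intervalIntegral.norm_integral_le_of_norm_le_const (a := (0:ℝ)) (b := 1) (C := η)
      (f := fun x => p.eval x - q x) (fun x hx => by
        rw [Set.uIoc_of_le zero_le_one] at hx
        exact (hp x ⟨hx.1.le, hx.2⟩).le)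
    simpa using this
  have hlt : A * η + η * A < ε := by
    have : η * (2 * A + 2) = ε := div_mul_cancel₀ _ (by positivity)
    nlinarith
  have hev : Tendsto (fun δ : ℝ => |δ * (∫ y, f y * Real.exp (-δ * y) * p.eval (Real.exp (-δ * y))) -
      A * ∫ x in (0:ℝ)..1, p.eval x| + (A * η + η * (δ * ∫ y, f y * Real.exp (-δ * y)))) (𝓝[>] 0)
      (𝓝 (0 + (A * η + η * A))) := by
    refine Tendsto.add ?_ ((hlim.const_mul η).const_add _)
    have := (h1.sub_const (A * ∫ x in (0:ℝ)..1, p.eval x)).abs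
    simpa using this
  rw [zero_add] at hev
  filter_upwards [hev.eventually_lt_const hlt, self_mem_nhdsWithin] with δ hδ1 hδ
  have hδ0 : 0 < δ := hδ
  refine lt_of_le_of_lt ?_ hδ1
  have hI : |(δ * ∫ y, f y * Real.exp (-δ * y) * q (Real.exp (-δ * y))) -
      δ * ∫ y, f y * Real.exp (-δ * y) * p.eval (Real.exp (-δ * y))| ≤ η * (δ * ∫ y, f y * Real.exp (-δ * y)) := by
    rw [← mul_sub, ← integral_sub (integrable_laplace_mul hneg hδ0 (hint δ hδ0) hq)
      (integrable_laplace_mul hneg hδ0 (hint δ hδ0) p.continuous), abs_mul, abs_of_pos hδ0, mul_left_comm]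
    refine mul_le_mul_of_nonneg_left ?_ hδ0.le
    rw [← integral_const_mul, ← Real.norm_eq_abs]
    refine norm_integral_le_of_norm_le ((hint δ hδ0).const_mul η) (Eventually.of_forall fun y => ?_)
    rw [← mul_sub, Real.norm_eq_abs, abs_mul, abs_of_nonneg (mul_nonneg (hf0 y) (Real.exp_pos _).le), mul_comm]
    rcases lt_or_ge y 0 with hy | hy
    · simp [hneg y hy]
    · refine mul_le_mul_of_nonneg_right ?_ (mul_nonneg (hf0 y) (Real.exp_pos _).le)
      rw [abs_sub_comm]
      refine (hp _ ⟨(Real.exp_pos _).le, Real.exp_le_one_iff.mpr ?_⟩).le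
      nlinarith
  have hJ' : |A * (∫ x in (0:ℝ)..1, p.eval x) - A * ∫ x in (0:ℝ)..1, q x| ≤ A * η := by
    rw [← mul_sub, abs_mul, abs_of_nonneg hA]
    exact mul_le_mul_of_nonneg_left hJ hA
  rw [Real.dist_eq]
  set a := δ * ∫ y, f y * Real.exp (-δ * y) * q (Real.exp (-δ * y))
  set b := δ * ∫ y, f y * Real.exp (-δ * y) * p.eval (Real.exp (-δ * y))
  set c := A * ∫ x in (0:ℝ)..1, p.eval x
  set d := A * ∫ x in (0:ℝ)..1, q x
  have t1 := abs_sub_le a b d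
  have t2 := abs_sub_le b c d
  linarith

lemma integral_inv_exp_neg_one : ∫ x in (Real.exp (-1))..1, x⁻¹ = 1 := by
  rw [integral_inv_of_pos (Real.exp_pos _) one_pos, one_div, ← Real.exp_neg, Real.log_exp, neg_neg]

/-- A continuous majorant of `x⁻¹` cut off below `e⁻¹`. -/
def cutoffUpper (n : ℕ) (x : ℝ) : ℝ := (max x (Real.exp (-1)))⁻¹ * (min (Real.exp 1 * x) 1) ^ n

/-- A continuous minorant of `x⁻¹` cut off below `e⁻¹`. -/
def cutoffLower (n : ℕ) (x : ℝ) : ℝ :=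
  (max x (Real.exp (-1)))⁻¹ * (1 - ((Real.exp 1 * max x (Real.exp (-1)))⁻¹) ^ n)

lemma max_exp_pos (x : ℝ) : 0 < max x (Real.exp (-1)) := lt_max_of_lt_right (Real.exp_pos _)

lemma continuous_cutoffUpper (n : ℕ) : Continuous (cutoffUpper n) := by
  unfold cutoffUpper
  exact ((continuous_id.max continuous_const).inv₀ fun x => (max_exp_pos x).ne').mul (by fun_prop)

lemma continuous_cutoffLower (n : ℕ) : Continuous (cutoffLower n) := by
  unfold cutoffLower
  refine ((continuous_id.max continuous_const).inv₀ fun x => (max_exp_pos x).ne').mul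
    (continuous_const.sub (Continuous.pow ?_ n))
  exact (continuous_const.mul (continuous_id.max continuous_const)).inv₀ fun x =>
    (mul_pos (Real.exp_pos _) (max_exp_pos x)).ne'

lemma exp_one_mul_exp_neg_one : Real.exp 1 * Real.exp (-1) = 1 := by
  rw [← Real.exp_add]; simp

lemma one_le_exp_mul {x : ℝ} (hx : Real.exp (-1) ≤ x) : 1 ≤ Real.exp 1 * x :=
  exp_one_mul_exp_neg_one.symm.trans_le (mul_le_mul_of_nonneg_left hx (Real.exp_pos _).le)

lemma exp_mul_le_one {x : ℝ} (hx : x ≤ Real.exp (-1)) : Real.exp 1 * x ≤ 1 :=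
  (mul_le_mul_of_nonneg_left hx (Real.exp_pos _).le).trans_eq exp_one_mul_exp_neg_one

lemma cutoffUpper_of_le {n : ℕ} {x : ℝ} (hx : Real.exp (-1) ≤ x) : cutoffUpper n x = x⁻¹ := by
  rw [cutoffUpper, max_eq_left hx, min_eq_right (one_le_exp_mul hx), one_pow, mul_one]

lemma cutoffUpper_of_ge {n : ℕ} {x : ℝ} (hx : x ≤ Real.exp (-1)) :
    cutoffUpper n x = Real.exp 1 ^ (n + 1) * x ^ n := by
  rw [cutoffUpper, max_eq_right hx, min_eq_left (exp_mul_le_one hx), ← Real.exp_neg, neg_neg]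
  ring

lemma cutoffUpper_nonneg {n : ℕ} {x : ℝ} (hx : 0 ≤ x) : 0 ≤ cutoffUpper n x := by
  unfold cutoffUpper
  positivity

lemma cutoffLower_of_ge {n : ℕ} {x : ℝ} (hx : x ≤ Real.exp (-1)) : cutoffLower n x = 0 := by
  rw [cutoffLower, max_eq_right hx, exp_one_mul_exp_neg_one]
  simp

lemma cutoffLower_of_le {n : ℕ} {x : ℝ} (hx : Real.exp (-1) ≤ x) :
    cutoffLower n x = x⁻¹ - (Real.exp 1 ^ n)⁻¹ * x ^ (-(n + 1 : ℤ)) := by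
  have hx0 : 0 < x := (Real.exp_pos _).trans_le hx
  rw [cutoffLower, max_eq_left hx, zpow_neg, show (n + 1 : ℤ) = ((n + 1 : ℕ) : ℤ) by push_cast; ring, zpow_natCast,
    mul_inv, mul_pow, pow_succ, mul_inv, inv_pow, inv_pow]
  ring

lemma cutoffLower_le {n : ℕ} {x : ℝ} (hx : Real.exp (-1) ≤ x) : cutoffLower n x ≤ x⁻¹ := by
  have hx0 : 0 < x := (Real.exp_pos _).trans_le hx
  rw [cutoffLower_of_le hx]
  have : 0 ≤ (Real.exp 1 ^ n)⁻¹ * x ^ (-(n + 1 : ℤ)) := by positivity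
  linarith

lemma integral_cutoffUpper (n : ℕ) : ∫ x in (0:ℝ)..1, cutoffUpper n x = 1 + 1 / (n + 1) := by
  have hle : Real.exp (-1) ≤ 1 := Real.exp_le_one_iff.mpr (by norm_num)
  rw [← intervalIntegral.integral_add_adjacent_intervals (b := Real.exp (-1))
    ((continuous_cutoffUpper n).intervalIntegrable _ _) ((continuous_cutoffUpper n).intervalIntegrable _ _)]
  have e1 : ∫ x in (0:ℝ)..Real.exp (-1), cutoffUpper n x = 1 / (n + 1) := by
    rw [intervalIntegral.integral_congr (g := fun x => Real.exp 1 ^ (n + 1) * x ^ n) (fun x hx => by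
      rw [Set.uIcc_of_le (Real.exp_pos _).le] at hx
      exact cutoffUpper_of_ge hx.2)]
    rw [intervalIntegral.integral_const_mul, integral_pow, zero_pow (by omega), sub_zero, ← mul_div_assoc, ← mul_pow,
      exp_one_mul_exp_neg_one, one_pow]
  have e2 : ∫ x in (Real.exp (-1))..1, cutoffUpper n x = 1 := by
    refine (intervalIntegral.integral_congr (g := fun x : ℝ => x⁻¹) fun x hx => ?_).trans integral_inv_exp_neg_one
    rw [Set.uIcc_of_le hle] at hx
    exact cutoffUpper_of_le hx.1
  rw [e1, e2, add_comm]

lemma le_integral_cutoffLower {n : ℕ} (hn : n ≠ 0) : 1 - 1 / n ≤ ∫ x in (0:ℝ)..1, cutoffLower n x := by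
  have hle : Real.exp (-1) ≤ 1 := Real.exp_le_one_iff.mpr (by norm_num)
  have hn0 : (0:ℝ) < n := by positivity
  have h0 : (0:ℝ) ∉ Set.uIcc (Real.exp (-1)) 1 := by
    rw [Set.uIcc_of_le hle]
    exact fun h => absurd h.1 (not_le.mpr (Real.exp_pos _))
  rw [← intervalIntegral.integral_add_adjacent_intervals (a := (0:ℝ)) (b := Real.exp (-1)) (c := 1)
    ((continuous_cutoffLower n).intervalIntegrable _ _) ((continuous_cutoffLower n).intervalIntegrable _ _)]
  have e1 : ∫ x in (0:ℝ)..Real.exp (-1), cutoffLower n x = 0 := by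
    rw [intervalIntegral.integral_congr (g := fun _ => (0:ℝ)) (fun x hx => by
      rw [Set.uIcc_of_le (Real.exp_pos _).le] at hx
      exact cutoffLower_of_ge hx.2)]
    simp
  have e2 : ∫ x in (Real.exp (-1))..1, cutoffLower n x =
      1 - (Real.exp 1 ^ n)⁻¹ * ((Real.exp 1 ^ n - 1) / n) := by
    rw [intervalIntegral.integral_congr (g := fun x => x⁻¹ - (Real.exp 1 ^ n)⁻¹ * x ^ (-(n + 1 : ℤ))) (fun x hx => by
      rw [Set.uIcc_of_le hle] at hx
      exact cutoffLower_of_le hx.1)]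
    rw [intervalIntegral.integral_sub (intervalIntegral.intervalIntegrable_inv (fun x hx h => h0 (h ▸ hx)) continuousOn_id)
      ((intervalIntegral.intervalIntegrable_zpow (Or.inr h0)).const_mul _), integral_inv_exp_neg_one,
      intervalIntegral.integral_const_mul, integral_zpow (Or.inr ⟨by omega, h0⟩)]
    congr 2
    rw [show (-(n + 1 : ℤ) + 1) = -(n : ℤ) by ring, zpow_neg, zpow_neg, zpow_natCast, zpow_natCast, one_pow, inv_one,
      ← inv_pow, ← Real.exp_neg, neg_neg]
    push_cast
    rw [show (-((n:ℝ) + 1) + 1) = -n by ring, div_neg, ← neg_div, neg_sub]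
  rw [e1, e2, zero_add]
  have hp : 0 < Real.exp 1 ^ n := by positivity
  have : (Real.exp 1 ^ n)⁻¹ * ((Real.exp 1 ^ n - 1) / n) ≤ 1 / n := by
    rw [← mul_div_assoc]
    gcongr
    rw [inv_mul_le_iff₀ hp]
    linarith
  linarith

/-- Karamata's Tauberian theorem for nonnegative functions. -/
lemma tendsto_mean_of_laplace {f : ℝ → ℝ} (hf0 : ∀ y, 0 ≤ f y) (hneg : ∀ y < 0, f y = 0)
    (hint : ∀ δ : ℝ, 0 < δ → Integrable fun y => f y * Real.exp (-δ * y)) {A : ℝ}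
    (hlim : Tendsto (fun δ : ℝ => δ * ∫ y, f y * Real.exp (-δ * y)) (𝓝[>] 0) (𝓝 A)) :
    Tendsto (fun Y : ℝ => (∫ y in (0:ℝ)..Y, f y) / Y) atTop (𝓝 A) := by
  have hA : 0 ≤ A := by
    refine ge_of_tendsto hlim ?_
    filter_upwards [self_mem_nhdsWithin] with δ hδ
    exact mul_nonneg (le_of_lt hδ) (integral_nonneg fun y => mul_nonneg (hf0 y) (Real.exp_pos _).le)
  have hU := fun n => tendsto_laplace_continuous hf0 hneg hint hlim (continuous_cutoffUpper n)
  have hL := fun n => tendsto_laplace_continuous hf0 hneg hint hlim (continuous_cutoffLower n)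
  have hexp : ∀ Y : ℝ, 0 < Y → ∀ y, Real.exp (-1) ≤ Real.exp (-Y⁻¹ * y) ↔ y ≤ Y := by
    intro Y hY y
    rw [Real.exp_le_exp, neg_mul, neg_le_neg_iff, inv_mul_le_iff₀ hY, mul_one]
  have hind : ∀ Y : ℝ, 0 < Y → ∫ y in (0:ℝ)..Y, f y = ∫ y, (Set.Iic Y).indicator f y := by
    intro Y hY
    rw [intervalIntegral.integral_of_le hY.le, ← integral_indicator measurableSet_Ioc]
    refine integral_congr_ae ?_
    filter_upwards [Measure.ae_ne volume (0:ℝ)] with y hy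
    rcases lt_or_gt_of_ne hy with h | h
    · rw [Set.indicator_of_notMem (fun h' => absurd h'.1 (not_lt.mpr h.le)),
        Set.indicator_of_mem (Set.mem_Iic.mpr (h.trans hY).le), hneg y h]
    · by_cases hyY : y ≤ Y
      · rw [Set.indicator_of_mem (show y ∈ Set.Ioc 0 Y from ⟨h, hyY⟩), Set.indicator_of_mem (Set.mem_Iic.mpr hyY)]
      · rw [Set.indicator_of_notMem (fun h' => hyY h'.2), Set.indicator_of_notMem (show y ∉ Set.Iic Y from hyY)]
  have hfm : AEStronglyMeasurable f volume := by
    refine ((hint 1 one_pos).aestronglyMeasurable.mul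
      (show AEStronglyMeasurable (fun y : ℝ => Real.exp y) volume by fun_prop)).congr (Eventually.of_forall fun y => ?_)
    simp only [Pi.mul_apply]
    rw [mul_assoc, ← Real.exp_add]
    simp
  have hup : ∀ n, ∀ Y : ℝ, 0 < Y → ∀ y, (Set.Iic Y).indicator f y ≤
      f y * Real.exp (-Y⁻¹ * y) * cutoffUpper n (Real.exp (-Y⁻¹ * y)) := by
    intro n Y hY y
    by_cases hyY : y ≤ Y
    · rw [Set.indicator_of_mem (Set.mem_Iic.mpr hyY), cutoffUpper_of_le ((hexp Y hY y).mpr hyY), mul_assoc,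
        mul_inv_cancel₀ (Real.exp_pos _).ne', mul_one]
    · rw [Set.indicator_of_notMem (show y ∉ Set.Iic Y from hyY)]
      exact mul_nonneg (mul_nonneg (hf0 y) (Real.exp_pos _).le) (cutoffUpper_nonneg (Real.exp_pos _).le)
  have hlo : ∀ n, ∀ Y : ℝ, 0 < Y → ∀ y, f y * Real.exp (-Y⁻¹ * y) * cutoffLower n (Real.exp (-Y⁻¹ * y)) ≤
      (Set.Iic Y).indicator f y := by
    intro n Y hY y
    by_cases hyY : y ≤ Y
    · rw [Set.indicator_of_mem (Set.mem_Iic.mpr hyY)]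
      refine (mul_le_mul_of_nonneg_left (cutoffLower_le ((hexp Y hY y).mpr hyY))
        (mul_nonneg (hf0 y) (Real.exp_pos _).le)).trans_eq ?_
      rw [mul_assoc, mul_inv_cancel₀ (Real.exp_pos _).ne', mul_one]
    · rw [Set.indicator_of_notMem (show y ∉ Set.Iic Y from hyY), cutoffLower_of_ge, mul_zero]
      by_contra h
      exact hyY ((hexp Y hY y).mp (not_le.mp h).le)
  have hUi : ∀ n, ∀ Y : ℝ, 0 < Y → Integrable fun y => f y * Real.exp (-Y⁻¹ * y) * cutoffUpper n (Real.exp (-Y⁻¹ * y)) :=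
    fun n Y hY => integrable_laplace_mul hneg (inv_pos.mpr hY) (hint _ (inv_pos.mpr hY)) (continuous_cutoffUpper n)
  have hLi : ∀ n, ∀ Y : ℝ, 0 < Y → Integrable fun y => f y * Real.exp (-Y⁻¹ * y) * cutoffLower n (Real.exp (-Y⁻¹ * y)) :=
    fun n Y hY => integrable_laplace_mul hneg (inv_pos.mpr hY) (hint _ (inv_pos.mpr hY)) (continuous_cutoffLower n)
  have hIi : ∀ Y : ℝ, 0 < Y → Integrable ((Set.Iic Y).indicator f) := fun Y hY =>
    (hUi 0 Y hY).mono' (hfm.indicator measurableSet_Iic) (Eventually.of_forall fun y => by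
      rw [Real.norm_of_nonneg (Set.indicator_nonneg (fun y _ => hf0 y) y)]
      exact hup 0 Y hY y)
  have hinv : Tendsto (fun Y : ℝ => Y⁻¹) atTop (𝓝[>] 0) := tendsto_inv_atTop_nhdsGT_zero
  refine tendsto_order.mpr ⟨fun a ha => ?_, fun b hb => ?_⟩
  · have h1 : Tendsto (fun n : ℕ => A * (1 - 1 / (n:ℝ))) atTop (𝓝 A) := by
      simpa using (tendsto_one_div_atTop_nhds_zero_nat.const_sub 1).const_mul A
    obtain ⟨n, hn, hn0⟩ := ((h1.eventually_const_lt ha).and (eventually_ne_atTop 0)).exists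
    have h2 : a < A * ∫ x in (0:ℝ)..1, cutoffLower n x :=
      hn.trans_le (mul_le_mul_of_nonneg_left (le_integral_cutoffLower hn0) hA)
    filter_upwards [((hL n).comp hinv).eventually_const_lt h2, eventually_gt_atTop 0] with Y hY hY0
    refine hY.trans_le ?_
    rw [hind Y hY0, div_eq_inv_mul]
    exact mul_le_mul_of_nonneg_left (integral_mono (hLi n Y hY0) (hIi Y hY0) (hlo n Y hY0)) (inv_pos.mpr hY0).le
  · have h1 : Tendsto (fun n : ℕ => A * (1 + 1 / ((n:ℝ) + 1))) atTop (𝓝 A) := by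
      simpa using (tendsto_one_div_add_atTop_nhds_zero_nat.const_add 1).const_mul A
    obtain ⟨n, hn⟩ := (h1.eventually_lt_const hb).exists
    rw [← integral_cutoffUpper] at hn
    filter_upwards [((hU n).comp hinv).eventually_lt_const hn, eventually_gt_atTop 0] with Y hY hY0
    refine lt_of_le_of_lt ?_ hY
    rw [hind Y hY0, div_eq_inv_mul]
    exact mul_le_mul_of_nonneg_left (integral_mono (hIi Y hY0) (hUi n Y hY0) (hup n Y hY0)) (inv_pos.mpr hY0).le

end Tauberian

section WeakMertens
variable {K : Type} [Field K] [NumberField K]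

lemma exists_rhData {Z : ℂ → ℂ} (hZ : IsDedekindZeta K Z) (hRH : ZetaRH Z)
    (hsimple : ∀ ρ : ℂ, Z ρ = 0 → 0 < ρ.re → ρ.re < 1 → deriv Z ρ ≠ 0) : ∃ E, RHData Z E := by
  obtain ⟨E, hE, h1, hEZ, ⟨C, N, hC, hgrow⟩, hhalf⟩ := exists_entire hZ
  have hZ0 : ∀ s, s ≠ 1 → E s = 0 → Z s = 0 := fun s hs h => by
    rw [hEZ s hs] at h
    exact (mul_eq_zero.mp h).resolve_left (sub_ne_zero.mpr hs)
  have hcrit : ∀ ρ : ℂ, E ρ = 0 → 0 < ρ.re → ρ.re = 1 / 2 := by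
    intro ρ h0 hre
    have hne : ρ ≠ 1 := by
      rintro rfl
      exact h1 h0
    rcases lt_trichotomy ρ.re 1 with h | h | h
    · exact hRH ρ (hZ0 ρ hne h0) hre h
    · refine absurd h0 ?_
      have e : ρ = 1 + (ρ.im : ℝ) * I := by
        apply Complex.ext <;> simp [h]
      rw [e]
      exact zeta_ne_zero_on_one hZ hE h1 hEZ ρ.im
    · exact absurd (hZ0 ρ hne h0) (zeta_ne_zero_of_one_lt_re hZ h)
  have hconj1 : ∀ s, s ≠ 1 → E ((starRingEnd ℂ) s) = (starRingEnd ℂ) (E s) := by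
    intro s hs
    have hs' : (starRingEnd ℂ) s ≠ 1 := by
      intro h
      apply hs
      rw [← Complex.conj_conj s, h, map_one]
    rw [hEZ _ hs', hEZ s hs, zeta_conj hZ hs, map_mul, map_sub, map_one]
  refine ⟨E, ⟨hE, hEZ, ?_, hcrit, ?_, ?_, ?_, ?_, ?_⟩⟩
  · intro s hs h0
    have := hcrit s h0 (by linarith)
    linarith
  · intro ρ h0 hre
    have hne : ρ ≠ 1 := ne_one_of_re_half hre
    rw [deriv_mul_at_zero hEZ hne (hZ.1 ρ hne) (hZ0 ρ hne h0)]
    exact mul_ne_zero (sub_ne_zero.mpr hne) (hsimple ρ (hZ0 ρ hne h0) (by linarith) (by linarith))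
  · intro h0
    have hne : (1 / 2 : ℂ) ≠ 1 := by norm_num
    exact hsimple _ (hZ0 _ hne h0) (by norm_num) (by norm_num) (hhalf (hZ0 _ hne h0))
  · have hcl : Set.univ ⊆ {s : ℂ | E ((starRingEnd ℂ) s) = (starRingEnd ℂ) (E s)} := by
      rw [← (dense_compl_singleton (1 : ℂ)).closure_eq]
      refine closure_minimal (fun s hs => hconj1 s hs) (isClosed_eq ?_ ?_)
      · exact hE.continuous.comp Complex.continuous_conj
      · exact Complex.continuous_conj.comp hE.continuous
    exact fun s => hcl (Set.mem_univ s)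
  · obtain ⟨B, hB0, hB⟩ := exists_bound_zeta hZ (show (1:ℝ) < 3 / 2 by norm_num)
    obtain ⟨B', hB0', hB'⟩ := exists_bound_inv_zeta hZ (show (1:ℝ) < 3 / 2 by norm_num)
    exact ⟨max 1 (max B B'), le_max_left _ _, fun s hs =>
      ⟨(hB s hs).trans ((le_max_left _ _).trans (le_max_right _ _)),
        (hB' s hs).trans ((le_max_right _ _).trans (le_max_right _ _))⟩⟩
  · refine ⟨((2 * N + 1 : ℕ) : ℝ), max 8 C, by positivity, fun s hs1 hs2 hT => ?_⟩
    have h8 : 8 ≤ s.im := (le_max_left _ _).trans hT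
    have hCi : C ≤ s.im := (le_max_right _ _).trans hT
    have hne : s ≠ 1 := by
      rintro rfl
      norm_num at h8
    have hn : ‖s‖ ≤ 6 + s.im := by
      refine (Complex.norm_le_abs_re_add_abs_im s).trans ?_
      rw [abs_of_nonneg (by linarith : 0 ≤ s.im)]
      have : |s.re| ≤ 6 := abs_le.mpr ⟨by linarith, hs2⟩
      linarith
    have h1' : 1 ≤ ‖s - 1‖ := by
      refine le_trans ?_ (Complex.abs_im_le_norm (s - 1))
      simp only [sub_im, one_im, sub_zero]
      rw [abs_of_nonneg (by linarith)]
      linarith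
    rw [Real.rpow_natCast]
    calc ‖Z s‖ ≤ ‖s - 1‖ * ‖Z s‖ := le_mul_of_one_le_left (norm_nonneg _) h1'
      _ = ‖E s‖ := by rw [hEZ s hne, norm_mul]
      _ ≤ C * (‖s‖ + 2) ^ N := hgrow s hs1
      _ ≤ s.im * (s.im ^ 2) ^ N := by
        gcongr
        nlinarith
      _ = s.im ^ (2 * N + 1) := by ring

lemma RHData.integrable_norm_sq_invZetaDiv {Z E : ℂ → ℂ} (H : RHData Z E) {δ : ℝ} (hδ : 0 < δ) :
    Integrable fun t : ℝ => ‖invZetaDiv E ((1 / 2 + δ : ℝ) + t * I)‖ ^ 2 := by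
  obtain ⟨D, hD, hb⟩ := H.exists_bound_strip hδ (1 / 2 + δ)
  have hint : Integrable fun t : ℝ => D ^ 2 * (1 + ‖t‖) ^ (-(3 / 2) : ℝ) :=
    (integrable_one_add_norm (by rw [Module.finrank_self]; norm_num)).const_mul _
  refine hint.mono' (((H.continuous_invZetaDiv_line hδ).norm.pow 2).aestronglyMeasurable)
    (Eventually.of_forall fun t => ?_)
  have h0 : 0 ≤ 1 + |t| := by positivity
  have h := hb ((1 / 2 + δ : ℝ) + t * I) (by simp) (by simp)
  have him : (((1 / 2 + δ : ℝ) : ℂ) + t * I).im = t := by simp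
  rw [him] at h
  rw [Real.norm_of_nonneg (by positivity), Real.norm_eq_abs]
  refine (pow_le_pow_left₀ (norm_nonneg _) h 2).trans_eq ?_
  rw [mul_pow, ← Real.rpow_natCast ((1 + |t|) ^ _), ← Real.rpow_mul h0]
  norm_num

lemma RHData.integral_norm_sq_invZetaDiv {Z E : ℂ → ℂ} (H : RHData Z E) {δ : ℝ} (hδ : 0 < δ) :
    ∫ t : ℝ, ‖invZetaDiv E ((1 / 2 + δ : ℝ) + t * I)‖ ^ 2 =
      2 * ∫ t in Set.Ioi (0:ℝ), ‖invZetaDiv E ((1 / 2 + δ : ℝ) + t * I)‖ ^ 2 := by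
  have hint := H.integrable_norm_sq_invZetaDiv hδ
  rw [← intervalIntegral.integral_Iic_add_Ioi (b := 0) hint.integrableOn hint.integrableOn, two_mul]
  congr 1
  rw [← neg_zero, ← integral_comp_neg_Ioi, neg_zero]
  refine setIntegral_congr_fun measurableSet_Ioi fun t _ => ?_
  have e : (((1 / 2 + δ : ℝ) : ℂ) + ((-t : ℝ) : ℂ) * I) = (starRingEnd ℂ) ((1 / 2 + δ : ℝ) + t * I) := by
    rw [map_add, map_mul, Complex.conj_ofReal, Complex.conj_ofReal, Complex.conj_I]
    push_cast
    ring
  rw [e, H.invZetaDiv_conj, RCLike.norm_conj]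

lemma summable_inv_norm_deriv_sq {E : ℂ → ℂ}
    (hW : ∑' ρ : critZeros E, ENNReal.ofReal ((ρ.1.im + 1) ^ (1 / 4 : ℝ) / ‖deriv E ρ.1‖ ^ 2) ≠ ⊤) :
    Summable fun ρ : critZeros E => 1 / ‖deriv E ρ.1‖ ^ 2 := by
  refine (ENNReal.summable_toReal hW).of_nonneg_of_le (fun ρ => by positivity) fun ρ => ?_
  have hρ : 0 < ρ.1.im := ρ.2.2.2
  rw [ENNReal.toReal_ofReal (by positivity)]
  gcongr
  exact Real.one_le_rpow (by linarith) (by norm_num)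

lemma RHData.tendsto_integral_norm_sq {Z E : ℂ → ℂ} (H : RHData Z E)
    (hW : ∑' ρ : critZeros E, ENNReal.ofReal ((ρ.1.im + 1) ^ (1 / 4 : ℝ) / ‖deriv E ρ.1‖ ^ 2) ≠ ⊤) :
    Tendsto (fun δ : ℝ => δ * ∫ t : ℝ, ‖invZetaDiv E ((1 / 2 + δ : ℝ) + t * I)‖ ^ 2) (𝓝[>] 0)
      (𝓝 (2 * Real.pi * ∑' ρ : critZeros E, 1 / ‖deriv E ρ.1‖ ^ 2)) := by
  have hs := summable_inv_norm_deriv_sq hW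
  have hpi := Real.pi_pos
  have h := H.mean_square_limit hW
  rw [← ENNReal.ofReal_tsum_of_nonneg (fun ρ => by positivity) (hs.mul_left Real.pi)] at h
  have h2 := ((ENNReal.tendsto_toReal ENNReal.ofReal_ne_top).comp h).const_mul 2
  rw [ENNReal.toReal_ofReal (tsum_nonneg fun ρ => by positivity), tsum_mul_left, ← mul_assoc] at h2
  refine h2.congr' ?_
  filter_upwards [self_mem_nhdsWithin] with δ hδ
  have hδ0 : 0 < δ := hδ
  simp only [Function.comp_apply]
  rw [← ofReal_integral_eq_lintegral_ofReal ((H.integrable_norm_sq_invZetaDiv hδ0).integrableOn.const_mul δ)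
    (Eventually.of_forall fun t => by positivity), ENNReal.toReal_ofReal (integral_nonneg fun t => by positivity),
    integral_const_mul, H.integral_norm_sq_invZetaDiv hδ0]
  ring

lemma mertensK_div_sq_mul_exp (δ y : ℝ) :
    (mertensK K (Real.exp y) / Real.exp (y / 2)) ^ 2 * Real.exp (-δ * y) =
      mertensK K (Real.exp y) ^ 2 * Real.exp (-(2 * (1 / 2 + δ / 2)) * y) := by
  rw [div_pow, ← Real.exp_nat_mul, div_eq_mul_inv, ← Real.exp_neg, mul_assoc, ← Real.exp_add]
  congr 2
  push_cast
  ring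

lemma measurable_mertensK_sq_mul_exp {Z : ℂ → ℂ} (hZ : IsDedekindZeta K Z) (a : ℝ) :
    Measurable fun y : ℝ => mertensK K (Real.exp y) ^ 2 * Real.exp (-(2 * a) * y) :=
  ((measurable_mertensK_exp hZ).pow_const 2).mul (by fun_prop)

lemma integrable_mertensK_sq {Z E : ℂ → ℂ} (hZ : IsDedekindZeta K Z) (H : RHData Z E) {a : ℝ} (ha : 1 / 2 < a) :
    Integrable fun y : ℝ => mertensK K (Real.exp y) ^ 2 * Real.exp (-(2 * a) * y) := by
  rcases lt_or_ge a 2 with h | h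
  · refine ⟨(measurable_mertensK_sq_mul_exp hZ a).aestronglyMeasurable, ?_⟩
    rw [hasFiniteIntegral_iff_ofReal (Eventually.of_forall fun y => by positivity),
      integral_mertensK_sq_of_half_lt hZ H ha h]
    exact ENNReal.ofReal_lt_top
  · refine (integrable_of_mertensK_bound hZ (by linarith : 1 < a) two_ne_zero).congr (Eventually.of_forall fun y => ?_)
    simp only
    rw [sq_abs, mul_pow, ← Real.exp_nat_mul]
    congr 2
    push_cast
    ring

lemma integral_mertensK_sq_eq {Z E : ℂ → ℂ} (hZ : IsDedekindZeta K Z) (H : RHData Z E) {a : ℝ} (ha : 1 / 2 < a)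
    (ha2 : a < 2) : ∫ y : ℝ, mertensK K (Real.exp y) ^ 2 * Real.exp (-(2 * a) * y) =
      (2 * Real.pi)⁻¹ * ∫ t : ℝ, ‖invZetaDiv E (a + t * I)‖ ^ 2 := by
  have hpi := Real.pi_pos
  rw [integral_eq_lintegral_of_nonneg_ae (Eventually.of_forall fun y => by positivity)
    (measurable_mertensK_sq_mul_exp hZ a).aestronglyMeasurable, integral_mertensK_sq_of_half_lt hZ H ha ha2,
    ENNReal.toReal_ofReal]
  exact mul_nonneg (by positivity) (integral_nonneg fun t => by positivity)

lemma RHData.tendsto_mean_mertensK_sq {Z E : ℂ → ℂ} (hZ : IsDedekindZeta K Z) (H : RHData Z E)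
    (hW : ∑' ρ : critZeros E, ENNReal.ofReal ((ρ.1.im + 1) ^ (1 / 4 : ℝ) / ‖deriv E ρ.1‖ ^ 2) ≠ ⊤) :
    Tendsto (fun Y : ℝ => (∫ y in (0:ℝ)..Y, (mertensK K (Real.exp y) / Real.exp (y / 2)) ^ 2) / Y) atTop
      (𝓝 (2 * ∑' ρ : critZeros E, 1 / ‖deriv E ρ.1‖ ^ 2)) := by
  have hpi := Real.pi_pos
  refine tendsto_mean_of_laplace (fun y => by positivity) (fun y hy => ?_) (fun δ hδ => ?_) ?_
  · rw [mertensK_exp_of_neg hy]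
    simp
  · simp only [mertensK_div_sq_mul_exp]
    exact integrable_mertensK_sq hZ H (by linarith)
  · simp only [mertensK_div_sq_mul_exp]
    have hhalf : Tendsto (fun δ : ℝ => δ / 2) (𝓝[>] 0) (𝓝[>] 0) := by
      refine tendsto_nhdsWithin_iff.mpr ⟨?_, ?_⟩
      · have : Tendsto (fun δ : ℝ => δ / 2) (𝓝 0) (𝓝 (0 / 2)) := tendsto_id.div_const 2
        rw [zero_div] at this
        exact this.mono_left nhdsWithin_le_nhds
      · filter_upwards [self_mem_nhdsWithin] with δ hδ
        exact half_pos (show (0:ℝ) < δ from hδ)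
    have h := ((H.tendsto_integral_norm_sq hW).comp hhalf).const_mul (Real.pi⁻¹)
    have e : Real.pi⁻¹ * (2 * Real.pi * ∑' ρ : critZeros E, 1 / ‖deriv E ρ.1‖ ^ 2) =
        2 * ∑' ρ : critZeros E, 1 / ‖deriv E ρ.1‖ ^ 2 := by
      field_simp
    rw [e] at h
    refine h.congr' ?_
    filter_upwards [Ioo_mem_nhdsGT (show (0:ℝ) < 1 by norm_num)] with δ hδ
    have := hδ.1
    have := hδ.2
    rw [integral_mertensK_sq_eq hZ H (by linarith) (by linarith)]
    simp only [Function.comp_apply]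
    rw [← mul_assoc, ← mul_assoc]
    congr 1
    field_simp

lemma RHData.critZeros_eq {Z E : ℂ → ℂ} (H : RHData Z E) :
    critZeros E = {ρ : ℂ | Z ρ = 0 ∧ ρ.re = 1 / 2 ∧ 0 < ρ.im} := by
  ext ρ
  simp only [critZeros, Set.mem_ofPred_eq]
  refine and_congr_left fun h => ?_
  exact (H.zeta_eq_zero_iff (ne_one_of_re_half h.1)).symm

lemma RHData.norm_deriv {Z E : ℂ → ℂ} (H : RHData Z E) {ρ : ℂ} (h0 : Z ρ = 0) (hre : ρ.re = 1 / 2) :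
    ‖deriv E ρ‖ = ‖ρ * deriv Z ρ‖ := by
  have hne := ne_one_of_re_half hre
  rw [deriv_mul_at_zero H.eq_mul hne (H.differentiableAt_zeta hne) h0, norm_mul, norm_mul,
    norm_sub_one_of_re_half hre]

end WeakMertens

/-- **The weak Mertens conjecture over `K` (Theorem 1.6).**
Let `K` be an abelian number field. Assume the Riemann hypothesis for `ζ_K`, that all
nontrivial zeros are simple, and that `J₋₁^K(T) ≪ T^{1+α}` for some fixed
`0 ≤ α < 2 - √3`. Then `∫_0^Y (M_K(e^y)/e^{y/2})² dy ∼ β Y`, where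
`β = 2 ∑_{γ>0} |ρ ζ_K'(ρ)|⁻²`, and the series defining `β` converges. -/
theorem weak_mertens_abelian
    (K : Type) [Field K] [NumberField K]
    (hGal : IsGalois ℚ K) (hab : ∀ σ τ : (K ≃ₐ[ℚ] K), σ * τ = τ * σ)
    (Z : ℂ → ℂ) (hZ : IsDedekindZeta K Z) (hRH : ZetaRH Z)
    (hsimple : ∀ ρ : ℂ, Z ρ = 0 → 0 < ρ.re → ρ.re < 1 → deriv Z ρ ≠ 0)
    (α : ℝ) (hα0 : 0 ≤ α) (hα : α < 2 - Real.sqrt 3)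
    (C : ℝ)
    (hJ : ∀ T : ℝ, 2 ≤ T →
      (∑' ρ : {ρ : ℂ // Z ρ = 0 ∧ ρ.re = 1 / 2 ∧ 0 ≤ ρ.im ∧ ρ.im ≤ T},
        1 / ‖deriv Z ρ.1‖ ^ 2) ≤ C * T ^ (1 + α)) :
    Summable (fun ρ : {ρ : ℂ // Z ρ = 0 ∧ ρ.re = 1 / 2 ∧ 0 < ρ.im} =>
        1 / ‖ρ.1 * deriv Z ρ.1‖ ^ 2) ∧
    Tendsto
      (fun Y : ℝ =>
        (∫ y in (0:ℝ)..Y, (mertensK K (Real.exp y) / Real.exp (y / 2)) ^ 2) / Y)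
      atTop
      (𝓝 (2 * ∑' ρ : {ρ : ℂ // Z ρ = 0 ∧ ρ.re = 1 / 2 ∧ 0 < ρ.im},
        1 / ‖ρ.1 * deriv Z ρ.1‖ ^ 2)) := by
  obtain ⟨E, H⟩ := exists_rhData hZ hRH hsimple
  have hα' : α ≤ 1 / 2 := by
    have : (3 / 2 : ℝ) ≤ Real.sqrt 3 := Real.le_sqrt_of_sq_le (by norm_num)
    linarith
  have hW := H.tsum_weighted_ne_top hα' hJ
  have h1 := summable_inv_norm_deriv_sq hW
  have h2 := H.tendsto_mean_mertensK_sq hZ hW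
  rw [H.critZeros_eq] at h1 h2
  have e : (fun ρ : {ρ : ℂ // Z ρ = 0 ∧ ρ.re = 1 / 2 ∧ 0 < ρ.im} => 1 / ‖ρ.1 * deriv Z ρ.1‖ ^ 2) =
      fun ρ => 1 / ‖deriv E ρ.1‖ ^ 2 := by
    funext ρ
    rw [H.norm_deriv ρ.2.1 ρ.2.2.1]
  rw [e]
  exact ⟨h1, h2⟩
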